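/- Let D ⊂ ℂⁿ be a bounded hyperconvex B-regular domain and u₀, u₁ ∈ PSH⁻(D), each satisfying one of the following conditions: u_j ≥ g_{u_j} + w_j for some w_j ∈ PSH⁻(D) with g_{w_j} = 0; or g_{u_j} = 0; or u_j has approximately model singularity. Then the geodesic u_t converges to u_j in capacity as t → j (j = 0,1) if and only if u₀ ≤ g_{u₁} and u₁ ≤ g_{u₀}. If moreover both u_j ∈ PSH_s⁻(D), or both u_j ∈ N(D, fb u_j) with fb u_j ∈ PSH_s⁻(D), these conditions are equivalent to g_{u₀} = g_{u₁}. -/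

import Mathlib

open MeasureTheory Filter Topology
open scoped ENNReal

noncomputable section

/-- Complex Euclidean space `ℂⁿ`. -/
abbrev Cn (n : ℕ) : Type := Fin n → ℂ

section Defs

variable {E : Type*} [NormedAddCommGroup E] [NormedSpace ℂ E]

/-- `u` is plurisubharmonic on `Ω`: it is upper semicontinuous on `Ω` (with values in
`EReal`) and on every closed disc of every complex line contained in `Ω` it satisfies the
maximum principle with respect to real parts of complex polynomials (an equivalent form of
the sub-mean value property on complex lines). -/
def PlurisubharmonicOn (u : E → EReal) (Ω : Set E) : Prop :=
  UpperSemicontinuousOn u Ω ∧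
  ∀ a b : E, ∀ r : ℝ, 0 < r →
    (∀ ζ : ℂ, ‖ζ‖ ≤ r → a + ζ • b ∈ Ω) →
    ∀ p : Polynomial ℂ,
      (∀ ζ : ℂ, ‖ζ‖ = r → u (a + ζ • b) ≤ ((Polynomial.eval ζ p).re : EReal)) →
      ∀ ζ : ℂ, ‖ζ‖ ≤ r → u (a + ζ • b) ≤ ((Polynomial.eval ζ p).re : EReal)

/-- Negative plurisubharmonic functions on `Ω` : the class `PSH⁻(Ω)`. -/
def PSHNeg (u : E → EReal) (Ω : Set E) : Prop :=
  PlurisubharmonicOn u Ω ∧ ∀ z ∈ Ω, u z ≤ 0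

/-- A set is pluripolar if it is contained in `{u = -∞}` for some psh `u ≢ -∞`
defined on a neighborhood of the set. -/
def Pluripolar (S : Set E) : Prop :=
  ∃ Ω : Set E, IsOpen Ω ∧ S ⊆ Ω ∧
    ∃ u : E → EReal, PlurisubharmonicOn u Ω ∧ (∃ z ∈ Ω, u z ≠ ⊥) ∧ ∀ z ∈ S, u z = ⊥

/-- Upper semicontinuous regularization (relative to `Ω`) of a function. -/
def uscReg (f : E → EReal) (Ω : Set E) : E → EReal :=
  fun z => Filter.limsup f (nhdsWithin z Ω)

/-- The psh envelope `P(h)` of a function `h` on `Ω`: the usc regularization of the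
supremum of all psh minorants of `h` on `Ω`. -/
def PEnv (h : E → EReal) (Ω : Set E) : E → EReal :=
  uscReg (fun z =>
    ⨆ v ∈ {v : E → EReal | PlurisubharmonicOn v Ω ∧ ∀ x ∈ Ω, v x ≤ h x}, v z) Ω

/-- The rooftop envelope `P(u,v) = P(min{u,v})`. -/
def Rooftop (u v : E → EReal) (Ω : Set E) : E → EReal :=
  PEnv (fun z => min (u z) (v z)) Ω

/-- The Green–Poisson residual function `g_φ`: usc regularization of the supremum of all
negative psh `w` with `w ≤ φ + C_w` on `Ω` for some constant `C_w`. -/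
def gp (φ : E → EReal) (Ω : Set E) : E → EReal :=
  uscReg (fun z =>
    ⨆ w ∈ {w : E → EReal | PSHNeg w Ω ∧ ∃ C : ℝ, ∀ x ∈ Ω, w x ≤ φ x + (C : EReal)}, w z) Ω

/-- The residual Green function `g_φ^o`: usc regularization of the supremum of all
negative psh `w` with `w ≤ φ + O(1)` locally in `Ω`. -/
def gpO (φ : E → EReal) (Ω : Set E) : E → EReal :=
  uscReg (fun z =>
    ⨆ w ∈ {w : E → EReal | PSHNeg w Ω ∧
      ∀ a ∈ Ω, ∃ U ∈ nhds a, ∃ C : ℝ, ∀ x ∈ U ∩ Ω, w x ≤ φ x + (C : EReal)}, w z) Ω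

/-- The residual Poisson function `g_φ^b`: usc regularization of the supremum of all
negative psh `w` with `w ≤ φ + O(1)` in a neighborhood of `∂Ω`. -/
def gpB (φ : E → EReal) (Ω : Set E) : E → EReal :=
  uscReg (fun z =>
    ⨆ w ∈ {w : E → EReal | PSHNeg w Ω ∧
      ∃ U : Set E, IsOpen U ∧ frontier Ω ⊆ U ∧
        ∃ C : ℝ, ∀ x ∈ U ∩ Ω, w x ≤ φ x + (C : EReal)}, w z) Ω

/-- The asymptotic rooftop `P[φ](ψ) = lim*_{C→∞} P(ψ, φ+C)`. -/
def asympRooftop (ψ φ : E → EReal) (Ω : Set E) : E → EReal :=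
  uscReg (fun z => ⨆ C : ℝ, Rooftop ψ (fun x => φ x + (C : EReal)) Ω z) Ω

/-- The unbounded locus `L(φ)` of `φ` in `Ω`: points of `Ω` having no neighborhood on
which `φ` is bounded. -/
def Lset (φ : E → EReal) (Ω : Set E) : Set E :=
  {a | a ∈ Ω ∧ ∀ U ∈ nhds a, ¬ ∃ M : ℝ, ∀ x ∈ U ∩ Ω, -(M : EReal) ≤ φ x ∧ φ x ≤ (M : EReal)}

/-- The boundary unbounded locus `BL(φ)`: boundary points near which `φ` is unbounded. -/
def BLset (φ : E → EReal) (Ω : Set E) : Set E :=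
  {b | b ∈ frontier Ω ∧
    ∀ U ∈ nhds b, ¬ ∃ M : ℝ, ∀ x ∈ U ∩ Ω, -(M : EReal) ≤ φ x ∧ φ x ≤ (M : EReal)}

/-- `PSH_s⁻(Ω)` : negative psh functions with small unbounded locus (both `L(φ)` and
`BL(φ)` pluripolar). -/
def PSHs (φ : E → EReal) (Ω : Set E) : Prop :=
  PSHNeg φ Ω ∧ Pluripolar (Lset φ Ω) ∧ Pluripolar (BLset φ Ω)

/-- `u` is a maximal psh function on the set `U`: it is psh there and for every `G ⋐ U`
and every psh `v` on a neighborhood of `closure G` with `v ≤ u` on `∂G`, one has `v ≤ u`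
on `G`. -/
def MaximalOn (u : E → EReal) (U : Set E) : Prop :=
  PlurisubharmonicOn u U ∧
  ∀ G : Set E, IsOpen G → IsCompact (closure G) → closure G ⊆ U →
    ∀ W : Set E, IsOpen W → closure G ⊆ W →
      ∀ v : E → EReal, PlurisubharmonicOn v W →
        (∀ z ∈ frontier G, v z ≤ u z) → ∀ z ∈ G, v z ≤ u z

/-- B-regularity of a domain: every continuous function on the boundary is the boundary
value of a psh function continuous up to the closure. -/
def BRegular (Ω : Set E) : Prop :=
  ∀ η : E → ℝ, ContinuousOn η (frontier Ω) →
    ∃ u : E → ℝ, PlurisubharmonicOn (fun z => ((u z : ℝ) : EReal)) Ω ∧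
      ContinuousOn u (closure Ω) ∧ ∀ ζ ∈ frontier Ω, u ζ = η ζ

/-- Pseudoconvexity: existence of a continuous psh exhaustion function. -/
def Pseudoconvex (Ω : Set E) : Prop :=
  IsOpen Ω ∧ ∃ u : E → ℝ, ContinuousOn u Ω ∧
    PlurisubharmonicOn (fun z => ((u z : ℝ) : EReal)) Ω ∧
    ∀ c : ℝ, IsCompact {z | z ∈ Ω ∧ u z ≤ c}

/-- Hyperconvexity: existence of a negative psh exhaustion function. -/
def Hyperconvex (Ω : Set E) : Prop :=
  ∃ ρ : E → EReal, PlurisubharmonicOn ρ Ω ∧ (∀ z ∈ Ω, ρ z < 0) ∧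
    ∀ c : ℝ, c < 0 →
      IsCompact (closure {z | z ∈ Ω ∧ ρ z ≤ (c : EReal)}) ∧
      closure {z | z ∈ Ω ∧ ρ z ≤ (c : EReal)} ⊆ Ω

/-- `H` is the least maximal psh majorant (`fb φ`) of `φ` on `Ω` (within `PSH⁻(Ω)`). -/
def IsLeastMaxMajorant (φ H : E → EReal) (Ω : Set E) : Prop :=
  MaximalOn H Ω ∧ (∀ z ∈ Ω, H z ≤ 0) ∧ (∀ z ∈ Ω, φ z ≤ H z) ∧
  ∀ H' : E → EReal, MaximalOn H' Ω → (∀ z ∈ Ω, H' z ≤ 0) → (∀ z ∈ Ω, φ z ≤ H' z) →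
    ∀ z ∈ Ω, H z ≤ H' z

/-- Extended-real logarithm, with `log 0 = -∞`. -/
def elog (x : ℝ) : EReal := if x ≤ 0 then (⊥ : EReal) else ((Real.log x : ℝ) : EReal)

end Defs

section MA

/-- Real second directional derivative `D²u(z)(v,w)`. -/
def reB (n : ℕ) (u : Cn n → ℝ) (z v w : Cn n) : ℝ :=
  fderiv ℝ (fun x => fderiv ℝ u x w) z v

/-- Entry `∂²u/∂z_j∂z̄_k` of the complex Hessian of a (C²) function `u`. -/
def cHessEntry (n : ℕ) (u : Cn n → ℝ) (z : Cn n) (j k : Fin n) : ℂ :=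
  (1 / 4 : ℂ) *
    ( ((reB n u z ((Pi.single j (1 : ℂ) : Cn n)) ((Pi.single k (1 : ℂ) : Cn n)) : ℝ) : ℂ)
    + ((reB n u z ((Pi.single j Complex.I : Cn n)) ((Pi.single k Complex.I : Cn n)) : ℝ) : ℂ)
    + Complex.I *
      ( ((reB n u z ((Pi.single j (1 : ℂ) : Cn n)) ((Pi.single k Complex.I : Cn n)) : ℝ) : ℂ)
      - ((reB n u z ((Pi.single j Complex.I : Cn n)) ((Pi.single k (1 : ℂ) : Cn n)) : ℝ) : ℂ)))

/-- Density of the Monge–Ampère measure `(dd^c u)ⁿ` of a smooth function `u`. -/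
def maDensity (n : ℕ) (u : Cn n → ℝ) (z : Cn n) : ℝ :=
  (4 : ℝ) ^ n * (n.factorial : ℝ) * (Matrix.det (Matrix.of fun j k => cHessEntry n u z j k)).re

/-- `μ` is the Bedford–Taylor Monge–Ampère measure `(dd^c u)ⁿ` of `u` on `Ω`:
it is locally finite on `Ω`, carried by `Ω`, and for every open `U ⊆ Ω` and every
decreasing sequence of smooth psh functions on `U` converging pointwise to `u`, the
corresponding smooth Monge–Ampère measures converge to `μ` against test functions
supported in `U`. -/
def IsMAMeasure (n : ℕ) (u : Cn n → EReal) (Ω : Set (Cn n)) (μ : Measure (Cn n)) : Prop :=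
  μ Ωᶜ = 0 ∧ (∀ K : Set (Cn n), IsCompact K → K ⊆ Ω → μ K ≠ ⊤) ∧
  ∀ U : Set (Cn n), IsOpen U → U ⊆ Ω →
    ∀ v : ℕ → Cn n → ℝ,
      (∀ k, ContDiffOn ℝ (⊤ : ℕ∞) (v k) U) →
      (∀ k, PlurisubharmonicOn (fun z => ((v k z : ℝ) : EReal)) U) →
      (∀ k, ∀ z ∈ U, v (k + 1) z ≤ v k z) →
      (∀ z ∈ U, (⨅ k, ((v k z : ℝ) : EReal)) = u z) →
      ∀ f : Cn n → ℝ, Continuous f → HasCompactSupport f → tsupport f ⊆ U →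
        Filter.Tendsto (fun k => ∫ z, f z * maDensity n (v k) z) Filter.atTop
          (nhds (∫ z, f z ∂μ))

/-- The Cegrell class `E₀(Ω)`: bounded negative psh functions with zero boundary values
and finite total Monge–Ampère mass. -/
def ClassE0 (n : ℕ) (Ω : Set (Cn n)) (φ : Cn n → EReal) : Prop :=
  PSHNeg φ Ω ∧ (∃ M : ℝ, ∀ z ∈ Ω, -(M : EReal) ≤ φ z) ∧
  (∀ ζ ∈ frontier Ω, Filter.Tendsto φ (nhdsWithin ζ Ω) (nhds (0 : EReal))) ∧
  ∃ μ : Measure (Cn n), IsMAMeasure n φ Ω μ ∧ μ Ω ≠ ⊤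

/-- The Cegrell class `E(Ω)`: negative psh functions that are locally decreasing limits
of functions of `E₀(Ω)` with uniformly bounded total Monge–Ampère masses. -/
def ClassE (n : ℕ) (Ω : Set (Cn n)) (φ : Cn n → EReal) : Prop :=
  PSHNeg φ Ω ∧
  ∀ z ∈ Ω, ∃ U : Set (Cn n), IsOpen U ∧ z ∈ U ∧ U ⊆ Ω ∧
    ∃ h : ℕ → Cn n → EReal, ∃ M : ℝ≥0∞, M ≠ ⊤ ∧
      (∀ j, ClassE0 n Ω (h j)) ∧
      (∀ j, ∀ x ∈ Ω, h (j + 1) x ≤ h j x) ∧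
      (∀ x ∈ U, (⨅ j, h j x) = φ x) ∧
      (∀ j, ∀ μ : Measure (Cn n), IsMAMeasure n (h j) Ω μ → μ Ω ≤ M)

/-- The Cegrell class `N(Ω) = {w ∈ E(Ω) : fb w = 0}`. -/
def ClassN (n : ℕ) (Ω : Set (Cn n)) : Set (Cn n → EReal) :=
  {w | ClassE n Ω w ∧ IsLeastMaxMajorant w 0 Ω}

/-- The Cegrell class `F(Ω) = {w ∈ E(Ω) : ∫ (dd^c w)ⁿ < ∞ and fb w = 0}`. -/
def ClassF (n : ℕ) (Ω : Set (Cn n)) : Set (Cn n → EReal) :=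
  {w | ClassE n Ω w ∧ IsLeastMaxMajorant w 0 Ω ∧
    ∀ μ : Measure (Cn n), IsMAMeasure n w Ω μ → μ Ω ≠ ⊤}

/-- Membership `φ ∈ K(Ω, H)`: `φ ∈ E(Ω)` and `H + w ≤ φ ≤ H` for some `w ∈ K`. -/
def InClassRel (n : ℕ) (Ω : Set (Cn n)) (K : Set (Cn n → EReal)) (H φ : Cn n → EReal) : Prop :=
  ClassE n Ω φ ∧ ∃ w ∈ K, ∀ z ∈ Ω, H z + w z ≤ φ z ∧ φ z ≤ H z

/-- The annulus `A = {1 < |ζ| < e}`. -/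
def annA : Set ℂ := {ζ : ℂ | 1 < ‖ζ‖ ∧ ‖ζ‖ < Real.exp 1}

/-- The class `W(u₀,u₁)` of subgeodesics: negative psh functions on `Ω × A` with boundary
limsups dominated by `u₀` on `|ζ| = 1` and by `u₁` on `|ζ| = e`. -/
def geodClass (n : ℕ) (Ω : Set (Cn n)) (u0 u1 : Cn n → EReal) : Set (Cn n × ℂ → EReal) :=
  {u | PSHNeg u (Ω ×ˢ annA) ∧
    (∀ z ∈ Ω, Filter.limsup (fun ζ : ℂ => u (z, ζ))
        ((nhds (1 : ℝ)).comap (fun ζ : ℂ => ‖ζ‖) ⊓ Filter.principal annA) ≤ u0 z) ∧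
    (∀ z ∈ Ω, Filter.limsup (fun ζ : ℂ => u (z, ζ))
        ((nhds (Real.exp 1)).comap (fun ζ : ℂ => ‖ζ‖) ⊓ Filter.principal annA) ≤ u1 z)}

/-- The geodesic `u_t(z) = P_W(z, e^t)`, the Perron envelope of the class `W(u₀,u₁)`. -/
def geodesic (n : ℕ) (Ω : Set (Cn n)) (u0 u1 : Cn n → EReal) (t : ℝ) (z : Cn n) : EReal :=
  ⨆ u ∈ geodClass n Ω u0 u1, u (z, ((Real.exp t : ℝ) : ℂ))

/-- The Monge–Ampère capacity `Cap(S) = sup {∫_S (dd^c u)ⁿ : u psh, -1 ≤ u ≤ 0}`. -/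
def MACap (n : ℕ) (Ω : Set (Cn n)) (S : Set (Cn n)) : ℝ≥0∞ :=
  ⨆ u ∈ {u : Cn n → EReal | PlurisubharmonicOn u Ω ∧ ∀ z ∈ Ω, -1 ≤ u z ∧ u z ≤ 0},
    ⨆ μ ∈ {μ : Measure (Cn n) | IsMAMeasure n u Ω μ}, μ S

/-- Convergence `u t → g` in capacity as `t → t₀` within `(0,1)`. -/
def TendstoInCap (n : ℕ) (Ω : Set (Cn n)) (u : ℝ → Cn n → EReal) (g : Cn n → EReal)
    (t0 : ℝ) : Prop :=
  ∀ ε : ℝ, 0 < ε → ∀ K : Set (Cn n), IsCompact K → K ⊆ Ω →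
    Filter.Tendsto
      (fun t => MACap n Ω
        {z | z ∈ K ∧ ¬ (u t z ≤ g z + (ε : EReal) ∧ g z ≤ u t z + (ε : EReal))})
      (nhdsWithin t0 (Set.Ioo (0 : ℝ) 1)) (nhds (0 : ℝ≥0∞))

/-- Convergence `u t → g` in `L¹_loc(Ω)` as `t → t₀` within `(0,1)`. -/
def TendstoL1loc (n : ℕ) (Ω : Set (Cn n)) (u : ℝ → Cn n → EReal) (g : Cn n → EReal)
    (t0 : ℝ) : Prop :=
  ∀ K : Set (Cn n), IsCompact K → K ⊆ Ω →
    Filter.Tendsto (fun t => ∫⁻ z in K, ENNReal.ofReal |(u t z).toReal - (g z).toReal|)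
      (nhdsWithin t0 (Set.Ioo (0 : ℝ) 1)) (nhds (0 : ℝ≥0∞))

end MA

set_option linter.unusedSectionVars false

section PolynomialApproximation

lemma re_eval_le_of_circle {q : Polynomial ℂ} {r c : ℝ} (hr : 0 < r)
    (h : ∀ ζ : ℂ, ‖ζ‖ = r → (q.eval ζ).re ≤ c) {ζ : ℂ} (hζ : ‖ζ‖ ≤ r) : (q.eval ζ).re ≤ c := by
  have hd : DiffContOnCl ℂ (fun z => Complex.exp (q.eval z)) (Metric.ball 0 r) :=
    (Complex.differentiable_exp.comp q.differentiable).diffContOnCl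
  have := Complex.norm_le_of_forall_mem_frontier_norm_le (f := fun z => Complex.exp (q.eval z))
    Metric.isBounded_ball hd (C := Real.exp c) (fun z hz => by
      rw [frontier_ball _ hr.ne', mem_sphere_zero_iff_norm] at hz
      simpa [Complex.norm_exp] using h z hz) (z := ζ)
    (by rw [closure_ball _ hr.ne']; simpa using hζ)
  simpa [Complex.norm_exp] using this

lemma le_re_eval_of_circle {q : Polynomial ℂ} {r c : ℝ} (hr : 0 < r)
    (h : ∀ ζ : ℂ, ‖ζ‖ = r → c ≤ (q.eval ζ).re) {ζ : ℂ} (hζ : ‖ζ‖ ≤ r) : c ≤ (q.eval ζ).re := by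
  have := re_eval_le_of_circle (q := -q) (c := -c) hr (fun z hz => by simpa using h z hz) hζ
  simpa using this

lemma exists_polynomial_approx_of_differentiableOn {f : ℂ → ℂ} {r R : ℝ} (hr : 0 ≤ r) (hrR : r < R)
    (hf : DifferentiableOn ℂ f (Metric.ball 0 R)) {ε : ℝ} (hε : 0 < ε) :
    ∃ p : Polynomial ℂ, ∀ ζ : ℂ, ‖ζ‖ ≤ r → ‖f ζ - p.eval ζ‖ < ε := by
  obtain ⟨s, hs1, hs2⟩ := exists_between hrR
  obtain ⟨s', hs1', hs2'⟩ := exists_between hs2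
  have hs0 : 0 < s := hr.trans_lt hs1
  lift s to NNReal using hs0.le
  lift s' to NNReal using hs0.le.trans hs1'.le
  have hp := (hf.mono (Metric.closedBall_subset_ball hs2')).hasFPowerSeriesOnBall
    (by exact_mod_cast hs0.trans hs1')
  have hu := hp.tendstoUniformlyOn (r' := s) (by exact_mod_cast hs1')
  rw [Metric.tendstoUniformlyOn_iff] at hu
  obtain ⟨N, hN⟩ := (hu ε hε).exists
  set P := cauchyPowerSeries f 0 s' with hP
  refine ⟨∑ k ∈ Finset.range N, Polynomial.C (P.coeff k) * Polynomial.X ^ k, fun ζ hζ => ?_⟩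
  have := hN ζ (by simpa using hζ.trans_lt hs1)
  rw [dist_eq_norm, zero_add] at this
  have hev : Polynomial.eval ζ (∑ k ∈ Finset.range N, Polynomial.C (P.coeff k) * Polynomial.X ^ k)
      = P.partialSum N ζ := by
    rw [Polynomial.eval_finsetSum, FormalMultilinearSeries.partialSum]
    refine Finset.sum_congr rfl fun k _ => ?_
    rw [FormalMultilinearSeries.apply_eq_pow_smul_coeff]
    simp only [Polynomial.eval_mul, Polynomial.eval_C, Polynomial.eval_pow, Polynomial.eval_X,
      smul_eq_mul, mul_comm]
  rwa [hev]

lemma exists_polynomial_approx_circle {g : ℂ → ℝ} {r : ℝ} (hr : 0 < r)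
    (hg : ContinuousOn g (Metric.sphere 0 r)) {ε : ℝ} (hε : 0 < ε) :
    ∃ p : Polynomial ℂ, ∀ ζ : ℂ, ‖ζ‖ = r → |g ζ - (p.eval ζ).re| < ε := by
  have : Fact (0 < (1 : ℝ)) := ⟨one_pos⟩
  have hG : Continuous fun x : AddCircle (1 : ℝ) =>
      ((g (r * (AddCircle.toCircle x : ℂ)) : ℝ) : ℂ) := by
    refine Complex.continuous_ofReal.comp (hg.comp_continuous ?_ ?_)
    · exact continuous_const.mul (continuous_subtype_val.comp AddCircle.continuous_toCircle)
    · intro x; simp [abs_of_pos hr, Circle.norm_coe]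
  let G : C(AddCircle (1 : ℝ), ℂ) := ⟨_, hG⟩
  have key : ∀ f ∈ Submodule.span ℂ (Set.range (@fourier (1:ℝ))), ∃ p q : Polynomial ℂ,
      ∀ x : AddCircle (1 : ℝ), f x = p.eval (AddCircle.toCircle x : ℂ) +
        (starRingEnd ℂ) (q.eval (AddCircle.toCircle x : ℂ)) := by
    intro f hf
    induction hf using Submodule.span_induction with
    | mem f hf =>
      obtain ⟨n, rfl⟩ := hf
      obtain ⟨m, rfl | rfl⟩ := n.eq_nat_or_neg
      · refine ⟨Polynomial.X ^ m, 0, fun x => ?_⟩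
        simp [fourier_apply, AddCircle.toCircle_nsmul]
      · refine ⟨0, Polynomial.X ^ m, fun x => ?_⟩
        rw [fourier_neg]
        simp [fourier_apply, AddCircle.toCircle_nsmul]
    | zero => exact ⟨0, 0, by simp⟩
    | add f g _ _ hf hg =>
      obtain ⟨p, q, h⟩ := hf
      obtain ⟨p', q', h'⟩ := hg
      exact ⟨p + p', q + q', fun x => by simp [h, h']; ring⟩
    | smul c f _ hf =>
      obtain ⟨p, q, h⟩ := hf
      exact ⟨Polynomial.C c * p, Polynomial.C ((starRingEnd ℂ) c) * q, fun x => by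
        simp [h]; ring⟩
  have hGm : G ∈ (Submodule.span ℂ (Set.range (@fourier (1:ℝ)))).topologicalClosure := by
    rw [span_fourier_closure_eq_top]; trivial
  obtain ⟨f, hf, hd⟩ := Metric.mem_closure_iff.1 hGm ε hε
  obtain ⟨p, q, hpq⟩ := key f hf
  refine ⟨(p + q).comp (Polynomial.C ((r : ℂ)⁻¹) * Polynomial.X), fun ζ hζ => ?_⟩
  have hrc : (r : ℂ) ≠ 0 := by exact_mod_cast hr.ne'
  obtain ⟨x, hx⟩ := (AddCircle.homeomorphCircle (T := (1:ℝ)) one_ne_zero).surjective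
    ⟨(r : ℂ)⁻¹ * ζ, by simp [Submonoid.unitSphere, hζ, abs_of_pos hr, hr.ne']⟩
  have hx' : (AddCircle.toCircle x : ℂ) = (r : ℂ)⁻¹ * ζ := by
    rw [AddCircle.homeomorphCircle_apply] at hx
    rw [hx]
  have h1 := (ContinuousMap.dist_apply_le_dist (f := G) (g := f) x).trans_lt hd
  rw [dist_eq_norm, hpq x] at h1
  have h2 := (Complex.abs_re_le_norm _).trans_lt h1
  simp only [G, ContinuousMap.coe_mk, hx'] at h2
  rw [mul_inv_cancel_left₀ hrc] at h2
  simpa using h2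

end PolynomialApproximation

section UscApproximation

/-- An upper semicontinuous nonpositive function on a compact set is a decreasing limit of
continuous functions. -/
lemma exists_antitone_continuous_approx {X : Type*} [MetricSpace X] {S : Set X}
    {u : X → EReal} (hu : UpperSemicontinuousOn u S) (h0 : ∀ x ∈ S, u x ≤ 0) :
    ∃ h : ℕ → X → ℝ, (∀ k, Continuous (h k)) ∧ (∀ k x, h (k + 1) x ≤ h k x) ∧
      (∀ k, ∀ x ∈ S, u x ≤ h k x) ∧ (∀ k, ∀ x, h k x ≤ 0) ∧
      ∀ x ∈ S, ∀ c : ℝ, u x < c → ∃ k, h k x < c := by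
  by_cases hS : S.Nonempty
  swap
  · rw [Set.not_nonempty_iff_eq_empty] at hS
    subst hS
    exact ⟨fun _ _ => 0, by fun_prop, by simp, by simp, by simp, by simp⟩
  have : Nonempty S := hS.to_subtype
  set v : ℕ → S → ℝ := fun k y => (max (u y) ((-(k:ℝ) : ℝ) : EReal)).toReal with hv
  have hvc : ∀ k y, ((v k y : ℝ) : EReal) = max (u y) ((-(k:ℝ) : ℝ) : EReal) := by
    intro k y
    apply EReal.coe_toReal
    · exact ((max_le (h0 y y.2) (by exact_mod_cast neg_nonpos.2 k.cast_nonneg)).trans_lt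
        EReal.zero_lt_top).ne
    · exact ((EReal.bot_lt_coe _).trans_le (le_max_right _ _)).ne'
  have hv0 : ∀ k y, v k y ≤ 0 := by
    intro k y
    have : ((v k y : ℝ) : EReal) ≤ ((0:ℝ) : EReal) := by
      rw [hvc]; exact max_le (h0 y y.2) (by exact_mod_cast neg_nonpos.2 k.cast_nonneg)
    exact_mod_cast this
  have hvle : ∀ (k : ℕ) y, -(k:ℝ) ≤ v k y := by
    intro k y
    have : ((-(k:ℝ) : ℝ) : EReal) ≤ ((v k y : ℝ) : EReal) := by
      rw [hvc]; exact le_max_right _ _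
    exact_mod_cast this
  have hvmono : ∀ k y, v (k+1) y ≤ v k y := by
    intro k y
    have : ((v (k+1) y : ℝ) : EReal) ≤ ((v k y : ℝ) : EReal) := by
      rw [hvc, hvc]
      refine max_le_max le_rfl ?_
      refine EReal.coe_le_coe_iff.2 ?_
      push_cast; linarith
    exact_mod_cast this
  have hbdd : ∀ k (x : X), BddAbove (Set.range fun y : S => v k y - k * dist x y) := by
    rintro k x
    refine ⟨0, ?_⟩
    rintro _ ⟨y, rfl⟩
    have := mul_nonneg (Nat.cast_nonneg (α := ℝ) k) (dist_nonneg (x := x) (y := (y:X)))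
    have := hv0 k y
    linarith
  refine ⟨fun k x => ⨆ y : S, (v k y - k * dist x y), ?_, ?_, ?_, ?_, ?_⟩
  · intro k
    have : LipschitzWith (k : NNReal) fun x : X => ⨆ y : S, (v k y - k * dist x y) := by
      refine LipschitzWith.of_le_add_mul _ fun x x' => ?_
      refine ciSup_le fun y => ?_
      have h1 : v k y - k * dist x' y ≤ _ := le_ciSup (hbdd k x') y
      have h2 := dist_triangle x' x y
      have h3 := mul_le_mul_of_nonneg_left h2 (Nat.cast_nonneg (α := ℝ) k)
      rw [dist_comm x' x] at h3
      push_cast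
      linarith
    exact this.continuous
  · intro k x
    refine ciSup_mono (hbdd k x) fun y => ?_
    have := hvmono k y
    have h3 : (k:ℝ) * dist x y ≤ (k+1 : ℕ) * dist x y :=
      mul_le_mul_of_nonneg_right (by push_cast; linarith) dist_nonneg
    linarith
  · intro k x hx
    have h1 := le_ciSup (hbdd k x) ⟨x, hx⟩
    simp only [dist_self, mul_zero, sub_zero] at h1
    calc u x ≤ ((v k ⟨x, hx⟩ : ℝ) : EReal) := by rw [hvc]; exact le_max_left _ _
      _ ≤ _ := by exact_mod_cast h1
  · intro k x
    refine ciSup_le fun y => ?_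
    have := mul_nonneg (Nat.cast_nonneg (α := ℝ) k) (dist_nonneg (x := x) (y := (y:X)))
    have := hv0 k y
    linarith
  · intro x hx c hc
    obtain ⟨c', h1, h2⟩ := EReal.lt_iff_exists_real_btwn.1 hc
    have h2 : c' < c := by exact_mod_cast h2
    obtain ⟨δ, hδ, hb⟩ := Metric.mem_nhdsWithin_iff.1 (hu x hx c' h1)
    obtain ⟨k, hk⟩ := exists_nat_gt (max (-c') (-c' / δ))
    refine ⟨k, lt_of_le_of_lt (ciSup_le fun y => ?_) h2⟩
    have hk1 : -c' < k := (le_max_left _ _).trans_lt hk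
    have hk2 : -c' < k * δ := by
      have := (le_max_right _ _).trans_lt hk
      rwa [div_lt_iff₀ hδ] at this
    by_cases hy : dist x y < δ
    · have h3 : u y < c' := hb ⟨by rw [Metric.mem_ball, dist_comm]; exact hy, y.2⟩
      have h4 : ((v k y : ℝ) : EReal) ≤ (c' : EReal) := by
        rw [hvc]; exact max_le h3.le (EReal.coe_le_coe_iff.2 (by linarith))
      have h4 : v k y ≤ c' := by exact_mod_cast h4
      have := mul_nonneg (Nat.cast_nonneg (α := ℝ) k) (dist_nonneg (x := x) (y := (y:X)))
      linarith
    · have := mul_le_mul_of_nonneg_left (not_lt.1 hy) (Nat.cast_nonneg (α := ℝ) k)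
      have := hv0 k y
      linarith

/-- Dini-type lemma. -/
lemma exists_forall_lt_of_antitone {X : Type*} [TopologicalSpace X] {S : Set X} (hS : IsCompact S)
    {h : ℕ → X → ℝ} (hc : ∀ k, ContinuousOn (h k) S)
    (ha : ∀ k, ∀ x ∈ S, h (k + 1) x ≤ h k x) {c : X → ℝ} (hcc : ContinuousOn c S)
    (hlt : ∀ x ∈ S, ∃ k, h k x < c x) : ∃ k, ∀ l, k ≤ l → ∀ x ∈ S, h l x < c x := by
  have hmono : ∀ x ∈ S, Antitone fun k => h k x := fun x hx =>
    antitone_nat_of_succ_le fun k => ha k x hx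
  suffices ∃ k, ∀ x ∈ S, h k x < c x by
    obtain ⟨k, hk⟩ := this
    exact ⟨k, fun l hl x hx => (hmono x hx hl).trans_lt (hk x hx)⟩
  have hO : ∀ k, ∃ O, IsOpen O ∧ S ∩ {x | h k x < c x} = S ∩ O := by
    intro k
    obtain ⟨O, hO, hOe⟩ := continuousOn_iff'.1 ((hc k).sub hcc) (Set.Iio 0) isOpen_Iio
    refine ⟨O, hO, ?_⟩
    rw [Set.inter_comm S O, ← hOe]
    ext x; simp [and_comm]
  choose O hOo hOe using hO
  obtain ⟨t, ht⟩ := hS.elim_finite_subcover O hOo (fun x hx => by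
    obtain ⟨k, hk⟩ := hlt x hx
    have : x ∈ S ∩ O k := by rw [← hOe]; exact ⟨hx, hk⟩
    exact Set.mem_iUnion.2 ⟨k, this.2⟩)
  refine ⟨t.sup id, fun x hx => ?_⟩
  obtain ⟨k, hk, hxk⟩ := Set.mem_iUnion₂.1 (ht hx)
  have : x ∈ S ∩ {x | h k x < c x} := by rw [hOe]; exact ⟨hx, hxk⟩
  exact (hmono x hx (Finset.le_sup (f := id) hk)).trans_lt this.2

end UscApproximation

section PshOperations

variable {E : Type*} [NormedAddCommGroup E] [NormedSpace ℂ E]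

/-- `H` is a uniform limit of real parts of polynomials on the closed disc of radius `r`. -/
def ReApprox (H : ℂ → ℝ) (r : ℝ) : Prop :=
  ∀ ε : ℝ, 0 < ε → ∃ p : Polynomial ℂ, ∀ ζ : ℂ, ‖ζ‖ ≤ r → |H ζ - (p.eval ζ).re| < ε

lemma ReApprox.of_differentiableOn {f : ℂ → ℂ} {r R : ℝ} (hr : 0 ≤ r) (hrR : r < R)
    (hf : DifferentiableOn ℂ f (Metric.ball 0 R)) : ReApprox (fun ζ => (f ζ).re) r := by
  intro ε hε
  obtain ⟨p, hp⟩ := exists_polynomial_approx_of_differentiableOn hr hrR hf hε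
  refine ⟨p, fun ζ hζ => ?_⟩
  rw [← Complex.sub_re]
  exact (Complex.abs_re_le_norm _).trans_lt (hp ζ hζ)

lemma ReApprox.congr {H H' : ℂ → ℝ} {r : ℝ} (h : ReApprox H r)
    (he : ∀ ζ : ℂ, ‖ζ‖ ≤ r → H' ζ = H ζ) : ReApprox H' r := by
  intro ε hε
  obtain ⟨p, hp⟩ := h ε hε
  exact ⟨p, fun ζ hζ => by rw [he ζ hζ]; exact hp ζ hζ⟩

lemma ReApprox.polynomial (p : Polynomial ℂ) (r : ℝ) : ReApprox (fun ζ => (p.eval ζ).re) r :=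
  fun ε hε => ⟨p, fun ζ _ => by simpa using hε⟩

lemma ReApprox.const (c : ℝ) (r : ℝ) : ReApprox (fun _ => c) r :=
  (ReApprox.polynomial (Polynomial.C (c : ℂ)) r).congr fun ζ _ => by simp

lemma ReApprox.add {H H' : ℂ → ℝ} {r : ℝ} (h : ReApprox H r) (h' : ReApprox H' r) :
    ReApprox (fun ζ => H ζ + H' ζ) r := by
  intro ε hε
  obtain ⟨p, hp⟩ := h (ε / 2) (by positivity)
  obtain ⟨q, hq⟩ := h' (ε / 2) (by positivity)
  refine ⟨p + q, fun ζ hζ => ?_⟩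
  have h1 := abs_lt.1 (hp ζ hζ)
  have h2 := abs_lt.1 (hq ζ hζ)
  rw [Polynomial.eval_add, Complex.add_re, abs_lt]
  constructor <;> linarith

lemma ReApprox.const_mul {H : ℂ → ℝ} {r : ℝ} (h : ReApprox H r) (c : ℝ) :
    ReApprox (fun ζ => c * H ζ) r := by
  intro ε hε
  obtain ⟨p, hp⟩ := h (ε / (|c| + 1)) (by positivity)
  refine ⟨Polynomial.C (c : ℂ) * p, fun ζ hζ => ?_⟩
  have h1 := hp ζ hζ
  rw [lt_div_iff₀ (by positivity)] at h1
  rw [Polynomial.eval_mul, Polynomial.eval_C, Complex.re_ofReal_mul, ← mul_sub, abs_mul]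
  nlinarith [abs_nonneg (H ζ - (p.eval ζ).re)]

lemma ReApprox.log_norm {a b : ℂ} {r : ℝ} (hr : 0 ≤ r)
    (h : ∀ ζ : ℂ, ‖ζ‖ ≤ r → a + ζ * b ≠ 0) : ReApprox (fun ζ => Real.log ‖a + ζ * b‖) r := by
  have ha : a ≠ 0 := by simpa using h 0 (by simpa using hr)
  have hlt : r * ‖b‖ < ‖a‖ := by
    by_contra hcon
    push Not at hcon
    have hb : b ≠ 0 := by
      rintro rfl
      simp at hcon
      exact ha hcon
    refine h (-a / b) ?_ (by field_simp; simp)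
    rw [norm_div, norm_neg, div_le_iff₀ (by positivity)]
    exact hcon
  obtain ⟨R, hrR, hR⟩ : ∃ R, r < R ∧ R * ‖b‖ < ‖a‖ := by
    have : ∀ᶠ R in 𝓝[>] r, R * ‖b‖ < ‖a‖ := by
      have hc : ContinuousAt (fun R : ℝ => R * ‖b‖) r := by fun_prop
      exact nhdsWithin_le_nhds (hc (Iio_mem_nhds hlt))
    obtain ⟨R, h1, h2⟩ := (this.and self_mem_nhdsWithin).exists
    exact ⟨R, h2, h1⟩
  have hslit : ∀ ζ : ℂ, ‖ζ‖ < R → 1 + ζ * (b / a) ∈ Complex.slitPlane := by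
    intro ζ hζ
    refine Complex.mem_slitPlane_of_norm_lt_one ?_
    rw [norm_mul, norm_div, mul_div_assoc', div_lt_one (by positivity)]
    exact (mul_le_mul_of_nonneg_right hζ.le (norm_nonneg _)).trans_lt hR
  have hd : DifferentiableOn ℂ (fun ζ => Complex.log (1 + ζ * (b / a))) (Metric.ball 0 R) := by
    intro ζ hζ
    refine DifferentiableAt.differentiableWithinAt ?_
    exact DifferentiableAt.clog (by fun_prop) (hslit ζ (by simpa using hζ))
  refine ((ReApprox.of_differentiableOn hr hrR hd).add (ReApprox.const (Real.log ‖a‖) r)).congr ?_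
  intro ζ hζ
  have h1 := Complex.slitPlane_ne_zero (hslit ζ (hζ.trans_lt hrR))
  rw [Complex.log_re, ← Real.log_mul (by simpa using h1) (by simpa using ha), ← norm_mul]
  congr 2
  field_simp

lemma EReal.le_coe_of_forall_pos_add {x : EReal} {c : ℝ}
    (h : ∀ ε : ℝ, 0 < ε → x ≤ ((c + ε : ℝ) : EReal)) : x ≤ (c : EReal) := by
  refine le_of_forall_gt_imp_ge_of_dense fun d hd => ?_
  obtain ⟨e, h1, h2⟩ := EReal.lt_iff_exists_real_btwn.1 hd
  have h1 : c < e := by exact_mod_cast h1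
  refine (h (e - c) (by linarith)).trans ?_
  simpa using h2.le

lemma PlurisubharmonicOn.mono {u : E → EReal} {Ω Ω' : Set E} (h : PlurisubharmonicOn u Ω)
    (hs : Ω' ⊆ Ω) : PlurisubharmonicOn u Ω' :=
  ⟨h.1.mono hs, fun a b r hr hd => h.2 a b r hr fun ζ hζ => hs (hd ζ hζ)⟩

lemma PlurisubharmonicOn.congr {u v : E → EReal} {Ω : Set E} (h : PlurisubharmonicOn u Ω)
    (he : ∀ z ∈ Ω, v z = u z) : PlurisubharmonicOn v Ω := by
  refine ⟨?_, fun a b r hr hd p hp ζ hζ => ?_⟩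
  · intro x hx c hc
    rw [he x hx] at hc
    filter_upwards [h.1 x hx c hc, self_mem_nhdsWithin] with y hy hy'
    rwa [he y hy']
  · rw [he _ (hd ζ hζ)]
    exact h.2 a b r hr hd p (fun ξ hξ => by rw [← he _ (hd ξ hξ.le)]; exact hp ξ hξ) ζ hζ

/-- The maximum principle with respect to limits of real parts of polynomials. -/
lemma PlurisubharmonicOn.le_of_reApprox {u : E → EReal} {Ω : Set E} (h : PlurisubharmonicOn u Ω)
    {a b : E} {r : ℝ} (hr : 0 < r) (hd : ∀ ζ : ℂ, ‖ζ‖ ≤ r → a + ζ • b ∈ Ω) {H : ℂ → ℝ}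
    (hH : ReApprox H r) (hc : ∀ ζ : ℂ, ‖ζ‖ = r → u (a + ζ • b) ≤ (H ζ : EReal))
    {ζ : ℂ} (hζ : ‖ζ‖ ≤ r) : u (a + ζ • b) ≤ (H ζ : EReal) := by
  refine EReal.le_coe_of_forall_pos_add fun ε hε => ?_
  obtain ⟨p, hp⟩ := hH (ε / 2) (by positivity)
  have h1 : ∀ ξ : ℂ, ((p + Polynomial.C ((ε / 2 : ℝ) : ℂ)).eval ξ).re = (p.eval ξ).re + ε / 2 := by
    intro ξ
    rw [Polynomial.eval_add, Polynomial.eval_C, Complex.add_re, Complex.ofReal_re]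
  refine (h.2 a b r hr hd (p + Polynomial.C ((ε / 2 : ℝ) : ℂ)) (fun ξ hξ => ?_) ζ hζ).trans ?_
  · refine (hc ξ hξ).trans (EReal.coe_le_coe_iff.2 ?_)
    rw [h1]
    have := (abs_lt.1 (hp ξ hξ.le)).2
    linarith
  · refine EReal.coe_le_coe_iff.2 ?_
    rw [h1]
    have := (abs_lt.1 (hp ζ hζ)).1
    linarith

lemma plurisubharmonicOn_const (c : ℝ) (Ω : Set E) :
    PlurisubharmonicOn (fun _ => (c : EReal)) Ω := by
  refine ⟨upperSemicontinuousOn_const, fun a b r hr _ p hp ζ hζ => ?_⟩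
  exact EReal.coe_le_coe_iff.2
    (le_re_eval_of_circle hr (fun ξ hξ => EReal.coe_le_coe_iff.1 (hp ξ hξ)) hζ)

lemma PlurisubharmonicOn.max {u v : E → EReal} {Ω : Set E} (hu : PlurisubharmonicOn u Ω)
    (hv : PlurisubharmonicOn v Ω) : PlurisubharmonicOn (fun z => max (u z) (v z)) Ω := by
  refine ⟨hu.1.sup hv.1, fun a b r hr hd p hp ζ hζ => max_le ?_ ?_⟩
  · exact hu.2 a b r hr hd p (fun ξ hξ => (le_max_left _ _).trans (hp ξ hξ)) ζ hζ
  · exact hv.2 a b r hr hd p (fun ξ hξ => (le_max_right _ _).trans (hp ξ hξ)) ζ hζ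

lemma EReal.add_coe_le_coe_iff {x : EReal} {a b : ℝ} :
    x + (a : EReal) ≤ (b : EReal) ↔ x ≤ ((b - a : ℝ) : EReal) := by
  induction x with
  | bot => simp
  | top => simpa using EReal.coe_ne_top (b - a)
  | coe x =>
    norm_cast
    constructor <;> intro h <;> linarith

lemma EReal.coe_mul_le_coe_iff {x : EReal} {c : ℝ} (hc : 0 < c) {b : ℝ} :
    (c : EReal) * x ≤ (b : EReal) ↔ x ≤ ((b / c : ℝ) : EReal) := by
  induction x with
  | bot => simp [EReal.coe_mul_bot_of_pos hc]
  | top => simp [EReal.coe_mul_top_of_pos hc]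
  | coe x =>
    norm_cast
    rw [le_div_iff₀ hc, mul_comm]

lemma PlurisubharmonicOn.add_coe {u : E → EReal} {Ω : Set E} (hu : PlurisubharmonicOn u Ω)
    {H : E → ℝ} (hH : ContinuousOn H Ω)
    (hA : ∀ a b : E, ∀ r : ℝ, 0 < r → (∀ ζ : ℂ, ‖ζ‖ ≤ r → a + ζ • b ∈ Ω) →
      ReApprox (fun ζ => H (a + ζ • b)) r) :
    PlurisubharmonicOn (fun z => u z + (H z : EReal)) Ω := by
  refine ⟨?_, fun a b r hr hd p hp ζ hζ => ?_⟩
  · refine hu.1.add' ?_ fun x hx => ?_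
    · exact (continuous_coe_real_ereal.comp_continuousOn hH).upperSemicontinuousOn
    · exact EReal.continuousAt_add (Or.inr (EReal.coe_ne_bot _)) (Or.inr (EReal.coe_ne_top _))
  · rw [EReal.add_coe_le_coe_iff]
    have h1 := ((ReApprox.polynomial p r).add ((hA a b r hr hd).const_mul (-1)))
    refine (hu.le_of_reApprox hr hd h1 (fun ξ hξ => ?_) hζ).trans ?_
    · have := hp ξ hξ
      rw [EReal.add_coe_le_coe_iff] at this
      refine this.trans (EReal.coe_le_coe_iff.2 ?_)
      linarith
    · refine EReal.coe_le_coe_iff.2 ?_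
      linarith

lemma PlurisubharmonicOn.add_const {u : E → EReal} {Ω : Set E} (hu : PlurisubharmonicOn u Ω)
    (c : ℝ) : PlurisubharmonicOn (fun z => u z + (c : EReal)) Ω :=
  hu.add_coe (H := fun _ => c) continuousOn_const fun _ _ r _ _ => ReApprox.const c r

lemma EReal.continuous_coe_mul_pos {c : ℝ} (hc : 0 < c) :
    Continuous fun x : EReal => (c : EReal) * x := by
  rw [continuous_iff_continuousAt]
  intro x
  have h0 : (c : EReal) ≠ 0 := by exact_mod_cast hc.ne'
  have h := EReal.continuousAt_mul (p := ((c : EReal), x)) (Or.inl h0) (Or.inl h0)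
    (Or.inl (EReal.coe_ne_bot _)) (Or.inl (EReal.coe_ne_top _))
  exact h.comp (f := fun x => ((c : EReal), x)) (by fun_prop)

lemma EReal.monotone_coe_mul {c : ℝ} (hc : 0 < c) :
    Monotone fun x : EReal => (c : EReal) * x :=
  fun _ _ h => mul_le_mul_of_nonneg_left h (by exact_mod_cast hc.le)

lemma PlurisubharmonicOn.const_mul {u : E → EReal} {Ω : Set E} (hu : PlurisubharmonicOn u Ω)
    {c : ℝ} (hc : 0 < c) : PlurisubharmonicOn (fun z => (c : EReal) * u z) Ω := by
  refine ⟨?_, fun a b r hr hd p hp ζ hζ => ?_⟩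
  · exact (EReal.continuous_coe_mul_pos hc).comp_upperSemicontinuousOn hu.1
      (EReal.monotone_coe_mul hc)
  · rw [EReal.coe_mul_le_coe_iff hc]
    have h1 := (ReApprox.polynomial p r).const_mul (c⁻¹)
    refine (hu.le_of_reApprox hr hd h1 (fun ξ hξ => ?_) hζ).trans ?_
    · have := hp ξ hξ
      rw [EReal.coe_mul_le_coe_iff hc] at this
      rwa [div_eq_inv_mul] at this
    · rw [div_eq_inv_mul]

lemma PSHNeg.add {u v : E → EReal} {Ω : Set E} (hu : PSHNeg u Ω) (hv : PSHNeg v Ω) :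
    PSHNeg (fun z => u z + v z) Ω := by
  refine ⟨⟨?_, fun a b r hr hd p hp ζ hζ => ?_⟩, fun z hz => add_nonpos (hu.2 z hz) (hv.2 z hz)⟩
  · refine hu.1.1.add' hv.1.1 fun x hx => EReal.continuousAt_add ?_ ?_
    · exact Or.inl ((hu.2 x hx).trans_lt EReal.zero_lt_top).ne
    · exact Or.inr ((hv.2 x hx).trans_lt EReal.zero_lt_top).ne
  set S := Metric.sphere (0 : ℂ) r
  have hmaps : Set.MapsTo (fun ζ : ℂ => a + ζ • b) S Ω := fun ξ hξ => hd ξ (by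
    rw [mem_sphere_zero_iff_norm] at hξ; exact hξ.le)
  have hcont : ContinuousOn (fun ζ : ℂ => a + ζ • b) S := by fun_prop
  obtain ⟨h, hc, ha, hle, hneg, hlim⟩ := exists_antitone_continuous_approx
    (hu.1.1.comp hcont hmaps) (fun ξ hξ => hu.2 _ (hmaps hξ))
  obtain ⟨h', hc', ha', hle', hneg', hlim'⟩ := exists_antitone_continuous_approx
    (hv.1.1.comp hcont hmaps) (fun ξ hξ => hv.2 _ (hmaps hξ))
  refine EReal.le_coe_of_forall_pos_add fun ε hε => ?_
  have hanti : ∀ ξ, Antitone fun k => h k ξ := fun ξ => antitone_nat_of_succ_le fun k => ha k ξ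
  have hanti' : ∀ ξ, Antitone fun k => h' k ξ := fun ξ => antitone_nat_of_succ_le fun k => ha' k ξ
  obtain ⟨k, hk⟩ := exists_forall_lt_of_antitone (isCompact_sphere (0:ℂ) r)
    (h := fun k ξ => h k ξ + h' k ξ) (c := fun ξ => (p.eval ξ).re + ε / 5)
    (fun k => ((hc k).add (hc' k)).continuousOn)
    (fun k x _ => add_le_add (ha k x) (ha' k x)) (by fun_prop) (fun ξ hξ => by
      have h1 : u (a + ξ • b) + v (a + ξ • b) ≤ _ := hp ξ (by simpa [S] using hξ)
      have hux := hu.2 _ (hmaps hξ)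
      have hvx := hv.2 _ (hmaps hξ)
      have l1 := hlim ξ hξ
      have l2 := hlim' ξ hξ
      simp only [Function.comp] at l1 l2
      generalize u (a + ξ • b) = x at h1 hux l1
      generalize v (a + ξ • b) = y at h1 hvx l2
      induction x with
      | bot => 
        obtain ⟨k, hk⟩ := l1 ((p.eval ξ).re + ε / 5) (EReal.bot_lt_coe _)
        exact ⟨k, by linarith [hneg' k ξ]⟩
      | top => simp at hux
      | coe x =>
        induction y with
        | bot => 
          obtain ⟨k, hk⟩ := l2 ((p.eval ξ).re + ε / 5) (EReal.bot_lt_coe _)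
          exact ⟨k, by linarith [hneg k ξ]⟩
        | top => simp at hvx
        | coe y =>
          have h1 : x + y ≤ (p.eval ξ).re := EReal.coe_le_coe_iff.1 h1
          obtain ⟨k, hk⟩ := l1 (x + ε / 10) (EReal.coe_lt_coe_iff.2 (by linarith))
          obtain ⟨l, hl⟩ := l2 (y + ε / 10) (EReal.coe_lt_coe_iff.2 (by linarith))
          refine ⟨Max.max k l, ?_⟩
          have := hanti ξ (le_max_left k l)
          have := hanti' ξ (le_max_right k l)
          linarith)
  obtain ⟨q, hq⟩ := exists_polynomial_approx_circle hr (hc k).continuousOn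
    (show 0 < ε / 5 by positivity)
  obtain ⟨q', hq'⟩ := exists_polynomial_approx_circle hr (hc' k).continuousOn
    (show 0 < ε / 5 by positivity)
  have hA := (ReApprox.polynomial q r).add (ReApprox.const (ε / 5) r)
  have hA' := (ReApprox.polynomial q' r).add (ReApprox.const (ε / 5) r)
  have e1 := hu.1.le_of_reApprox hr hd hA (fun ξ hξ => (hle k ξ (by simpa [S] using hξ)).trans
    (EReal.coe_le_coe_iff.2 (by linarith [(abs_lt.1 (hq ξ hξ)).2]))) hζ
  have e2 := hv.1.le_of_reApprox hr hd hA' (fun ξ hξ => (hle' k ξ (by simpa [S] using hξ)).trans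
    (EReal.coe_le_coe_iff.2 (by linarith [(abs_lt.1 (hq' ξ hξ)).2]))) hζ
  have e3 := re_eval_le_of_circle (q := q + q' - p) (c := 3 * (ε / 5)) hr (fun ξ hξ => by
    have := hk k le_rfl ξ (by simpa [S] using hξ)
    have h1 := (abs_lt.1 (hq ξ hξ)).1
    have h2 := (abs_lt.1 (hq' ξ hξ)).1
    simp only [Polynomial.eval_sub, Polynomial.eval_add, Complex.sub_re, Complex.add_re]
    linarith) hζ
  simp only [Polynomial.eval_sub, Polynomial.eval_add, Complex.sub_re, Complex.add_re] at e3
  refine (add_le_add e1 e2).trans ?_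
  rw [← EReal.coe_add]
  refine EReal.coe_le_coe_iff.2 ?_
  linarith

lemma PSHNeg.max {u v : E → EReal} {Ω : Set E} (hu : PSHNeg u Ω) (hv : PSHNeg v Ω) :
    PSHNeg (fun z => max (u z) (v z)) Ω :=
  ⟨hu.1.max hv.1, fun z hz => max_le (hu.2 z hz) (hv.2 z hz)⟩

lemma PSHNeg.const_mul {u : E → EReal} {Ω : Set E} (hu : PSHNeg u Ω) {c : ℝ} (hc : 0 < c) :
    PSHNeg (fun z => (c : EReal) * u z) Ω :=
  ⟨hu.1.const_mul hc, fun z hz => by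
    have := EReal.monotone_coe_mul hc (hu.2 z hz)
    simpa using this⟩

end PshOperations

section CircleMeans

lemma integral_circle_re_eval (p : Polynomial ℂ) (s : ℝ) :
    ∫ θ in (0:ℝ)..2 * Real.pi, (p.eval (circleMap 0 s θ)).re = 2 * Real.pi * (p.eval 0).re := by
  have h := (p.differentiable.diffContOnCl (s := Metric.ball 0 |s|)).circleAverage
  rw [Real.circleAverage_def] at h
  have h2 := congrArg Complex.re h
  rw [Complex.smul_re] at h2
  have h3 : ∫ θ in (0:ℝ)..2 * Real.pi, (p.eval (circleMap 0 s θ)).re =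
      (∫ θ in (0:ℝ)..2 * Real.pi, p.eval (circleMap 0 s θ)).re := by
    refine Complex.reCLM.intervalIntegral_comp_comm (Continuous.intervalIntegrable ?_ _ _)
    fun_prop
  rw [h3, ← h2, smul_eq_mul, ← mul_assoc, mul_inv_cancel₀ (by positivity), one_mul]

variable {E : Type*} [NormedAddCommGroup E] [NormedSpace ℂ E] [MeasurableSpace E] [BorelSpace E]

lemma intervalIntegrable_of_abs_le {f : ℝ → ℝ} {M a b : ℝ} (hf : Measurable f)
    (hM : ∀ x, |f x| ≤ M) : IntervalIntegrable f volume a b := by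
  refine (intervalIntegrable_const (c := M)).mono_fun hf.aestronglyMeasurable ?_
  refine ae_of_all _ fun x => ?_
  exact (hM x).trans (le_abs_self _)

lemma measurable_circle_comp {u : E → ℝ} (hm : Measurable u) (a b : E) (s : ℝ) :
    Measurable fun θ : ℝ => u (a + circleMap 0 s θ • b) :=
  hm.comp (by fun_prop : Continuous fun θ : ℝ => a + circleMap 0 s θ • b).measurable

lemma integral_circle_mono {u : E → ℝ} {Ω : Set E}
    (hu : PlurisubharmonicOn (fun z => (u z : EReal)) Ω) (hm : Measurable u) {M : ℝ}
    (hM : ∀ z, |u z| ≤ M) {a b : E} {r s : ℝ} (hr : 0 ≤ r) (hrs : r ≤ s)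
    (hd : ∀ ζ : ℂ, ‖ζ‖ ≤ s → a + ζ • b ∈ Ω) :
    ∫ θ in (0:ℝ)..2 * Real.pi, u (a + circleMap 0 r θ • b) ≤
      ∫ θ in (0:ℝ)..2 * Real.pi, u (a + circleMap 0 s θ • b) := by
  rcases (hr.trans hrs).eq_or_lt with hs | hs
  · rw [show r = s by linarith]
  have hpi := Real.pi_pos
  set S := Metric.sphere (0 : ℂ) s
  have hmaps : Set.MapsTo (fun ζ : ℂ => a + ζ • b) S Ω := fun ξ hξ => hd ξ (by
    rw [mem_sphere_zero_iff_norm] at hξ; exact hξ.le)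
  have hcont : ContinuousOn (fun ζ : ℂ => a + ζ • b) S := by fun_prop
  have hu' := hu.add_const (-M)
  obtain ⟨h, hc, ha, hle, hneg, hlim⟩ := exists_antitone_continuous_approx
    (hu'.1.comp hcont hmaps) (fun ξ hξ => by
      have := (abs_le.1 (hM (a + ξ • b))).2
      change (u (a + ξ • b) : EReal) + ((-M : ℝ) : EReal) ≤ ((0 : ℝ) : EReal)
      rw [← EReal.coe_add]
      exact EReal.coe_le_coe_iff.2 (by linarith))
  have hle : ∀ k, ∀ ξ ∈ S, u (a + ξ • b) - M ≤ h k ξ := fun k ξ hξ =>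
    EReal.coe_le_coe_iff.1 (hle k ξ hξ)
  have hS : ∀ θ, circleMap 0 s θ ∈ S := fun θ => by
    simp [S, abs_of_pos hs]
  have key : ∀ k, ∀ ε : ℝ, 0 < ε → ∫ θ in (0:ℝ)..2 * Real.pi, u (a + circleMap 0 r θ • b) ≤
      (∫ θ in (0:ℝ)..2 * Real.pi, (h k (circleMap 0 s θ) + M)) + 2 * Real.pi * ε := by
    intro k ε hε
    obtain ⟨q, hq⟩ := exists_polynomial_approx_circle hs (hc k).continuousOn
      (show 0 < ε / 2 by positivity)
    have hA := (ReApprox.polynomial q s).add (ReApprox.const (ε / 2 + M) s)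
    have e1 : ∀ ζ : ℂ, ‖ζ‖ ≤ s → u (a + ζ • b) ≤ (q.eval ζ).re + (ε / 2 + M) := fun ζ hζ => by
      refine EReal.coe_le_coe_iff.1 (hu.le_of_reApprox hs hd hA (fun ξ hξ => ?_) hζ)
      refine EReal.coe_le_coe_iff.2 ?_
      have h1 := hle k ξ (by simpa [S] using hξ)
      have h2 := (abs_lt.1 (hq ξ hξ)).2
      linarith
    have hqi : ∀ s, IntervalIntegrable (fun θ => (q.eval (circleMap 0 s θ)).re) volume 0
        (2 * Real.pi) := fun s => by
      refine Continuous.intervalIntegrable ?_ _ _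
      fun_prop
    have hki : IntervalIntegrable (fun θ => h k (circleMap 0 s θ)) volume 0
        (2 * Real.pi) := Continuous.intervalIntegrable ((hc k).comp (by fun_prop)) _ _
    calc _ ≤ ∫ θ in (0:ℝ)..2 * Real.pi, ((q.eval (circleMap 0 r θ)).re + (ε / 2 + M)) := by
          refine intervalIntegral.integral_mono (by positivity)
            (intervalIntegrable_of_abs_le (measurable_circle_comp hm _ _ _) fun θ => hM _)
            ((hqi r).add (by simp)) fun θ => ?_
          exact e1 _ (by simpa [abs_of_nonneg hr] using hrs)
      _ = ∫ θ in (0:ℝ)..2 * Real.pi, ((q.eval (circleMap 0 s θ)).re + (ε / 2 + M)) := by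
          rw [intervalIntegral.integral_add (hqi r) (by simp),
            intervalIntegral.integral_add (hqi s) (by simp), integral_circle_re_eval,
            integral_circle_re_eval]
      _ ≤ ∫ θ in (0:ℝ)..2 * Real.pi, ((h k (circleMap 0 s θ) + M) + ε) := by
          refine intervalIntegral.integral_mono (by positivity) ((hqi s).add (by simp))
            ((hki.add (by simp)).add (by simp)) fun θ => ?_
          have h2 := (abs_lt.1 (hq (circleMap 0 s θ) (by simp [abs_of_pos hs]))).1
          simp only
          linarith
      _ = _ := by
          rw [intervalIntegral.integral_add (hki.add (by simp)) (by simp)]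
          simp
  have key2 : ∀ k, ∫ θ in (0:ℝ)..2 * Real.pi, u (a + circleMap 0 r θ • b) ≤
      ∫ θ in (0:ℝ)..2 * Real.pi, (h k (circleMap 0 s θ) + M) := by
    intro k
    refine le_of_forall_pos_le_add fun ε hε => ?_
    have := key k (ε / (2 * Real.pi)) (by positivity)
    rwa [mul_div_cancel₀ _ (by positivity)] at this
  refine ge_of_tendsto' (x := atTop)
    (f := fun k => ∫ θ in (0:ℝ)..2 * Real.pi, (h k (circleMap 0 s θ) + M)) ?_ key2
  refine intervalIntegral.tendsto_integral_filter_of_dominated_convergence (fun _ => 3 * M)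
    (Eventually.of_forall fun k => ?_) (Eventually.of_forall fun k => ae_of_all _ fun θ _ => ?_)
    (by simp) (ae_of_all _ fun θ _ => ?_)
  · refine Continuous.aestronglyMeasurable ?_
    exact ((hc k).comp (by fun_prop)).add continuous_const
  · have h1 := hle k _ (hS θ)
    have h2 := hneg k (circleMap 0 s θ)
    have h3 := abs_le.1 (hM (a + circleMap 0 s θ • b))
    rw [Real.norm_eq_abs, abs_le]
    constructor <;> linarith
  · refine tendsto_order.2 ⟨fun c hc => Eventually.of_forall fun k => ?_, fun c hc => ?_⟩
    · have h1 := hle k _ (hS θ)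
      linarith
    · obtain ⟨k, hk⟩ := hlim _ (hS θ) (c - M) (by
        change (u _ : EReal) + ((-M : ℝ) : EReal) < _
        rw [← EReal.coe_add]
        exact EReal.coe_lt_coe_iff.2 (by linarith))
      refine eventually_atTop.2 ⟨k, fun l hl => ?_⟩
      have : h l (circleMap 0 s θ) ≤ h k (circleMap 0 s θ) := antitone_nat_of_succ_le
        (f := fun k => h k (circleMap 0 s θ)) (fun k => ha k _) hl
      linarith

/-- Maximum principle for continuous functions satisfying a strict local condition at interior
maxima. -/
lemma le_of_forall_not_isMaxOn {s : ℂ → ℝ} {r : ℝ}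
    (hs : ContinuousOn s (Metric.closedBall 0 r)) (hc : ∀ ζ : ℂ, ‖ζ‖ = r → s ζ ≤ 0)
    (hmax : ∀ δ : ℝ, 0 < δ → ∀ ζ₀ : ℂ, ‖ζ₀‖ < r →
      ¬ IsMaxOn (fun ζ => s ζ + δ * ‖ζ‖ ^ 2) (Metric.closedBall 0 r) ζ₀)
    {ζ : ℂ} (hζ : ‖ζ‖ ≤ r) : s ζ ≤ 0 := by
  refine le_of_forall_pos_le_add fun ε hε => ?_
  set δ := ε / (r ^ 2 + 1) with hδ
  have hδ0 : 0 < δ := by positivity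
  obtain ⟨ζ₀, h1, h2⟩ := (isCompact_closedBall (0:ℂ) r).exists_isMaxOn
    ⟨0, by simpa using (norm_nonneg ζ).trans hζ⟩
    (f := fun ζ => s ζ + δ * ‖ζ‖ ^ 2) (by fun_prop)
  have h3 : ‖ζ₀‖ ≤ r := by simpa using h1
  have h4 : ‖ζ₀‖ = r := by
    by_contra hne
    exact hmax δ hδ0 ζ₀ (lt_of_le_of_ne h3 hne) h2
  have h5 : s ζ + δ * ‖ζ‖ ^ 2 ≤ s ζ₀ + δ * ‖ζ₀‖ ^ 2 := h2 (by simpa using hζ)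
  have h6 := hc ζ₀ h4
  have h7 : δ * r ^ 2 ≤ ε := by
    rw [hδ, div_mul_eq_mul_div, div_le_iff₀ (by positivity)]
    nlinarith
  rw [h4] at h5
  have : 0 ≤ δ * ‖ζ‖ ^ 2 := by positivity
  linarith

end CircleMeans

section Smoothing

variable {E : Type*} [NormedAddCommGroup E] [NormedSpace ℂ E] [NormedSpace ℝ E]
  [IsScalarTower ℝ ℂ E] [FiniteDimensional ℝ E] [MeasurableSpace E] [BorelSpace E]

lemma measurePreserving_smul_of_norm_eq_one (μ : Measure E) [μ.IsAddHaarMeasure] {c : ℂ}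
    (hc : ‖c‖ = 1) : MeasurePreserving (fun y : E => c • y) μ μ := by
  have hc0 : c ≠ 0 := by
    rintro rfl
    simp at hc
  refine ⟨(continuous_const_smul c).measurable, ?_⟩
  let e : E ≃L[ℝ] E := (ContinuousLinearEquiv.smulLeft (R₁ := ℂ) (M₁ := E)
    (Units.mk0 c hc0)).restrictScalars ℝ
  have he : (e : E → E) = fun y : E => c • y := rfl
  have key : ∀ ν : Measure E, ν.IsAddHaarMeasure → ν (Metric.ball 0 1) = μ (Metric.ball 0 1) →
      ν = μ := by
    intro ν hν h2
    have h1 := Measure.isAddLeftInvariant_eq_smul ν μ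
    have h5 := Metric.measure_ball_pos μ (0 : E) one_pos
    have h6 : μ (Metric.ball (0 : E) 1) ≠ ⊤ := measure_ball_lt_top.ne
    generalize Measure.addHaarScalarFactor ν μ = t at h1
    rw [h1, Measure.smul_apply, ENNReal.smul_def, smul_eq_mul] at h2
    have h7 : (t : ℝ≥0∞) = 1 := (ENNReal.mul_left_inj h5.ne' h6).1 (by rw [h2, one_mul])
    have h8 : t = 1 := by exact_mod_cast h7
    rw [h1, h8, one_smul]
  refine key _ (e.isAddHaarMeasure_map μ) ?_
  rw [Measure.map_apply (continuous_const_smul c).measurable measurableSet_ball]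
  congr 1
  ext y
  simp [norm_smul, hc]

/-- A probability density supported in the unit ball and invariant under multiplication by
complex numbers of modulus one. -/
structure CircledKernel (μ : Measure E) (k : E → ℝ) : Prop where
  measurable : Measurable k
  nonneg : ∀ y, 0 ≤ k y
  circled : ∀ (c : ℂ) (y : E), ‖c‖ = 1 → k (c • y) = k y
  support : ∀ y, 1 < ‖y‖ → k y = 0
  integrable : Integrable k μ
  integral_eq_one : ∫ y, k y ∂μ = 1

/-- The average of `v` around `x` at scale `ε` with respect to the density `k`. -/
def kAvg (μ : Measure E) (k v : E → ℝ) (ε : ℝ) (x : E) : ℝ :=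
  ∫ y, k y * v (x + (ε : ℂ) • y) ∂μ

variable {μ : Measure E} [μ.IsAddHaarMeasure] {k v : E → ℝ} {M : ℝ}

lemma CircledKernel.integrable_mul (hk : CircledKernel μ k) {f : E → ℝ}
    (hf : Measurable f) (hM : ∀ z, |f z| ≤ M) : Integrable (fun y => k y * f y) μ := by
  refine (hk.integrable.mul_const M).mono' (hk.measurable.mul hf).aestronglyMeasurable ?_
  refine ae_of_all _ fun y => ?_
  rw [norm_mul, Real.norm_eq_abs, Real.norm_eq_abs, abs_of_nonneg (hk.nonneg y)]
  exact mul_le_mul_of_nonneg_left (hM y) (hk.nonneg y)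

lemma CircledKernel.integrable_kAvg (hk : CircledKernel μ k) (hv : Measurable v)
    (hM : ∀ z, |v z| ≤ M) (c : ℂ) (x : E) : Integrable (fun y => k y * v (x + c • y)) μ :=
  hk.integrable_mul (f := fun y => v (x + c • y))
    (hv.comp (by fun_prop : Continuous fun y : E => x + c • y).measurable) (fun z => hM _)

lemma CircledKernel.integral_smul_eq (hk : CircledKernel μ k) (c : ℂ) (hc : ‖c‖ = 1)
    (d : ℂ) (x : E) : ∫ y, k y * v (x + (d * c) • y) ∂μ = ∫ y, k y * v (x + d • y) ∂μ := by
  have hc0 : c ≠ 0 := by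
    rintro rfl
    simp at hc
  have h := (measurePreserving_smul_of_norm_eq_one μ hc).integral_comp
    (Homeomorph.smulOfNeZero c hc0).measurableEmbedding (fun y => k y * v (x + d • y))
  rw [← h]
  refine integral_congr_ae (ae_of_all _ fun y => ?_)
  simp only
  rw [hk.circled c y hc, smul_smul]

lemma CircledKernel.integral_swap (hk : CircledKernel μ k) (hv : Measurable v)
    (hM : ∀ z, |v z| ≤ M) {F : ℝ × E → E} (hF : Continuous F) :
    Integrable (fun y => k y * ∫ θ in (0:ℝ)..2 * Real.pi, v (F (θ, y))) μ ∧
    ∫ θ in (0:ℝ)..2 * Real.pi, (∫ y, k y * v (F (θ, y)) ∂μ) =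
      ∫ y, (k y * ∫ θ in (0:ℝ)..2 * Real.pi, v (F (θ, y))) ∂μ := by
  have hpi := Real.pi_pos
  have hInt : Integrable (Function.uncurry fun (θ : ℝ) (y : E) => k y * v (F (θ, y)))
      ((volume.restrict (Set.uIoc 0 (2 * Real.pi))).prod μ) := by
    have hfin : IsFiniteMeasure (volume.restrict (Set.uIoc 0 (2 * Real.pi))) := by
      rw [Set.uIoc_of_le (by positivity)]
      infer_instance
    have h1 : Integrable (fun p : ℝ × E => (1:ℝ) * k p.2)
        ((volume.restrict (Set.uIoc 0 (2 * Real.pi))).prod μ) :=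
      (integrable_const (1:ℝ)).mul_prod hk.integrable
    refine (h1.mul_const M).mono' ?_ (ae_of_all _ fun p => ?_)
    · exact ((hk.measurable.comp measurable_snd).mul
        (hv.comp hF.measurable)).aestronglyMeasurable
    · simp only [Function.uncurry, one_mul]
      rw [norm_mul, Real.norm_eq_abs, Real.norm_eq_abs, abs_of_nonneg (hk.nonneg _)]
      exact mul_le_mul_of_nonneg_left (hM _) (hk.nonneg _)
  have hmul : ∀ y, (∫ θ in (0:ℝ)..2 * Real.pi, k y * v (F (θ, y))) =
      k y * ∫ θ in (0:ℝ)..2 * Real.pi, v (F (θ, y)) := fun y =>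
    intervalIntegral.integral_const_mul _ _
  constructor
  · have h2 := hInt.integral_prod_right
    rw [Set.uIoc_of_le (by positivity)] at h2
    refine h2.congr (ae_of_all _ fun y => ?_)
    simp only [Function.uncurry]
    rw [← hmul, intervalIntegral.integral_of_le (by positivity)]
  · rw [intervalIntegral_integral_swap hInt]
    exact integral_congr_ae (ae_of_all _ hmul)

lemma CircledKernel.two_pi_mul_kAvg (hk : CircledKernel μ k) (hv : Measurable v)
    (hM : ∀ z, |v z| ≤ M) (ε : ℝ) (x : E) :
    Integrable (fun y => k y * ∫ θ in (0:ℝ)..2 * Real.pi, v (x + circleMap 0 ε θ • y)) μ ∧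
    2 * Real.pi * kAvg μ k v ε x =
      ∫ y, (k y * ∫ θ in (0:ℝ)..2 * Real.pi, v (x + circleMap 0 ε θ • y)) ∂μ := by
  have hcirc : Continuous fun p : ℝ × E => x + circleMap 0 ε p.1 • p.2 :=
    continuous_const.add (((continuous_circleMap 0 ε).comp continuous_fst).smul continuous_snd)
  obtain ⟨h1, h2⟩ := hk.integral_swap hv hM hcirc
  refine ⟨h1, h2 ▸ ?_⟩
  have h3 : ∀ θ : ℝ, ∫ y, k y * v (x + circleMap 0 ε θ • y) ∂μ = kAvg μ k v ε x := by
    intro θ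
    have := hk.integral_smul_eq (v := v) (Complex.exp (θ * Complex.I))
      (Complex.norm_exp_ofReal_mul_I θ) ε x
    rw [kAvg, ← this]
    simp [circleMap]
  simp_rw [h3]
  simp

variable {Ω : Set E}

lemma kAvg_mono (hk : CircledKernel μ k) (hpsh : PlurisubharmonicOn (fun z => (v z : EReal)) Ω)
    (hv : Measurable v) (hM : ∀ z, |v z| ≤ M) {ε δ : ℝ} (hε : 0 ≤ ε) (hεδ : ε ≤ δ) {x : E}
    (hx : Metric.closedBall x δ ⊆ Ω) : kAvg μ k v ε x ≤ kAvg μ k v δ x := by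
  have hpi := Real.pi_pos
  obtain ⟨i1, e1⟩ := hk.two_pi_mul_kAvg hv hM ε x
  obtain ⟨i2, e2⟩ := hk.two_pi_mul_kAvg hv hM δ x
  refine le_of_mul_le_mul_left ?_ (show 0 < 2 * Real.pi by positivity)
  rw [e1, e2]
  refine integral_mono i1 i2 fun y => ?_
  by_cases hy : 1 < ‖y‖
  · simp [hk.support y hy]
  refine mul_le_mul_of_nonneg_left ?_ (hk.nonneg y)
  refine integral_circle_mono hpsh hv hM hε hεδ fun ζ hζ => hx ?_
  rw [Metric.mem_closedBall, dist_eq_norm, add_sub_cancel_left, norm_smul]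
  nlinarith [norm_nonneg ζ, norm_nonneg y]

lemma kAvg_zero (hk : CircledKernel μ k) (x : E) : kAvg μ k v 0 x = v x := by
  simp [kAvg, integral_mul_const, hk.integral_eq_one]

lemma le_kAvg (hk : CircledKernel μ k) (hpsh : PlurisubharmonicOn (fun z => (v z : EReal)) Ω)
    (hv : Measurable v) (hM : ∀ z, |v z| ≤ M) {ε : ℝ} (hε : 0 ≤ ε) {x : E}
    (hx : Metric.closedBall x ε ⊆ Ω) : v x ≤ kAvg μ k v ε x := by
  rw [← kAvg_zero (μ := μ) (v := v) hk x]
  exact kAvg_mono hk hpsh hv hM le_rfl hε hx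

lemma kAvg_mono_fun (hk : CircledKernel μ k) {w : E → ℝ}
    (hv : Measurable v) (hM : ∀ z, |v z| ≤ M) {M' : ℝ} (hw : Measurable w)
    (hM' : ∀ z, |w z| ≤ M') {ε : ℝ} (hε : 0 ≤ ε) {x : E}
    (h : ∀ z ∈ Metric.closedBall x ε, v z ≤ w z) : kAvg μ k v ε x ≤ kAvg μ k w ε x := by
  refine integral_mono (hk.integrable_kAvg hv hM _ _) (hk.integrable_kAvg hw hM' _ _) fun y => ?_
  by_cases hy : 1 < ‖y‖
  · simp [hk.support y hy]
  refine mul_le_mul_of_nonneg_left (h _ ?_) (hk.nonneg y)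
  rw [Metric.mem_closedBall, dist_eq_norm, add_sub_cancel_left, norm_smul, Complex.norm_real,
    Real.norm_eq_abs, abs_of_nonneg hε]
  nlinarith [norm_nonneg y]

lemma kAvg_congr (hk : CircledKernel μ k) {w : E → ℝ} {ε : ℝ} (hε : 0 ≤ ε) {x : E}
    (h : ∀ z ∈ Metric.closedBall x ε, v z = w z) : kAvg μ k v ε x = kAvg μ k w ε x := by
  refine integral_congr_ae (ae_of_all _ fun y => ?_)
  by_cases hy : 1 < ‖y‖
  · simp [hk.support y hy]
  simp only
  rw [h]
  rw [Metric.mem_closedBall, dist_eq_norm, add_sub_cancel_left, norm_smul, Complex.norm_real,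
    Real.norm_eq_abs, abs_of_nonneg hε]
  nlinarith [norm_nonneg y]

lemma kAvg_const (hk : CircledKernel μ k) (c ε : ℝ) (x : E) : kAvg μ k (fun _ => c) ε x = c := by
  simp [kAvg, integral_mul_const, hk.integral_eq_one]

lemma kAvg_add (hk : CircledKernel μ k) {w : E → ℝ}
    (hv : Measurable v) (hM : ∀ z, |v z| ≤ M) {M' : ℝ} (hw : Measurable w)
    (hM' : ∀ z, |w z| ≤ M') (ε : ℝ) (x : E) :
    kAvg μ k (fun z => v z + w z) ε x = kAvg μ k v ε x + kAvg μ k w ε x := by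
  simp only [kAvg, mul_add]
  exact integral_add (hk.integrable_kAvg hv hM _ _) (hk.integrable_kAvg hw hM' _ _)

lemma exists_kAvg_le (hk : CircledKernel μ k)
    (hpsh : UpperSemicontinuousOn (fun z => (v z : EReal)) Ω) (hΩ : IsOpen Ω)
    (hv : Measurable v) (hM : ∀ z, |v z| ≤ M) {x : E} (hx : x ∈ Ω) {c : ℝ} (hc : v x < c) :
    ∃ η : ℝ, 0 < η ∧ ∀ ε, 0 ≤ ε → ε < η → kAvg μ k v ε x ≤ c := by
  have h1 := hpsh x hx c (EReal.coe_lt_coe_iff.2 hc)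
  rw [hΩ.nhdsWithin_eq hx] at h1
  obtain ⟨η, hη, hb⟩ := Metric.eventually_nhds_iff_ball.1 h1
  refine ⟨η, hη, fun ε h0 h1 => ?_⟩
  rw [← kAvg_const (μ := μ) hk c ε x]
  refine kAvg_mono_fun hk hv hM (M' := |c|) measurable_const (fun _ => le_rfl) h0 fun z hz => ?_
  exact (EReal.coe_lt_coe_iff.1 (hb z (lt_of_le_of_lt hz h1))).le

lemma locallyIntegrable_of_abs_le (hv : Measurable v) (hM : ∀ z, |v z| ≤ M) :
    LocallyIntegrable v μ := by
  refine (locallyIntegrable_const M).mono hv.aestronglyMeasurable (ae_of_all _ fun z => ?_)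
  exact (hM z).trans (le_abs_self M)

lemma contDiff_kAvg_of_locallyIntegrable (hk : CircledKernel μ k) (hks : ContDiff ℝ (⊤ : ℕ∞) k)
    (hv : LocallyIntegrable v μ) {ε : ℝ} (hε : 0 < ε) :
    ContDiff ℝ (⊤ : ℕ∞) (kAvg μ k v ε) := by
  set f : E → ℝ := fun t => |((-ε) ^ Module.finrank ℝ E)⁻¹| * k ((-ε)⁻¹ • t) with hf
  have hfs : ContDiff ℝ (⊤ : ℕ∞) f := by
    rw [hf]
    fun_prop
  have hfc : HasCompactSupport f := by
    refine HasCompactSupport.intro (isCompact_closedBall (0:E) ε) fun t ht => ?_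
    rw [hf]
    simp only
    rw [hk.support, mul_zero]
    rw [Metric.mem_closedBall, dist_zero_right, not_le] at ht
    rw [norm_smul, norm_inv, norm_neg, Real.norm_eq_abs, abs_of_pos hε, inv_mul_eq_div,
      one_lt_div hε]
    exact ht
  have := hfc.contDiff_convolution_left (ContinuousLinearMap.mul ℝ ℝ) hfs hv
  convert this using 1
  ext x
  rw [convolution_def]
  simp only [ContinuousLinearMap.mul_apply', hf, mul_assoc]
  rw [integral_const_mul]
  have h1 := Measure.integral_comp_smul μ (fun z => k ((-ε)⁻¹ • z) * v (x - z)) (-ε)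
  rw [smul_eq_mul] at h1
  rw [← h1, kAvg]
  refine integral_congr_ae (ae_of_all _ fun y => ?_)
  simp only
  rw [inv_smul_smul₀ (by linarith [hε] : (-ε) ≠ 0), neg_smul, sub_neg_eq_add]
  congr 3
  exact algebraMap_smul ℂ ε y

end Smoothing

section Kernels

variable {E : Type*} [NormedAddCommGroup E] [NormedSpace ℂ E] [NormedSpace ℝ E]
  [IsScalarTower ℝ ℂ E] [FiniteDimensional ℝ E] [MeasurableSpace E] [BorelSpace E]
  {μ : Measure E} [μ.IsAddHaarMeasure] {k v : E → ℝ} {M : ℝ} {Ω : Set E}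

lemma circledKernel_normalize (h1 : Measurable k) (h2 : ∀ y, 0 ≤ k y)
    (h3 : ∀ (c : ℂ) (y : E), ‖c‖ = 1 → k (c • y) = k y) (h4 : ∀ y, 1 < ‖y‖ → k y = 0)
    (h5 : Integrable k μ) (h6 : 0 < ∫ y, k y ∂μ) :
    CircledKernel μ (fun y => (∫ y, k y ∂μ)⁻¹ * k y) where
  measurable := h1.const_mul _
  nonneg y := mul_nonneg (inv_nonneg.2 h6.le) (h2 y)
  circled c y hc := by rw [h3 c y hc]
  support y hy := by rw [h4 y hy, mul_zero]
  integrable := h5.const_mul _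
  integral_eq_one := by rw [integral_const_mul, inv_mul_cancel₀ h6.ne']

variable (μ) in
lemma exists_contDiff_circledKernel :
    ∃ k : E → ℝ, CircledKernel μ k ∧ ContDiff ℝ (⊤ : ℕ∞) k := by
  have : FiniteDimensional ℂ E := FiniteDimensional.right ℝ ℂ E
  let L : E ≃L[ℂ] (Fin (Module.finrank ℂ E) → ℂ) :=
    ContinuousLinearEquiv.ofFinrankEq (by simp)
  obtain ⟨K, hK0, hK⟩ : ∃ K : ℝ, 0 < K ∧ ∀ y, ‖y‖ ≤ K * ‖L y‖ := by
    refine ⟨‖(L.symm : (Fin (Module.finrank ℂ E) → ℂ) →L[ℂ] E)‖ + 1, by positivity, fun y => ?_⟩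
    have := (L.symm : (Fin (Module.finrank ℂ E) → ℂ) →L[ℂ] E).le_opNorm (L y)
    simp only [ContinuousLinearEquiv.coe_coe, ContinuousLinearEquiv.symm_apply_apply] at this
    nlinarith [norm_nonneg (L y)]
  set Q : E → ℝ := fun y => ∑ i, Complex.normSq (L y i) with hQ
  have hQs : ContDiff ℝ (⊤ : ℕ∞) Q := by
    refine ContDiff.sum fun i _ => ?_
    let l : E →L[ℝ] ℂ := ((ContinuousLinearMap.proj (R := ℂ) (φ := fun _ => ℂ) i).comp
      (L : E →L[ℂ] (Fin (Module.finrank ℂ E) → ℂ))).restrictScalars ℝ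
    have hl : ∀ y, L y i = l y := fun y => rfl
    simp only [hl, Complex.normSq_apply]
    have hre : ContDiff ℝ (⊤ : ℕ∞) fun y => (l y).re := (Complex.reCLM.comp l).contDiff
    have him : ContDiff ℝ (⊤ : ℕ∞) fun y => (l y).im := (Complex.imCLM.comp l).contDiff
    exact (hre.mul hre).add (him.mul him)
  have hQ0 : ∀ y, 0 ≤ Q y := fun y => Finset.sum_nonneg fun i _ => Complex.normSq_nonneg _
  have hQn : ∀ y, ‖L y‖ ^ 2 ≤ Q y := by
    intro y
    rw [← Real.sqrt_le_sqrt_iff (hQ0 y), Real.sqrt_sq (norm_nonneg _),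
      pi_norm_le_iff_of_nonneg (Real.sqrt_nonneg _)]
    intro i
    refine Real.le_sqrt_of_sq_le ?_
    rw [← Complex.normSq_eq_norm_sq]
    exact Finset.single_le_sum (f := fun i => Complex.normSq (L y i))
      (fun i _ => Complex.normSq_nonneg _) (Finset.mem_univ i)
  set k : E → ℝ := fun y => Real.smoothTransition (1 - K ^ 2 * Q y) with hk
  have hks : ContDiff ℝ (⊤ : ℕ∞) k := by
    rw [hk]
    exact Real.smoothTransition.contDiff.comp (contDiff_const.sub (contDiff_const.mul hQs))
  have hsupp : ∀ y, 1 < ‖y‖ → k y = 0 := by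
    intro y hy
    refine Real.smoothTransition.zero_of_nonpos ?_
    have h1 := hK y
    have h2 := hQn y
    have h3 : 1 ≤ K * ‖L y‖ := by linarith
    nlinarith [mul_le_mul_of_nonneg_left h2 (sq_nonneg K)]
  have hcs : HasCompactSupport k := by
    refine HasCompactSupport.intro (isCompact_closedBall (0:E) 1) fun y hy => hsupp y ?_
    simpa using hy
  refine ⟨_, circledKernel_normalize (μ := μ) (k := k) hks.continuous.measurable
    (fun y => Real.smoothTransition.nonneg _) ?_ hsupp
    (hks.continuous.integrable_of_hasCompactSupport hcs) ?_, contDiff_const.mul hks⟩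
  · intro c y hc
    simp [hk, hQ, Complex.normSq_eq_norm_sq, hc]
  · refine hks.continuous.integral_pos_of_hasCompactSupport_nonneg_nonzero hcs
      (fun y => Real.smoothTransition.nonneg _) (x := 0) ?_
    simp [hk, hQ]

variable (μ) in
/-- The normalized indicator function of the unit ball. -/
def ballKernel (y : E) : ℝ :=
  (∫ y, (Metric.closedBall (0:E) 1).indicator (fun _ => (1:ℝ)) y ∂μ)⁻¹ *
    (Metric.closedBall (0:E) 1).indicator (fun _ => (1:ℝ)) y

variable (μ) in
lemma circledKernel_ballKernel : CircledKernel μ (ballKernel μ) := by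
  refine circledKernel_normalize (measurable_const.indicator measurableSet_closedBall)
    (fun y => Set.indicator_nonneg (fun _ _ => zero_le_one) _) ?_ ?_ ?_ ?_
  · intro c y hc
    have : c • y ∈ Metric.closedBall (0:E) 1 ↔ y ∈ Metric.closedBall (0:E) 1 := by
      simp [norm_smul, hc]
    by_cases h : y ∈ Metric.closedBall (0:E) 1
    · rw [Set.indicator_of_mem h, Set.indicator_of_mem (this.2 h)]
    · rw [Set.indicator_of_notMem h, Set.indicator_of_notMem (mt this.1 h)]
  · intro y hy
    simp [hy]
  · exact (integrable_indicator_iff measurableSet_closedBall).2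
      (integrableOn_const measure_closedBall_lt_top.ne)
  · rw [integral_indicator measurableSet_closedBall]
    simp only [integral_const, smul_eq_mul, mul_one, MeasurableSet.univ,
      measureReal_restrict_apply, Set.univ_inter]
    exact ENNReal.toReal_pos (Metric.measure_closedBall_pos μ _ one_pos).ne'
      measure_closedBall_lt_top.ne

lemma re_eval_add_mul_sq (ζ₀ ξ : ℂ) :
    ‖ζ₀ + ξ‖ ^ 2 = ‖ζ₀‖ ^ 2 + 2 * ((starRingEnd ℂ) ζ₀ * ξ).re + ‖ξ‖ ^ 2 := by
  rw [← Complex.normSq_eq_norm_sq, ← Complex.normSq_eq_norm_sq, ← Complex.normSq_eq_norm_sq]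
  simp [Complex.normSq_apply]
  ring

lemma kAvg_submean (hk : CircledKernel μ k) (hpsh : PlurisubharmonicOn (fun z => (v z : EReal)) Ω)
    (hv : Measurable v) (hM : ∀ z, |v z| ≤ M) {ε ρ : ℝ} (hε : 0 ≤ ε) (hρ : 0 ≤ ρ) {a b : E}
    (hd : ∀ ζ : ℂ, ‖ζ‖ ≤ ρ → Metric.closedBall (a + ζ • b) ε ⊆ Ω) :
    2 * Real.pi * kAvg μ k v ε a ≤
      ∫ θ in (0:ℝ)..2 * Real.pi, kAvg μ k v ε (a + circleMap 0 ρ θ • b) := by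
  have hpi := Real.pi_pos
  have hcirc : Continuous fun p : ℝ × E => a + circleMap 0 ρ p.1 • b + (ε : ℂ) • p.2 :=
    (continuous_const.add (((continuous_circleMap 0 ρ).comp continuous_fst).smul
      continuous_const)).add (continuous_snd.const_smul _)
  obtain ⟨i1, e1⟩ := hk.integral_swap hv hM hcirc
  change _ ≤ ∫ θ in (0:ℝ)..2 * Real.pi,
    ∫ y, k y * v (a + circleMap 0 ρ θ • b + (ε : ℂ) • y) ∂μ
  rw [e1, kAvg, ← integral_const_mul]
  refine integral_mono ((hk.integrable_kAvg hv hM (ε:ℂ) a).const_mul _) i1 fun y => ?_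
  by_cases hy : 1 < ‖y‖
  · simp [hk.support y hy]
  simp only
  rw [mul_left_comm]
  refine mul_le_mul_of_nonneg_left ?_ (hk.nonneg y)
  have := integral_circle_mono hpsh hv hM (a := a + (ε : ℂ) • y) (b := b) le_rfl hρ
    fun ζ hζ => hd ζ hζ (by
      rw [Metric.mem_closedBall, dist_eq_norm, add_right_comm, add_sub_cancel_left, norm_smul,
        Complex.norm_real, Real.norm_eq_abs, abs_of_nonneg hε]
      nlinarith [norm_nonneg y])
  simp only [circleMap_zero_radius, Function.const_apply, zero_smul, add_zero,
    intervalIntegral.integral_const, sub_zero, smul_eq_mul] at this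
  refine this.trans (le_of_eq ?_)
  simp only [add_right_comm]

lemma plurisubharmonicOn_kAvg (hk : CircledKernel μ k)
    (hks : ContDiff ℝ (⊤ : ℕ∞) k)
    (hpsh : PlurisubharmonicOn (fun z => (v z : EReal)) Ω)
    (hv : Measurable v) (hM : ∀ z, |v z| ≤ M) {ε : ℝ} (hε : 0 < ε) :
    PlurisubharmonicOn (fun z => (kAvg μ k v ε z : EReal)) {x | Metric.closedBall x ε ⊆ Ω} := by
  have hpi := Real.pi_pos
  have hcont : Continuous (kAvg μ k v ε) :=
    (contDiff_kAvg_of_locallyIntegrable hk hks (locallyIntegrable_of_abs_le hv hM) hε).continuous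
  refine ⟨(continuous_coe_real_ereal.comp hcont).upperSemicontinuous.upperSemicontinuousOn _,
    fun a b r hr hd p hp ζ hζ => EReal.coe_le_coe_iff.2 (sub_nonpos.1 ?_)⟩
  refine le_of_forall_not_isMaxOn (s := fun ζ => kAvg μ k v ε (a + ζ • b) - (p.eval ζ).re)
    (r := r) (Continuous.continuousOn ?_) (fun ξ hξ => sub_nonpos.2
      (EReal.coe_le_coe_iff.1 (hp ξ hξ))) ?_ hζ
  · exact (hcont.comp (by fun_prop)).sub (by fun_prop)
  intro δ hδ ζ₀ hζ₀ hmax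
  set ρ := r - ‖ζ₀‖ with hρ
  have hρ0 : 0 < ρ := sub_pos.2 hζ₀
  have hin : ∀ ξ : ℂ, ‖ξ‖ ≤ ρ → ‖ζ₀ + ξ‖ ≤ r := fun ξ hξ =>
    (norm_add_le _ _).trans (by linarith)
  have h1 := kAvg_submean hk hpsh hv hM hε.le hρ0.le (a := a + ζ₀ • b) (b := b) fun ξ hξ => by
    rw [add_assoc, ← add_smul]
    exact hd _ (hin ξ hξ)
  set m := kAvg μ k v ε (a + ζ₀ • b) - (p.eval ζ₀).re + δ * ‖ζ₀‖ ^ 2 with hm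
  set q : Polynomial ℂ := p.comp (Polynomial.X + Polynomial.C ζ₀) -
    Polynomial.C ((δ * 2 : ℂ) * (starRingEnd ℂ) ζ₀) * Polynomial.X with hq
  have h2 : ∀ θ : ℝ, kAvg μ k v ε (a + ζ₀ • b + circleMap 0 ρ θ • b) ≤
      (q.eval (circleMap 0 ρ θ)).re + (m - δ * ‖ζ₀‖ ^ 2 - δ * ρ ^ 2) := by
    intro θ
    set ξ := circleMap 0 ρ θ
    have hξ : ‖ξ‖ = ρ := by simp [ξ, abs_of_pos hρ0]
    have h3 : kAvg μ k v ε (a + (ζ₀ + ξ) • b) - (p.eval (ζ₀ + ξ)).re + δ * ‖ζ₀ + ξ‖ ^ 2 ≤ m :=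
      hmax (by simpa using hin ξ hξ.le)
    rw [re_eval_add_mul_sq, hξ, add_smul, ← add_assoc] at h3
    have h4 : (q.eval ξ).re = (p.eval (ζ₀ + ξ)).re - δ * (2 * ((starRingEnd ℂ) ζ₀ * ξ).re) := by
      rw [hq]
      simp only [Polynomial.eval_sub, Polynomial.eval_comp, Polynomial.eval_add, Polynomial.eval_X,
        Polynomial.eval_C, Polynomial.eval_mul, Complex.sub_re, add_comm ξ ζ₀]
      have : (δ * 2 : ℂ) * (starRingEnd ℂ) ζ₀ * ξ = ((δ * 2 : ℝ) : ℂ) * ((starRingEnd ℂ) ζ₀ * ξ) := by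
        push_cast; ring
      rw [this, Complex.re_ofReal_mul]
      ring
    rw [h4]
    linarith
  have hqi : IntervalIntegrable (fun θ => (q.eval (circleMap 0 ρ θ)).re) volume 0
        (2 * Real.pi) := by
    refine Continuous.intervalIntegrable ?_ _ _
    fun_prop
  have h5 := intervalIntegral.integral_mono (μ := volume) (show (0:ℝ) ≤ 2 * Real.pi by positivity)
    (Continuous.intervalIntegrable (hcont.comp (by fun_prop)) _ _) (hqi.add (by simp)) h2
  rw [intervalIntegral.integral_add hqi (by simp), integral_circle_re_eval] at h5
  have h6 : (q.eval 0).re = (p.eval ζ₀).re := by simp [hq]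
  rw [h6] at h5
  simp only [intervalIntegral.integral_const, sub_zero, smul_eq_mul] at h5
  have h7 := h1.trans h5
  rw [← mul_add] at h7
  have h8 := le_of_mul_le_mul_left h7 (by positivity)
  have : 0 < δ * ρ ^ 2 := by positivity
  linarith

end Kernels

section HolomorphicDisc

variable {E : Type*} [NormedAddCommGroup E] [NormedSpace ℂ E] [NormedSpace ℝ E]
  [IsScalarTower ℝ ℂ E] [FiniteDimensional ℝ E] [MeasurableSpace E] [BorelSpace E]
  {Ω : Set E}

open Classical in
/-- The truncation of `u` from below at height `-N` on `Ω`, extended by `-N` outside of `Ω`. -/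
def trunc (Ω : Set E) (u : E → EReal) (N : ℝ) (z : E) : ℝ :=
  if z ∈ Ω then (max (u z) (-N : ℝ)).toReal else -N

lemma coe_trunc {u : E → EReal} (h0 : ∀ z ∈ Ω, u z ≤ 0) {N : ℝ} {z : E} (hz : z ∈ Ω) :
    ((trunc Ω u N z : ℝ) : EReal) = max (u z) (-N : ℝ) := by
  rw [trunc, if_pos hz, EReal.coe_toReal]
  · exact (max_lt ((h0 z hz).trans_lt EReal.zero_lt_top) (EReal.coe_lt_top _)).ne
  · exact ((EReal.bot_lt_coe _).trans_le (le_max_right _ _)).ne'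

lemma neg_le_trunc {u : E → EReal} (h0 : ∀ z ∈ Ω, u z ≤ 0) (N : ℝ) (z : E) :
    -N ≤ trunc Ω u N z := by
  by_cases hz : z ∈ Ω
  · rw [← EReal.coe_le_coe_iff, coe_trunc h0 hz]
    exact le_max_right _ _
  · rw [trunc, if_neg hz]

lemma trunc_nonpos {u : E → EReal} (h0 : ∀ z ∈ Ω, u z ≤ 0) {N : ℝ} (hN : 0 ≤ N) (z : E) :
    trunc Ω u N z ≤ 0 := by
  by_cases hz : z ∈ Ω
  · rw [← EReal.coe_le_coe_iff, coe_trunc h0 hz]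
    exact max_le (h0 z hz) (EReal.coe_le_coe_iff.2 (by linarith))
  · rw [trunc, if_neg hz]
    linarith

lemma abs_trunc_le {u : E → EReal} (h0 : ∀ z ∈ Ω, u z ≤ 0) {N : ℝ} (hN : 0 ≤ N) (z : E) :
    |trunc Ω u N z| ≤ N :=
  abs_le.2 ⟨neg_le_trunc h0 N z, (trunc_nonpos h0 hN z).trans hN⟩

lemma le_trunc {u : E → EReal} (h0 : ∀ z ∈ Ω, u z ≤ 0) {N : ℝ} {z : E} (hz : z ∈ Ω) :
    u z ≤ (trunc Ω u N z : EReal) := by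
  rw [coe_trunc h0 hz]
  exact le_max_left _ _

lemma trunc_anti {u : E → EReal} (h0 : ∀ z ∈ Ω, u z ≤ 0) {N M : ℝ} (h : N ≤ M) (z : E) :
    trunc Ω u M z ≤ trunc Ω u N z := by
  by_cases hz : z ∈ Ω
  · rw [← EReal.coe_le_coe_iff, coe_trunc h0 hz, coe_trunc h0 hz]
    exact max_le_max le_rfl (EReal.coe_le_coe_iff.2 (by linarith))
  · rw [trunc, if_neg hz, trunc, if_neg hz]
    linarith

lemma PSHNeg.plurisubharmonicOn_trunc {u : E → EReal} (hu : PSHNeg u Ω) (N : ℝ) :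
    PlurisubharmonicOn (fun z => (trunc Ω u N z : EReal)) Ω :=
  (hu.1.max (plurisubharmonicOn_const (-N) Ω)).congr fun _ hz => coe_trunc hu.2 hz

lemma measurable_trunc {u : E → EReal} (hΩ : IsOpen Ω) (hu : UpperSemicontinuousOn u Ω) (N : ℝ) :
    Measurable (trunc Ω u N) := by
  refine measurable_of_restrict_of_restrict_compl hΩ.measurableSet ?_ ?_
  · have h1 : Measurable (Ω.domRestrict u) := by
      refine UpperSemicontinuous.measurable fun x c hc => ?_
      have := hu x x.2 c hc
      rwa [← map_nhds_subtype_val, eventually_map] at this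
    have h2 : Ω.domRestrict (trunc Ω u N) = fun x => (max (Ω.domRestrict u x) (-N : ℝ)).toReal := by
      funext x
      simp [trunc, Set.domRestrict_apply]
    rw [h2]
    exact (h1.max measurable_const).ereal_toReal
  · have h2 : Ωᶜ.domRestrict (trunc Ω u N) = fun x => -N := by
      funext x
      have hx : (x : E) ∉ Ω := x.2
      simp [trunc, Set.domRestrict_apply, hx]
    rw [h2]
    exact measurable_const

lemma exists_trunc_lt {u : E → EReal} (h0 : ∀ z ∈ Ω, u z ≤ 0) {z : E} (hz : z ∈ Ω) {c : ℝ}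
    (hc : u z < c) : ∀ᶠ N : ℕ in atTop, trunc Ω u N z < c := by
  obtain ⟨N, hN⟩ := exists_nat_gt (-c)
  filter_upwards [eventually_ge_atTop N] with k hk
  rw [← EReal.coe_lt_coe_iff, coe_trunc h0 hz]
  have : (N:ℝ) ≤ k := by exact_mod_cast hk
  exact max_lt hc (EReal.coe_lt_coe_iff.2 (by linarith))

/-- The real part of a real-linear functional applied to a holomorphic map is harmonic. -/
lemma exists_complexLinear_re (L : E →L[ℝ] ℝ) : ∃ Λ : E →L[ℂ] ℂ, ∀ x, (Λ x).re = L x := by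
  have : FiniteDimensional ℂ E := FiniteDimensional.right ℝ ℂ E
  have hr : ∀ (c : ℝ) (x : E), (c : ℂ) • x = c • x := fun c x => algebraMap_smul ℂ c x
  let Λ : E →ₗ[ℂ] ℂ :=
    { toFun := fun x => (L x : ℂ) - Complex.I * L (Complex.I • x)
      map_add' := fun x y => by
        simp only [map_add, smul_add]; push_cast; ring
      map_smul' := fun c x => by
        have h1 : c • x = c.re • x + c.im • (Complex.I • x) := by
          rw [← hr, ← hr, smul_smul, ← add_smul, Complex.re_add_im]
        have h2 : Complex.I • (c • x) = c.re • (Complex.I • x) - c.im • x := by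
          rw [h1, ← hr, ← hr, ← hr, ← hr, smul_add, smul_smul, smul_smul, smul_smul, smul_smul,
            sub_eq_add_neg, ← neg_smul]
          congr 1
          · ring_nf
          · congr 1
            linear_combination (c.im : ℂ) * Complex.I_mul_I
        rw [h2, h1]
        simp only [map_add, map_sub, map_smul, smul_eq_mul, RingHom.id_apply]
        apply Complex.ext <;> simp <;> ring }
  refine ⟨LinearMap.toContinuousLinearMap Λ, fun x => ?_⟩
  simp [Λ]

lemma holomorphic_disc_smooth {s : E → ℝ} (hs : ContDiff ℝ 1 s)
    (hpsh : PlurisubharmonicOn (fun z => (s z : EReal)) Ω) (hΩ : IsOpen Ω) {f : ℂ → E} {r R : ℝ}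
    (hrR : r < R) (hf : DifferentiableOn ℂ f (Metric.ball 0 R))
    (hfΩ : ∀ ζ : ℂ, ‖ζ‖ ≤ r → f ζ ∈ Ω) {p : Polynomial ℂ}
    (hp : ∀ ζ : ℂ, ‖ζ‖ = r → s (f ζ) ≤ (p.eval ζ).re) {ζ : ℂ} (hζ : ‖ζ‖ ≤ r) :
    s (f ζ) ≤ (p.eval ζ).re := by
  have hsub : Metric.closedBall (0:ℂ) r ⊆ Metric.ball 0 R := Metric.closedBall_subset_ball hrR
  rw [← sub_nonpos]
  refine le_of_forall_not_isMaxOn (s := fun ζ => s (f ζ) - (p.eval ζ).re) (r := r) ?_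
    (fun ξ hξ => sub_nonpos.2 (hp ξ hξ)) ?_ hζ
  · exact (hs.continuous.comp_continuousOn (hf.continuousOn.mono hsub)).sub
      (Continuous.continuousOn (by fun_prop))
  intro δ hδ ζ₀ hζ₀ hmax
  have hζR : Metric.ball (0:ℂ) R ∈ 𝓝 ζ₀ := Metric.isOpen_ball.mem_nhds (by simpa using hζ₀.trans hrR)
  have hds := (Complex.differentiableOn_dslope hζR).2 hf
  set b := dslope f ζ₀ ζ₀ with hb
  set x := f ζ₀ with hx
  have hfe : ∀ η, f (ζ₀ + η) = x + η • dslope f ζ₀ (ζ₀ + η) := by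
    intro η
    have := sub_smul_dslope f ζ₀ (ζ₀ + η)
    rw [add_sub_cancel_left] at this
    rw [this]; simp [hx]
  have hO : (fun η => dslope f ζ₀ (ζ₀ + η) - b) =O[𝓝 0] (fun η : ℂ => η) := by
    have h1 := (hds.differentiableAt hζR).isBigO_sub
    have h2 : Tendsto (fun η : ℂ => ζ₀ + η) (𝓝 0) (𝓝 ζ₀) := by
      have : Continuous (fun η : ℂ => ζ₀ + η) := by fun_prop
      simpa using this.tendsto 0
    have := h1.comp_tendsto h2
    simpa only [Function.comp_def, add_sub_cancel_left, hb, dslope_same] using this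
  obtain ⟨C, hC0, hC⟩ := hO.exists_pos
  rw [Asymptotics.isBigOWith_iff] at hC
  have hst : HasStrictFDerivAt s (fderiv ℝ s x) x :=
    hs.contDiffAt.hasStrictFDerivAt one_ne_zero
  obtain ⟨Λ, hΛ⟩ := exists_complexLinear_re (fderiv ℝ s x)
  have hτ : (0:ℝ) < δ / 2 / C := by positivity
  have hlo := hst.isLittleO.def hτ
  have hcontf : Tendsto (fun η : ℂ => (f (ζ₀ + η), x + η • b)) (𝓝 0) (𝓝 (x, x)) := by
    refine Tendsto.prodMk_nhds ?_ ?_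
    · have h1 : ContinuousAt f ζ₀ := (hf.differentiableAt hζR).continuousAt
      have h2 : Tendsto (fun η : ℂ => ζ₀ + η) (𝓝 0) (𝓝 ζ₀) := by
        have : Continuous (fun η : ℂ => ζ₀ + η) := by fun_prop
        simpa using this.tendsto 0
      exact h1.tendsto.comp h2
    · have : Continuous (fun η : ℂ => x + η • b) := by fun_prop
      simpa using this.tendsto 0
  have hxΩ : x ∈ Ω := hfΩ _ hζ₀.le
  have hin : ∀ᶠ η : ℂ in 𝓝 0, x + η • b ∈ Ω := by
    have : Continuous (fun η : ℂ => x + η • b) := by fun_prop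
    exact this.tendsto 0 |>.eventually (hΩ.mem_nhds (by simpa using hxΩ))
  obtain ⟨ρ₀, hρ₀, hev⟩ := Metric.eventually_nhds_iff_ball.1
    (hC.and ((hcontf.eventually hlo).and hin))
  set ρ := min (ρ₀ / 2) ((r - ‖ζ₀‖) / 2) with hρ
  have hρ0 : 0 < ρ := lt_min (by positivity) (by linarith)
  have hρ1 : ρ < ρ₀ := (min_le_left _ _).trans_lt (by linarith)
  have hρ2 : ‖ζ₀‖ + ρ < r := by
    have := min_le_right (ρ₀ / 2) ((r - ‖ζ₀‖) / 2)
    rw [← hρ] at this; linarith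
  have hev' : ∀ η : ℂ, ‖η‖ ≤ ρ → η ∈ Metric.ball (0:ℂ) ρ₀ := fun η hη => by
    simpa using hη.trans_lt hρ1
  set m := s x - (p.eval ζ₀).re + δ * ‖ζ₀‖ ^ 2 with hm
  set H : ℂ → ℝ := fun η => ((p.comp (Polynomial.X + Polynomial.C ζ₀) -
      Polynomial.C ((δ * 2 : ℂ) * (starRingEnd ℂ) ζ₀) * Polynomial.X).eval η).re +
      (m - δ * ‖ζ₀‖ ^ 2 - δ / 2 * ρ ^ 2) + (-1) * (Λ (f (ζ₀ + η) - (x + η • b))).re with hH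
  have hHR : ReApprox H ρ := by
    refine ((ReApprox.polynomial _ _).add (ReApprox.const _ _)).add
      (ReApprox.const_mul (ReApprox.of_differentiableOn
        (f := fun η => Λ (f (ζ₀ + η) - (x + η • b))) hρ0.le (R := R - ‖ζ₀‖) (by linarith) ?_) _)
    refine Λ.differentiable.comp_differentiableOn (DifferentiableOn.sub ?_ (by fun_prop))
    refine hf.comp (by fun_prop) fun η hη => ?_
    simp only [mem_ball_zero_iff] at hη ⊢
    exact (norm_add_le _ _).trans_lt (by linarith)
  have key := hpsh.le_of_reApprox (a := x) (b := b) hρ0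
    (fun η hη => (hev η (hev' η hη)).2.2) hHR (fun η hη => EReal.coe_le_coe_iff.2 ?_)
    (ζ := 0) (by simpa using hρ0.le)
  · rw [EReal.coe_le_coe_iff] at key
    simp only [zero_smul, add_zero, hH] at key
    have h6 : ((p.comp (Polynomial.X + Polynomial.C ζ₀) -
      Polynomial.C ((δ * 2 : ℂ) * (starRingEnd ℂ) ζ₀) * Polynomial.X).eval 0).re =
      (p.eval ζ₀).re := by simp
    rw [h6, ← hx, sub_self, map_zero, Complex.zero_re, mul_zero] at key
    have : 0 < δ / 2 * ρ ^ 2 := by positivity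
    linarith
  · obtain ⟨e1, e2, -⟩ := hev η (hev' η hη.le)
    have hbd : ‖f (ζ₀ + η) - (x + η • b)‖ ≤ C * ρ ^ 2 := by
      rw [hfe, add_sub_add_left_eq_sub, ← smul_sub, norm_smul, hη]
      rw [hη] at e1
      nlinarith
    have h8 := (le_abs_self _).trans (Real.norm_eq_abs _ ▸ e2)
    simp only at h8
    have hsgn : s (x + η • b) - s (f (ζ₀ + η)) + fderiv ℝ s x (f (ζ₀ + η) - (x + η • b)) ≤
        δ / 2 * ρ ^ 2 := by
      have h9 := (neg_le_abs _).trans (Real.norm_eq_abs _ ▸ e2)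
      simp only at h9
      have : δ / 2 / C * ‖f (ζ₀ + η) - (x + η • b)‖ ≤ δ / 2 * ρ ^ 2 := by
        calc _ ≤ δ / 2 / C * (C * ρ ^ 2) := mul_le_mul_of_nonneg_left hbd hτ.le
          _ = _ := by field_simp
      linarith
    have h3 : s (f (ζ₀ + η)) - (p.eval (ζ₀ + η)).re + δ * ‖ζ₀ + η‖ ^ 2 ≤ m :=
      hmax (by
        simp only [mem_closedBall_zero_iff]
        exact (norm_add_le _ _).trans (by linarith))
    rw [re_eval_add_mul_sq, hη] at h3
    have h4 : ((p.comp (Polynomial.X + Polynomial.C ζ₀) -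
      Polynomial.C ((δ * 2 : ℂ) * (starRingEnd ℂ) ζ₀) * Polynomial.X).eval η).re =
      (p.eval (ζ₀ + η)).re - δ * (2 * ((starRingEnd ℂ) ζ₀ * η).re) := by
      simp only [Polynomial.eval_sub, Polynomial.eval_comp, Polynomial.eval_add, Polynomial.eval_X,
        Polynomial.eval_C, Polynomial.eval_mul, Complex.sub_re, add_comm η ζ₀]
      have : (δ * 2 : ℂ) * (starRingEnd ℂ) ζ₀ * η = ((δ * 2 : ℝ) : ℂ) * ((starRingEnd ℂ) ζ₀ * η) := by
        push_cast; ring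
      rw [this, Complex.re_ofReal_mul]
      ring
    rw [hH]
    simp only
    rw [h4, hΛ]
    linarith

/-- Plurisubharmonic functions satisfy the maximum principle on holomorphic discs. -/
lemma PSHNeg.holomorphic_disc {u : E → EReal} (hu : PSHNeg u Ω) (hΩ : IsOpen Ω) {f : ℂ → E}
    {r R : ℝ} (hrR : r < R) (hf : DifferentiableOn ℂ f (Metric.ball 0 R))
    (hfΩ : ∀ ζ : ℂ, ‖ζ‖ ≤ r → f ζ ∈ Ω) {p : Polynomial ℂ}
    (hp : ∀ ζ : ℂ, ‖ζ‖ = r → u (f ζ) ≤ ((p.eval ζ).re : EReal)) {ζ : ℂ} (hζ : ‖ζ‖ ≤ r) :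
    u (f ζ) ≤ ((p.eval ζ).re : EReal) := by
  have hsub : Metric.closedBall (0:ℂ) r ⊆ Metric.ball 0 R := Metric.closedBall_subset_ball hrR
  obtain ⟨k, hk, hks⟩ := exists_contDiff_circledKernel (Measure.addHaar : Measure E)
  have hK : IsCompact (f '' Metric.closedBall 0 r) :=
    (isCompact_closedBall 0 r).image_of_continuousOn (hf.continuousOn.mono hsub)
  obtain ⟨d, hd, hdΩ⟩ := hK.exists_cthickening_subset_open hΩ (by
    rintro _ ⟨ξ, hξ, rfl⟩
    exact hfΩ ξ (by simpa using hξ))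
  have hball : ∀ ξ : ℂ, ‖ξ‖ ≤ r → Metric.closedBall (f ξ) d ⊆ Ω := fun ξ hξ =>
    (Metric.closedBall_subset_cthickening (Set.mem_image_of_mem f (by simpa using hξ)) d).trans hdΩ
  set ε : ℕ → ℝ := fun j => d / 2 / (j + 1) with hε
  have hε0 : ∀ j, 0 < ε j := fun j => by positivity
  have hεd : ∀ j, ε j < d := fun j => by
    have : ε j ≤ d / 2 := div_le_self (by positivity) (by linarith [j.cast_nonneg (α := ℝ)])
    linarith
  have hεanti : ∀ j, ε (j + 1) ≤ ε j := fun j => by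
    refine div_le_div_of_nonneg_left (by positivity) (by positivity) ?_
    push_cast; linarith
  set h : ℕ → E → ℝ := fun j => kAvg Measure.addHaar k (trunc Ω u j) (ε j) with hh
  have hm := fun N : ℝ => measurable_trunc hΩ hu.1.1 N
  have hb := fun N : ℕ => abs_trunc_le (N := (N:ℝ)) hu.2 N.cast_nonneg
  have hsm : ∀ j, ContDiff ℝ (⊤ : ℕ∞) (h j) := fun j =>
    contDiff_kAvg_of_locallyIntegrable hk hks (locallyIntegrable_of_abs_le (hm _) (hb j)) (hε0 j)
  have hanti : ∀ j, ∀ ξ : ℂ, ‖ξ‖ ≤ r → h (j + 1) (f ξ) ≤ h j (f ξ) := by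
    intro j ξ hξ
    refine (kAvg_mono_fun hk (hm _) (hb (j+1)) (hm _) (hb j) (hε0 _).le fun z _ => ?_).trans
      (kAvg_mono hk (hu.plurisubharmonicOn_trunc _) (hm _) (hb j) (hε0 _).le (hεanti j)
        ((Metric.closedBall_subset_closedBall (hεd _).le).trans (hball ξ hξ)))
    exact trunc_anti hu.2 (by push_cast; linarith) z
  refine EReal.le_coe_of_forall_pos_add fun η hη => ?_
  obtain ⟨j, hj⟩ := exists_forall_lt_of_antitone (S := Metric.sphere (0:ℂ) r) (isCompact_sphere 0 r)
    (h := fun j ξ => h j (f ξ))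
    (c := fun ξ => (p.eval ξ).re + η)
    (fun j => (hsm j).continuous.comp_continuousOn
      (hf.continuousOn.mono (Metric.sphere_subset_closedBall.trans hsub)))
    (fun j ξ hξ => hanti j ξ (by simpa using (mem_sphere_zero_iff_norm.1 hξ).le))
    (Continuous.continuousOn (by fun_prop)) (fun ξ hξ => by
      have hξ' : ‖ξ‖ = r := by simpa using hξ
      have hlt : u (f ξ) < (((p.eval ξ).re + η / 2 : ℝ) : EReal) :=
        (hp ξ hξ').trans_lt (EReal.coe_lt_coe_iff.2 (by linarith))
      obtain ⟨N, hN⟩ := (exists_trunc_lt hu.2 (hfΩ ξ hξ'.le) hlt).exists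
      obtain ⟨e, he, hle⟩ := exists_kAvg_le hk (hu.plurisubharmonicOn_trunc N).1 hΩ (hm _) (hb N) (hfΩ ξ hξ'.le) hN
      have hlim : Tendsto ε atTop (𝓝 0) :=
        tendsto_const_nhds.div_atTop
          (tendsto_atTop_add_const_right _ _ tendsto_natCast_atTop_atTop)
      obtain ⟨j, hj1, hj2⟩ := ((hlim.eventually (gt_mem_nhds he)).and
        (eventually_ge_atTop N)).exists
      refine ⟨j, ?_⟩
      have h1 := hle (ε j) (hε0 j).le hj1
      have h2 := kAvg_mono_fun hk (hm j) (hb j) (hm N) (hb N) (hε0 j).le (x := f ξ)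
        fun z _ => trunc_anti hu.2 (by exact_mod_cast hj2) z
      have : h j (f ξ) ≤ (p.eval ξ).re + η / 2 := h2.trans h1
      linarith)
  have hpj := plurisubharmonicOn_kAvg hk hks (hu.plurisubharmonicOn_trunc j) (hm _) (hb j) (hε0 j)
  have hpj' : PlurisubharmonicOn (fun z => (h j z : EReal)) (Metric.thickening (d / 2)
      (f '' Metric.closedBall 0 r)) := by
    refine hpj.mono fun x hx => ?_
    obtain ⟨y, ⟨ξ, hξ, rfl⟩, hy⟩ := Metric.mem_thickening_iff.1 hx
    refine (Metric.closedBall_subset_closedBall' ?_).trans (hball ξ (by simpa using hξ))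
    have : ε j ≤ d / 2 := div_le_self (by positivity) (by linarith [j.cast_nonneg (α := ℝ)])
    linarith
  have fin := holomorphic_disc_smooth ((hsm j).of_le (by exact_mod_cast le_top)) hpj'
    Metric.isOpen_thickening hrR hf
    (fun ξ hξ => Metric.self_subset_thickening (by positivity) _
      (Set.mem_image_of_mem f (by simpa using hξ)))
    (p := p + Polynomial.C (η : ℂ)) (fun ξ hξ => by
      have := hj j le_rfl ξ (by simpa using hξ)
      simpa using this.le) hζ
  refine (le_trunc hu.2 (N := (j:ℝ)) (hfΩ ζ hζ)).trans (EReal.coe_le_coe_iff.2 ?_)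
  refine (le_kAvg hk (hu.plurisubharmonicOn_trunc j) (hm _) (hb j) (hε0 j).le
    ((Metric.closedBall_subset_closedBall (hεd _).le).trans (hball ζ hζ))).trans ?_
  simpa using fin

end HolomorphicDisc

section Annulus

lemma norm_exp_ofReal (t : ℝ) : ‖((Real.exp t : ℝ) : ℂ)‖ = Real.exp t := by
  rw [Complex.norm_real, Real.norm_eq_abs, abs_of_pos (Real.exp_pos t)]

lemma mem_annA_iff {ζ : ℂ} : ζ ∈ annA ↔ 1 < ‖ζ‖ ∧ ‖ζ‖ < Real.exp 1 := Iff.rfl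

lemma mem_annA_iff_log {ζ : ℂ} : ζ ∈ annA ↔ Real.log ‖ζ‖ ∈ Set.Ioo (0:ℝ) 1 := by
  rw [mem_annA_iff, Set.mem_Ioo]
  rcases eq_or_ne ζ 0 with rfl | h
  · simp
  have h0 : 0 < ‖ζ‖ := norm_pos_iff.2 h
  rw [Real.log_pos_iff h0.le, Real.log_lt_iff_lt_exp h0]

lemma exp_mem_annA {t : ℝ} : ((Real.exp t : ℝ) : ℂ) ∈ annA ↔ t ∈ Set.Ioo (0:ℝ) 1 := by
  rw [mem_annA_iff_log, norm_exp_ofReal, Real.log_exp]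

lemma isOpen_annA : IsOpen annA :=
  (isOpen_lt continuous_const continuous_norm).inter (isOpen_lt continuous_norm continuous_const)

variable {n : ℕ} {Ω : Set (Cn n)} {u : Cn n × ℂ → EReal} {u0 u1 : Cn n → EReal}

/-- The maximum principle on annuli, with respect to functions of the form
`ζ ↦ a * log ‖ζ‖ + b`. -/
lemma PSHNeg.le_log_of_annulus (hu : PSHNeg u (Ω ×ˢ annA)) {z : Cn n} (hz : z ∈ Ω) {s₁ s₂ : ℝ}
    (hs₁ : 0 < s₁) (hs₂ : s₂ < 1) {a b : ℝ}
    (h₁ : ∀ ζ : ℂ, ‖ζ‖ = Real.exp s₁ → u (z, ζ) ≤ ((a * s₁ + b : ℝ) : EReal))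
    (h₂ : ∀ ζ : ℂ, ‖ζ‖ = Real.exp s₂ → u (z, ζ) ≤ ((a * s₂ + b : ℝ) : EReal)) {ζ : ℂ}
    (hζ₁ : Real.exp s₁ ≤ ‖ζ‖) (hζ₂ : ‖ζ‖ ≤ Real.exp s₂) :
    u (z, ζ) ≤ ((a * Real.log ‖ζ‖ + b : ℝ) : EReal) := by
  have hK : IsCompact {ζ : ℂ | Real.exp s₁ ≤ ‖ζ‖ ∧ ‖ζ‖ ≤ Real.exp s₂} := by
    refine (isCompact_closedBall (0:ℂ) (Real.exp s₂)).of_isClosed_subset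
      ((isClosed_le continuous_const continuous_norm).inter
        (isClosed_le continuous_norm continuous_const)) fun ξ hξ => by simpa using hξ.2
  set K := {ζ : ℂ | Real.exp s₁ ≤ ‖ζ‖ ∧ ‖ζ‖ ≤ Real.exp s₂} with hKdef
  have hKA : ∀ ξ ∈ K, ξ ∈ annA := fun ξ hξ =>
    ⟨(Real.one_lt_exp_iff.2 hs₁).trans_le hξ.1, hξ.2.trans_lt (Real.exp_lt_exp.2 hs₂)⟩
  have hK0 : ∀ ξ ∈ annA, ξ ≠ 0 := fun ξ hξ => by
    rintro rfl
    have := hξ.1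
    simp at this
    linarith
  refine EReal.le_coe_of_forall_pos_add fun η hη => ?_
  by_contra hcon
  push Not at hcon
  set e2 := Real.exp s₂ ^ 2 with he2
  have he2pos : 0 < e2 := by positivity
  set δ := η / (2 * e2) with hδ
  have hδ0 : 0 < δ := by positivity
  have hδe : δ * e2 = η / 2 := by rw [hδ]; field_simp
  set J : ℂ → ℝ := fun ξ => -(a * Real.log ‖ξ‖ + b) + δ * ‖ξ‖ ^ 2 with hJ
  have hJc : ContinuousOn J annA := by
    have : ContinuousOn (fun ξ : ℂ => Real.log ‖ξ‖) annA :=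
      continuous_norm.continuousOn.log fun ξ hξ => norm_ne_zero_iff.2 (hK0 ξ hξ)
    fun_prop
  have husc : UpperSemicontinuousOn (fun ξ => u (z, ξ) + (J ξ : EReal)) K := by
    have h1 : UpperSemicontinuousOn (fun ξ => u (z, ξ)) K :=
      hu.1.1.comp (by fun_prop : Continuous fun ξ : ℂ => (z, ξ)).continuousOn
        fun ξ hξ => ⟨hz, hKA ξ hξ⟩
    have h2 : UpperSemicontinuousOn (fun ξ => (J ξ : EReal)) K :=
      (continuous_coe_real_ereal.comp_continuousOn (hJc.mono hKA)).upperSemicontinuousOn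
    refine h1.add' h2 fun x _ => EReal.continuousAt_add ?_ ?_
    · exact Or.inr (EReal.coe_ne_bot _)
    · exact Or.inr (EReal.coe_ne_top _)
  obtain ⟨ζ₀, hζ₀, hmax⟩ := husc.exists_isMaxOn (s := K) ⟨ζ, ⟨hζ₁, hζ₂⟩⟩ hK
  have hbig : ∀ ξ ∈ K, u (z, ξ) + (J ξ : EReal) ≤ u (z, ζ₀) + (J ζ₀ : EReal) := fun ξ hξ => hmax hξ
  have hlow : ((η : ℝ) : EReal) < u (z, ζ₀) + (J ζ₀ : EReal) := by
    refine lt_of_lt_of_le ?_ (hbig ζ ⟨hζ₁, hζ₂⟩)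
    refine lt_of_le_of_lt ?_ (EReal.add_lt_add_of_lt_of_le' hcon le_rfl (EReal.coe_ne_bot _)
      (fun h => absurd h (EReal.coe_ne_top _)))
    rw [← EReal.coe_add]
    refine EReal.coe_le_coe_iff.2 ?_
    have : 0 ≤ δ * ‖ζ‖ ^ 2 := by positivity
    simp only [hJ]; linarith
  have htop : u (z, ζ₀) ≠ ⊤ := ((hu.2 _ ⟨hz, hKA _ hζ₀⟩).trans_lt EReal.zero_lt_top).ne
  have hbot : u (z, ζ₀) ≠ ⊥ := fun h => by simp [h] at hlow
  obtain ⟨x, hx⟩ : ∃ x : ℝ, (x : EReal) = u (z, ζ₀) := ⟨_, EReal.coe_toReal htop hbot⟩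
  rw [← hx, ← EReal.coe_add] at hlow
  have hlow' := EReal.coe_lt_coe_iff.1 hlow
  have hnb : ∀ s : ℝ, (∀ ζ : ℂ, ‖ζ‖ = Real.exp s → u (z, ζ) ≤ ((a * s + b : ℝ) : EReal)) →
      ‖ζ₀‖ ≠ Real.exp s := by
    intro s hs hcon
    have h1 := hs ζ₀ hcon
    rw [← hx] at h1
    have h1 := EReal.coe_le_coe_iff.1 h1
    simp only [hJ, hcon, Real.log_exp] at hlow'
    have : δ * Real.exp s ^ 2 ≤ δ * e2 := by
      rw [← hcon]
      exact mul_le_mul_of_nonneg_left (pow_le_pow_left₀ (norm_nonneg _) hζ₀.2 2) hδ0.le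
    linarith
  have hl1 : Real.exp s₁ < ‖ζ₀‖ := lt_of_le_of_ne hζ₀.1 (Ne.symm (hnb s₁ h₁))
  have hl2 : ‖ζ₀‖ < Real.exp s₂ := lt_of_le_of_ne hζ₀.2 (hnb s₂ h₂)
  set ρ := min (‖ζ₀‖ - Real.exp s₁) (Real.exp s₂ - ‖ζ₀‖) with hρ
  have hρ0 : 0 < ρ := lt_min (by linarith) (by linarith)
  have hin : ∀ ξ : ℂ, ‖ξ‖ ≤ ρ → ζ₀ + ξ ∈ K := by
    intro ξ hξ
    have h3 := hξ.trans (min_le_left _ _)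
    have h4 := hξ.trans (min_le_right _ _)
    constructor
    · have := norm_sub_norm_le ζ₀ (-ξ)
      rw [sub_neg_eq_add, norm_neg] at this
      linarith
    · exact (norm_add_le _ _).trans (by linarith)
  set H : ℂ → ℝ := fun ξ => a * Real.log ‖ζ₀ + ξ * 1‖ +
    ((Polynomial.C (-(δ * 2 : ℂ) * (starRingEnd ℂ) ζ₀) * Polynomial.X).eval ξ).re +
      (x + J ζ₀ + b - δ * ‖ζ₀‖ ^ 2 - δ * ρ ^ 2) with hH
  have hHR : ReApprox H ρ :=
    (((ReApprox.log_norm hρ0.le fun ξ hξ => by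
      rw [mul_one]
      exact hK0 _ (hKA _ (hin ξ hξ))).const_mul _).add (ReApprox.polynomial _ _)).add
      (ReApprox.const _ _)
  have key := hu.1.le_of_reApprox (a := (z, ζ₀)) (b := (0, 1)) hρ0 (fun ξ hξ => by
      simpa using ⟨hz, hKA _ (hin ξ hξ)⟩) hHR (fun ξ hξ => ?_) (ζ := 0) (by simpa using hρ0.le)
  · simp only [zero_smul, add_zero, ← hx] at key
    have := EReal.coe_le_coe_iff.1 key
    simp only [hH, hJ] at this
    simp at this
    have : 0 < δ * ρ ^ 2 := by positivity
    linarith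
  · have h1 := hbig _ (hin ξ hξ.le)
    have h2 : ((z, ζ₀) : Cn n × ℂ) + ξ • ((0, 1) : Cn n × ℂ) = (z, ζ₀ + ξ) := by simp
    rw [h2]
    rw [← hx, ← EReal.coe_add, EReal.add_coe_le_coe_iff] at h1
    refine h1.trans (EReal.coe_le_coe_iff.2 (le_of_eq ?_))
    simp only [hH, hJ, mul_one, re_eval_add_mul_sq, hξ]
    have h4 : ((Polynomial.C (-(δ * 2 : ℂ) * (starRingEnd ℂ) ζ₀) * Polynomial.X).eval ξ).re =
        - δ * (2 * ((starRingEnd ℂ) ζ₀ * ξ).re) := by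
      simp only [Polynomial.eval_X, Polynomial.eval_C, Polynomial.eval_mul]
      have : (-(δ * 2 : ℂ)) * (starRingEnd ℂ) ζ₀ * ξ =
          ((-δ * 2 : ℝ) : ℂ) * ((starRingEnd ℂ) ζ₀ * ξ) := by
        push_cast; ring
      rw [this, Complex.re_ofReal_mul]
      ring
    rw [h4]
    ring

end Annulus

section Kiselev

lemma UpperSemicontinuousOn.eventually_lt_coe {X Y : Type*} [TopologicalSpace X]
    [TopologicalSpace Y] {u : Y → EReal} {O : Set Y} (hu : UpperSemicontinuousOn u O)
    (hO : IsOpen O) {φ : X → Y} {g : X → ℝ} {x : X} (hφ : ContinuousAt φ x) (hg : ContinuousAt g x)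
    (hx : φ x ∈ O) (h : u (φ x) < g x) : ∀ᶠ y in 𝓝 x, u (φ y) < g y := by
  obtain ⟨c, h1, h2⟩ := EReal.lt_iff_exists_real_btwn.1 h
  have h3 := hu _ hx c h1
  rw [hO.nhdsWithin_eq hx] at h3
  filter_upwards [hφ.eventually h3, hg.eventually (lt_mem_nhds (EReal.coe_lt_coe_iff.1 h2))]
    with y h4 h5
  exact h4.trans (EReal.coe_lt_coe_iff.2 h5)

variable {n : ℕ} {Ω : Set (Cn n)} {u : Cn n × ℂ → EReal} {u0 u1 : Cn n → EReal}

lemma PSHNeg.le_log_of_eventually (hu : PSHNeg u (Ω ×ˢ annA)) {z : Cn n} (hz : z ∈ Ω) {a b : ℝ}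
    (h₁ : ∀ᶠ s in 𝓝[>] (0:ℝ), ∀ ζ : ℂ, ‖ζ‖ = Real.exp s → u (z, ζ) ≤ ((a * s + b : ℝ) : EReal))
    (h₂ : ∀ᶠ s in 𝓝[<] (1:ℝ), ∀ ζ : ℂ, ‖ζ‖ = Real.exp s → u (z, ζ) ≤ ((a * s + b : ℝ) : EReal))
    {ζ : ℂ} (hζ : ζ ∈ annA) : u (z, ζ) ≤ ((a * Real.log ‖ζ‖ + b : ℝ) : EReal) := by
  have h0 : 0 < ‖ζ‖ := zero_lt_one.trans hζ.1
  have hl := mem_annA_iff_log.1 hζ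
  obtain ⟨s₁, e1, e2, e3⟩ := (h₁.and ((eventually_mem_nhdsWithin).and
    (mem_nhdsWithin_of_mem_nhds (gt_mem_nhds hl.1)))).exists
  obtain ⟨s₂, f1, f2, f3⟩ := (h₂.and ((eventually_mem_nhdsWithin).and
    (mem_nhdsWithin_of_mem_nhds (lt_mem_nhds hl.2)))).exists
  refine hu.le_log_of_annulus hz e2 f2 e1 f1 ?_ ?_
  · exact ((Real.lt_log_iff_exp_lt h0).1 e3).le
  · exact ((Real.log_lt_iff_lt_exp h0).1 f3).le

lemma eventually_circle_lt {g : ℂ → EReal} {c : ℝ} {t : ℝ} {l : Filter ℝ} (hl : l ≤ 𝓝 t)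
    (hl' : ∀ᶠ s in l, s ∈ Set.Ioo (0:ℝ) 1) {x : EReal}
    (h : Filter.limsup g ((nhds (Real.exp t)).comap (fun ζ : ℂ => ‖ζ‖) ⊓
      Filter.principal annA) ≤ x) (hx : x < c) :
    ∀ᶠ s in l, ∀ ζ : ℂ, ‖ζ‖ = Real.exp s → g ζ < c := by
  have h1 := eventually_lt_of_limsup_lt (h.trans_lt hx)
  rw [eventually_inf_principal, eventually_comap] at h1
  have h2 := (Real.continuous_exp.tendsto t).mono_left hl
  filter_upwards [h2.eventually h1, hl'] with s hs hs' ζ hζ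
  refine hs ζ hζ ?_
  rw [mem_annA_iff_log, hζ, Real.log_exp]
  exact hs'

lemma le_of_mem_geodClass (hu : u ∈ geodClass n Ω u0 u1) {z : Cn n} (hz : z ∈ Ω) {c₀ c₁ : ℝ}
    (h0 : u0 z ≤ c₀) (h1 : u1 z ≤ c₁) {ζ : ℂ} (hζ : ζ ∈ annA) :
    u (z, ζ) ≤ (((1 - Real.log ‖ζ‖) * c₀ + Real.log ‖ζ‖ * c₁ : ℝ) : EReal) := by
  refine EReal.le_coe_of_forall_pos_add fun ε hε => ?_
  obtain ⟨hp, hl0, hl1⟩ := hu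
  have e1 : ∀ᶠ s in 𝓝[>] (0:ℝ), s ∈ Set.Ioo (0:ℝ) 1 := Ioo_mem_nhdsGT one_pos
  have e2 : ∀ᶠ s in 𝓝[<] (1:ℝ), s ∈ Set.Ioo (0:ℝ) 1 := Ioo_mem_nhdsLT one_pos
  have l0 := hl0 z hz
  rw [← Real.exp_zero] at l0
  have k0 := eventually_circle_lt (c := c₀ + ε / 2) nhdsWithin_le_nhds e1 l0
    (h0.trans_lt (EReal.coe_lt_coe_iff.2 (by linarith)))
  have k1 := eventually_circle_lt (c := c₁ + ε / 2) nhdsWithin_le_nhds e2 (hl1 z hz)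
    (h1.trans_lt (EReal.coe_lt_coe_iff.2 (by linarith)))
  have c0 : ∀ᶠ s in 𝓝[>] (0:ℝ), c₀ + ε / 2 < (c₁ - c₀) * s + (c₀ + ε) := by
    have : Continuous fun s => (c₁ - c₀) * s + (c₀ + ε) := by fun_prop
    exact mem_nhdsWithin_of_mem_nhds (this.continuousAt.eventually
      (lt_mem_nhds (by linarith)))
  have c1 : ∀ᶠ s in 𝓝[<] (1:ℝ), c₁ + ε / 2 < (c₁ - c₀) * s + (c₀ + ε) := by
    have : Continuous fun s => (c₁ - c₀) * s + (c₀ + ε) := by fun_prop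
    exact mem_nhdsWithin_of_mem_nhds (this.continuousAt.eventually
      (lt_mem_nhds (by linarith)))
  have := hp.le_log_of_eventually hz (a := c₁ - c₀) (b := c₀ + ε) ?_ ?_ hζ
  · refine this.trans (EReal.coe_le_coe_iff.2 (le_of_eq (by ring)))
  · filter_upwards [k0, c0] with s h3 h4 ξ hξ
    exact (h3 ξ hξ).le.trans (EReal.coe_le_coe_iff.2 h4.le)
  · filter_upwards [k1, c1] with s h3 h4 ξ hξ
    exact (h3 ξ hξ).le.trans (EReal.coe_le_coe_iff.2 h4.le)

/-- The supremum of the rotations of `u` in the annulus variable. -/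
def rotSup (u : Cn n × ℂ → EReal) (x : Cn n × ℂ) : EReal :=
  ⨆ c : Circle, u (x.1, (c : ℂ) * x.2)

lemma circle_mul_mem_annA {ζ : ℂ} (hζ : ζ ∈ annA) (c : Circle) : (c : ℂ) * ζ ∈ annA := by
  rw [mem_annA_iff, norm_mul, Circle.norm_coe, one_mul]
  exact hζ

lemma le_rotSup (u : Cn n × ℂ → EReal) (x : Cn n × ℂ) : u x ≤ rotSup u x := by
  have := le_iSup (fun c : Circle => u (x.1, (c : ℂ) * x.2)) 1
  simp only [Circle.coe_one, one_mul] at this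
  exact this

lemma rotSup_congr (u : Cn n × ℂ → EReal) {z : Cn n} {ζ ξ : ℂ} (h : ‖ζ‖ = ‖ξ‖) :
    rotSup u (z, ζ) = rotSup u (z, ξ) := by
  have key : ∀ ζ ξ : ℂ, ‖ζ‖ = ‖ξ‖ → rotSup u (z, ζ) ≤ rotSup u (z, ξ) := by
    intro ζ ξ h
    refine iSup_le fun c => ?_
    simp only
    rcases eq_or_ne ξ 0 with rfl | h0
    · have : ζ = 0 := by simpa using h
      subst this
      exact le_iSup (fun c : Circle => u (z, (c : ℂ) * 0)) c
    · let d : Circle := ⟨ζ / ξ, mem_sphere_zero_iff_norm.2 (by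
        rw [norm_div, h, div_self (norm_ne_zero_iff.2 h0)])⟩
      have hd : ((c * d : Circle) : ℂ) * ξ = c * ζ := by
        rw [Circle.coe_mul, mul_assoc]
        congr 1
        change ζ / ξ * ξ = ζ
        field_simp
      have := le_iSup (fun c : Circle => u (z, (c : ℂ) * ξ)) (c * d)
      simp only [hd] at this
      exact this
  exact le_antisymm (key _ _ h) (key _ _ h.symm)

lemma PSHNeg.rotSup (hu : PSHNeg u (Ω ×ˢ annA)) (hΩ : IsOpen Ω) :
    PSHNeg (rotSup u) (Ω ×ˢ annA) := by
  have hO := hΩ.prod isOpen_annA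
  refine ⟨⟨?_, fun a b r hr hd p hp ζ hζ => iSup_le fun c => ?_⟩, fun x hx => iSup_le fun c => ?_⟩
  · intro x hx y hy
    obtain ⟨y', h1, h2⟩ := exists_between hy
    rw [hO.nhdsWithin_eq hx]
    have := isCompact_univ.eventually_forall_of_forall_eventually (x₀ := x) (K := Set.univ)
      (P := fun x (c : Circle) => u (x.1, (c : ℂ) * x.2) < y') (fun c _ => by
        have hm : (x.1, (c : ℂ) * x.2) ∈ Ω ×ˢ annA := ⟨hx.1, circle_mul_mem_annA hx.2 c⟩
        have h3 := hu.1.1 _ hm y' ((le_iSup (fun c : Circle => u (x.1, (c : ℂ) * x.2)) c).trans_lt h1)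
        rw [hO.nhdsWithin_eq hm] at h3
        have hc : Continuous fun q : (Cn n × ℂ) × Circle => (q.1.1, (q.2 : ℂ) * q.1.2) := by
          fun_prop
        exact (hc.tendsto (x, c)).eventually h3)
    filter_upwards [this] with x' hx'
    exact (iSup_le fun c => (hx' c trivial).le).trans_lt h2
  · have h1 : ∀ ξ : ℂ, ((a + ξ • b).1, (c : ℂ) * (a + ξ • b).2) =
        (a.1, (c : ℂ) * a.2) + ξ • (b.1, (c : ℂ) * b.2) := by
      intro ξ
      ext1
      · simp
      · simp [mul_add, mul_left_comm]
    rw [h1]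
    refine hu.1.2 _ _ r hr (fun ξ hξ => ?_) p (fun ξ hξ => ?_) ζ hζ
    · rw [← h1]
      exact ⟨(hd ξ hξ).1, circle_mul_mem_annA (hd ξ hξ).2 c⟩
    · rw [← h1]
      exact (le_iSup (fun c : Circle => u ((a + ξ • b).1, (c : ℂ) * (a + ξ • b).2)) c).trans (hp ξ hξ)
  · exact hu.2 _ ⟨hx.1, circle_mul_mem_annA hx.2 c⟩

/-- **Kiselev's minimum principle** for rotation invariant functions on `Ω × annA`. -/
lemma PSHNeg.kiselev (hu : PSHNeg u (Ω ×ˢ annA)) (hΩ : IsOpen Ω)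
    (hrot : ∀ z : Cn n, ∀ ζ ξ : ℂ, ‖ζ‖ = ‖ξ‖ → u (z, ζ) = u (z, ξ)) (α β : ℝ) :
    PlurisubharmonicOn (fun z => ⨅ s ∈ Set.Ioo (0:ℝ) 1,
      u (z, ((Real.exp s : ℝ) : ℂ)) + ((α * s + β : ℝ) : EReal)) Ω := by
  have hO := hΩ.prod isOpen_annA
  classical
  refine ⟨upperSemicontinuousOn_biInf fun s hs => ?_, fun a b r hr hd p hp ζ hζ => ?_⟩
  · have h1 : UpperSemicontinuousOn (fun z => u (z, ((Real.exp s : ℝ) : ℂ))) Ω :=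
      hu.1.1.comp (by fun_prop : Continuous fun z : Cn n =>
        (z, ((Real.exp s : ℝ) : ℂ))).continuousOn fun z hz => ⟨hz, exp_mem_annA.2 hs⟩
    refine h1.add' upperSemicontinuousOn_const fun x _ => EReal.continuousAt_add ?_ ?_
    · exact Or.inr (EReal.coe_ne_bot _)
    · exact Or.inr (EReal.coe_ne_top _)
  refine EReal.le_coe_of_forall_pos_add fun η hη => ?_
  let T : Metric.sphere (0:ℂ) r → Set ℝ := fun ξ => {s | s ∈ Set.Ioo (0:ℝ) 1 ∧
    u (a + (ξ : ℂ) • b, ((Real.exp s : ℝ) : ℂ)) <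
      (((p.eval (ξ : ℂ)).re + η - (α * s + β) : ℝ) : EReal)}
  have hdS : ∀ ξ : Metric.sphere (0:ℂ) r, a + (ξ : ℂ) • b ∈ Ω := fun ξ =>
    hd ξ (mem_sphere_zero_iff_norm.1 ξ.2).le
  have hopen : ∀ (ξ : Metric.sphere (0:ℂ) r) (s : ℝ), s ∈ T ξ →
      ∀ᶠ q : Metric.sphere (0:ℂ) r × ℝ in 𝓝 (ξ, s), q.2 ∈ T q.1 := by
    rintro ξ s ⟨h1, h2⟩
    have e1 : ∀ᶠ q : Metric.sphere (0:ℂ) r × ℝ in 𝓝 (ξ, s), q.2 ∈ Set.Ioo (0:ℝ) 1 :=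
      continuous_snd.continuousAt.eventually (Ioo_mem_nhds h1.1 h1.2)
    have e2 := hu.1.1.eventually_lt_coe hO (x := (ξ, s))
      (φ := fun q : Metric.sphere (0:ℂ) r × ℝ =>
        (a + (q.1 : ℂ) • b, ((Real.exp q.2 : ℝ) : ℂ)))
      (g := fun q => (p.eval (q.1 : ℂ)).re + η - (α * q.2 + β))
      (Continuous.continuousAt (by fun_prop)) (Continuous.continuousAt (by fun_prop))
      ⟨hdS ξ, exp_mem_annA.2 h1⟩ h2
    filter_upwards [e1, e2] with q h3 h4 using ⟨h3, h4⟩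
  have hne : ∀ ξ, ∃ s, s ∈ T ξ := by
    intro ξ
    have h1 := (hp ξ (mem_sphere_zero_iff_norm.1 ξ.2)).trans_lt
      (EReal.coe_lt_coe_iff.2 (lt_add_of_pos_right _ (half_pos hη)))
    simp only [iInf_lt_iff] at h1
    obtain ⟨s, hs, h2⟩ := h1
    refine ⟨s, hs, ?_⟩
    exact (EReal.add_coe_le_coe_iff.1 h2.le).trans_lt (EReal.coe_lt_coe_iff.2 (by linarith))
  have hconv : ∀ ξ, Convex ℝ (T ξ) := by
    intro ξ
    refine Set.OrdConnected.convex ⟨?_⟩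
    rintro s₁ ⟨h1, h2⟩ s₂ ⟨h3, h4⟩ s ⟨h5, h6⟩
    have hs : s ∈ Set.Ioo (0:ℝ) 1 := ⟨h1.1.trans_le h5, h6.trans_lt h3.2⟩
    refine ⟨hs, ?_⟩
    obtain ⟨c₁, k1, k1'⟩ := EReal.lt_iff_exists_real_btwn.1 h2
    obtain ⟨c₂, k2, k2'⟩ := EReal.lt_iff_exists_real_btwn.1 h4
    have k1' := EReal.coe_lt_coe_iff.1 k1'
    have k2' := EReal.coe_lt_coe_iff.1 k2'
    set P := Max.max (c₁ + (α * s₁ + β)) (c₂ + (α * s₂ + β)) with hP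
    have hPlt : P < (p.eval (ξ : ℂ)).re + η := _root_.max_lt (by linarith) (by linarith)
    have := hu.le_log_of_annulus (hdS ξ) (s₁ := s₁) (s₂ := s₂) h1.1 h3.2 (a := -α) (b := P - β)
      (ζ := ((Real.exp s : ℝ) : ℂ)) (fun ζ hζ => ?_) (fun ζ hζ => ?_) ?_ ?_
    · refine this.trans_lt (EReal.coe_lt_coe_iff.2 ?_)
      rw [norm_exp_ofReal, Real.log_exp]
      linarith
    · rw [hrot _ ζ ((Real.exp s₁ : ℝ) : ℂ) (by rw [hζ, norm_exp_ofReal])]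
      refine k1.le.trans (EReal.coe_le_coe_iff.2 ?_)
      have := le_max_left (c₁ + (α * s₁ + β)) (c₂ + (α * s₂ + β))
      linarith
    · rw [hrot _ ζ ((Real.exp s₂ : ℝ) : ℂ) (by rw [hζ, norm_exp_ofReal])]
      refine k2.le.trans (EReal.coe_le_coe_iff.2 ?_)
      have := le_max_right (c₁ + (α * s₁ + β)) (c₂ + (α * s₂ + β))
      linarith
    · rw [norm_exp_ofReal]
      exact Real.exp_le_exp.2 h5
    · rw [norm_exp_ofReal]
      exact Real.exp_le_exp.2 h6
  obtain ⟨τ, hτ⟩ := exists_continuous_forall_mem_convex_of_local_const hconv (fun ξ => by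
    obtain ⟨s, hs⟩ := hne ξ
    refine ⟨s, ?_⟩
    have : Continuous fun ξ : Metric.sphere (0:ℂ) r => (ξ, s) := by fun_prop
    exact (this.tendsto ξ).eventually (hopen ξ s hs))
  obtain ⟨d, hd0, hdT⟩ : ∃ d : ℝ, 0 < d ∧ ∀ (ξ : Metric.sphere (0:ℂ) r) (s : ℝ),
      |τ ξ - s| < d → s ∈ T ξ := by
    have hcp : IsCompact (Set.range fun ξ => (ξ, τ ξ)) := isCompact_range (by fun_prop)
    have hop : IsOpen {q : Metric.sphere (0:ℂ) r × ℝ | q.2 ∈ T q.1} :=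
      isOpen_iff_eventually.2 fun q hq => hopen q.1 q.2 hq
    obtain ⟨d, hd0, hdd⟩ := hcp.exists_thickening_subset_open hop (by
      rintro _ ⟨ξ, rfl⟩
      exact hτ ξ)
    refine ⟨d, hd0, fun ξ s hs => ?_⟩
    suffices h : (ξ, s) ∈ Metric.thickening d (Set.range fun ξ => (ξ, τ ξ)) from hdd h
    refine Metric.mem_thickening_iff.2 ⟨_, Set.mem_range_self ξ, ?_⟩
    rw [Prod.dist_eq]
    simp only [dist_self, Real.dist_eq]
    rw [abs_sub_comm] at hs
    exact max_lt hd0 hs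
  obtain ⟨q, hq⟩ := exists_polynomial_approx_circle
    (g := fun ξ => if h : ξ ∈ Metric.sphere (0:ℂ) r then τ ⟨ξ, h⟩ else 0) hr (by
      rw [continuousOn_iff_continuous_domRestrict]
      refine τ.continuous.congr fun ξ => ?_
      simp [Set.domRestrict]) hd0
  have hqT : ∀ ξ : Metric.sphere (0:ℂ) r, (q.eval (ξ : ℂ)).re ∈ T ξ := by
    intro ξ
    refine hdT ξ _ ?_
    have := hq ξ (by simp)
    rwa [dif_pos ξ.2] at this
  have hqin : ∀ ξ : ℂ, ‖ξ‖ ≤ r → (q.eval ξ).re ∈ Set.Ioo (0:ℝ) 1 := by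
    intro ξ hξ
    have hcq : ContinuousOn (fun ξ : ℂ => (q.eval ξ).re) (Metric.sphere 0 r) :=
      Continuous.continuousOn (by fun_prop)
    have hS : (Metric.sphere (0:ℂ) r).Nonempty := NormedSpace.sphere_nonempty.2 hr.le
    obtain ⟨x, hx, hxm⟩ := (isCompact_sphere (0:ℂ) r).exists_isMaxOn hS hcq
    obtain ⟨y, hy, hym⟩ := (isCompact_sphere (0:ℂ) r).exists_isMinOn hS hcq
    constructor
    · exact (hqT ⟨y, hy⟩).1.1.trans_le
        (le_re_eval_of_circle hr (fun ζ hζ => hym (by simpa using hζ)) hξ)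
    · exact (re_eval_le_of_circle hr (fun ζ hζ => hxm (by simpa using hζ)) hξ).trans_lt
        (hqT ⟨x, hx⟩).1.2
  have key := hu.holomorphic_disc hO (lt_add_one r)
    (f := fun ξ => (a + ξ • b, Complex.exp (q.eval ξ)))
    (p := p - Polynomial.C (α : ℂ) * q + Polynomial.C ((η - β : ℝ) : ℂ)) ?_ (fun ξ hξ => ?_)
    (fun ξ hξ => ?_) hζ
  · refine (iInf₂_le (q.eval ζ).re (hqin ζ hζ)).trans ?_
    rw [EReal.add_coe_le_coe_iff, hrot _ _ (Complex.exp (q.eval ζ))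
      (by rw [norm_exp_ofReal, Complex.norm_exp])]
    refine key.trans (EReal.coe_le_coe_iff.2 (le_of_eq ?_))
    simp only [Polynomial.eval_add, Polynomial.eval_sub, Polynomial.eval_mul, Polynomial.eval_C,
      Complex.add_re, Complex.sub_re, Complex.re_ofReal_mul, Complex.ofReal_re]
    ring
  · refine Differentiable.differentiableOn ?_
    refine Differentiable.prodMk (by fun_prop) ?_
    exact Complex.differentiable_exp.comp q.differentiable
  · refine ⟨hd ξ hξ, ?_⟩
    rw [mem_annA_iff_log, Complex.norm_exp, Real.log_exp]
    exact hqin ξ hξ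
  · have := (hqT ⟨ξ, by simpa using hξ⟩).2
    simp only at this
    rw [hrot _ _ (Complex.exp (q.eval ξ))
      (by rw [norm_exp_ofReal, Complex.norm_exp])] at this
    refine this.le.trans (EReal.coe_le_coe_iff.2 (le_of_eq ?_))
    simp only [Polynomial.eval_add, Polynomial.eval_sub, Polynomial.eval_mul, Polynomial.eval_C,
      Complex.add_re, Complex.sub_re, Complex.re_ofReal_mul, Complex.ofReal_re]
    ring

end Kiselev

section Gp

variable {E : Type*} [NormedAddCommGroup E] [NormedSpace ℂ E] {Ω : Set E}

lemma le_uscReg (f : E → EReal) {z : E} (hz : z ∈ Ω) : f z ≤ uscReg f Ω z := by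
  refine le_limsup_of_frequently_le' ?_
  refine Filter.Frequently.mono ?_ (fun _ h => h)
  intro h
  have := (mem_of_mem_nhdsWithin hz h : z ∈ {x | ¬ f z ≤ f x})
  exact this le_rfl

lemma le_gp {φ w : E → EReal} (hw : PSHNeg w Ω) {C : ℝ} (hC : ∀ x ∈ Ω, w x ≤ φ x + (C : EReal))
    {z : E} (hz : z ∈ Ω) : w z ≤ gp φ Ω z := by
  refine le_trans ?_ (le_uscReg _ hz)
  exact le_iSup₂ (f := fun (w : E → EReal) (_ : w ∈ {w : E → EReal | PSHNeg w Ω ∧ ∃ C : ℝ,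
      ∀ x ∈ Ω, w x ≤ φ x + (C : EReal)}) => w z) w ⟨hw, C, hC⟩

lemma le_gp_self {φ : E → EReal} (hφ : PSHNeg φ Ω) {z : E} (hz : z ∈ Ω) : φ z ≤ gp φ Ω z :=
  le_gp hφ (C := 0) (fun x _ => by simp) hz

end Gp

section GeodesicBounds

variable {n : ℕ} {Ω : Set (Cn n)} {u : Cn n × ℂ → EReal} {u0 u1 : Cn n → EReal}

lemma PSHNeg.le_of_le_left (hu : PSHNeg u (Ω ×ˢ annA)) {z : Cn n} (hz : z ∈ Ω) {s t ℓ : ℝ}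
    (hs : 0 < s) (hst : s < t) (ht : t < 1)
    (h : ∀ ζ : ℂ, ‖ζ‖ = Real.exp s → u (z, ζ) ≤ (ℓ : EReal)) :
    u (z, ((Real.exp t : ℝ) : ℂ)) ≤ ((ℓ * (1 - t) / (1 - s) : ℝ) : EReal) := by
  have h1s : (1 - s) ≠ 0 := by linarith
  have hlim : Tendsto (fun s₂ : ℝ => ((ℓ * (s₂ - t) / (s₂ - s) : ℝ) : EReal)) (𝓝[<] 1)
      (𝓝 ((ℓ * (1 - t) / (1 - s) : ℝ) : EReal)) := by
    refine (continuous_coe_real_ereal.tendsto _).comp (tendsto_nhdsWithin_of_tendsto_nhds ?_)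
    have : ContinuousAt (fun s₂ : ℝ => ℓ * (s₂ - t) / (s₂ - s)) 1 :=
      ContinuousAt.div (by fun_prop) (by fun_prop) h1s
    exact this
  refine ge_of_tendsto hlim ?_
  filter_upwards [Ioo_mem_nhdsLT ht] with s₂ hs₂
  have hd : s₂ - s ≠ 0 := by linarith [hs₂.1]
  have := hu.le_log_of_annulus hz (s₁ := s) (s₂ := s₂) hs hs₂.2 (a := -ℓ / (s₂ - s))
    (b := ℓ * s₂ / (s₂ - s)) (ζ := ((Real.exp t : ℝ) : ℂ)) (fun ζ hζ => ?_) (fun ζ hζ => ?_) ?_ ?_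
  · refine this.trans (EReal.coe_le_coe_iff.2 (le_of_eq ?_))
    rw [norm_exp_ofReal, Real.log_exp]
    ring
  · refine (h ζ hζ).trans (EReal.coe_le_coe_iff.2 (le_of_eq ?_))
    field_simp
    ring
  · refine (hu.2 (z, ζ) ⟨hz, ?_⟩).trans (EReal.coe_le_coe_iff.2 (le_of_eq ?_))
    · rw [mem_annA_iff_log, hζ, Real.log_exp]
      exact ⟨by linarith [hs₂.1], hs₂.2⟩
    · field_simp
      ring
  · rw [norm_exp_ofReal]
    exact Real.exp_le_exp.2 hst.le
  · rw [norm_exp_ofReal]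
    exact Real.exp_le_exp.2 hs₂.1.le

lemma PSHNeg.le_of_le_right (hu : PSHNeg u (Ω ×ˢ annA)) {z : Cn n} (hz : z ∈ Ω) {s t ℓ : ℝ}
    (hs : s < 1) (hst : t < s) (ht : 0 < t)
    (h : ∀ ζ : ℂ, ‖ζ‖ = Real.exp s → u (z, ζ) ≤ (ℓ : EReal)) :
    u (z, ((Real.exp t : ℝ) : ℂ)) ≤ ((ℓ * t / s : ℝ) : EReal) := by
  have h1s : s ≠ 0 := by linarith
  have hlim : Tendsto (fun s₁ : ℝ => ((ℓ * (t - s₁) / (s - s₁) : ℝ) : EReal)) (𝓝[>] 0)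
      (𝓝 ((ℓ * t / s : ℝ) : EReal)) := by
    refine (continuous_coe_real_ereal.tendsto _).comp (tendsto_nhdsWithin_of_tendsto_nhds ?_)
    have : ContinuousAt (fun s₁ : ℝ => ℓ * (t - s₁) / (s - s₁)) 0 :=
      ContinuousAt.div (by fun_prop) (by fun_prop) (by simpa using h1s)
    simpa [ContinuousAt] using this
  refine ge_of_tendsto hlim ?_
  filter_upwards [Ioo_mem_nhdsGT ht] with s₁ hs₁
  have hd : s - s₁ ≠ 0 := by linarith [hs₁.2]
  have := hu.le_log_of_annulus hz (s₁ := s₁) (s₂ := s) hs₁.1 hs (a := ℓ / (s - s₁))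
    (b := - (ℓ * s₁) / (s - s₁)) (ζ := ((Real.exp t : ℝ) : ℂ)) (fun ζ hζ => ?_) (fun ζ hζ => ?_)
    ?_ ?_
  · refine this.trans (EReal.coe_le_coe_iff.2 (le_of_eq ?_))
    rw [norm_exp_ofReal, Real.log_exp]
    ring
  · refine (hu.2 (z, ζ) ⟨hz, ?_⟩).trans (EReal.coe_le_coe_iff.2 (le_of_eq ?_))
    · rw [mem_annA_iff_log, hζ, Real.log_exp]
      exact ⟨hs₁.1, by linarith [hs₁.2]⟩
    · field_simp
      ring
  · refine (h ζ hζ).trans (EReal.coe_le_coe_iff.2 (le_of_eq ?_))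
    field_simp
    ring
  · rw [norm_exp_ofReal]
    exact Real.exp_le_exp.2 hs₁.2.le
  · rw [norm_exp_ofReal]
    exact Real.exp_le_exp.2 hst.le

lemma rotSup_le_of_mem_geodClass (hu : u ∈ geodClass n Ω u0 u1) {z : Cn n} (hz : z ∈ Ω)
    {c₀ c₁ : ℝ} (h0 : u0 z ≤ c₀) (h1 : u1 z ≤ c₁) {s : ℝ} (hs : s ∈ Set.Ioo (0:ℝ) 1) :
    rotSup u (z, ((Real.exp s : ℝ) : ℂ)) ≤ (((1 - s) * c₀ + s * c₁ : ℝ) : EReal) := by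
  refine iSup_le fun c => ?_
  refine (le_of_mem_geodClass hu hz h0 h1 (circle_mul_mem_annA (exp_mem_annA.2 hs) c)).trans ?_
  simp only [norm_mul, Circle.norm_coe, one_mul, norm_exp_ofReal, Real.log_exp, le_refl]

lemma le_gp_of_affine (hΩ : IsOpen Ω) (hu : PSHNeg u (Ω ×ˢ annA))
    (hrot : ∀ z : Cn n, ∀ ζ ξ : ℂ, ‖ζ‖ = ‖ξ‖ → u (z, ζ) = u (z, ξ)) {φ : Cn n → EReal} {α β C : ℝ}
    (h0 : ∀ z ∈ Ω, ∀ δ : ℝ, 0 < δ → ∃ s ∈ Set.Ioo (0:ℝ) 1,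
      u (z, ((Real.exp s : ℝ) : ℂ)) + ((α * s + β : ℝ) : EReal) ≤ (δ : EReal))
    (hφ : ∀ z ∈ Ω, ∀ x : ℝ, φ z ≤ x → ∀ δ : ℝ, 0 < δ → ∃ s ∈ Set.Ioo (0:ℝ) 1,
      u (z, ((Real.exp s : ℝ) : ℂ)) + ((α * s + β : ℝ) : EReal) ≤ ((x + C + δ : ℝ) : EReal))
    {z₀ : Cn n} (hz₀ : z₀ ∈ Ω) {κ : EReal} (hκ : ∀ s ∈ Set.Ioo (0:ℝ) 1,
      κ ≤ u (z₀, ((Real.exp s : ℝ) : ℂ)) + ((α * s + β : ℝ) : EReal)) :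
    κ ≤ gp φ Ω z₀ := by
  have hM := hu.kiselev hΩ hrot α β
  refine le_trans (le_iInf₂ hκ) (le_gp (φ := φ) (C := C) ⟨hM, fun z hz => ?_⟩ (fun z hz => ?_) hz₀)
  · refine EReal.le_coe_of_forall_pos_add fun δ hδ => ?_
    obtain ⟨s, hs, h⟩ := h0 z hz δ hδ
    rw [zero_add]
    exact (iInf₂_le s hs).trans h
  · have key : ∀ x : ℝ, φ z ≤ x → (⨅ s ∈ Set.Ioo (0:ℝ) 1,
        u (z, ((Real.exp s : ℝ) : ℂ)) + ((α * s + β : ℝ) : EReal)) ≤ ((x + C : ℝ) : EReal) := by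
      intro x hx
      refine EReal.le_coe_of_forall_pos_add fun δ hδ => ?_
      obtain ⟨s, hs, h⟩ := hφ z hz x hx δ hδ
      exact (iInf₂_le s hs).trans h
    generalize φ z = y at key
    induction y with
    | bot =>
      rw [EReal.bot_add]
      refine le_of_eq (EReal.eq_bot_iff_forall_lt _ |>.2 fun x => ?_)
      refine (key (x - C - 1) bot_le).trans_lt (EReal.coe_lt_coe_iff.2 (by linarith))
    | top => simp
    | coe y =>
      rw [← EReal.coe_add]
      exact key y le_rfl

lemma le_one_sub_mul_gp (hΩ : IsOpen Ω) (hu : u ∈ geodClass n Ω u0 u1) (hu0 : ∀ z ∈ Ω, u0 z ≤ 0)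
    {z : Cn n} (hz : z ∈ Ω) {t c : ℝ} (ht : t ∈ Set.Ioo (0:ℝ) 1)
    (hc : gp u1 Ω z ≤ c) : u (z, ((Real.exp t : ℝ) : ℂ)) ≤ (((1 - t) * c : ℝ) : EReal) := by
  refine (le_rotSup u _).trans ?_
  have hv := hu.1.rotSup hΩ
  have hrot : ∀ z : Cn n, ∀ ζ ξ : ℂ, ‖ζ‖ = ‖ξ‖ → rotSup u (z, ζ) = rotSup u (z, ξ) :=
    fun z ζ ξ h => rotSup_congr u h
  by_cases hbot : rotSup u (z, ((Real.exp t : ℝ) : ℂ)) = ⊥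
  · rw [hbot]; exact bot_le
  have hneg := hv.2 (z, ((Real.exp t : ℝ) : ℂ)) ⟨hz, exp_mem_annA.2 ht⟩
  obtain ⟨a, ha⟩ : ∃ a : ℝ, (a : EReal) = rotSup u (z, ((Real.exp t : ℝ) : ℂ)) :=
    ⟨_, EReal.coe_toReal (hneg.trans_lt EReal.zero_lt_top).ne hbot⟩
  rw [← ha] at hneg ⊢
  have hneg := EReal.coe_le_coe_iff.1 hneg
  have h1t : 0 < 1 - t := by linarith [ht.2]
  have ht0 := ht.1
  have key := le_gp_of_affine hΩ hv hrot (φ := u1) (α := -a / t) (β := 0) (C := -a / t)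
    (fun x hx δ hδ => ?_) (fun x hx y hy δ hδ => ?_) hz (κ := ((a / (1 - t) : ℝ) : EReal))
    (fun s hs => ?_)
  · have := EReal.coe_le_coe_iff.1 (key.trans hc)
    rw [div_le_iff₀ h1t] at this
    exact EReal.coe_le_coe_iff.2 (by linarith)
  · have hc : Tendsto (fun s : ℝ => -a / t * s + 0) (𝓝[>] 0) (𝓝 0) := by
      refine tendsto_nhdsWithin_of_tendsto_nhds ?_
      have : Continuous fun s : ℝ => -a / t * s + 0 := by fun_prop
      simpa using this.tendsto 0
    obtain ⟨s, h1, h2⟩ := ((hc.eventually (gt_mem_nhds hδ)).and (Ioo_mem_nhdsGT one_pos)).exists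
    refine ⟨s, h2, (EReal.add_coe_le_coe_iff).2 ((hv.2 _ ⟨hx, exp_mem_annA.2 h2⟩).trans ?_)⟩
    exact EReal.coe_le_coe_iff.2 (by linarith)
  · have hc : Tendsto (fun s : ℝ => s * y + (-a / t * s + 0)) (𝓝[<] 1) (𝓝 (y + -a / t)) := by
      refine tendsto_nhdsWithin_of_tendsto_nhds ?_
      have : Continuous fun s : ℝ => s * y + (-a / t * s + 0) := by fun_prop
      simpa using this.tendsto 1
    obtain ⟨s, h1, h2⟩ := ((hc.eventually (gt_mem_nhds (lt_add_of_pos_right _ hδ))).and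
      (Ioo_mem_nhdsLT one_pos)).exists
    refine ⟨s, h2, (EReal.add_coe_le_coe_iff).2
      ((rotSup_le_of_mem_geodClass hu hx (hu0 x hx) hy h2).trans ?_)⟩
    exact EReal.coe_le_coe_iff.2 (by simp only [mul_zero, zero_add]; linarith)
  · by_contra hcon
    push Not at hcon
    obtain ⟨ℓ, hℓ1, hℓ2⟩ : ∃ ℓ : ℝ, rotSup u (z, ((Real.exp s : ℝ) : ℂ)) ≤ ℓ ∧
        ℓ + (-a / t * s) < a / (1 - t) := by
      obtain ⟨y, hy1, hy2⟩ := EReal.lt_iff_exists_real_btwn.1 hcon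
      exact ⟨_, EReal.add_coe_le_coe_iff.1 hy1.le, by
        have := EReal.coe_lt_coe_iff.1 hy2
        linarith⟩
    have hcirc : ∀ ζ : ℂ, ‖ζ‖ = Real.exp s → rotSup u (z, ζ) ≤ (ℓ : EReal) := fun ζ hζ => by
      rwa [hrot z ζ ((Real.exp s : ℝ) : ℂ) (by rw [hζ, norm_exp_ofReal])]
    have hs0 := hs.1
    have h1s : 0 < 1 - s := by linarith [hs.2]
    have hdiv : a / (1 - t) ≤ 0 := div_nonpos_of_nonpos_of_nonneg hneg h1t.le
    have hdiv' : 0 ≤ -a / t * s := mul_nonneg (div_nonneg (by linarith) ht0.le) hs0.le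
    have hdiv'' : a / (1 - t) * (1 - s) ≥ a / (1 - t) := by nlinarith
    rcases lt_trichotomy s t with h | h | h
    · have := hv.le_of_le_left hz hs.1 h ht.2 hcirc
      rw [← ha] at this
      have := EReal.coe_le_coe_iff.1 this
      rw [le_div_iff₀ h1s] at this
      have h3 : a / (1 - t) * (1 - s) ≤ ℓ := by
        rw [div_mul_eq_mul_div, div_le_iff₀ h1t]; exact this
      linarith
    · subst h
      rw [← ha] at hℓ1
      have := EReal.coe_le_coe_iff.1 hℓ1
      have h4 : -a / s * s = -a := by field_simp
      linarith
    · have := hv.le_of_le_right hz hs.2 h ht.1 hcirc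
      rw [← ha] at this
      have := EReal.coe_le_coe_iff.1 this
      rw [le_div_iff₀ hs0] at this
      have h3 : a / t * s ≤ ℓ := by
        rw [div_mul_eq_mul_div, div_le_iff₀ ht0]; exact this
      have h4 : -a / t * s = -(a / t * s) := by ring
      linarith

lemma le_mul_gp (hΩ : IsOpen Ω) (hu : u ∈ geodClass n Ω u0 u1) (hu1 : ∀ z ∈ Ω, u1 z ≤ 0)
    {z : Cn n} (hz : z ∈ Ω) {t c : ℝ} (ht : t ∈ Set.Ioo (0:ℝ) 1)
    (hc : gp u0 Ω z ≤ c) : u (z, ((Real.exp t : ℝ) : ℂ)) ≤ ((t * c : ℝ) : EReal) := by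
  refine (le_rotSup u _).trans ?_
  have hv := hu.1.rotSup hΩ
  have hrot : ∀ z : Cn n, ∀ ζ ξ : ℂ, ‖ζ‖ = ‖ξ‖ → rotSup u (z, ζ) = rotSup u (z, ξ) :=
    fun z ζ ξ h => rotSup_congr u h
  by_cases hbot : rotSup u (z, ((Real.exp t : ℝ) : ℂ)) = ⊥
  · rw [hbot]; exact bot_le
  have hneg := hv.2 (z, ((Real.exp t : ℝ) : ℂ)) ⟨hz, exp_mem_annA.2 ht⟩
  obtain ⟨a, ha⟩ : ∃ a : ℝ, (a : EReal) = rotSup u (z, ((Real.exp t : ℝ) : ℂ)) :=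
    ⟨_, EReal.coe_toReal (hneg.trans_lt EReal.zero_lt_top).ne hbot⟩
  rw [← ha] at hneg ⊢
  have hneg := EReal.coe_le_coe_iff.1 hneg
  have h1t : 0 < 1 - t := by linarith [ht.2]
  have ht0 := ht.1
  have key := le_gp_of_affine hΩ hv hrot (φ := u0) (α := a / (1 - t)) (β := -a / (1 - t))
    (C := -a / (1 - t))
    (fun x hx δ hδ => ?_) (fun x hx y hy δ hδ => ?_) hz (κ := ((a / t : ℝ) : EReal))
    (fun s hs => ?_)
  · have := EReal.coe_le_coe_iff.1 (key.trans hc)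
    rw [div_le_iff₀ ht0] at this
    exact EReal.coe_le_coe_iff.2 (by linarith)
  · have hc : Tendsto (fun s : ℝ => a / (1 - t) * s + -a / (1 - t)) (𝓝[<] 1) (𝓝 0) := by
      refine tendsto_nhdsWithin_of_tendsto_nhds ?_
      have : Continuous fun s : ℝ => a / (1 - t) * s + -a / (1 - t) := by fun_prop
      convert this.tendsto 1 using 2
      ring
    obtain ⟨s, h1, h2⟩ := ((hc.eventually (gt_mem_nhds hδ)).and (Ioo_mem_nhdsLT one_pos)).exists
    refine ⟨s, h2, (EReal.add_coe_le_coe_iff).2 ((hv.2 _ ⟨hx, exp_mem_annA.2 h2⟩).trans ?_)⟩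
    exact EReal.coe_le_coe_iff.2 (by linarith)
  · have hc : Tendsto (fun s : ℝ => (1 - s) * y + (a / (1 - t) * s + -a / (1 - t))) (𝓝[>] 0)
        (𝓝 (y + -a / (1 - t))) := by
      refine tendsto_nhdsWithin_of_tendsto_nhds ?_
      have : Continuous fun s : ℝ => (1 - s) * y + (a / (1 - t) * s + -a / (1 - t)) := by fun_prop
      simpa using this.tendsto 0
    obtain ⟨s, h1, h2⟩ := ((hc.eventually (gt_mem_nhds (lt_add_of_pos_right _ hδ))).and
      (Ioo_mem_nhdsGT one_pos)).exists
    refine ⟨s, h2, (EReal.add_coe_le_coe_iff).2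
      ((rotSup_le_of_mem_geodClass hu hx hy (hu1 x hx) h2).trans ?_)⟩
    exact EReal.coe_le_coe_iff.2 (by simp only [mul_zero, add_zero]; linarith)
  · by_contra hcon
    push Not at hcon
    obtain ⟨ℓ, hℓ1, hℓ2⟩ : ∃ ℓ : ℝ, rotSup u (z, ((Real.exp s : ℝ) : ℂ)) ≤ ℓ ∧
        ℓ + -(a / (1 - t)) * (1 - s) < a / t := by
      obtain ⟨y, hy1, hy2⟩ := EReal.lt_iff_exists_real_btwn.1 hcon
      exact ⟨_, EReal.add_coe_le_coe_iff.1 hy1.le, by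
        have := EReal.coe_lt_coe_iff.1 hy2
        have e : -(a / (1 - t)) * (1 - s) = a / (1 - t) * s + -a / (1 - t) := by ring
        linarith⟩
    have hcirc : ∀ ζ : ℂ, ‖ζ‖ = Real.exp s → rotSup u (z, ζ) ≤ (ℓ : EReal) := fun ζ hζ => by
      rwa [hrot z ζ ((Real.exp s : ℝ) : ℂ) (by rw [hζ, norm_exp_ofReal])]
    have hs0 := hs.1
    have h1s : 0 < 1 - s := by linarith [hs.2]
    have hdiv : a / t ≤ 0 := div_nonpos_of_nonpos_of_nonneg hneg ht0.le
    have hdiv' : 0 ≤ -(a / (1 - t)) * (1 - s) :=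
      mul_nonneg (neg_nonneg.2 (div_nonpos_of_nonpos_of_nonneg hneg h1t.le)) h1s.le
    have hdiv'' : a / t * s ≥ a / t := by nlinarith [hs.2]
    rcases lt_trichotomy s t with h | h | h
    · have := hv.le_of_le_left hz hs.1 h ht.2 hcirc
      rw [← ha] at this
      have := EReal.coe_le_coe_iff.1 this
      rw [le_div_iff₀ h1s] at this
      have h3 : a / (1 - t) * (1 - s) ≤ ℓ := by
        rw [div_mul_eq_mul_div, div_le_iff₀ h1t]; exact this
      linarith
    · subst h
      rw [← ha] at hℓ1
      have := EReal.coe_le_coe_iff.1 hℓ1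
      have h4 : -(a / (1 - s)) * (1 - s) = -a := by field_simp
      linarith
    · have := hv.le_of_le_right hz hs.2 h ht.1 hcirc
      rw [← ha] at this
      have := EReal.coe_le_coe_iff.1 this
      rw [le_div_iff₀ hs0] at this
      have h3 : a / t * s ≤ ℓ := by
        rw [div_mul_eq_mul_div, div_le_iff₀ ht0]; exact this
      linarith

end GeodesicBounds

section GeodesicEnvelope

variable {n : ℕ} {Ω : Set (Cn n)} {u0 u1 v : Cn n → EReal}

lemma geodesic_le {t : ℝ} {z : Cn n} {c : EReal}
    (h : ∀ u ∈ geodClass n Ω u0 u1, u (z, ((Real.exp t : ℝ) : ℂ)) ≤ c) :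
    geodesic n Ω u0 u1 t z ≤ c :=
  iSup₂_le h

lemma geodesic_le_one_sub_mul_gp (hΩ : IsOpen Ω) (hu0 : ∀ z ∈ Ω, u0 z ≤ 0)
    {z : Cn n} (hz : z ∈ Ω) {t c : ℝ} (ht : t ∈ Set.Ioo (0:ℝ) 1) (hc : gp u1 Ω z ≤ c) :
    geodesic n Ω u0 u1 t z ≤ (((1 - t) * c : ℝ) : EReal) :=
  geodesic_le fun _ hu => le_one_sub_mul_gp hΩ hu hu0 hz ht hc

lemma geodesic_le_mul_gp (hΩ : IsOpen Ω) (hu1 : ∀ z ∈ Ω, u1 z ≤ 0)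
    {z : Cn n} (hz : z ∈ Ω) {t c : ℝ} (ht : t ∈ Set.Ioo (0:ℝ) 1) (hc : gp u0 Ω z ≤ c) :
    geodesic n Ω u0 u1 t z ≤ ((t * c : ℝ) : EReal) :=
  geodesic_le fun _ hu => le_mul_gp hΩ hu hu1 hz ht hc

lemma geodesic_le_one_sub_mul (hu1 : ∀ z ∈ Ω, u1 z ≤ 0)
    {z : Cn n} (hz : z ∈ Ω) {t c : ℝ} (ht : t ∈ Set.Ioo (0:ℝ) 1) (hc : u0 z ≤ c) :
    geodesic n Ω u0 u1 t z ≤ (((1 - t) * c : ℝ) : EReal) :=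
  geodesic_le fun _ hu => by
    have := le_of_mem_geodClass hu hz hc (c₁ := 0) (hu1 z hz) (exp_mem_annA.2 ht)
    rwa [norm_exp_ofReal, Real.log_exp, mul_zero, add_zero] at this

lemma geodesic_le_mul (hu0 : ∀ z ∈ Ω, u0 z ≤ 0)
    {z : Cn n} (hz : z ∈ Ω) {t c : ℝ} (ht : t ∈ Set.Ioo (0:ℝ) 1) (hc : u1 z ≤ c) :
    geodesic n Ω u0 u1 t z ≤ ((t * c : ℝ) : EReal) :=
  geodesic_le fun _ hu => by
    have := le_of_mem_geodClass hu hz (c₀ := 0) (hu0 z hz) hc (exp_mem_annA.2 ht)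
    rwa [norm_exp_ofReal, Real.log_exp, mul_zero, zero_add] at this

lemma continuousOn_log_norm_annA : ContinuousOn (fun ζ : ℂ => Real.log ‖ζ‖) annA :=
  continuous_norm.continuousOn.log fun _ hξ => (zero_lt_one.trans hξ.1).ne'

lemma limsup_add_log_le {x y : EReal} {a b s : ℝ} (h : x + ((a * s + b : ℝ) : EReal) ≤ y) :
    Filter.limsup (fun ζ : ℂ => x + ((a * Real.log ‖ζ‖ + b : ℝ) : EReal))
      ((nhds (Real.exp s)).comap (fun ζ : ℂ => ‖ζ‖) ⊓ Filter.principal annA) ≤ y := by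
  have h1 : Tendsto (fun r : ℝ => x + ((a * Real.log r + b : ℝ) : EReal)) (𝓝 (Real.exp s))
      (𝓝 (x + ((a * s + b : ℝ) : EReal))) := by
    have h2 : ContinuousAt (fun r : ℝ => ((a * Real.log r + b : ℝ) : EReal)) (Real.exp s) := by
      refine continuous_coe_real_ereal.continuousAt.comp ?_
      have := Real.continuousAt_log (Real.exp_pos s).ne'
      fun_prop
    have h3 : Tendsto (fun y : EReal => x + y) (𝓝 ((a * Real.log (Real.exp s) + b : ℝ) : EReal))
        (𝓝 (x + ((a * Real.log (Real.exp s) + b : ℝ) : EReal))) := by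
      refine (EReal.continuousAt_add (p := (x, ((a * Real.log (Real.exp s) + b : ℝ) : EReal)))
        (Or.inr (EReal.coe_ne_bot _)) (Or.inr (EReal.coe_ne_top _))).tendsto.comp
        (Continuous.tendsto (by fun_prop) _)
    have := h3.comp h2
    rwa [Real.log_exp] at this
  have h4 : Tendsto (fun ζ : ℂ => x + ((a * Real.log ‖ζ‖ + b : ℝ) : EReal))
      ((nhds (Real.exp s)).comap (fun ζ : ℂ => ‖ζ‖) ⊓ Filter.principal annA)
      (𝓝 (x + ((a * s + b : ℝ) : EReal))) := (h1.comp tendsto_comap).mono_left inf_le_left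
  refine le_trans ?_ h
  refine le_of_forall_gt fun c hc => ?_
  obtain ⟨d, hd1, hd2⟩ := exists_between hc
  refine lt_of_le_of_lt (limsup_le_of_le (by isBoundedDefault) ?_) hd2
  exact (h4.eventually (gt_mem_nhds hd1)).mono fun _ h => h.le

lemma le_geodesic (hv : PSHNeg v Ω) {a b : ℝ} (hb : b ≤ 0) (hab : a + b ≤ 0)
    (h0 : ∀ z ∈ Ω, v z + (b : EReal) ≤ u0 z) (h1 : ∀ z ∈ Ω, v z + ((a + b : ℝ) : EReal) ≤ u1 z)
    {z : Cn n} {t : ℝ} :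
    v z + ((a * t + b : ℝ) : EReal) ≤ geodesic n Ω u0 u1 t z := by
  have key : (fun x : Cn n × ℂ => v x.1 + ((a * Real.log ‖x.2‖ + b : ℝ) : EReal)) ∈
      geodClass n Ω u0 u1 := by
    refine ⟨⟨?_, fun x hx => ?_⟩, fun z hz => ?_, fun z hz => ?_⟩
    · have hv' : PlurisubharmonicOn (fun x : Cn n × ℂ => v x.1) (Ω ×ˢ annA) := by
        refine ⟨hv.1.1.comp continuousOn_fst fun x hx => hx.1,
          fun x y r hr hd p hp ζ hζ => ?_⟩
        exact hv.1.2 x.1 y.1 r hr (fun ξ hξ => (hd ξ hξ).1) p hp ζ hζ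
      refine hv'.add_coe (H := fun x : Cn n × ℂ => a * Real.log ‖x.2‖ + b) ?_
        fun x y r hr hd => ?_
      · have := continuousOn_log_norm_annA.comp (continuousOn_snd (s := Ω ×ˢ annA))
          fun x hx => hx.2
        exact (continuousOn_const.mul this).add continuousOn_const
      · have h3 : ReApprox (fun ζ => Real.log ‖x.2 + ζ * y.2‖) r := ReApprox.log_norm hr.le
          fun ξ hξ => norm_pos_iff.1 (zero_lt_one.trans (hd ξ hξ).2.1)
        exact (h3.const_mul a).add (ReApprox.const b r)
    · refine add_nonpos (hv.2 _ hx.1) (EReal.coe_le_coe_iff.2 ?_)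
      have := mem_annA_iff_log.1 hx.2
      nlinarith [this.1, this.2]
    · have := limsup_add_log_le (x := v z) (y := u0 z) (a := a) (b := b) (s := 0)
        (by rw [mul_zero, zero_add]; exact h0 z hz)
      rwa [Real.exp_zero] at this
    · have := limsup_add_log_le (x := v z) (y := u1 z) (a := a) (b := b) (s := 1)
        (by rw [mul_one]; exact h1 z hz)
      exact this
  have := le_iSup₂ (f := fun (u : Cn n × ℂ → EReal) (_ : u ∈ geodClass n Ω u0 u1) =>
    u (z, ((Real.exp t : ℝ) : ℂ))) _ key
  simp only [norm_exp_ofReal, Real.log_exp] at this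
  exact this

end GeodesicEnvelope

section BallMean

variable {E : Type*} [NormedAddCommGroup E] [NormedSpace ℂ E] [NormedSpace ℝ E]
  [IsScalarTower ℝ ℂ E] [FiniteDimensional ℝ E] [MeasurableSpace E] [BorelSpace E]
  {μ : Measure E} [μ.IsAddHaarMeasure] {Ω : Set E} {u v : E → EReal}

lemma integral_indicator_closedBall_comp (V : E → ℝ) (x : E) {r : ℝ} (hr : 0 < r) :
    ∫ y, (Metric.closedBall (0:E) 1).indicator (fun _ => (1:ℝ)) y * V (x + (r : ℂ) • y) ∂μ =
      (r ^ Module.finrank ℝ E)⁻¹ * ∫ y in Metric.closedBall x r, V y ∂μ := by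
  have h1 : ∀ y : E, (Metric.closedBall (0:E) 1).indicator (fun _ => (1:ℝ)) y * V (x + (r : ℂ) • y)
      = (fun w => (Metric.closedBall x r).indicator V (x + w)) (r • y) := by
    intro y
    have hy : (r : ℂ) • y = r • y := algebraMap_smul ℂ r y
    have hiff : x + r • y ∈ Metric.closedBall x r ↔ y ∈ Metric.closedBall (0:E) 1 := by
      simp [norm_smul, abs_of_pos hr, hr]
    simp only [hy]
    by_cases h : y ∈ Metric.closedBall (0:E) 1
    · rw [Set.indicator_of_mem h, Set.indicator_of_mem (hiff.2 h), one_mul]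
    · rw [Set.indicator_of_notMem h, Set.indicator_of_notMem (mt hiff.1 h), zero_mul]
  simp_rw [h1]
  rw [Measure.integral_comp_smul_of_nonneg μ
      (fun w => (Metric.closedBall x r).indicator V (x + w)) r (hR := hr.le),
    integral_add_left_eq_self (fun w => (Metric.closedBall x r).indicator V w),
    integral_indicator measurableSet_closedBall, smul_eq_mul]

lemma kAvg_ballKernel (V : E → ℝ) (x : E) {r : ℝ} (hr : 0 < r) :
    kAvg μ (ballKernel μ) V r x =
      (μ.real (Metric.closedBall x r))⁻¹ * ∫ y in Metric.closedBall x r, V y ∂μ := by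
  have h1 := integral_indicator_closedBall_comp (μ := μ) V x hr
  have h2 := integral_indicator_closedBall_comp (μ := μ) (fun _ => (1:ℝ)) x hr
  simp only [mul_one, integral_const, smul_eq_mul, measureReal_restrict_apply_univ] at h2
  simp only [kAvg, ballKernel, mul_assoc]
  rw [integral_const_mul, h1, h2, mul_inv, inv_inv, ← mul_assoc]
  congr 1
  have : (r ^ Module.finrank ℝ E) ≠ 0 := by positivity
  field_simp

/-- The supremum over the levels of truncation of the integrals of `-u`, i.e. the integral of
`-u` over `S`. -/
def negIntegral (μ : Measure E) (Ω : Set E) (u : E → EReal) (S : Set E) : ℝ≥0∞ :=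
  ⨆ N : ℕ, ∫⁻ z in S, ENNReal.ofReal (-(trunc Ω u N z)) ∂μ

lemma negIntegral_mono {S T : Set E} (h : S ⊆ T) : negIntegral μ Ω u S ≤ negIntegral μ Ω u T :=
  iSup_mono fun _ => lintegral_mono_set h

lemma negIntegral_union_le (S T : Set E) :
    negIntegral μ Ω u (S ∪ T) ≤ negIntegral μ Ω u S + negIntegral μ Ω u T :=
  iSup_le fun N => (lintegral_union_le _ S T).trans (add_le_add
    (le_iSup (fun N : ℕ => ∫⁻ z in S, ENNReal.ofReal (-(trunc Ω u N z)) ∂μ) N)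
    (le_iSup (fun N : ℕ => ∫⁻ z in T, ENNReal.ofReal (-(trunc Ω u N z)) ∂μ) N))

lemma negIntegral_anti (hv0 : ∀ z ∈ Ω, v z ≤ 0) (h : ∀ z ∈ Ω, u z ≤ v z) (S : Set E) :
    negIntegral μ Ω v S ≤ negIntegral μ Ω u S := by
  refine iSup_mono fun N => lintegral_mono fun z => ENNReal.ofReal_le_ofReal (neg_le_neg ?_)
  by_cases hz : z ∈ Ω
  · rw [← EReal.coe_le_coe_iff, coe_trunc hv0 hz,
      coe_trunc (fun z hz => (h z hz).trans (hv0 z hz)) hz]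
    exact max_le_max (h z hz) le_rfl
  · rw [trunc, if_neg hz, trunc, if_neg hz]

lemma PSHNeg.trunc_le_mean (hu : PSHNeg u Ω) (hΩ : IsOpen Ω) {x : E} {r : ℝ} (hr : 0 < r)
    (hx : Metric.closedBall x r ⊆ Ω) {N : ℝ} (hN : 0 ≤ N) :
    trunc Ω u N x ≤
      (μ.real (Metric.closedBall x r))⁻¹ * ∫ y in Metric.closedBall x r, trunc Ω u N y ∂μ := by
  rw [← kAvg_ballKernel _ _ hr]
  exact le_kAvg (circledKernel_ballKernel μ) (hu.plurisubharmonicOn_trunc N)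
    (measurable_trunc hΩ hu.1.1 N) (abs_trunc_le hu.2 hN) hr.le hx

lemma PSHNeg.integrableOn_trunc (hu : PSHNeg u Ω) (hΩ : IsOpen Ω) {N : ℝ} (hN : 0 ≤ N) {K : Set E}
    (hK : IsCompact K) : IntegrableOn (trunc Ω u N) K μ :=
  (locallyIntegrable_of_abs_le (measurable_trunc hΩ hu.1.1 N)
    (abs_trunc_le hu.2 hN)).integrableOn_isCompact hK

lemma measureReal_closedBall_pos (x : E) {r : ℝ} (hr : 0 < r) :
    0 < μ.real (Metric.closedBall x r) :=
  ENNReal.toReal_pos (Metric.measure_closedBall_pos μ x hr).ne' measure_closedBall_lt_top.ne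

lemma PSHNeg.negIntegral_closedBall_le (hu : PSHNeg u Ω) (hΩ : IsOpen Ω) {x : E} {r : ℝ}
    (hr : 0 < r) (hx : Metric.closedBall x r ⊆ Ω) {c : ℝ} (hc : (-c : ℝ) ≤ u x) :
    negIntegral μ Ω u (Metric.closedBall x r) ≤
      ENNReal.ofReal (μ.real (Metric.closedBall x r) * c) := by
  refine iSup_le fun N => ?_
  have hN : (0:ℝ) ≤ N := N.cast_nonneg
  have hi : IntegrableOn (fun z => -trunc Ω u N z) (Metric.closedBall x r) μ :=
    (hu.integrableOn_trunc hΩ hN (isCompact_closedBall _ _)).neg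
  rw [← ofReal_integral_eq_lintegral_ofReal hi
    (ae_of_all _ fun z => neg_nonneg.2 (trunc_nonpos hu.2 hN z))]
  refine ENNReal.ofReal_le_ofReal ?_
  have h1 := hu.trunc_le_mean (μ := μ) hΩ hr hx hN
  have h2 := measureReal_closedBall_pos (μ := μ) x hr
  rw [← div_eq_inv_mul, le_div_iff₀ h2] at h1
  have h3 := EReal.coe_le_coe_iff.1 (hc.trans (le_trunc hu.2 (N := N)
    (hx (Metric.mem_closedBall_self hr.le))))
  rw [integral_neg]
  nlinarith

lemma PSHNeg.le_of_ae_le (hu : PSHNeg u Ω) (hΩ : IsOpen Ω) {x : E} {r : ℝ}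
    (hr : 0 < r) (hx : Metric.closedBall x r ⊆ Ω) {c : ℝ}
    (hc : ∀ᵐ z ∂(μ.restrict (Metric.closedBall x r)), u z ≤ c) : u x ≤ c := by
  obtain ⟨N, hN⟩ := exists_nat_gt (-c)
  have hN0 : (0:ℝ) ≤ N := N.cast_nonneg
  refine (le_trunc hu.2 (N := N) (hx (Metric.mem_closedBall_self hr.le))).trans
    (EReal.coe_le_coe_iff.2 ?_)
  refine (hu.trunc_le_mean (μ := μ) hΩ hr hx hN0).trans ?_
  have h2 := measureReal_closedBall_pos (μ := μ) x hr
  rw [← div_eq_inv_mul, div_le_iff₀ h2]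
  have : ∫ y in Metric.closedBall x r, trunc Ω u N y ∂μ ≤ ∫ y in Metric.closedBall x r, c ∂μ := by
    refine integral_mono_ae (hu.integrableOn_trunc hΩ hN0 (isCompact_closedBall _ _))
      (integrableOn_const (measure_closedBall_lt_top (μ := μ)).ne) ?_
    filter_upwards [hc, ae_restrict_mem measurableSet_closedBall] with z h1 h2
    rw [← EReal.coe_le_coe_iff, coe_trunc hu.2 (hx h2)]
    exact max_le h1 (EReal.coe_le_coe_iff.2 (by linarith))
  refine this.trans (le_of_eq ?_)
  rw [setIntegral_const, smul_eq_mul, mul_comm]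

/-- Chebyshev's inequality for negative plurisubharmonic functions. -/
lemma PSHNeg.measure_lt_le (hu : PSHNeg u Ω) (hΩ : IsOpen Ω) {K : Set E} (hK : K ⊆ Ω)
    {η : ℝ} (hη : 0 < η) :
    μ {z | z ∈ K ∧ u z < (-η : ℝ)} ≤ negIntegral μ Ω u K / ENNReal.ofReal η := by
  obtain ⟨N, hN⟩ := exists_nat_gt η
  have h1 : {z | z ∈ K ∧ u z < (-η : ℝ)} ⊆
      {z | ENNReal.ofReal η ≤ ENNReal.ofReal (-(trunc Ω u N z))} ∩ K := by
    rintro z ⟨hz, hz'⟩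
    refine ⟨ENNReal.ofReal_le_ofReal ?_, hz⟩
    have : trunc Ω u N z ≤ -η := by
      rw [← EReal.coe_le_coe_iff, coe_trunc hu.2 (hK hz)]
      exact max_le hz'.le (EReal.coe_le_coe_iff.2 (by linarith))
    linarith
  have hm : Measurable fun z => ENNReal.ofReal (-(trunc Ω u N z)) :=
    (measurable_trunc hΩ hu.1.1 N).neg.ennreal_ofReal
  refine (measure_mono h1).trans ?_
  rw [← Measure.restrict_apply (measurableSet_le measurable_const hm)]
  refine (meas_ge_le_lintegral_div hm.aemeasurable (by simpa using hη)
    ENNReal.ofReal_ne_top).trans ?_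
  exact ENNReal.div_le_div_right (le_iSup (fun N : ℕ =>
    ∫⁻ z in K, ENNReal.ofReal (-(trunc Ω u N z)) ∂μ) N) _

end BallMean

section GpClass

variable {E : Type*} [NormedAddCommGroup E] [NormedSpace ℂ E] [NormedSpace ℝ E]
  [IsScalarTower ℝ ℂ E] [FiniteDimensional ℝ E] [MeasurableSpace E] [BorelSpace E]
  {μ : Measure E} [μ.IsAddHaarMeasure] {Ω : Set E} {u v w : E → EReal}

/-- Negative psh functions on `Ω` bounded above by `φ` plus a constant. -/
def gpClass (φ : E → EReal) (Ω : Set E) : Set (E → EReal) :=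
  {w : E → EReal | PSHNeg w Ω ∧ ∃ C : ℝ, ∀ x ∈ Ω, w x ≤ φ x + (C : EReal)}

lemma exists_mem_gpClass_closedBall (hΩ : IsOpen Ω) (hw : Set.EqOn (gp w Ω) 0 Ω) {x : E}
    (hx : x ∈ Ω) : ∃ r > 0, ∀ η : ℝ, 0 < η → ∃ v ∈ gpClass w Ω,
      negIntegral μ Ω v (Metric.closedBall x r) ≤ ENNReal.ofReal η := by
  obtain ⟨R, hR, hRΩ⟩ := Metric.nhds_basis_closedBall.mem_iff.1 (hΩ.mem_nhds hx)
  set r := R / 3 with hr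
  have hr0 : 0 < r := by positivity
  refine ⟨r, hr0, fun η hη => ?_⟩
  set V := μ.real (Metric.closedBall x (2 * r)) with hV
  have hV0 : 0 < V := measureReal_closedBall_pos x (by positivity)
  have h1 : ((-(η / V) : ℝ) : EReal) < limsup (fun z => ⨆ v ∈ gpClass w Ω, v z) (𝓝[Ω] x) := by
    have h2 : limsup (fun z => ⨆ v ∈ gpClass w Ω, v z) (𝓝[Ω] x) = 0 := hw hx
    rw [h2, ← EReal.coe_zero, EReal.coe_lt_coe_iff]
    have : 0 < η / V := by positivity
    linarith
  have h2 := frequently_lt_of_lt_limsup (by isBoundedDefault) h1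
  have h3 : ∀ᶠ y in 𝓝[Ω] x, y ∈ Metric.ball x r ∧ y ∈ Ω :=
    (eventually_mem_set.2 (mem_nhdsWithin_of_mem_nhds (Metric.ball_mem_nhds x hr0))).and
      self_mem_nhdsWithin
  obtain ⟨y, hy, hyr, hyΩ⟩ := (h2.and_eventually h3).exists
  simp only [lt_iSup_iff] at hy
  obtain ⟨v, hv, hvy⟩ := hy
  refine ⟨v, hv, ?_⟩
  rw [Metric.mem_ball] at hyr
  have hsub : Metric.closedBall y (2 * r) ⊆ Ω :=
    (Metric.closedBall_subset_closedBall' (by linarith)).trans hRΩ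
  refine (negIntegral_mono (Metric.closedBall_subset_closedBall'
    (by rw [dist_comm] at hyr; linarith) : Metric.closedBall x r ⊆ Metric.closedBall y (2 * r))).trans ?_
  refine (hv.1.negIntegral_closedBall_le hΩ (by positivity) hsub hvy.le).trans
    (ENNReal.ofReal_le_ofReal (le_of_eq ?_))
  have : μ.real (Metric.closedBall y (2 * r)) = V := by
    rw [hV, measureReal_def, measureReal_def, Measure.addHaar_closedBall_center,
      ← Measure.addHaar_closedBall_center μ x]
  rw [this]
  field_simp

lemma max_mem_gpClass {v₁ v₂ : E → EReal} (h₁ : v₁ ∈ gpClass w Ω) (h₂ : v₂ ∈ gpClass w Ω) :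
    (fun z => max (v₁ z) (v₂ z)) ∈ gpClass w Ω := by
  obtain ⟨h1, C1, hC1⟩ := h₁
  obtain ⟨h2, C2, hC2⟩ := h₂
  refine ⟨h1.max h2, max C1 C2, fun x hx => max_le ((hC1 x hx).trans ?_) ((hC2 x hx).trans ?_)⟩
  · exact add_le_add le_rfl (EReal.coe_le_coe_iff.2 (le_max_left _ _))
  · exact add_le_add le_rfl (EReal.coe_le_coe_iff.2 (le_max_right _ _))

lemma bot_mem_gpClass (w : E → EReal) (Ω : Set E) : (fun _ => ⊥) ∈ gpClass w Ω :=
  ⟨⟨⟨fun _ _ _ h => Eventually.of_forall fun _ => h, fun _ _ _ _ _ _ _ _ _ => bot_le⟩,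
    fun _ _ => bot_le⟩, 0, fun _ _ => bot_le⟩

lemma exists_mem_gpClass_negIntegral_le (hΩ : IsOpen Ω) (hw : Set.EqOn (gp w Ω) 0 Ω) {K : Set E}
    (hK : IsCompact K) (hKΩ : K ⊆ Ω) {η : ℝ} (hη : 0 < η) :
    ∃ v ∈ gpClass w Ω, negIntegral μ Ω v K ≤ ENNReal.ofReal η := by
  suffices h : ∀ η : ℝ, 0 < η → ∃ v ∈ gpClass w Ω, negIntegral μ Ω v K ≤ ENNReal.ofReal η from
    h η hη
  refine hK.induction_on (p := fun K => ∀ η : ℝ, 0 < η → ∃ v ∈ gpClass w Ω,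
    negIntegral μ Ω v K ≤ ENNReal.ofReal η) ?_ ?_ ?_ ?_
  · exact fun η _ => ⟨_, bot_mem_gpClass w Ω, by simp [negIntegral]⟩
  · intro s t hst ht η hη
    obtain ⟨v, hv, h⟩ := ht η hη
    exact ⟨v, hv, (negIntegral_mono hst).trans h⟩
  · intro s t hs ht η hη
    obtain ⟨v₁, hv₁, h₁⟩ := hs (η / 2) (half_pos hη)
    obtain ⟨v₂, hv₂, h₂⟩ := ht (η / 2) (half_pos hη)
    have hm := max_mem_gpClass hv₁ hv₂
    refine ⟨_, hm, (negIntegral_union_le s t).trans ?_⟩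
    rw [← add_halves η, ENNReal.ofReal_add (half_pos hη).le (half_pos hη).le]
    exact add_le_add ((negIntegral_anti hm.1.2 (fun z _ => le_max_left _ _) s).trans h₁)
      ((negIntegral_anti hm.1.2 (fun z _ => le_max_right _ _) t).trans h₂)
  · intro x hx
    obtain ⟨r, hr, h⟩ := exists_mem_gpClass_closedBall (μ := μ) hΩ hw (hKΩ hx)
    exact ⟨_, mem_nhdsWithin_of_mem_nhds (Metric.closedBall_mem_nhds x hr), h⟩

lemma PSHNeg.negIntegral_lt_top (hv : PSHNeg v Ω) (hΩ : IsOpen Ω) (hc : IsConnected Ω)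
    (hne : ∃ z ∈ Ω, v z ≠ ⊥) {K : Set E} (hK : IsCompact K) (hKΩ : K ⊆ Ω) :
    negIntegral μ Ω v K < ⊤ := by
  set T : Set E := {x | ∃ r > 0, negIntegral μ Ω v (Metric.closedBall x r) < ⊤} with hT
  have hTo : IsOpen T := by
    refine isOpen_iff_mem_nhds.2 fun x ⟨r, hr, hx⟩ => ?_
    filter_upwards [Metric.ball_mem_nhds x (half_pos hr)] with y hy
    refine ⟨r / 2, half_pos hr, (negIntegral_mono ?_).trans_lt hx⟩
    rw [Metric.mem_ball] at hy
    exact Metric.closedBall_subset_closedBall' (by linarith)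
  have hpt : ∀ x ∈ Ω, v x ≠ ⊥ → ∀ r > 0, Metric.closedBall x r ⊆ Ω →
      negIntegral μ Ω v (Metric.closedBall x r) < ⊤ := by
    intro x hx hvx r hr hr'
    have h2 : ((-(-(v x).toReal) : ℝ) : EReal) ≤ v x := by
      rw [neg_neg, EReal.coe_toReal ((hv.2 x hx).trans_lt EReal.zero_lt_top).ne hvx]
    exact (hv.negIntegral_closedBall_le hΩ hr hr' h2).trans_lt ENNReal.ofReal_lt_top
  have hsub : Ω ⊆ T := by
    obtain ⟨z, hz, hvz⟩ := hne
    obtain ⟨R, hR, hRΩ⟩ := Metric.nhds_basis_closedBall.mem_iff.1 (hΩ.mem_nhds hz)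
    refine hc.isPreconnected.subset_of_closure_inter_subset hTo
      ⟨z, hz, R, hR, hpt z hz hvz R hR hRΩ⟩ ?_
    rintro x ⟨hxT, hx⟩
    obtain ⟨R, hR, hRΩ⟩ := Metric.nhds_basis_closedBall.mem_iff.1 (hΩ.mem_nhds hx)
    set r := R / 3 with hr
    have hr0 : 0 < r := by positivity
    -- a point near `x` in `Ω` where `v` is finite
    obtain ⟨y, hy, s, hs, hfin⟩ := Metric.mem_closure_iff.1 hxT r hr0 |>.imp fun y h =>
      And.intro h.2 h.1
    have hyΩ : y ∈ Ω := hRΩ (by rw [Metric.mem_closedBall, dist_comm]; linarith)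
    set s' := min s (r - dist x y) with hs'
    have hs'0 : 0 < s' := lt_min hs (by linarith)
    obtain ⟨y', hy', hne⟩ : ∃ y' ∈ Metric.closedBall y s', v y' ≠ ⊥ := by
      by_contra! hbot
      have hsub : ∀ z ∈ Metric.closedBall y s', z ∈ Ω := by
        intro z hz
        refine hRΩ ?_
        rw [Metric.mem_closedBall] at hz ⊢
        have := dist_triangle z y x
        have h1 : s' ≤ r - dist x y := min_le_right _ _
        rw [dist_comm y x] at this
        linarith
      have h1 : ∀ N : ℕ, (N : ℝ≥0∞) * μ (Metric.closedBall y s') ≤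
          negIntegral μ Ω v (Metric.closedBall y s) := by
        intro N
        have h2 : negIntegral μ Ω v (Metric.closedBall y s') ≤
          negIntegral μ Ω v (Metric.closedBall y s) := negIntegral_mono
            (Metric.closedBall_subset_closedBall (min_le_left _ _))
        refine le_trans ?_ h2
        refine le_trans (le_of_eq ?_) (le_iSup (fun N : ℕ =>
          ∫⁻ z in Metric.closedBall y s', ENNReal.ofReal (-(trunc Ω v N z)) ∂μ) N)
        rw [← setLIntegral_const]
        refine setLIntegral_congr_fun measurableSet_closedBall fun z hz => ?_
        have : trunc Ω v N z = -(N:ℝ) := by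
          rw [← EReal.coe_eq_coe_iff, coe_trunc hv.2 (hsub z hz), hbot z hz]
          simp
        simp [this]
      have hpos : 0 < μ (Metric.closedBall y s') := Metric.measure_closedBall_pos μ y hs'0
      obtain ⟨N, hN⟩ := ENNReal.exists_nat_mul_gt hpos.ne' hfin.ne
      exact absurd (h1 N) (not_le.2 hN)
    rw [Metric.mem_closedBall] at hy'
    have h1 : s' ≤ r - dist x y := min_le_right _ _
    have hd : dist y' x ≤ r := by
      have := dist_triangle y' y x
      rw [dist_comm y x] at this
      linarith
    have hy'Ω : y' ∈ Ω := hRΩ (by rw [Metric.mem_closedBall]; linarith)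
    refine ⟨r, hr0, (negIntegral_mono (Metric.closedBall_subset_closedBall' ?_)).trans_lt
      (hpt y' hy'Ω hne (2 * r) (by positivity)
        ((Metric.closedBall_subset_closedBall' (by linarith)).trans hRΩ))⟩
    rw [dist_comm]
    linarith
  refine hK.induction_on (p := fun K => negIntegral μ Ω v K < ⊤) ?_ ?_ ?_ ?_
  · simp [negIntegral]
  · exact fun s t hst ht => (negIntegral_mono hst).trans_lt ht
  · exact fun s t hs ht => (negIntegral_union_le s t).trans_lt (ENNReal.add_lt_top.2 ⟨hs, ht⟩)
  · intro x hx
    obtain ⟨r, hr, h⟩ := hsub (hKΩ hx)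
    exact ⟨_, mem_nhdsWithin_of_mem_nhds (Metric.closedBall_mem_nhds x hr), h⟩

end GpClass

section Idempotency

variable {E : Type*} [NormedAddCommGroup E] [NormedSpace ℂ E] [NormedSpace ℝ E]
  [IsScalarTower ℝ ℂ E] [FiniteDimensional ℝ E] [MeasurableSpace E] [BorelSpace E]
  {Ω : Set E} {u v w : E → EReal}

lemma eventually_uscReg_lt (f : E → EReal) {z : E} {c : EReal} (hc : uscReg f Ω z < c) :
    ∀ᶠ y in 𝓝[Ω] z, uscReg f Ω y < c := by
  obtain ⟨c', h1, h2⟩ := exists_between hc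
  have h3 : ∀ᶠ y in 𝓝[Ω] z, f y < c' := eventually_lt_of_limsup_lt h1 (by isBoundedDefault)
  filter_upwards [eventually_eventually_nhdsWithin.2 h3] with y hy
  refine lt_of_le_of_lt ?_ h2
  exact limsup_le_of_le (by isBoundedDefault) (hy.mono fun _ h => h.le)

lemma exists_closedBall_gp_lt (hΩ : IsOpen Ω) {z : E} (hz : z ∈ Ω) {c : ℝ} (hc : gp u Ω z < c) :
    ∃ r > 0, Metric.closedBall z r ⊆ Ω ∧ ∀ y ∈ Metric.closedBall z r, gp u Ω y < c := by
  have h := eventually_uscReg_lt _ hc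
  rw [hΩ.nhdsWithin_eq hz] at h
  obtain ⟨r, hr, h⟩ := Metric.nhds_basis_closedBall.mem_iff.1 (h.and (hΩ.mem_nhds hz))
  exact ⟨r, hr, fun y hy => (h hy).2, fun y hy => (h hy).1⟩

/-- A negative psh function dominated by `gp u` almost everywhere is dominated everywhere. -/
lemma PSHNeg.le_gp_of_ae (μ : Measure E) [μ.IsAddHaarMeasure] (hv : PSHNeg v Ω) (hΩ : IsOpen Ω)
    (h : ∀ z ∈ Ω, ∀ c : ℝ, ∀ η > 0, ∀ r > 0, Metric.closedBall z r ⊆ Ω →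
      (∀ y ∈ Metric.closedBall z r, gp u Ω y < c) →
      μ {y | y ∈ Metric.closedBall z r ∧ ((c + η : ℝ) : EReal) < v y} = 0) {z : E} (hz : z ∈ Ω) :
    v z ≤ gp u Ω z := by
  refine EReal.le_of_forall_lt_iff_le.1 fun c hc => ?_
  obtain ⟨r, hr, hrΩ, hr'⟩ := exists_closedBall_gp_lt hΩ hz hc
  refine EReal.le_coe_of_forall_pos_add fun η hη => ?_
  refine hv.le_of_ae_le (μ := μ) hΩ hr hrΩ ?_
  rw [ae_restrict_iff' measurableSet_closedBall, ae_iff]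
  convert h z hz c η hη r hr hrΩ hr' using 3 with y
  simp

lemma PSHNeg.le_gp_of_le_add (hv : PSHNeg v Ω) (hΩ : IsOpen Ω) (hw : Set.EqOn (gp w Ω) 0 Ω)
    (huw : ∀ z ∈ Ω, gp u Ω z + w z ≤ u z) {C : ℝ} (hC : ∀ z ∈ Ω, v z ≤ gp u Ω z + (C : EReal))
    {z : E} (hz : z ∈ Ω) : v z ≤ gp u Ω z := by
  let μ : Measure E := Measure.addHaar
  refine hv.le_gp_of_ae μ hΩ (fun z hz c η hη r hr hrΩ hgp => ?_) hz
  refine le_antisymm ?_ bot_le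
  refine ENNReal.le_of_forall_pos_le_add fun δ hδ _ => ?_
  rw [zero_add]
  obtain ⟨v', ⟨hv', C', hC'⟩, hle⟩ := exists_mem_gpClass_negIntegral_le (μ := μ) hΩ hw
    (isCompact_closedBall z r) hrΩ (mul_pos hη (NNReal.coe_pos.2 hδ))
  have hadd : ∀ y ∈ Ω, v y + v' y ≤ gp u Ω y := by
    intro y hy
    refine le_gp (hv.add hv') (C := C + C') (fun x hx => ?_) hy
    calc v x + v' x ≤ (gp u Ω x + (C : EReal)) + (w x + (C' : EReal)) :=
          add_le_add (hC x hx) (hC' x hx)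
      _ = (gp u Ω x + w x) + ((C + C' : ℝ) : EReal) := by
          rw [EReal.coe_add, add_add_add_comm]
      _ ≤ _ := add_le_add (huw x hx) le_rfl
  have hsub : {y | y ∈ Metric.closedBall z r ∧ ((c + η : ℝ) : EReal) < v y} ⊆
      {y | y ∈ Metric.closedBall z r ∧ v' y < ((-η : ℝ) : EReal)} := by
    rintro y ⟨hy, hyv⟩
    refine ⟨hy, ?_⟩
    by_contra! hcon
    have h1 := add_le_add hyv.le hcon
    rw [← EReal.coe_add] at h1
    have h2 := (h1.trans (hadd y (hrΩ hy))).trans_lt (hgp y hy)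
    rw [EReal.coe_lt_coe_iff] at h2
    linarith
  refine (measure_mono hsub).trans ((hv'.measure_lt_le hΩ hrΩ hη).trans ?_)
  refine (ENNReal.div_le_div_right hle _).trans (le_of_eq ?_)
  rw [ENNReal.ofReal_mul hη.le, mul_div_assoc, mul_comm, ENNReal.div_mul_cancel]
  · simp
  · simpa using hη
  · exact ENNReal.ofReal_ne_top

lemma PSHNeg.le_gp_of_le_mul (hv : PSHNeg v Ω)
    (hu : ∀ σ : ℝ, σ ∈ Set.Ioo (0 : ℝ) 1 →
        ∃ C : ℝ, ∀ z ∈ Ω, gp u Ω z ≤ (σ : EReal) * u z + (C : EReal))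
    {C : ℝ} (hC : ∀ z ∈ Ω, v z ≤ gp u Ω z + (C : EReal))
    {z : E} (hz : z ∈ Ω) : v z ≤ gp u Ω z := by
  have key : ∀ σ : ℝ, σ ∈ Set.Ioo (0:ℝ) 1 → ((σ⁻¹ : ℝ) : EReal) * v z ≤ gp u Ω z := by
    intro σ hσ
    obtain ⟨C', hC'⟩ := hu σ hσ
    refine le_gp (hv.const_mul (inv_pos.2 hσ.1)) (C := σ⁻¹ * (C' + C)) (fun x hx => ?_) hz
    have h1 : v x ≤ (σ : EReal) * u x + ((C' + C : ℝ) : EReal) := by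
      rw [EReal.coe_add, ← add_assoc]
      exact (hC x hx).trans (add_le_add (hC' x hx) le_rfl)
    have hs := inv_pos.2 hσ.1
    refine (EReal.monotone_coe_mul hs h1).trans (le_of_eq ?_)
    change ((σ⁻¹ : ℝ) : EReal) * ((σ : EReal) * u x + ((C' + C : ℝ) : EReal)) = _
    rw [EReal.left_distrib_of_nonneg_of_ne_top (EReal.coe_nonneg.2 hs.le) (EReal.coe_ne_top _),
      ← mul_assoc, ← EReal.coe_mul, ← EReal.coe_mul, inv_mul_cancel₀ hσ.1.ne', EReal.coe_one,
      one_mul]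
  refine EReal.le_of_forall_lt_iff_le.1 fun c hc => ?_
  have h2 : ∀ σ : ℝ, σ ∈ Set.Ioo (0:ℝ) 1 → v z ≤ ((σ * c : ℝ) : EReal) := by
    intro σ hσ
    have := (key σ hσ).trans hc.le
    rw [EReal.coe_mul_le_coe_iff (inv_pos.2 hσ.1), div_inv_eq_mul, mul_comm] at this
    exact this
  have hlim : Tendsto (fun σ : ℝ => ((σ * c : ℝ) : EReal)) (𝓝[<] 1) (𝓝 (c : EReal)) := by
    refine (continuous_coe_real_ereal.tendsto _).comp (tendsto_nhdsWithin_of_tendsto_nhds ?_)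
    simpa using (continuous_mul_const c).tendsto (1:ℝ)
  refine ge_of_tendsto hlim ?_
  filter_upwards [Ioo_mem_nhdsLT (zero_lt_one' ℝ)] with σ hσ using h2 σ hσ

/-- The three alternatives for the behaviour of `u` relative to its residual function. -/
def GpCond (u : E → EReal) (Ω : Set E) : Prop :=
  (∃ w : E → EReal, PSHNeg w Ω ∧ Set.EqOn (gp w Ω) 0 Ω ∧
        ∀ z ∈ Ω, gp u Ω z + w z ≤ u z) ∨
      Set.EqOn (gp u Ω) 0 Ω ∨
      (∀ σ : ℝ, σ ∈ Set.Ioo (0 : ℝ) 1 →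
        ∃ C : ℝ, ∀ z ∈ Ω, gp u Ω z ≤ (σ : EReal) * u z + (C : EReal))

lemma GpCond.cases (h : GpCond u Ω) (hu : PSHNeg u Ω) :
    (∃ w : E → EReal, PSHNeg w Ω ∧ Set.EqOn (gp w Ω) 0 Ω ∧ ∀ z ∈ Ω, gp u Ω z + w z ≤ u z) ∨
      (∀ σ : ℝ, σ ∈ Set.Ioo (0 : ℝ) 1 →
        ∃ C : ℝ, ∀ z ∈ Ω, gp u Ω z ≤ (σ : EReal) * u z + (C : EReal)) := by
  rcases h with h | h | h
  · exact Or.inl h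
  · exact Or.inl ⟨u, hu, h, fun z hz => by rw [h hz]; simp⟩
  · exact Or.inr h

lemma GpCond.le_gp (h : GpCond u Ω) (hu : PSHNeg u Ω) (hΩ : IsOpen Ω) (hv : PSHNeg v Ω)
    {C : ℝ} (hC : ∀ z ∈ Ω, v z ≤ gp u Ω z + (C : EReal)) {z : E} (hz : z ∈ Ω) :
    v z ≤ gp u Ω z := by
  rcases h.cases hu with ⟨w, hw, hw0, hle⟩ | h
  · exact hv.le_gp_of_le_add hΩ hw0 hle hC hz
  · exact hv.le_gp_of_le_mul h hC hz

lemma GpCond.gp_le_gp {u₀ : E → EReal} (h : GpCond u Ω) (hu : PSHNeg u Ω) (hΩ : IsOpen Ω)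
    (h0 : ∀ z ∈ Ω, u₀ z ≤ gp u Ω z) {z : E} (hz : z ∈ Ω) : gp u₀ Ω z ≤ gp u Ω z := by
  refine EReal.le_of_forall_lt_iff_le.1 fun c hc => ?_
  have hev := eventually_uscReg_lt _ hc
  have : (𝓝[Ω] z).NeBot := mem_closure_iff_nhdsWithin_neBot.1 (subset_closure hz)
  refine limsup_le_of_le (by isBoundedDefault) ?_
  filter_upwards [hev, self_mem_nhdsWithin] with x hx hxΩ
  refine le_trans (iSup₂_le fun v hv => ?_) hx.le
  obtain ⟨hv, C, hC⟩ := hv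
  exact h.le_gp hu hΩ hv (C := C) (fun y hy => (hC y hy).trans (add_le_add (h0 y hy) le_rfl)) hxΩ

lemma gp_eqOn_iff {u₀ u₁ : E → EReal} (hΩ : IsOpen Ω) (h0 : PSHNeg u₀ Ω) (h1 : PSHNeg u₁ Ω)
    (hc0 : GpCond u₀ Ω) (hc1 : GpCond u₁ Ω) :
    ((∀ z ∈ Ω, u₀ z ≤ gp u₁ Ω z) ∧ (∀ z ∈ Ω, u₁ z ≤ gp u₀ Ω z)) ↔
      Set.EqOn (gp u₀ Ω) (gp u₁ Ω) Ω := by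
  refine ⟨fun ⟨h, h'⟩ z hz => le_antisymm (hc1.gp_le_gp h1 hΩ h hz) (hc0.gp_le_gp h0 hΩ h' hz),
    fun h => ⟨fun z hz => ?_, fun z hz => ?_⟩⟩
  · exact h hz ▸ le_gp_self h0 hz
  · exact (h hz).symm ▸ le_gp_self h1 hz

end Idempotency

section MixedDiscriminant

open scoped ComplexOrder MatrixOrder

variable {n : ℕ}

/-- The mixed discriminant of `n` complex `n × n` matrices, normalised so that
`mixDet (fun _ => H) = n! * det H`. -/
def mixDet (H : Fin n → Matrix (Fin n) (Fin n) ℂ) : ℂ :=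
  ∑ σ : Equiv.Perm (Fin n), ∑ τ : Equiv.Perm (Fin n),
    ((Equiv.Perm.sign σ : ℤ) : ℂ) * ((Equiv.Perm.sign τ : ℤ) : ℂ) * ∏ i, H i (σ i) (τ i)

lemma mixDet_const (H : Matrix (Fin n) (Fin n) ℂ) :
    mixDet (fun _ => H) = (n.factorial : ℂ) * H.det := by
  have key : ∀ σ : Equiv.Perm (Fin n), ∑ τ : Equiv.Perm (Fin n),
      ((Equiv.Perm.sign σ : ℤ) : ℂ) * ((Equiv.Perm.sign τ : ℤ) : ℂ) * ∏ i, H (σ i) (τ i) =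
      H.det := by
    intro σ
    rw [← Matrix.det_transpose, Matrix.det_apply']
    refine Fintype.sum_equiv (Equiv.mulRight σ⁻¹) _ _ fun τ => ?_
    simp only [Equiv.coe_mulRight, Equiv.Perm.sign_mul, Equiv.Perm.sign_inv, Matrix.transpose_apply]
    rw [← Equiv.prod_comp σ (fun j => H j ((τ * σ⁻¹) j))]
    simp [Equiv.Perm.mul_apply, mul_comm]
  simp only [mixDet, key]
  simp [Fintype.card_perm]

lemma prod_update_apply (H : Fin n → Matrix (Fin n) (Fin n) ℂ) (i : Fin n)
    (A : Matrix (Fin n) (Fin n) ℂ) (σ τ : Equiv.Perm (Fin n)) :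
    ∏ j, Function.update H i A j (σ j) (τ j) =
      A (σ i) (τ i) * ∏ j ∈ Finset.univ.erase i, H j (σ j) (τ j) := by
  rw [← Finset.mul_prod_erase _ _ (Finset.mem_univ i), Function.update_self]
  congr 1
  refine Finset.prod_congr rfl fun j hj => ?_
  rw [Function.update_of_ne (Finset.ne_of_mem_erase hj)]

lemma mixDet_update_add (H : Fin n → Matrix (Fin n) (Fin n) ℂ) (i : Fin n)
    (A B : Matrix (Fin n) (Fin n) ℂ) :
    mixDet (Function.update H i (A + B)) =
      mixDet (Function.update H i A) + mixDet (Function.update H i B) := by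
  simp only [mixDet, prod_update_apply, Matrix.add_apply, ← Finset.sum_add_distrib]
  refine Finset.sum_congr rfl fun σ _ => Finset.sum_congr rfl fun τ _ => ?_
  ring

lemma mixDet_update_smul (H : Fin n → Matrix (Fin n) (Fin n) ℂ) (i : Fin n) (c : ℂ)
    (A : Matrix (Fin n) (Fin n) ℂ) :
    mixDet (Function.update H i (c • A)) = c * mixDet (Function.update H i A) := by
  simp only [mixDet, prod_update_apply, Matrix.smul_apply, Finset.mul_sum, smul_eq_mul]
  refine Finset.sum_congr rfl fun σ _ => Finset.sum_congr rfl fun τ _ => ?_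
  ring

lemma mixDet_conjTranspose_mul_self (B : Fin n → Matrix (Fin n) (Fin n) ℂ) :
    mixDet (fun i => (B i).conjTranspose * B i) =
      ∑ m : Fin n → Fin n, star (Matrix.det (Matrix.of fun i j => B i (m i) j)) *
        Matrix.det (Matrix.of fun i j => B i (m i) j) := by
  have h1 : ∀ σ τ : Equiv.Perm (Fin n), ∏ i, ((B i).conjTranspose * B i) (σ i) (τ i) =
      ∑ m : Fin n → Fin n, ∏ i, (star (B i (m i) (σ i)) * B i (m i) (τ i)) := by
    intro σ τ
    simp only [Matrix.mul_apply, Matrix.conjTranspose_apply]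
    rw [Finset.prod_univ_sum]
    rfl
  have h2 : ∀ m : Fin n → Fin n, Matrix.det (Matrix.of fun i j => B i (m i) j) =
      ∑ σ : Equiv.Perm (Fin n), ((Equiv.Perm.sign σ : ℤ) : ℂ) * ∏ i, B i (m i) (σ i) := by
    intro m
    rw [← Matrix.det_transpose, Matrix.det_apply']
    rfl
  simp only [mixDet, h1, h2, star_sum, Finset.sum_mul_sum]
  simp only [Finset.mul_sum]
  have h3 : ∀ f : Equiv.Perm (Fin n) → Equiv.Perm (Fin n) → (Fin n → Fin n) → ℂ,
      ∑ σ, ∑ τ, ∑ m, f σ τ m = ∑ m, ∑ σ, ∑ τ, f σ τ m := by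
    intro f
    rw [Finset.sum_comm (s := (Finset.univ : Finset (Fin n → Fin n)))]
    refine Finset.sum_congr rfl fun σ _ => ?_
    rw [Finset.sum_comm]
  rw [h3]
  refine Finset.sum_congr rfl fun m _ => Finset.sum_congr rfl fun σ _ =>
    Finset.sum_congr rfl fun τ _ => ?_
  rw [Finset.prod_mul_distrib, star_mul', star_prod]
  simp only [star_intCast]
  ring

lemma mixDet_nonneg {H : Fin n → Matrix (Fin n) (Fin n) ℂ} (hH : ∀ i, (H i).PosSemidef) :
    0 ≤ mixDet H := by
  choose B hB using fun i =>
    CStarAlgebra.nonneg_iff_eq_star_mul_self.1 (hH i).nonneg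
  have : H = fun i => (B i).conjTranspose * B i := funext hB
  rw [this, mixDet_conjTranspose_mul_self]
  exact Finset.sum_nonneg fun m _ => star_mul_self_nonneg _

end MixedDiscriminant

section ComplexDerivatives

open scoped ContDiff

variable {E : Type*} [NormedAddCommGroup E] [NormedSpace ℝ E]

/-- The derivative of a complex-valued function along the complexified vector `v + i w`. -/
def cD (v w : E) (F : E → ℂ) (x : E) : ℂ := fderiv ℝ F x v + Complex.I * fderiv ℝ F x w

variable {v w v' w' : E} {F G : E → ℂ} {x : E}

lemma contDiff_cD (hF : ContDiff ℝ ∞ F) : ContDiff ℝ ∞ (cD v w F) := by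
  have h : ContDiff ℝ ∞ (fderiv ℝ F) := hF.fderiv_right (by simp)
  exact (h.clm_apply contDiff_const).add (contDiff_const.mul (h.clm_apply contDiff_const))

lemma ContDiff.differentiableAt_top (hF : ContDiff ℝ ∞ F) : DifferentiableAt ℝ F x :=
  (hF.differentiable (by simp)) x

lemma cD_mul (hF : ContDiff ℝ ∞ F) (hG : ContDiff ℝ ∞ G) :
    cD v w (fun y => F y * G y) x = cD v w F x * G x + F x * cD v w G x := by
  simp only [cD]
  rw [fderiv_fun_mul hF.differentiableAt_top hG.differentiableAt_top]
  simp
  ring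

lemma cD_finsetProd {ι : Type*} [DecidableEq ι] {s : Finset ι} {f : ι → E → ℂ}
    (hf : ∀ i, ContDiff ℝ ∞ (f i)) :
    cD v w (fun y => ∏ i ∈ s, f i y) x = ∑ i ∈ s, cD v w (f i) x * ∏ j ∈ s.erase i, f j x := by
  simp only [cD]
  rw [fderiv_finsetProd fun i _ => (hf i).differentiableAt_top]
  simp only [sum_apply, smul_apply, smul_eq_mul,
    Finset.mul_sum, ← Finset.sum_add_distrib]
  refine Finset.sum_congr rfl fun i _ => ?_
  ring

lemma fderiv_cD_apply (hF : ContDiff ℝ ∞ F) (a : E) :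
    fderiv ℝ (cD v w F) x a =
      fderiv ℝ (fderiv ℝ F) x a v + Complex.I * fderiv ℝ (fderiv ℝ F) x a w := by
  have h : ContDiff ℝ ∞ (fderiv ℝ F) := hF.fderiv_right (by simp)
  have hd : DifferentiableAt ℝ (fderiv ℝ F) x := (h.differentiable (by simp)) x
  have h1 : ∀ u : E, DifferentiableAt ℝ (fun y => fderiv ℝ F y u) x := fun u =>
    hd.clm_apply (differentiableAt_const u)
  have h2 : ∀ u : E, fderiv ℝ (fun y => fderiv ℝ F y u) x a = fderiv ℝ (fderiv ℝ F) x a u := by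
    intro u
    rw [fderiv_clm_apply hd (differentiableAt_const u)]
    simp
  have h3 : cD v w F = fun y => fderiv ℝ F y v + Complex.I * fderiv ℝ F y w := rfl
  rw [h3, fderiv_fun_add (h1 v) ((h1 w).const_mul _), fderiv_const_mul (h1 w)]
  simp [h2]

lemma cD_comm (hF : ContDiff ℝ ∞ F) :
    cD v w (cD v' w' F) x = cD v' w' (cD v w F) x := by
  have hs : IsSymmSndFDerivAt ℝ F x := (hF.contDiffAt).isSymmSndFDerivAt
    (by simp only [minSmoothness_of_isRCLikeNormedField]; exact WithTop.coe_le_coe.2 le_top)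
  have h1 : ∀ a b, fderiv ℝ (fderiv ℝ F) x a b = fderiv ℝ (fderiv ℝ F) x b a := fun a b => hs a b
  rw [cD, cD, fderiv_cD_apply hF, fderiv_cD_apply hF, fderiv_cD_apply hF, fderiv_cD_apply hF,
    h1 v v', h1 v w', h1 w v', h1 w w']
  ring

lemma HasCompactSupport.cD (hF : HasCompactSupport F) : HasCompactSupport (cD v w F) := by
  refine (hF.fderiv (𝕜 := ℝ)).mono fun x hx => ?_
  rw [Function.mem_support] at hx ⊢
  contrapose! hx
  simp [_root_.cD, hx]

variable [FiniteDimensional ℝ E] [MeasurableSpace E] [BorelSpace E] {μ : Measure E}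
  [μ.IsAddHaarMeasure]

lemma integral_mul_cD (hF : ContDiff ℝ ∞ F) (hG : ContDiff ℝ ∞ G)
    (hc : HasCompactSupport F ∨ HasCompactSupport G) :
    ∫ x, F x * cD v w G x ∂μ = -∫ x, cD v w F x * G x ∂μ := by
  have hF' : ContDiff ℝ ∞ (fderiv ℝ F) := hF.fderiv_right (by simp)
  have hG' : ContDiff ℝ ∞ (fderiv ℝ G) := hG.fderiv_right (by simp)
  have i1 : ∀ u : E, Integrable (fun x => F x * fderiv ℝ G x u) μ := fun u => by
    refine Continuous.integrable_of_hasCompactSupport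
      (hF.continuous.mul (hG'.continuous.clm_apply continuous_const)) ?_
    rcases hc with hc | hc
    · exact hc.mul_right
    · exact (hc.fderiv_apply (𝕜 := ℝ) u).mul_left
  have i2 : ∀ u : E, Integrable (fun x => fderiv ℝ F x u * G x) μ := fun u => by
    refine Continuous.integrable_of_hasCompactSupport
      ((hF'.continuous.clm_apply continuous_const).mul hG.continuous) ?_
    rcases hc with hc | hc
    · exact (hc.fderiv_apply (𝕜 := ℝ) u).mul_right
    · exact hc.mul_left
  have i3 : Integrable (fun x => F x * G x) μ := by
    refine Continuous.integrable_of_hasCompactSupport (hF.continuous.mul hG.continuous) ?_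
    rcases hc with hc | hc
    · exact hc.mul_right
    · exact hc.mul_left
  have key : ∀ u : E, ∫ x, F x * fderiv ℝ G x u ∂μ = -∫ x, fderiv ℝ F x u * G x ∂μ := fun u =>
    integral_mul_fderiv_eq_neg_fderiv_mul_of_integrable (i2 u) (i1 u) i3
      (fun x _ => hF.differentiableAt_top) (fun x _ => hG.differentiableAt_top)
  calc ∫ x, F x * cD v w G x ∂μ
      = ∫ x, (F x * fderiv ℝ G x v + Complex.I * (F x * fderiv ℝ G x w)) ∂μ := by
        refine integral_congr_ae (ae_of_all _ fun x => ?_)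
        simp only [cD]
        ring
    _ = -∫ x, (fderiv ℝ F x v * G x + Complex.I * (fderiv ℝ F x w * G x)) ∂μ := by
        rw [integral_add (i1 v) ((i1 w).const_mul _), integral_const_mul, key, key,
          integral_add (i2 v) ((i2 w).const_mul _), integral_const_mul]
        ring
    _ = -∫ x, cD v w F x * G x ∂μ := by
        congr 1
        refine integral_congr_ae (ae_of_all _ fun x => ?_)
        simp only [cD]
        ring

end ComplexDerivatives

section Antisymmetrization

open scoped ContDiff

variable {E : Type*} [NormedAddCommGroup E] [NormedSpace ℝ E] {n : ℕ}

lemma sum_sign_cD_prod_eq_zero (v w : Fin n → E) {G : Fin n → E → ℂ}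
    (hG : ∀ i, ContDiff ℝ ∞ (G i)) (i₀ : Fin n) (x : E) :
    ∑ σ : Equiv.Perm (Fin n), ((Equiv.Perm.sign σ : ℤ) : ℂ) * cD (v (σ i₀)) (w (σ i₀))
      (fun y => ∏ i ∈ Finset.univ.erase i₀, cD (v (σ i)) (w (σ i)) (G i) y) x = 0 := by
  simp_rw [cD_finsetProd (fun i => contDiff_cD (hG i)), Finset.mul_sum]
  rw [Finset.sum_comm]
  refine Finset.sum_eq_zero fun i₁ hi₁ => ?_
  have hne : i₁ ≠ i₀ := Finset.ne_of_mem_erase hi₁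
  refine Finset.sum_involution (fun σ _ => σ * Equiv.swap i₀ i₁) ?_ ?_ ?_ ?_
  · intro σ _
    have hprod : ∏ j ∈ (Finset.univ.erase i₀).erase i₁,
          cD (v ((σ * Equiv.swap i₀ i₁) j)) (w ((σ * Equiv.swap i₀ i₁) j)) (G j) x =
        ∏ j ∈ (Finset.univ.erase i₀).erase i₁, cD (v (σ j)) (w (σ j)) (G j) x := by
      refine Finset.prod_congr rfl fun j hj => ?_
      have h1 := Finset.ne_of_mem_erase hj
      have h2 := Finset.ne_of_mem_erase (Finset.mem_of_mem_erase hj)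
      rw [Equiv.Perm.mul_apply, Equiv.swap_apply_of_ne_of_ne h2 h1]
    rw [hprod, Equiv.Perm.mul_apply, Equiv.Perm.mul_apply, Equiv.swap_apply_left,
      Equiv.swap_apply_right, cD_comm (hG i₁), Equiv.Perm.sign_mul, Equiv.Perm.sign_swap hne.symm]
    push_cast
    ring
  · intro σ _ _ h
    have h2 : Equiv.swap i₀ i₁ = 1 := by simpa using h
    exact hne.symm (Equiv.swap_eq_one_iff.1 h2)
  · exact fun σ _ => Finset.mem_univ _
  · intro σ _
    rw [mul_assoc, Equiv.swap_mul_self, mul_one]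

variable [FiniteDimensional ℝ E] [MeasurableSpace E] [BorelSpace E] {μ : Measure E}
  [μ.IsAddHaarMeasure]

lemma contDiff_prod_cD (v w : Fin n → E) {G : Fin n → E → ℂ}
    (hG : ∀ i, ContDiff ℝ ∞ (G i)) (s : Finset (Fin n)) (σ : Fin n → Fin n) :
    ContDiff ℝ ∞ (fun y => ∏ i ∈ s, cD (v (σ i)) (w (σ i)) (G i) y) :=
  contDiff_prod fun i _ => contDiff_cD (hG i)

lemma integral_sum_sign_mul_cD (v w : Fin n → E) {G : Fin n → E → ℂ}
    (hG : ∀ i, ContDiff ℝ ∞ (G i)) (i₀ : Fin n) {f g : E → ℂ} (hf : ContDiff ℝ ∞ f)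
    (hg : ContDiff ℝ ∞ g) (hc : HasCompactSupport f ∨ HasCompactSupport g) :
    ∑ σ : Equiv.Perm (Fin n), ((Equiv.Perm.sign σ : ℤ) : ℂ) * ∫ x, f x *
        (cD (v (σ i₀)) (w (σ i₀)) g x * ∏ i ∈ Finset.univ.erase i₀, cD (v (σ i)) (w (σ i)) (G i) x)
        ∂μ =
      -∑ σ : Equiv.Perm (Fin n), ((Equiv.Perm.sign σ : ℤ) : ℂ) * ∫ x, cD (v (σ i₀)) (w (σ i₀)) f x *
        (g x * ∏ i ∈ Finset.univ.erase i₀, cD (v (σ i)) (w (σ i)) (G i) x) ∂μ := by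
  set P : Equiv.Perm (Fin n) → E → ℂ := fun σ y =>
    ∏ i ∈ Finset.univ.erase i₀, cD (v (σ i)) (w (σ i)) (G i) y with hP
  have hPs : ∀ σ, ContDiff ℝ ∞ (P σ) := fun σ => contDiff_prod_cD v w hG _ σ
  have hcs : ∀ a b : E, HasCompactSupport (cD a b f) ∨ HasCompactSupport g := fun a b =>
    hc.imp (fun h => h.cD) id
  have int : ∀ {a b c : E → ℂ}, ContDiff ℝ ∞ a → ContDiff ℝ ∞ b → ContDiff ℝ ∞ c →
      (HasCompactSupport a ∨ HasCompactSupport b) → Integrable (fun x => a x * (b x * c x)) μ := by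
    intro a b c ha hb hc h
    refine Continuous.integrable_of_hasCompactSupport
      (ha.continuous.mul (hb.continuous.mul hc.continuous)) ?_
    rcases h with h | h
    · exact h.mul_right
    · exact (h.mul_right).mul_left
  have key : ∀ σ : Equiv.Perm (Fin n), ∫ x, f x * (cD (v (σ i₀)) (w (σ i₀)) g x * P σ x) ∂μ =
      -∫ x, cD (v (σ i₀)) (w (σ i₀)) f x * (g x * P σ x) ∂μ -
        ∫ x, f x * (g x * cD (v (σ i₀)) (w (σ i₀)) (P σ) x) ∂μ := by
    intro σ
    have h1 : ∫ x, f x * (cD (v (σ i₀)) (w (σ i₀)) g x * P σ x) ∂μ =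
        ∫ x, (f x * P σ x) * cD (v (σ i₀)) (w (σ i₀)) g x ∂μ :=
      integral_congr_ae (ae_of_all _ fun x => by dsimp only; ring)
    rw [h1, integral_mul_cD (hf.mul (hPs σ)) hg (hc.imp (fun h => h.mul_right) id),
      ← neg_add', ← integral_add (int (contDiff_cD hf) hg (hPs σ) (hcs _ _))
        (int hf hg (contDiff_cD (hPs σ)) hc)]
    congr 1
    refine integral_congr_ae (ae_of_all _ fun x => ?_)
    dsimp only
    rw [cD_mul hf (hPs σ)]
    ring
  have hzero : ∑ σ : Equiv.Perm (Fin n), ((Equiv.Perm.sign σ : ℤ) : ℂ) *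
      ∫ x, f x * (g x * cD (v (σ i₀)) (w (σ i₀)) (P σ) x) ∂μ = 0 := by
    simp_rw [← integral_const_mul]
    rw [← integral_finsetSum _ fun σ _ => (int hf hg (contDiff_cD (hPs σ)) hc).const_mul _]
    refine (integral_congr_ae (ae_of_all _ fun x => ?_)).trans (integral_zero _ _)
    have h0 := sum_sign_cD_prod_eq_zero v w hG i₀ x
    calc _ = f x * g x * ∑ σ : Equiv.Perm (Fin n), ((Equiv.Perm.sign σ : ℤ) : ℂ) *
          cD (v (σ i₀)) (w (σ i₀)) (P σ) x := by
          rw [Finset.mul_sum]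
          exact Finset.sum_congr rfl fun σ _ => by ring
      _ = 0 := by rw [h0, mul_zero]
  have hcongr : ∀ σ : Equiv.Perm (Fin n), ((Equiv.Perm.sign σ : ℤ) : ℂ) *
      ∫ x, f x * (cD (v (σ i₀)) (w (σ i₀)) g x * P σ x) ∂μ =
      -(((Equiv.Perm.sign σ : ℤ) : ℂ) * ∫ x, cD (v (σ i₀)) (w (σ i₀)) f x * (g x * P σ x) ∂μ) -
        ((Equiv.Perm.sign σ : ℤ) : ℂ) * ∫ x, f x * (g x * cD (v (σ i₀)) (w (σ i₀)) (P σ) x) ∂μ := by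
    intro σ
    rw [key]
    ring
  rw [Finset.sum_congr rfl fun σ _ => hcongr σ, Finset.sum_sub_distrib, hzero, sub_zero,
    Finset.sum_neg_distrib]

end Antisymmetrization

section MixedMA

open scoped ContDiff

variable {n : ℕ}

/-- The complex Hessian matrix. -/
def hessC (n : ℕ) (u : Cn n → ℝ) (x : Cn n) : Matrix (Fin n) (Fin n) ℂ :=
  Matrix.of fun j k => cHessEntry n u x j k

/-- The density of the mixed Monge–Ampère measure of `n` functions. -/
def mixMA (n : ℕ) (F : Fin n → Cn n → ℝ) (x : Cn n) : ℝ :=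
  4 ^ n * (mixDet fun i => hessC n (F i) x).re

lemma maDensity_eq_mixMA (u : Cn n → ℝ) (x : Cn n) : maDensity n u x = mixMA n (fun _ => u) x := by
  rw [mixMA, mixDet_const, maDensity, mul_assoc]
  congr 1
  rw [← Complex.ofReal_natCast, Complex.re_ofReal_mul]
  rfl

/-- Real part of the complexified vector defining `∂/∂z_j` and `∂/∂z̄_j`. -/
def dzRe (j : Fin n) : Cn n := (1 / 2 : ℝ) • Pi.single j (1 : ℂ)

/-- Imaginary part of the complexified vector defining `∂/∂z̄_j`. -/
def dzIm (j : Fin n) : Cn n := (1 / 2 : ℝ) • Pi.single j Complex.I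

lemma fderiv_ofReal_comp {u : Cn n → ℝ} {x : Cn n} (hu : DifferentiableAt ℝ u x) (v : Cn n) :
    fderiv ℝ (fun y => (u y : ℂ)) x v = (fderiv ℝ u x v : ℂ) := by
  have h := (Complex.ofRealCLM.hasFDerivAt.comp x hu.hasFDerivAt).fderiv
  have h2 : (⇑Complex.ofRealCLM ∘ u) = fun y => (u y : ℂ) := rfl
  rw [h2] at h
  rw [h]
  rfl

lemma contDiff_ofReal_comp {u : Cn n → ℝ} (hu : ContDiff ℝ ∞ u) :
    ContDiff ℝ ∞ (fun y => (u y : ℂ)) := Complex.ofRealCLM.contDiff.comp hu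

lemma cHessEntry_eq_cD {u : Cn n → ℝ} (hu : ContDiff ℝ ∞ u) (x : Cn n) (j k : Fin n) :
    cHessEntry n u x j k = cD (dzRe j) (-dzIm j) (cD (dzRe k) (dzIm k) fun y => (u y : ℂ)) x := by
  have hu' : ContDiff ℝ ∞ (fderiv ℝ u) := hu.fderiv_right (by simp)
  have h1 : (fderiv ℝ fun y => (u y : ℂ)) =
      fun y => Complex.ofRealCLM.comp (fderiv ℝ u y) := by
    funext y
    ext v
    rw [fderiv_ofReal_comp ((hu.differentiable (by simp)) y)]
    rfl
  have hd : DifferentiableAt ℝ (fderiv ℝ u) x := (hu'.differentiable (by simp)) x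
  have h2 : ∀ a b, fderiv ℝ (fderiv ℝ fun y => (u y : ℂ)) x a b = (reB n u x a b : ℂ) := by
    intro a b
    have h3 : HasFDerivAt (fun y => Complex.ofRealCLM.comp (fderiv ℝ u y))
        ((ContinuousLinearMap.compL ℝ (Cn n) ℝ ℂ Complex.ofRealCLM).comp
          (fderiv ℝ (fderiv ℝ u) x)) x :=
      (ContinuousLinearMap.compL ℝ (Cn n) ℝ ℂ Complex.ofRealCLM).hasFDerivAt.comp x
        hd.hasFDerivAt
    rw [h1, h3.fderiv, reB, fderiv_clm_apply hd (differentiableAt_const b)]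
    simp
  rw [cD, fderiv_cD_apply (contDiff_ofReal_comp hu), fderiv_cD_apply (contDiff_ofReal_comp hu)]
  have h3 : ∀ a b : Cn n, fderiv ℝ (fderiv ℝ fun y => (u y : ℂ)) x ((1 / 2 : ℝ) • a)
      ((1 / 2 : ℝ) • b) = (1 / 4 : ℂ) * (reB n u x a b : ℂ) := by
    intro a b
    rw [← h2, map_smul, map_smul, smul_apply, smul_smul, Complex.real_smul]
    norm_num
  simp only [dzRe, dzIm, map_neg, neg_apply]
  rw [h3, h3, h3, h3, cHessEntry]
  linear_combination ((1 / 4 : ℂ) * (reB n u x (Pi.single j Complex.I)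
    (Pi.single k Complex.I) : ℂ)) * Complex.I_sq

lemma cHessEntry_eq_cD' {u : Cn n → ℝ} (hu : ContDiff ℝ ∞ u) (x : Cn n) (j k : Fin n) :
    cHessEntry n u x j k = cD (dzRe k) (dzIm k) (cD (dzRe j) (-dzIm j) fun y => (u y : ℂ)) x := by
  rw [cHessEntry_eq_cD hu, cD_comm (contDiff_ofReal_comp hu)]

lemma continuous_cHessEntry {u : Cn n → ℝ} (hu : ContDiff ℝ ∞ u) (j k : Fin n) :
    Continuous fun x => cHessEntry n u x j k := by
  simp_rw [cHessEntry_eq_cD hu]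
  exact (contDiff_cD (contDiff_cD (contDiff_ofReal_comp hu))).continuous

lemma continuous_mixDet_hessC {F : Fin n → Cn n → ℝ} (hF : ∀ i, ContDiff ℝ ∞ (F i)) :
    Continuous fun x => mixDet fun i => hessC n (F i) x := by
  simp only [mixDet, hessC, Matrix.of_apply]
  refine continuous_finsetSum _ fun σ _ => continuous_finsetSum _ fun τ _ => ?_
  exact continuous_const.mul (continuous_finsetProd _ fun i _ => continuous_cHessEntry (hF i) _ _)

lemma continuous_mixMA {F : Fin n → Cn n → ℝ} (hF : ∀ i, ContDiff ℝ ∞ (F i)) :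
    Continuous (mixMA n F) :=
  continuous_const.mul (Complex.continuous_re.comp (continuous_mixDet_hessC hF))

/-- The matrix of second derivatives along two families of complexified vectors. -/
def cD2 (v w v' w' : Fin n → Cn n) (u : Cn n → ℝ) (x : Cn n) : Matrix (Fin n) (Fin n) ℂ :=
  Matrix.of fun j k => cD (v j) (w j) (cD (v' k) (w' k) fun y => (u y : ℂ)) x

lemma cD2_apply (v w v' w' : Fin n → Cn n) (u : Cn n → ℝ) (x : Cn n) (j k : Fin n) :
    cD2 v w v' w' u x j k = cD (v j) (w j) (cD (v' k) (w' k) fun y => (u y : ℂ)) x := rfl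

lemma continuous_cD2 {v w v' w' : Fin n → Cn n} {u : Cn n → ℝ} (hu : ContDiff ℝ ∞ u)
    (j k : Fin n) : Continuous fun x => cD2 v w v' w' u x j k :=
  (contDiff_cD (contDiff_cD (contDiff_ofReal_comp hu))).continuous

lemma integral_mul_mixDet_cD2 (v w v' w' : Fin n → Cn n)
    (F : Fin n → Cn n → ℝ) (hF : ∀ i, ContDiff ℝ ∞ (F i)) (i₀ : Fin n)
    {f g : Cn n → ℝ} (hf : ContDiff ℝ ∞ f) (hg : ContDiff ℝ ∞ g)
    (hc : HasCompactSupport f ∨ HasCompactSupport g) :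
    ∫ x, (f x : ℂ) * mixDet (fun i => cD2 v w v' w' (Function.update F i₀ g i) x) =
      -∑ τ : Equiv.Perm (Fin n), ∑ σ : Equiv.Perm (Fin n),
        ((Equiv.Perm.sign τ : ℤ) : ℂ) * (((Equiv.Perm.sign σ : ℤ) : ℂ) *
        ∫ x, cD (v (σ i₀)) (w (σ i₀)) (fun y => (f y : ℂ)) x *
          (cD (v' (τ i₀)) (w' (τ i₀)) (fun y => (g y : ℂ)) x *
          ∏ i ∈ Finset.univ.erase i₀, cD2 v w v' w' (F i) x (σ i) (τ i))) := by
  have hf' := contDiff_ofReal_comp hf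
  have hg' := contDiff_ofReal_comp hg
  have hc' : HasCompactSupport (fun y => (f y : ℂ)) ∨ HasCompactSupport (fun y => (g y : ℂ)) :=
    hc.imp (fun h => h.comp_left (g := fun r : ℝ => (r : ℂ)) Complex.ofReal_zero)
      (fun h => h.comp_left (g := fun r : ℝ => (r : ℂ)) Complex.ofReal_zero)
  have hupd : ∀ x, (fun i => cD2 v w v' w' (Function.update F i₀ g i) x) =
      Function.update (fun i => cD2 v w v' w' (F i) x) i₀ (cD2 v w v' w' g x) := by
    intro x
    funext i
    by_cases h : i = i₀
    · subst h; simp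
    · simp [h]
  have hmix : ∀ x, mixDet (fun i => cD2 v w v' w' (Function.update F i₀ g i) x) =
      ∑ σ : Equiv.Perm (Fin n), ∑ τ : Equiv.Perm (Fin n),
        ((Equiv.Perm.sign σ : ℤ) : ℂ) * ((Equiv.Perm.sign τ : ℤ) : ℂ) *
        (cD2 v w v' w' g x (σ i₀) (τ i₀) *
          ∏ i ∈ Finset.univ.erase i₀, cD2 v w v' w' (F i) x (σ i) (τ i)) := by
    intro x
    rw [hupd, mixDet]
    simp_rw [prod_update_apply]
  simp only [hmix]
  have hInt : ∀ σ τ : Equiv.Perm (Fin n), Integrable (fun x => ((Equiv.Perm.sign σ : ℤ) : ℂ) *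
      (((Equiv.Perm.sign τ : ℤ) : ℂ) * ((f x : ℂ) * (cD2 v w v' w' g x (σ i₀) (τ i₀) *
        ∏ i ∈ Finset.univ.erase i₀, cD2 v w v' w' (F i) x (σ i) (τ i))))) := by
    intro σ τ
    refine Integrable.const_mul (Integrable.const_mul ?_ _) _
    refine Continuous.integrable_of_hasCompactSupport (hf'.continuous.mul
      ((continuous_cD2 hg _ _).mul
        (continuous_finsetProd _ fun i _ => continuous_cD2 (hF i) _ _))) ?_
    rcases hc' with h | h
    · exact h.mul_right
    · have : HasCompactSupport fun x => cD2 v w v' w' g x (σ i₀) (τ i₀) := by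
        exact h.cD.cD
      exact (this.mul_right).mul_left
  calc _ = ∫ x, ∑ τ : Equiv.Perm (Fin n), ∑ σ : Equiv.Perm (Fin n),
        ((Equiv.Perm.sign σ : ℤ) : ℂ) * (((Equiv.Perm.sign τ : ℤ) : ℂ) *
        ((f x : ℂ) * (cD2 v w v' w' g x (σ i₀) (τ i₀) *
        ∏ i ∈ Finset.univ.erase i₀, cD2 v w v' w' (F i) x (σ i) (τ i)))) := by
        refine integral_congr_ae (ae_of_all _ fun x => ?_)
        dsimp only
        rw [Finset.sum_comm, Finset.mul_sum]
        refine Finset.sum_congr rfl fun τ _ => ?_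
        rw [Finset.mul_sum]
        exact Finset.sum_congr rfl fun σ _ => by ring
    _ = ∑ τ : Equiv.Perm (Fin n), ∑ σ : Equiv.Perm (Fin n),
        ((Equiv.Perm.sign σ : ℤ) : ℂ) * (((Equiv.Perm.sign τ : ℤ) : ℂ) *
        ∫ x, ((f x : ℂ) * (cD2 v w v' w' g x (σ i₀) (τ i₀) *
        ∏ i ∈ Finset.univ.erase i₀, cD2 v w v' w' (F i) x (σ i) (τ i)))) := by
        rw [integral_finsetSum _ fun τ _ => integrable_finsetSum _ fun σ _ => hInt σ τ]
        refine Finset.sum_congr rfl fun τ _ => ?_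
        rw [integral_finsetSum _ fun σ _ => hInt σ τ]
        simp_rw [integral_const_mul]
    _ = _ := by
        rw [← Finset.sum_neg_distrib]
        refine Finset.sum_congr rfl fun τ _ => ?_
        have := integral_sum_sign_mul_cD (μ := volume) v w
          (G := fun i => cD (v' (τ i)) (w' (τ i)) fun y => (F i y : ℂ))
          (fun i => contDiff_cD (contDiff_ofReal_comp (hF i))) i₀ hf' (contDiff_cD hg')
          (g := cD (v' (τ i₀)) (w' (τ i₀)) fun y => (g y : ℂ))
          (hc'.imp id fun h => h.cD)
        simp only [← cD2_apply] at this
        rw [Finset.sum_congr rfl fun σ _ => mul_left_comm _ _ _, ← Finset.mul_sum, this, ← Finset.mul_sum, mul_neg]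

lemma mixDet_transpose (H : Fin n → Matrix (Fin n) (Fin n) ℂ) :
    mixDet (fun i => (H i).transpose) = mixDet H := by
  rw [mixDet, Finset.sum_comm]
  refine Finset.sum_congr rfl fun σ _ => Finset.sum_congr rfl fun τ _ => ?_
  rw [mul_comm (((Equiv.Perm.sign τ : ℤ) : ℂ))]
  rfl

lemma hessC_eq_cD2 {u : Cn n → ℝ} (hu : ContDiff ℝ ∞ u) (x : Cn n) :
    hessC n u x = cD2 dzRe (fun j => -dzIm j) dzRe dzIm u x := by
  ext j k
  exact cHessEntry_eq_cD hu x j k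

lemma hessC_transpose_eq_cD2 {u : Cn n → ℝ} (hu : ContDiff ℝ ∞ u) (x : Cn n) :
    (hessC n u x).transpose = cD2 dzRe dzIm dzRe (fun j => -dzIm j) u x := by
  ext j k
  exact cHessEntry_eq_cD' hu x k j

lemma integral_mul_mixDet_comm (F : Fin n → Cn n → ℝ) (hF : ∀ i, ContDiff ℝ ∞ (F i)) (i₀ : Fin n)
    {f g : Cn n → ℝ} (hf : ContDiff ℝ ∞ f) (hg : ContDiff ℝ ∞ g)
    (hc : HasCompactSupport f ∨ HasCompactSupport g) :
    ∫ x, (f x : ℂ) * mixDet (fun i => hessC n (Function.update F i₀ g i) x) =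
      ∫ x, (g x : ℂ) * mixDet (fun i => hessC n (Function.update F i₀ f i) x) := by
  have hU : ∀ {h : Cn n → ℝ}, ContDiff ℝ ∞ h → ∀ i, ContDiff ℝ ∞ (Function.update F i₀ h i) := by
    intro h hh i
    by_cases hi : i = i₀
    · subst hi; simpa using hh
    · simpa [hi] using hF i
  have h1 : ∀ x, mixDet (fun i => hessC n (Function.update F i₀ g i) x) =
      mixDet (fun i => cD2 dzRe (fun j => -dzIm j) dzRe dzIm (Function.update F i₀ g i) x) :=
    fun x => congrArg mixDet (funext fun i => hessC_eq_cD2 (hU hg i) x)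
  have h2 : ∀ x, mixDet (fun i => hessC n (Function.update F i₀ f i) x) =
      mixDet (fun i => cD2 dzRe dzIm dzRe (fun j => -dzIm j) (Function.update F i₀ f i) x) :=
    fun x => (mixDet_transpose _).symm.trans
      (congrArg mixDet (funext fun i => hessC_transpose_eq_cD2 (hU hf i) x))
  simp only [h1, h2]
  rw [integral_mul_mixDet_cD2 _ _ _ _ F hF i₀ hf hg hc,
    integral_mul_mixDet_cD2 _ _ _ _ F hF i₀ hg hf hc.symm, Finset.sum_comm]
  congr 1
  refine Finset.sum_congr rfl fun σ _ => Finset.sum_congr rfl fun τ _ => ?_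
  rw [mul_left_comm]
  congr 2
  refine integral_congr_ae (ae_of_all _ fun x => ?_)
  dsimp only
  rw [mul_left_comm]
  congr 2
  refine Finset.prod_congr rfl fun i _ => ?_
  rw [← hessC_eq_cD2 (hF i), ← hessC_transpose_eq_cD2 (hF i)]
  rfl

lemma contDiff_update_slot {F : Fin n → Cn n → ℝ} (hF : ∀ i, ContDiff ℝ ∞ (F i)) (i₀ : Fin n)
    {h : Cn n → ℝ} (hh : ContDiff ℝ ∞ h) (i : Fin n) :
    ContDiff ℝ ∞ (Function.update F i₀ h i) := by
  by_cases hi : i = i₀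
  · subst hi; simpa using hh
  · simpa [hi] using hF i

lemma mixDet_hessC_congr {F G : Fin n → Cn n → ℝ} {x : Cn n} (h : ∀ i, F i =ᶠ[𝓝 x] G i) :
    mixDet (fun i => hessC n (F i) x) = mixDet (fun i => hessC n (G i) x) := by
  congr 1
  funext i
  have h1 : ∀ v w, reB n (F i) x v w = reB n (G i) x v w := by
    intro v w
    have h2 : (fun y => fderiv ℝ (F i) y w) =ᶠ[𝓝 x] fun y => fderiv ℝ (G i) y w := by
      filter_upwards [(h i).fderiv (𝕜 := ℝ)] with y hy
      rw [hy]
    rw [reB, reB, h2.fderiv_eq]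
  ext j k
  simp only [hessC, Matrix.of_apply, cHessEntry, h1]

lemma mixMA_congr {F G : Fin n → Cn n → ℝ} {x : Cn n} (h : ∀ i, F i =ᶠ[𝓝 x] G i) :
    mixMA n F x = mixMA n G x := by
  rw [mixMA, mixMA, mixDet_hessC_congr h]

lemma hessC_eq_zero_of_notMem_tsupport {g : Cn n → ℝ} {x : Cn n} (hx : x ∉ tsupport g) :
    hessC n g x = 0 := by
  have hloc : g =ᶠ[𝓝 x] fun _ => 0 := notMem_tsupport_iff_eventuallyEq.1 hx
  ext j k
  have h1 : ∀ v w, reB n g x v w = 0 := by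
    intro v w
    have h2 : (fun y => fderiv ℝ g y w) =ᶠ[𝓝 x] fun _ => 0 := by
      filter_upwards [hloc.fderiv (𝕜 := ℝ)] with y hy
      rw [hy]
      simp
    rw [reB, h2.fderiv_eq]
    simp
  simp [hessC, cHessEntry, h1]

lemma hessC_update (F : Fin n → Cn n → ℝ) (i₀ : Fin n) (g : Cn n → ℝ) (x : Cn n) :
    (fun i => hessC n (Function.update F i₀ g i) x) =
      Function.update (fun i => hessC n (F i) x) i₀ (hessC n g x) := by
  funext i
  by_cases hi : i = i₀
  · subst hi; simp
  · simp [hi]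

lemma mixDet_hessC_update_eq_zero (F : Fin n → Cn n → ℝ) (i₀ : Fin n) {g : Cn n → ℝ} {x : Cn n}
    (hx : x ∉ tsupport g) : mixDet (fun i => hessC n (Function.update F i₀ g i) x) = 0 := by
  rw [hessC_update, hessC_eq_zero_of_notMem_tsupport hx, ← zero_smul ℂ (0 : Matrix _ _ ℂ),
    mixDet_update_smul, zero_mul]

/-- Integration by parts for mixed Monge–Ampère densities. -/
lemma integral_mul_mixMA_comm (F : Fin n → Cn n → ℝ) (hF : ∀ i, ContDiff ℝ ∞ (F i)) (i₀ : Fin n)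
    {f g : Cn n → ℝ} (hf : ContDiff ℝ ∞ f) (hg : ContDiff ℝ ∞ g)
    (hc : HasCompactSupport f ∨ HasCompactSupport g) :
    ∫ x, f x * mixMA n (Function.update F i₀ g) x =
      ∫ x, g x * mixMA n (Function.update F i₀ f) x := by
  have key : ∀ {f g : Cn n → ℝ}, ContDiff ℝ ∞ f → ContDiff ℝ ∞ g →
      (HasCompactSupport f ∨ HasCompactSupport g) →
      ∫ x, f x * mixMA n (Function.update F i₀ g) x =
        4 ^ n * (∫ x, (f x : ℂ) * mixDet (fun i => hessC n (Function.update F i₀ g i) x)).re := by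
    intro f g hf hg hc
    have hInt : Integrable fun x =>
        (f x : ℂ) * mixDet (fun i => hessC n (Function.update F i₀ g i) x) := by
      refine Continuous.integrable_of_hasCompactSupport ((contDiff_ofReal_comp hf).continuous.mul
        (continuous_mixDet_hessC (contDiff_update_slot hF i₀ hg))) ?_
      rcases hc with h | h
      · exact (h.comp_left (g := fun r : ℝ => (r : ℂ)) Complex.ofReal_zero).mul_right
      · refine HasCompactSupport.mul_left ?_
        refine HasCompactSupport.of_support_subset_isCompact h.isCompact fun x hx => ?_
        by_contra hx'
        refine hx ?_
        exact mixDet_hessC_update_eq_zero F i₀ hx'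
    rw [← RCLike.re_eq_complex_re, ← integral_re hInt, ← integral_const_mul]
    refine integral_congr_ae (ae_of_all _ fun x => ?_)
    simp only [mixMA, RCLike.re_eq_complex_re, Complex.re_ofReal_mul]
    ring
  rw [key hf hg hc, key hg hf hc.symm, integral_mul_mixDet_comm F hF i₀ hf hg hc]

end MixedMA

section Levi

open scoped ContDiff ComplexOrder

variable {n : ℕ}

/-- A one-sided second order Taylor estimate. -/
lemma eventually_le_taylor_two {E : Type*} [NormedAddCommGroup E] [NormedSpace ℝ E] {u : E → ℝ}
    (hu : Differentiable ℝ u) {x : E} (hx : DifferentiableAt ℝ (fderiv ℝ u) x) {ε : ℝ}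
    (hε : 0 < ε) :
    ∀ᶠ y in 𝓝 (0 : E), u (x + y) ≤
      u x + fderiv ℝ u x y + 1 / 2 * fderiv ℝ (fderiv ℝ u) x y y + ε * ‖y‖ ^ 2 := by
  have h := hasFDerivAt_iff_isLittleO_nhds_zero.1 hx.hasFDerivAt
  have h' := h.def hε
  obtain ⟨r, hr, hball⟩ := Metric.eventually_nhds_iff_ball.1 h'
  filter_upwards [Metric.ball_mem_nhds (0 : E) hr] with y hy
  set H := fderiv ℝ (fderiv ℝ u) x
  set G : ℝ → ℝ := fun s => u (x + s • y) - s * fderiv ℝ u x y - s ^ 2 / 2 * H y y -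
    ε * ‖y‖ ^ 2 * s
  have hd : ∀ s, HasDerivAt G (fderiv ℝ u (x + s • y) y - fderiv ℝ u x y - s * H y y -
      ε * ‖y‖ ^ 2) s := by
    intro s
    have h1 : HasDerivAt (fun s : ℝ => x + s • y) y s := by
      simpa using ((hasDerivAt_id s).smul_const y).const_add x
    have h2 : HasDerivAt (fun s : ℝ => u (x + s • y)) (fderiv ℝ u (x + s • y) y) s :=
      (hu (x + s • y)).hasFDerivAt.comp_hasDerivAt s h1
    have h3 : HasDerivAt (fun s : ℝ => s ^ 2 / 2 * H y y) (s * H y y) s := by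
      have := ((hasDerivAt_pow 2 s).div_const 2).mul_const (H y y)
      refine this.congr_deriv ?_
      simp
    have h4 : HasDerivAt (fun s : ℝ => s * fderiv ℝ u x y) (fderiv ℝ u x y) s := by
      simpa using (hasDerivAt_id s).mul_const (fderiv ℝ u x y)
    have h5 : HasDerivAt (fun s : ℝ => ε * ‖y‖ ^ 2 * s) (ε * ‖y‖ ^ 2) s := by
      simpa using (hasDerivAt_id s).const_mul (ε * ‖y‖ ^ 2)
    exact ((h2.sub h4).sub h3).sub h5
  have hanti : AntitoneOn G (Set.Icc 0 1) := by
    refine antitoneOn_of_deriv_nonpos (convex_Icc 0 1)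
      (fun s _ => (hd s).continuousAt.continuousWithinAt)
      (fun s _ => (hd s).differentiableAt.differentiableWithinAt) fun s hs => ?_
    rw [interior_Icc] at hs
    rw [(hd s).deriv]
    have hsy : ‖s • y‖ ≤ ‖y‖ := by
      rw [norm_smul, Real.norm_of_nonneg hs.1.le]
      exact mul_le_of_le_one_left (norm_nonneg _) hs.2.le
    have h6 := hball (s • y) (by
      rw [mem_ball_zero_iff] at hy ⊢
      exact hsy.trans_lt hy)
    have h7 : (fderiv ℝ u (x + s • y) - fderiv ℝ u x - H (s • y)) y ≤ ε * ‖y‖ * ‖y‖ :=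
      (le_abs_self _).trans (((fderiv ℝ u (x + s • y) - fderiv ℝ u x - H (s • y)).le_opNorm y).trans
        (mul_le_mul_of_nonneg_right (h6.trans (by gcongr)) (norm_nonneg _)))
    have h8 : (fderiv ℝ u (x + s • y) - fderiv ℝ u x - H (s • y)) y =
        fderiv ℝ u (x + s • y) y - fderiv ℝ u x y - s * H y y := by
      simp
    rw [h8] at h7
    nlinarith [h7]
  have := hanti (Set.left_mem_Icc.2 zero_le_one) (Set.right_mem_Icc.2 zero_le_one) zero_le_one
  simp only [G, one_smul, zero_smul, add_zero] at this
  linarith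

lemma smul_eq_re_add_im (ζ : ℂ) (a : Cn n) : ζ • a = ζ.re • a + ζ.im • (Complex.I • a) := by
  ext i
  apply Complex.ext <;> simp <;> ring

lemma reB_eq {u : Cn n → ℝ} (hu : ContDiff ℝ ∞ u) (x a b : Cn n) :
    reB n u x a b = fderiv ℝ (fderiv ℝ u) x a b := by
  have hd : DifferentiableAt ℝ (fderiv ℝ u) x :=
    ((hu.fderiv_right (m := ∞) (by simp)).differentiable (by simp)) x
  rw [reB]
  have := (hd.hasFDerivAt.clm_apply (hasFDerivAt_const b x)).fderiv
  rw [this]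
  simp

lemma reB_comm {u : Cn n → ℝ} (hu : ContDiff ℝ ∞ u) (x a b : Cn n) :
    reB n u x a b = reB n u x b a := by
  rw [reB_eq hu, reB_eq hu]
  have h2 : ContDiffAt ℝ 2 u x := hu.contDiffAt.of_le (WithTop.coe_le_coe.2 le_top)
  exact (h2.isSymmSndFDerivAt (by simp [minSmoothness_of_isRCLikeNormedField])) a b

/-- The Levi form of a smooth psh function is nonnegative. -/
lemma levi_nonneg_of_plurisubharmonicOn {u : Cn n → ℝ} (hu : ContDiff ℝ ∞ u) {U : Set (Cn n)}
    (hU : IsOpen U) (hpsh : PlurisubharmonicOn (fun z => (u z : EReal)) U) {x : Cn n} (hx : x ∈ U)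
    (a : Cn n) : 0 ≤ reB n u x a a + reB n u x (Complex.I • a) (Complex.I • a) := by
  by_contra! hneg
  set s := -(reB n u x a a + reB n u x (Complex.I • a) (Complex.I • a)) with hs
  have hs0 : 0 < s := by linarith
  set ε := s / (8 * (‖a‖ ^ 2 + 1)) with hε
  have hε0 : 0 < ε := by positivity
  have hεa : ε * ‖a‖ ^ 2 ≤ s / 8 := by
    rw [hε, div_mul_eq_mul_div, div_le_div_iff₀ (by positivity) (by norm_num)]
    nlinarith [sq_nonneg ‖a‖]
  have hd : DifferentiableAt ℝ (fderiv ℝ u) x :=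
    ((hu.fderiv_right (m := ∞) (by simp)).differentiable (by simp)) x
  have hT := eventually_le_taylor_two (hu.differentiable (by simp)) hd hε0
  have hcont : Tendsto (fun ζ : ℂ => ζ • a) (𝓝 0) (𝓝 0) := by
    have : Continuous fun ζ : ℂ => ζ • a := by fun_prop
    simpa using this.tendsto 0
  have hcont2 : Tendsto (fun ζ : ℂ => x + ζ • a) (𝓝 0) (𝓝 x) := by
    have : Continuous fun ζ : ℂ => x + ζ • a := by fun_prop
    simpa using this.tendsto 0
  obtain ⟨r, hr, hball⟩ := Metric.eventually_nhds_iff_ball.1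
    ((hcont.eventually hT).and (hcont2.eventually (hU.mem_nhds hx)))
  set L := fderiv ℝ u x
  set lam : ℂ := ⟨L a, -L (Complex.I • a)⟩ with hlam
  set kap : ℂ := ⟨1 / 4 * (reB n u x a a - reB n u x (Complex.I • a) (Complex.I • a)),
    -(1 / 2 * reB n u x a (Complex.I • a))⟩ with hkap
  set ρ := r / 2 with hρ
  have hρ0 : 0 < ρ := by positivity
  set p : Polynomial ℂ := Polynomial.C ((u x - s / 8 * ρ ^ 2 : ℝ) : ℂ) +
    Polynomial.C lam * Polynomial.X + Polynomial.C kap * Polynomial.X ^ 2 with hp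
  have hpe : ∀ ζ, (p.eval ζ).re = u x - s / 8 * ρ ^ 2 + (lam * ζ).re + (kap * ζ ^ 2).re := by
    intro ζ
    simp only [hp, Polynomial.eval_add, Polynomial.eval_mul, Polynomial.eval_C, Polynomial.eval_X,
      Polynomial.eval_pow, Complex.add_re, Complex.ofReal_re]
  have hmem : ∀ ζ : ℂ, ‖ζ‖ ≤ ρ → ζ ∈ Metric.ball (0 : ℂ) r := by
    intro ζ hζ
    rw [mem_ball_zero_iff]
    linarith
  have key := hpsh.2 x a ρ hρ0 (fun ζ hζ => (hball ζ (hmem ζ hζ)).2) p ?_ 0 (by simpa using hρ0.le)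
  · have h1 := EReal.coe_le_coe_iff.1 key
    rw [hpe] at h1
    simp at h1
    nlinarith [mul_pos hs0 (pow_pos hρ0 2)]
  · intro ζ hζ
    refine EReal.coe_le_coe_iff.2 ((hball ζ (hmem ζ hζ.le)).1.trans ?_)
    rw [hpe, ← reB_eq hu]
    have hz := smul_eq_re_add_im ζ a
    have hL : L (ζ • a) = (lam * ζ).re := by
      rw [hz, map_add, map_smul, map_smul, Complex.mul_re, hlam]
      simp only [smul_eq_mul]
      ring
    have hB : reB n u x (ζ • a) (ζ • a) = ζ.re ^ 2 * reB n u x a a +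
        2 * ζ.re * ζ.im * reB n u x a (Complex.I • a) +
        ζ.im ^ 2 * reB n u x (Complex.I • a) (Complex.I • a) := by
      have hc := reB_comm hu x (Complex.I • a) a
      rw [hz]
      simp only [reB_eq hu] at hc ⊢
      simp only [map_add, map_smul, add_apply, smul_apply, smul_eq_mul]
      rw [hc]
      ring
    have hk : (kap * ζ ^ 2).re = 1 / 4 * (reB n u x a a - reB n u x (Complex.I • a) (Complex.I • a)) *
        (ζ.re ^ 2 - ζ.im ^ 2) + reB n u x a (Complex.I • a) * (ζ.re * ζ.im) := by
      rw [Complex.mul_re, hkap, pow_two]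
      simp only [Complex.mul_re, Complex.mul_im]
      ring
    have hn : ζ.re ^ 2 + ζ.im ^ 2 = ρ ^ 2 := by
      rw [← hζ, ← Complex.normSq_eq_norm_sq, Complex.normSq_apply]
      ring
    have hna : ε * ‖ζ • a‖ ^ 2 ≤ s / 8 * ρ ^ 2 := by
      rw [norm_smul, hζ, mul_pow]
      nlinarith [mul_le_mul_of_nonneg_right hεa (sq_nonneg ρ)]
    rw [hL, hB, hk]
    have e1 : 1 / 2 * (ζ.re ^ 2 * reB n u x a a +
        2 * ζ.re * ζ.im * reB n u x a (Complex.I • a) +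
        ζ.im ^ 2 * reB n u x (Complex.I • a) (Complex.I • a)) =
        1 / 4 * (reB n u x a a - reB n u x (Complex.I • a) (Complex.I • a)) *
        (ζ.re ^ 2 - ζ.im ^ 2) + reB n u x a (Complex.I • a) * (ζ.re * ζ.im) - s / 4 * ρ ^ 2 := by
      rw [← hn, hs]
      ring
    rw [e1]
    linarith

/-- The Levi form as a sesquilinear form. -/
def leviForm (n : ℕ) (u : Cn n → ℝ) (x a b : Cn n) : ℂ :=
  (1 / 4 : ℂ) * ((reB n u x a b : ℂ) + (reB n u x (Complex.I • a) (Complex.I • b) : ℂ) +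
    Complex.I * ((reB n u x a (Complex.I • b) : ℂ) - (reB n u x (Complex.I • a) b : ℂ)))

lemma cHessEntry_eq_leviForm (u : Cn n → ℝ) (x : Cn n) (j k : Fin n) :
    cHessEntry n u x j k = leviForm n u x (Pi.single j 1) (Pi.single k 1) := by
  have h : ∀ j : Fin n, (Complex.I • Pi.single j (1 : ℂ) : Cn n) = Pi.single j Complex.I := by
    intro j
    rw [← Pi.single_smul, smul_eq_mul, mul_one]
  rw [leviForm, h, h, cHessEntry]

lemma leviForm_smul_smul {u : Cn n → ℝ} (hu : ContDiff ℝ ∞ u) (x a b : Cn n) (c d : ℂ) :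
    leviForm n u x (c • a) (d • b) = c * (starRingEnd ℂ) d * leviForm n u x a b := by
  have hz := fun (ζ : ℂ) (a : Cn n) => smul_eq_re_add_im ζ a
  have hz' : ∀ (ζ : ℂ) (a : Cn n), Complex.I • ζ • a = ζ.re • Complex.I • a - ζ.im • a := by
    intro ζ a
    rw [smul_smul, hz]
    simp
    abel
  rw [leviForm, leviForm, hz' c, hz' d, hz c, hz d]
  simp only [reB_eq hu, map_add, map_sub, map_smul, add_apply, sub_apply, smul_apply, smul_eq_mul,
    Complex.ofReal_add, Complex.ofReal_sub, Complex.ofReal_mul]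
  have hc := Complex.re_add_im c
  have hd : (starRingEnd ℂ) d = (d.re : ℂ) - d.im * Complex.I := by
    apply Complex.ext <;> simp
  rw [hd]
  conv_rhs => rw [← hc]
  have hI : Complex.I ^ 2 = -1 := Complex.I_sq
  ring_nf
  simp only [hI, show Complex.I ^ 3 = -Complex.I by rw [pow_succ, hI]; ring]
  ring

lemma leviForm_sum {u : Cn n → ℝ} (hu : ContDiff ℝ ∞ u) (x : Cn n) {ι κ : Type*} (s : Finset ι)
    (t : Finset κ) (a : ι → Cn n) (b : κ → Cn n) :
    leviForm n u x (∑ i ∈ s, a i) (∑ j ∈ t, b j) = ∑ i ∈ s, ∑ j ∈ t, leviForm n u x (a i) (b j) := by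
  simp only [leviForm, reB_eq hu, Finset.smul_sum, map_sum, sum_apply, Complex.ofReal_sum,
    Finset.mul_sum, Finset.sum_add_distrib, Finset.sum_sub_distrib, mul_add, mul_sub]
  simp only [Finset.sum_comm (s := t)]

lemma leviForm_self {u : Cn n → ℝ} (hu : ContDiff ℝ ∞ u) (x a : Cn n) :
    leviForm n u x a a =
      ((1 / 4 * (reB n u x a a + reB n u x (Complex.I • a) (Complex.I • a)) : ℝ) : ℂ) := by
  rw [leviForm, reB_comm hu x (Complex.I • a) a]
  push_cast
  ring

lemma isHermitian_hessC {u : Cn n → ℝ} (hu : ContDiff ℝ ∞ u) (x : Cn n) :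
    (hessC n u x).IsHermitian := by
  ext j k
  simp only [hessC, Matrix.conjTranspose_apply, Matrix.of_apply, cHessEntry]
  simp only [Complex.star_def, map_mul, map_add, map_sub, Complex.conj_ofReal, Complex.conj_I,
    map_div₀, map_one, map_ofNat]
  rw [reB_comm hu x (Pi.single k 1) (Pi.single j 1),
    reB_comm hu x (Pi.single k Complex.I) (Pi.single j Complex.I),
    reB_comm hu x (Pi.single k 1) (Pi.single j Complex.I),
    reB_comm hu x (Pi.single k Complex.I) (Pi.single j 1)]
  ring

lemma posSemidef_hessC_of_levi {u : Cn n → ℝ} (hu : ContDiff ℝ ∞ u) {x : Cn n}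
    (h : ∀ a, 0 ≤ reB n u x a a + reB n u x (Complex.I • a) (Complex.I • a)) :
    (hessC n u x).PosSemidef := by
  refine Matrix.PosSemidef.of_dotProduct_mulVec_nonneg (isHermitian_hessC hu x) fun c => ?_
  have hdec : (star c : Cn n) = ∑ j, (star c) j • Pi.single j (1 : ℂ) := by
    ext i
    simp [Finset.sum_apply, Pi.single_apply]
  have : star c ⬝ᵥ (hessC n u x).mulVec c = leviForm n u x (star c) (star c) := by
    conv_rhs => rw [hdec]
    rw [leviForm_sum hu]
    simp only [leviForm_smul_smul hu, dotProduct, Matrix.mulVec, Finset.mul_sum, hessC,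
      Matrix.of_apply, cHessEntry_eq_leviForm]
    refine Finset.sum_congr rfl fun i _ => Finset.sum_congr rfl fun j _ => ?_
    simp
    ring
  rw [this, leviForm_self hu]
  exact_mod_cast mul_nonneg (by norm_num) (h (star c))

lemma posSemidef_hessC {u : Cn n → ℝ} (hu : ContDiff ℝ ∞ u) {U : Set (Cn n)}
    (hU : IsOpen U) (hpsh : PlurisubharmonicOn (fun z => (u z : EReal)) U) {x : Cn n}
    (hx : x ∈ U) : (hessC n u x).PosSemidef :=
  posSemidef_hessC_of_levi hu (levi_nonneg_of_plurisubharmonicOn hu hU hpsh hx)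

end Levi

section MixedOrder

open scoped ContDiff ComplexOrder Manifold

variable {n : ℕ}

lemma exists_contDiff_cutoff {K V : Set (Cn n)} (hK : IsCompact K) (hV : IsOpen V) (hKV : K ⊆ V) :
    ∃ χ : Cn n → ℝ, ContDiff ℝ ∞ χ ∧ HasCompactSupport χ ∧ tsupport χ ⊆ V ∧
      (∀ x, 0 ≤ χ x) ∧ (∀ x, χ x ≤ 1) ∧ ∀ x ∈ K, ∀ᶠ y in 𝓝 x, χ y = 1 := by
  obtain ⟨L, hL, hKL, hLV⟩ := exists_compact_between hK hV hKV
  obtain ⟨f, h1, h0, hf⟩ := exists_contMDiffMap_one_nhds_of_subset_interior (n := ⊤)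
    𝓘(ℝ, Cn n) hK.isClosed hKL
  have hsupp : Function.support f ⊆ L := fun x hx => by
    by_contra hx'
    exact hx (h0 x hx')
  have hts : tsupport f ⊆ L := closure_minimal hsupp hL.isClosed
  refine ⟨f, f.contMDiff.contDiff, hL.of_isClosed_subset (isClosed_tsupport _) hts,
    hts.trans hLV, fun x => (hf x).1, fun x => (hf x).2, fun x hx => ?_⟩
  exact (Filter.eventually_of_mem (nhds_le_nhdsSet hx h1) fun y hy => hy)

lemma reB_add {f g : Cn n → ℝ} (hf : ContDiff ℝ ∞ f) (hg : ContDiff ℝ ∞ g) (x v w : Cn n) :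
    reB n (fun y => f y + g y) x v w = reB n f x v w + reB n g x v w := by
  have h1 : fderiv ℝ (fun y => f y + g y) = fun y => fderiv ℝ f y + fderiv ℝ g y := by
    funext y
    exact fderiv_fun_add (hf.differentiable (by simp) y) (hg.differentiable (by simp) y)
  have hd : ∀ {u : Cn n → ℝ}, ContDiff ℝ ∞ u → DifferentiableAt ℝ (fderiv ℝ u) x := fun hu =>
    ((hu.fderiv_right (m := ∞) (by simp)).differentiable (by simp)) x
  rw [reB_eq hf, reB_eq hg, reB_eq (hf.add hg), h1, fderiv_fun_add (hd hf) (hd hg)]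
  rfl

lemma reB_const_mul {f : Cn n → ℝ} (hf : ContDiff ℝ ∞ f) (c : ℝ) (x v w : Cn n) :
    reB n (fun y => c * f y) x v w = c * reB n f x v w := by
  have h1 : fderiv ℝ (fun y => c * f y) = fun y => c • fderiv ℝ f y := by
    funext y
    exact fderiv_const_mul (hf.differentiable (by simp) y) c
  have hd : DifferentiableAt ℝ (fderiv ℝ f) x :=
    ((hf.fderiv_right (m := ∞) (by simp)).differentiable (by simp)) x
  rw [reB_eq hf, reB_eq (contDiff_const.mul hf), h1, fderiv_fun_const_smul hd]
  rfl

lemma reB_const (c : ℝ) (x v w : Cn n) : reB n (fun _ => c) x v w = 0 := by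
  simp [reB]

lemma hessC_add {f g : Cn n → ℝ} (hf : ContDiff ℝ ∞ f) (hg : ContDiff ℝ ∞ g) (x : Cn n) :
    hessC n (fun y => f y + g y) x = hessC n f x + hessC n g x := by
  ext j k
  simp only [hessC, Matrix.of_apply, Matrix.add_apply, cHessEntry, reB_add hf hg]
  push_cast
  ring

lemma hessC_const_mul {f : Cn n → ℝ} (hf : ContDiff ℝ ∞ f) (c : ℝ) (x : Cn n) :
    hessC n (fun y => c * f y) x = (c : ℂ) • hessC n f x := by
  ext j k
  simp only [hessC, Matrix.of_apply, Matrix.smul_apply, cHessEntry, reB_const_mul hf, smul_eq_mul]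
  push_cast
  ring

lemma hessC_const (c : ℝ) (x : Cn n) : hessC n (fun _ => c) x = 0 := by
  ext j k
  simp [hessC, cHessEntry, reB_const]

lemma hessC_sub {f g : Cn n → ℝ} (hf : ContDiff ℝ ∞ f) (hg : ContDiff ℝ ∞ g) (x : Cn n) :
    hessC n (fun y => f y - g y) x = hessC n f x - hessC n g x := by
  have h : (fun y => f y - g y) = fun y => f y + (-1) * g y := by
    funext y; ring
  rw [h, hessC_add hf (contDiff_const.mul hg), hessC_const_mul hg]
  simp [sub_eq_add_neg]

lemma mixMA_update (F : Fin n → Cn n → ℝ) (i : Fin n) (f : Cn n → ℝ) (x : Cn n) :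
    mixMA n (Function.update F i f) x =
      4 ^ n * (mixDet (Function.update (fun j => hessC n (F j) x) i (hessC n f x))).re := by
  rw [mixMA, hessC_update]

lemma mixMA_update_sub (F : Fin n → Cn n → ℝ) (i : Fin n) {f g : Cn n → ℝ} (hf : ContDiff ℝ ∞ f)
    (hg : ContDiff ℝ ∞ g) (x : Cn n) :
    mixMA n (Function.update F i fun y => f y - g y) x =
      mixMA n (Function.update F i f) x - mixMA n (Function.update F i g) x := by
  have h : hessC n f x = hessC n (fun y => f y - g y) x + hessC n g x := by
    rw [hessC_sub hf hg, sub_add_cancel]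
  rw [mixMA_update, mixMA_update F i f, mixMA_update F i g, h, mixDet_update_add, Complex.add_re]
  ring

lemma mixMA_update_const_mul (F : Fin n → Cn n → ℝ) (i : Fin n) {f : Cn n → ℝ}
    (hf : ContDiff ℝ ∞ f) (c : ℝ) (x : Cn n) :
    mixMA n (Function.update F i fun y => c * f y) x = c * mixMA n (Function.update F i f) x := by
  rw [mixMA_update, mixMA_update, hessC_const_mul hf, mixDet_update_smul, Complex.re_ofReal_mul]
  ring

lemma mixMA_nonneg {F : Fin n → Cn n → ℝ} {x : Cn n} (h : ∀ i, (hessC n (F i) x).PosSemidef) :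
    0 ≤ mixMA n F x :=
  mul_nonneg (by positivity) (Complex.le_def.1 (mixDet_nonneg h)).1

lemma mixMA_update_nonneg {F : Fin n → Cn n → ℝ} {x : Cn n} {i : Fin n} {f : Cn n → ℝ}
    (h : ∀ j, j ≠ i → (hessC n (F j) x).PosSemidef) (hf : (hessC n f x).PosSemidef) :
    0 ≤ mixMA n (Function.update F i f) x := by
  refine mixMA_nonneg fun j => ?_
  by_cases hj : j = i
  · subst hj; simpa using hf
  · simpa [hj] using h j hj

lemma mixMA_update_eq_zero (F : Fin n → Cn n → ℝ) (i : Fin n) {g : Cn n → ℝ} {x : Cn n}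
    (hx : x ∉ tsupport g) : mixMA n (Function.update F i g) x = 0 := by
  rw [mixMA, mixDet_hessC_update_eq_zero F i hx]
  simp

/-- The squared Euclidean distance to `a`. -/
def sqDist (n : ℕ) (a z : Cn n) : ℝ := ∑ i, ((z i - a i).re ^ 2 + (z i - a i).im ^ 2)

lemma contDiff_sqDist (a : Cn n) : ContDiff ℝ ∞ (sqDist n a) := by
  have h1 : ∀ i, ContDiff ℝ ∞ fun z : Cn n => (z i - a i).re := fun i =>
    Complex.reCLM.contDiff.comp ((contDiff_apply ℝ ℂ i).sub contDiff_const)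
  have h2 : ∀ i, ContDiff ℝ ∞ fun z : Cn n => (z i - a i).im := fun i =>
    Complex.imCLM.contDiff.comp ((contDiff_apply ℝ ℂ i).sub contDiff_const)
  exact ContDiff.sum fun i _ => ((h1 i).pow 2).add ((h2 i).pow 2)

lemma reB_sqDist (a x v w : Cn n) :
    reB n (sqDist n a) x v w = 2 * ∑ i, ((v i).re * (w i).re + (v i).im * (w i).im) := by
  have h1 : ∀ i (y : Cn n), HasFDerivAt (fun z : Cn n => (z i - a i).re)
      (Complex.reCLM.comp (ContinuousLinearMap.proj (R := ℝ) (φ := fun _ : Fin n => ℂ) i)) y :=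
    fun i y => Complex.reCLM.hasFDerivAt.comp y
      (((ContinuousLinearMap.proj (R := ℝ) (φ := fun _ : Fin n => ℂ) i).hasFDerivAt).sub_const (a i))
  have h2 : ∀ i (y : Cn n), HasFDerivAt (fun z : Cn n => (z i - a i).im)
      (Complex.imCLM.comp (ContinuousLinearMap.proj (R := ℝ) (φ := fun _ : Fin n => ℂ) i)) y :=
    fun i y => Complex.imCLM.hasFDerivAt.comp y
      (((ContinuousLinearMap.proj (R := ℝ) (φ := fun _ : Fin n => ℂ) i).hasFDerivAt).sub_const (a i))
  have h3 : ∀ y : Cn n, fderiv ℝ (sqDist n a) y w =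
      ∑ i, (2 * (w i).re * (y i - a i).re + 2 * (w i).im * (y i - a i).im) := by
    intro y
    have := (HasFDerivAt.fun_sum (u := Finset.univ) fun i _ =>
      ((h1 i y).pow 2).fun_add ((h2 i y).pow 2)).fderiv
    change fderiv ℝ (fun z => ∑ i, ((z i - a i).re ^ 2 + (z i - a i).im ^ 2)) y w = _
    rw [this, sum_apply]
    refine Finset.sum_congr rfl fun i _ => ?_
    simp
    ring
  rw [reB]
  simp only [h3]
  have := (HasFDerivAt.fun_sum (u := Finset.univ) fun i _ =>
      ((h1 i x).const_mul (2 * (w i).re)).fun_add ((h2 i x).const_mul (2 * (w i).im))).fderiv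
  rw [this, sum_apply, Finset.mul_sum]
  refine Finset.sum_congr rfl fun i _ => ?_
  simp
  ring

lemma norm_sq_le_sqDist (a z : Cn n) : ‖z - a‖ ^ 2 ≤ sqDist n a z := by
  have h0 : 0 ≤ sqDist n a z := Finset.sum_nonneg fun i _ => by positivity
  rw [← Real.le_sqrt (norm_nonneg _) h0]
  refine (pi_norm_le_iff_of_nonneg (Real.sqrt_nonneg _)).2 fun i => ?_
  refine Real.le_sqrt_of_sq_le ?_
  rw [Pi.sub_apply, ← Complex.normSq_eq_norm_sq, Complex.normSq_apply]
  have := Finset.single_le_sum (f := fun i => (z i - a i).re ^ 2 + (z i - a i).im ^ 2)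
    (fun i _ => by positivity) (Finset.mem_univ i)
  refine le_trans (le_of_eq ?_) this
  ring

lemma levi_sqDist (a x v : Cn n) : 4 * ‖v‖ ^ 2 ≤
    reB n (sqDist n a) x v v + reB n (sqDist n a) x (Complex.I • v) (Complex.I • v) := by
  have h := norm_sq_le_sqDist (0 : Cn n) v
  rw [sub_zero, sqDist] at h
  rw [reB_sqDist, reB_sqDist, ← mul_add, ← Finset.sum_add_distrib]
  have h2 : ∑ i, ((v i).re * (v i).re + (v i).im * (v i).im + (((Complex.I • v) i).re *
      ((Complex.I • v) i).re + ((Complex.I • v) i).im * ((Complex.I • v) i).im)) =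
      2 * ∑ i, ((v i - (0 : Cn n) i).re ^ 2 + (v i - (0 : Cn n) i).im ^ 2) := by
    rw [Finset.mul_sum]
    refine Finset.sum_congr rfl fun i _ => ?_
    simp
    ring
  rw [h2]
  linarith

lemma posSemidef_hessC_sqDist (a x : Cn n) : (hessC n (sqDist n a) x).PosSemidef :=
  posSemidef_hessC_of_levi (contDiff_sqDist a) fun v => le_trans (by positivity) (levi_sqDist a x v)

lemma hessC_sqDist_apply (a x : Cn n) (j k : Fin n) :
    hessC n (sqDist n a) x j k = if j = k then 1 else 0 := by
  have hs : ∀ c d : ℂ, (∑ i, (((Pi.single j c : Cn n) i).re * ((Pi.single k d : Cn n) i).re +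
      ((Pi.single j c : Cn n) i).im * ((Pi.single k d : Cn n) i).im)) =
      if j = k then c.re * d.re + c.im * d.im else 0 := by
    intro c d
    rw [Finset.sum_eq_single j (fun i _ hi => by simp [Pi.single_eq_of_ne hi])
      (fun h => absurd (Finset.mem_univ j) h)]
    split_ifs with h
    · subst h; simp
    · simp [Pi.single_eq_of_ne h]
  simp only [hessC, Matrix.of_apply, cHessEntry, reB_sqDist, hs]
  split_ifs
  · simp; norm_num
  · simp

lemma hessC_sqDist (a x : Cn n) : hessC n (sqDist n a) x = 1 := by
  ext j k
  rw [hessC_sqDist_apply, Matrix.one_apply]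

lemma ContDiff.exists_norm_le {F : Type*} [NormedAddCommGroup F] [NormedSpace ℝ F] {f : Cn n → F}
    (hf : ContDiff ℝ ∞ f) {K : Set (Cn n)} (hK : IsCompact K) (h0 : ∀ x ∉ K, f x = 0) :
    ∃ C : ℝ, 0 ≤ C ∧ ∀ x, ‖f x‖ ≤ C := by
  obtain ⟨C, hC⟩ := hK.exists_bound_of_continuousOn hf.continuous.continuousOn
  refine ⟨max C 0, le_max_right _ _, fun x => ?_⟩
  by_cases hx : x ∈ K
  · exact (hC x hx).trans (le_max_left _ _)
  · rw [h0 x hx, norm_zero]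
    exact le_max_right _ _

lemma exists_abs_reB_le {χ : Cn n → ℝ} (hχ : ContDiff ℝ ∞ χ) (hc : HasCompactSupport χ) :
    ∃ C : ℝ, 0 ≤ C ∧ ∀ x v w, |reB n χ x v w| ≤ C * ‖v‖ * ‖w‖ := by
  have h1 : ContDiff ℝ ∞ (fderiv ℝ (fderiv ℝ χ)) :=
    (hχ.fderiv_right (m := ∞) (by simp)).fderiv_right (m := ∞) (by simp)
  obtain ⟨C, hC0, hC⟩ := h1.exists_norm_le hc.isCompact fun x hx => by
    have h2 : fderiv ℝ χ =ᶠ[𝓝 x] fun _ => 0 := by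
      filter_upwards [(isClosed_tsupport χ).isOpen_compl.mem_nhds hx] with y hy
      exact fderiv_of_notMem_tsupport ℝ hy
    rw [h2.fderiv_eq, fderiv_fun_const]
    rfl
  refine ⟨C, hC0, fun x v w => ?_⟩
  rw [reB_eq hχ, ← Real.norm_eq_abs]
  refine ((fderiv ℝ (fderiv ℝ χ) x).le_opNorm₂ v w).trans ?_
  gcongr
  exact hC x

lemma exists_abs_levi_le {χ : Cn n → ℝ} (hχ : ContDiff ℝ ∞ χ) (hc : HasCompactSupport χ) :
    ∃ C : ℝ, 0 ≤ C ∧ ∀ x v,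
      |reB n χ x v v + reB n χ x (Complex.I • v) (Complex.I • v)| ≤ 2 * C * ‖v‖ ^ 2 := by
  obtain ⟨C, hC0, hC⟩ := exists_abs_reB_le hχ hc
  refine ⟨C, hC0, fun x v => (abs_add_le _ _).trans ?_⟩
  have h1 := hC x v v
  have h2 := hC x (Complex.I • v) (Complex.I • v)
  rw [norm_smul, Complex.norm_I, one_mul] at h2
  linarith

/-- A compactly supported smooth function has complex Hessian dominated by that of a multiple of
the squared distance. -/
lemma exists_posSemidef_hessC_add {χ : Cn n → ℝ} (hχ : ContDiff ℝ ∞ χ) (hc : HasCompactSupport χ)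
    (a : Cn n) : ∃ C : ℝ, 0 ≤ C ∧ ∀ x c, |c| ≤ 1 →
      (hessC n (fun y => C * sqDist n a y - c * χ y) x).PosSemidef := by
  obtain ⟨C, hC0, hb⟩ := exists_abs_levi_le hχ hc
  have hq := contDiff_sqDist a
  refine ⟨C, hC0, fun x c hc1 => posSemidef_hessC_of_levi
    ((contDiff_const.mul hq).sub (contDiff_const.mul hχ)) fun v => ?_⟩
  have hr : ∀ w, reB n (fun y => C * sqDist n a y - c * χ y) x w w =
      C * reB n (sqDist n a) x w w - c * reB n χ x w w := by
    intro w
    have h : (fun y => C * sqDist n a y - c * χ y) = fun y => C * sqDist n a y + (-c) * χ y := by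
      funext y; ring
    rw [h, reB_add (contDiff_const.mul hq) (contDiff_const.mul hχ), reB_const_mul hq,
      reB_const_mul hχ]
    ring
  rw [hr, hr]
  have h1 := hb x v
  have h2 := mul_le_mul_of_nonneg_left (levi_sqDist a x v) hC0
  have h3 : |c * (reB n χ x v v + reB n χ x (Complex.I • v) (Complex.I • v))| ≤
      2 * C * ‖v‖ ^ 2 := by
    rw [abs_mul]
    exact (mul_le_of_le_one_left (abs_nonneg _) hc1).trans h1
  have h4 := (abs_le.1 h3).2
  have h5 := mul_nonneg hC0 (sq_nonneg ‖v‖)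
  linarith

lemma exists_abs_mixMA_update_le {χ : Cn n → ℝ} (hχ : ContDiff ℝ ∞ χ) (hc : HasCompactSupport χ)
    (a : Cn n) : ∃ C : ℝ, 0 ≤ C ∧ ∀ (F : Fin n → Cn n → ℝ) (i : Fin n) (x : Cn n),
      (∀ j, j ≠ i → (hessC n (F j) x).PosSemidef) →
      |mixMA n (Function.update F i χ) x| ≤ C * mixMA n (Function.update F i (sqDist n a)) x := by
  obtain ⟨C, hC, h⟩ := exists_posSemidef_hessC_add hχ hc a
  have hq := contDiff_sqDist a
  refine ⟨C, hC, fun F i x hF => ?_⟩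
  have hle : ∀ c : ℝ, |c| ≤ 1 → c * mixMA n (Function.update F i χ) x ≤
      C * mixMA n (Function.update F i (sqDist n a)) x := by
    intro c hc1
    have h1 := mixMA_update_nonneg hF (h x c hc1)
    rw [mixMA_update_sub F i (contDiff_const.mul hq) (contDiff_const.mul hχ),
      mixMA_update_const_mul F i hq, mixMA_update_const_mul F i hχ] at h1
    linarith
  have h1 := hle 1 (by simp)
  have h2 := hle (-1) (by simp)
  exact abs_le.2 ⟨by linarith, by linarith⟩

end MixedOrder

section MassBounds

open scoped ContDiff ComplexOrder

variable {n : ℕ}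

lemma integrable_mul_mixMA {f : Cn n → ℝ} (hf : Continuous f) (hc : HasCompactSupport f)
    {F : Fin n → Cn n → ℝ} (hF : ∀ i, ContDiff ℝ ∞ (F i)) :
    Integrable (fun x => f x * mixMA n F x) :=
  (hf.mul (continuous_mixMA hF)).integrable_of_hasCompactSupport hc.mul_right

lemma integrable_mul_mixMA_update {f : Cn n → ℝ} (hf : Continuous f)
    {F : Fin n → Cn n → ℝ} (hF : ∀ i, ContDiff ℝ ∞ (F i)) {g : Cn n → ℝ} (hg : ContDiff ℝ ∞ g)
    (hc : HasCompactSupport g) (i : Fin n) :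
    Integrable (fun x => f x * mixMA n (Function.update F i g) x) := by
  refine (hf.mul (continuous_mixMA (contDiff_update_slot hF i hg))).integrable_of_hasCompactSupport
    (hc.mono' fun x hx => ?_)
  by_contra h
  exact hx (by simp [mixMA_update_eq_zero F i h])

/-- Integration by parts moves the test function into a slot, where it is dominated by a multiple
of the squared distance. -/
lemma abs_integral_mul_mixMA_update_le {χ χ' : Cn n → ℝ} (hχ : ContDiff ℝ ∞ χ)
    (hc : HasCompactSupport χ) (hχ' : Continuous χ') (hc' : HasCompactSupport χ')
    (h0 : ∀ x, 0 ≤ χ' x) (h1 : ∀ x ∈ tsupport χ, χ' x = 1) {V : Set (Cn n)}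
    (hV' : tsupport χ' ⊆ V) :
    ∃ C : ℝ, 0 ≤ C ∧ ∀ (F : Fin n → Cn n → ℝ) (i : Fin n) (g : Cn n → ℝ) (M : ℝ),
      (∀ j, ContDiff ℝ ∞ (F j)) → ContDiff ℝ ∞ g →
      (∀ j, j ≠ i → ∀ x ∈ V, (hessC n (F j) x).PosSemidef) →
      (∀ x ∈ V, |g x| ≤ M) → 0 ≤ M →
      |∫ x, χ x * mixMA n (Function.update F i g) x| ≤
        M * (C * ∫ x, χ' x * mixMA n (Function.update F i (sqDist n 0)) x) := by
  obtain ⟨C, hC, h⟩ := exists_abs_mixMA_update_le hχ hc (0 : Cn n)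
  refine ⟨C, hC, fun F i g M hF hg hpsd hM hM0 => ?_⟩
  rw [integral_mul_mixMA_comm F hF i hχ hg (Or.inl hc), ← integral_const_mul, ← integral_const_mul]
  refine abs_integral_le_integral_abs.trans (integral_mono
    (integrable_mul_mixMA_update hg.continuous hF hχ hc i).abs
    (((integrable_mul_mixMA hχ' hc' (contDiff_update_slot hF i
      (contDiff_sqDist 0))).const_mul C).const_mul M) fun x => ?_)
  change |g x * mixMA n (Function.update F i χ) x| ≤
    M * (C * (χ' x * mixMA n (Function.update F i (sqDist n 0)) x))
  by_cases hxV : x ∈ V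
  · have hpos := mixMA_update_nonneg (F := F) (i := i) (fun j hj => hpsd j hj x hxV)
      (posSemidef_hessC_sqDist (0 : Cn n) x)
    by_cases hx : x ∈ tsupport χ
    · rw [h1 x hx, one_mul, abs_mul]
      exact mul_le_mul (hM x hxV) (h F i x fun j hj => hpsd j hj x hxV) (abs_nonneg _) hM0
    · rw [mixMA_update_eq_zero F i hx, mul_zero, abs_zero]
      exact mul_nonneg hM0 (mul_nonneg hC (mul_nonneg (h0 x) hpos))
  · have hx' : x ∉ tsupport χ' := fun hx => hxV (hV' hx)
    have hx0 : χ' x = 0 := image_eq_zero_of_notMem_tsupport hx'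
    have hx : x ∉ tsupport χ := fun hx => by
      rw [h1 x hx] at hx0
      exact one_ne_zero hx0
    rw [mixMA_update_eq_zero F i hx, hx0]
    simp

/-- Local mass bound for mixed Monge–Ampère densities of uniformly bounded functions
(Chern–Levine–Nirenberg). -/
lemma exists_integral_mul_mixMA_le {V : Set (Cn n)} (hV : IsOpen V) {ι : Type*}
    {F : ι → Fin n → Cn n → ℝ} (hF : ∀ k i, ContDiff ℝ ∞ (F k i))
    (hpsd : ∀ k i, ∀ x ∈ V, (hessC n (F k i) x).PosSemidef) {M : ℝ}
    (hM : ∀ k i, ∀ x ∈ V, |F k i x| ≤ M) (p : Finset (Fin n)) :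
    ∀ χ : Cn n → ℝ, Continuous χ → HasCompactSupport χ → tsupport χ ⊆ V → (∀ x, 0 ≤ χ x) →
      ∃ B : ℝ, 0 ≤ B ∧ ∀ k,
        ∫ x, χ x * mixMA n (fun i => if i ∈ p then F k i else sqDist n 0) x ≤ B := by
  have hsm : ∀ (p : Finset (Fin n)) k i, ContDiff ℝ ∞ (if i ∈ p then F k i else sqDist n 0) := by
    intro p k i
    split_ifs
    exacts [hF k i, contDiff_sqDist 0]
  have hps : ∀ (p : Finset (Fin n)) k i, ∀ x ∈ V,
      (hessC n (if i ∈ p then F k i else sqDist n 0) x).PosSemidef := by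
    intro p k i x hx
    split_ifs
    exacts [hpsd k i x hx, posSemidef_hessC_sqDist 0 x]
  induction p using Finset.induction_on with
  | empty =>
    intro χ _ _ _ _
    exact ⟨|∫ x, χ x * mixMA n (fun _ => sqDist n 0) x|, abs_nonneg _, fun k => by
      simpa using le_abs_self _⟩
  | insert i p hi ih =>
    intro χ hχ hc hχV hχ0
    obtain ⟨b, hb⟩ := hc.exists_bound_of_continuous hχ
    have hb0 : 0 ≤ b := (norm_nonneg _).trans (hb 0)
    obtain ⟨χ₁, h1s, h1c, h1V, h10, -, h11⟩ := exists_contDiff_cutoff hc.isCompact hV hχV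
    obtain ⟨χ₂, h2s, h2c, h2V, h20, -, h21⟩ := exists_contDiff_cutoff h1c.isCompact hV h1V
    obtain ⟨C, hC, hle⟩ := abs_integral_mul_mixMA_update_le h1s h1c h2s.continuous h2c h20
      (fun x hx => (h21 x hx).self_of_nhds) h2V
    obtain ⟨B, hB, ihB⟩ := ih χ₂ h2s.continuous h2c h2V h20
    refine ⟨b * (|M| * (C * B)), by positivity, fun k => ?_⟩
    have hcomp : ∫ x, χ x * mixMA n (fun j => if j ∈ insert i p then F k j else sqDist n 0) x ≤
        b * ∫ x, χ₁ x * mixMA n (fun j => if j ∈ insert i p then F k j else sqDist n 0) x := by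
      rw [← integral_const_mul]
      refine integral_mono (integrable_mul_mixMA hχ hc (hsm _ k))
        ((integrable_mul_mixMA h1s.continuous h1c (hsm _ k)).const_mul b) fun x => ?_
      change χ x * _ ≤ b * (χ₁ x * _)
      rw [← mul_assoc]
      by_cases hx : x ∈ tsupport χ
      · refine mul_le_mul_of_nonneg_right ?_ (mixMA_nonneg fun j => hps _ k j x (hχV hx))
        rw [(h11 x hx).self_of_nhds, mul_one]
        exact (le_abs_self _).trans (hb x)
      · rw [image_eq_zero_of_notMem_tsupport hx, zero_mul]
        by_cases hxV : x ∈ V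
        · exact mul_nonneg (mul_nonneg hb0 (h10 x)) (mixMA_nonneg fun j => hps _ k j x hxV)
        · rw [image_eq_zero_of_notMem_tsupport fun h => hxV (h1V h)]
          simp
    refine hcomp.trans (mul_le_mul_of_nonneg_left ?_ hb0)
    have e1 : (fun j => if j ∈ insert i p then F k j else sqDist n 0) =
        Function.update (fun j => if j ∈ p then F k j else sqDist n 0) i (F k i) := by
      funext j
      by_cases hj : j = i
      · subst hj; simp
      · simp [hj]
    have e2 : (fun j => if j ∈ p then F k j else sqDist n 0) =
        Function.update (fun j => if j ∈ p then F k j else sqDist n 0) i (sqDist n 0) := by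
      funext j
      by_cases hj : j = i
      · subst hj; simp [hi]
      · simp [hj]
    rw [e1]
    refine (le_abs_self _).trans ((hle _ i (F k i) |M| (hsm p k) (hF k i)
      (fun j _ => hps p k j) (fun x hx => (hM k i x hx).trans (le_abs_self M))
      (abs_nonneg M)).trans ?_)
    rw [← e2]
    gcongr
    exact ihB k

end MassBounds

section MAConvergence

open scoped ContDiff ComplexOrder

variable {n : ℕ}

lemma tendsto_integral_mul_mixMA_hybrid {V : Set (Cn n)} (hV : IsOpen V) {v : ℕ → Cn n → ℝ}
    {u : Cn n → ℝ} (hv : ∀ k, ContDiff ℝ ∞ (v k)) (hu : ContDiff ℝ ∞ u)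
    (hvp : ∀ k, ∀ x ∈ V, (hessC n (v k) x).PosSemidef) (hup : ∀ x ∈ V, (hessC n u x).PosSemidef)
    {M : ℝ} (hvM : ∀ k, ∀ x ∈ V, |v k x| ≤ M) (huM : ∀ x ∈ V, |u x| ≤ M)
    (hlim : ∀ ε : ℝ, 0 < ε → ∀ᶠ k in atTop, ∀ x ∈ V, |v k x - u x| ≤ ε)
    {f : Cn n → ℝ} (hf : ContDiff ℝ ∞ f) (hc : HasCompactSupport f) (hfV : tsupport f ⊆ V)
    (p : Finset (Fin n)) :
    Tendsto (fun k => ∫ x, f x * mixMA n (fun i => if i ∈ p then v k else u) x) atTop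
      (𝓝 (∫ x, f x * mixMA n (fun _ => u) x)) := by
  have hsm : ∀ (p : Finset (Fin n)) k (i : Fin n), ContDiff ℝ ∞ (if i ∈ p then v k else u) := by
    intro p k i
    split_ifs
    exacts [hv k, hu]
  have hps : ∀ (p : Finset (Fin n)) k (i : Fin n), ∀ x ∈ V,
      (hessC n (if i ∈ p then v k else u) x).PosSemidef := by
    intro p k i x hx
    split_ifs
    exacts [hvp k x hx, hup x hx]
  induction p using Finset.induction_on with
  | empty => simp
  | insert i p hi ih =>
    obtain ⟨χ, hs, hχc, hχV, hχ0, -, hχ1⟩ := exists_contDiff_cutoff hc.isCompact hV hfV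
    obtain ⟨C, hC, hle⟩ := abs_integral_mul_mixMA_update_le hf hc hs.continuous hχc hχ0
      (fun x hx => (hχ1 x hx).self_of_nhds) hχV
    obtain ⟨B, hB, hmass⟩ := exists_integral_mul_mixMA_le hV (hsm p) (hps p) (M := M)
      (by intro k j x hx; split_ifs; exacts [hvM k x hx, huM x hx])
      (Finset.univ.erase i) χ hs.continuous hχc hχV hχ0
    have e0 : ∀ k, (fun j => if j ∈ Finset.univ.erase i then (if j ∈ p then v k else u)
        else sqDist n 0) = Function.update (fun j => if j ∈ p then v k else u) i (sqDist n 0) := by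
      intro k
      funext j
      by_cases hj : j = i
      · subst hj; simp
      · simp [hj]
    have e1 : ∀ k, (fun j => if j ∈ insert i p then v k else u) =
        Function.update (fun j => if j ∈ p then v k else u) i (v k) := by
      intro k
      funext j
      by_cases hj : j = i
      · subst hj; simp
      · simp [hj]
    have e2 : ∀ k, (fun j => if j ∈ p then v k else u) =
        Function.update (fun j => if j ∈ p then v k else u) i u := by
      intro k
      funext j
      by_cases hj : j = i
      · subst hj; simp [hi]
      · simp [hj]
    have hdiff : ∀ ε : ℝ, 0 < ε → ∀ᶠ k in atTop,
        |(∫ x, f x * mixMA n (fun j => if j ∈ insert i p then v k else u) x) -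
          ∫ x, f x * mixMA n (fun j => if j ∈ p then v k else u) x| ≤ ε * (C * B) := by
      intro ε hε
      filter_upwards [hlim ε hε] with k hk
      have hd := hle _ i (fun x => v k x - u x) ε (hsm p k) ((hv k).sub hu)
        (fun j _ => hps p k j) hk hε.le
      have hsub : ∀ x, f x * mixMA n (Function.update (fun j => if j ∈ p then v k else u) i
          fun x => v k x - u x) x =
          f x * mixMA n (fun j => if j ∈ insert i p then v k else u) x -
          f x * mixMA n (fun j => if j ∈ p then v k else u) x := by
        intro x
        rw [mixMA_update_sub _ i (hv k) hu, ← e1, ← e2, mul_sub]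
      simp only [hsub] at hd
      rw [integral_sub (integrable_mul_mixMA hf.continuous hc (hsm _ k))
        (integrable_mul_mixMA hf.continuous hc (hsm _ k)), ← e0] at hd
      refine hd.trans ?_
      gcongr
      exact hmass k
    have hz : Tendsto (fun k => (∫ x, f x * mixMA n (fun j => if j ∈ insert i p then v k else u) x) -
          ∫ x, f x * mixMA n (fun j => if j ∈ p then v k else u) x) atTop (𝓝 0) := by
      rw [Metric.tendsto_nhds]
      intro ε hε
      have hpos : 0 < C * B + 1 := by positivity
      filter_upwards [hdiff (ε / (C * B + 1)) (by positivity)] with k hk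
      rw [Real.dist_eq, sub_zero]
      refine hk.trans_lt ?_
      rw [div_mul_eq_mul_div, div_lt_iff₀ hpos]
      nlinarith
    simpa using hz.add ih

lemma tendsto_integral_mul_mixMA {V : Set (Cn n)} (hV : IsOpen V) {v : ℕ → Cn n → ℝ}
    {u : Cn n → ℝ} (hv : ∀ k, ContDiff ℝ ∞ (v k)) (hu : ContDiff ℝ ∞ u)
    (hvp : ∀ k, ∀ x ∈ V, (hessC n (v k) x).PosSemidef) (hup : ∀ x ∈ V, (hessC n u x).PosSemidef)
    {M : ℝ} (hvM : ∀ k, ∀ x ∈ V, |v k x| ≤ M) (huM : ∀ x ∈ V, |u x| ≤ M)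
    (hlim : ∀ ε : ℝ, 0 < ε → ∀ᶠ k in atTop, ∀ x ∈ V, |v k x - u x| ≤ ε)
    {f : Cn n → ℝ} (hf : Continuous f) (hc : HasCompactSupport f) (hfV : tsupport f ⊆ V) :
    Tendsto (fun k => ∫ x, f x * mixMA n (fun _ => v k) x) atTop
      (𝓝 (∫ x, f x * mixMA n (fun _ => u) x)) := by
  obtain ⟨χ, hs, hχc, hχV, hχ0, -, hχ1⟩ := exists_contDiff_cutoff hc.isCompact hV hfV
  obtain ⟨B, hB, hmass⟩ := exists_integral_mul_mixMA_le hV (F := fun (k : Option ℕ) _ =>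
      k.elim u v) (M := M)
    (by rintro (_ | k) i; exacts [hu, hv k]) (by rintro (_ | k) i x hx; exacts [hup x hx, hvp k x hx])
    (by rintro (_ | k) i x hx; exacts [huM x hx, hvM k x hx]) Finset.univ χ hs.continuous hχc hχV hχ0
  simp only [Finset.mem_univ, if_true] at hmass
  have hclose : ∀ {ε : ℝ} {g : Cn n → ℝ}, Continuous g → (∀ x, dist (g x) (f x) < ε) →
      Function.support g ⊆ Function.support f → 0 < ε → ∀ w : Cn n → ℝ, ContDiff ℝ ∞ w →
      (∀ x ∈ V, (hessC n w x).PosSemidef) → ∫ x, χ x * mixMA n (fun _ => w) x ≤ B →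
      |(∫ x, f x * mixMA n (fun _ => w) x) - ∫ x, g x * mixMA n (fun _ => w) x| ≤ ε * B := by
    intro ε g hg hgf hsup hε w hw hwp hwB
    have hgc : HasCompactSupport g := hc.mono hsup
    rw [← integral_sub (integrable_mul_mixMA hf hc fun _ => hw)
      (integrable_mul_mixMA hg hgc fun _ => hw)]
    refine abs_integral_le_integral_abs.trans (le_trans (integral_mono
      ((integrable_mul_mixMA hf hc fun _ => hw).sub (integrable_mul_mixMA hg hgc fun _ => hw)).abs
      ((integrable_mul_mixMA hs.continuous hχc fun _ => hw).const_mul ε) fun x => ?_)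
      (by rw [integral_const_mul]; gcongr))
    change |f x * mixMA n (fun _ => w) x - g x * mixMA n (fun _ => w) x| ≤
      ε * (χ x * mixMA n (fun _ => w) x)
    rw [← sub_mul, abs_mul, ← mul_assoc]
    by_cases hx : x ∈ tsupport f
    · have hm := mixMA_nonneg (F := fun _ => w) fun _ => hwp x (hfV hx)
      rw [(hχ1 x hx).self_of_nhds, mul_one, abs_of_nonneg hm]
      refine mul_le_mul_of_nonneg_right ?_ hm
      rw [← Real.dist_eq, dist_comm]
      exact (hgf x).le
    · have hf0 := image_eq_zero_of_notMem_tsupport hx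
      have hg0 : g x = 0 := by
        by_contra h
        exact hx (subset_tsupport f (hsup h))
      rw [hf0, hg0, sub_zero, abs_zero, zero_mul]
      by_cases hxV : x ∈ V
      · exact mul_nonneg (mul_nonneg hε.le (hχ0 x)) (mixMA_nonneg fun _ => hwp x hxV)
      · rw [image_eq_zero_of_notMem_tsupport fun h => hxV (hχV h)]
        simp
  rw [Metric.tendsto_nhds]
  intro η hη
  set ε := η / (3 * (B + 1)) with hεdef
  have hε : 0 < ε := by positivity
  have hεB : ε * B < η / 3 := by
    rw [hεdef, div_mul_eq_mul_div, div_lt_div_iff₀ (by positivity) (by norm_num)]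
    nlinarith
  obtain ⟨g, hgs, hgf, hsup⟩ := hf.exists_contDiff_approx ⊤ (ε := fun _ => ε) continuous_const
    fun _ => hε
  have hgc : HasCompactSupport g := hc.mono hsup
  have hgV : tsupport g ⊆ V := (closure_mono hsup).trans hfV
  have ht := tendsto_integral_mul_mixMA_hybrid hV hv hu hvp hup hvM huM hlim hgs hgc hgV Finset.univ
  simp only [Finset.mem_univ, if_true] at ht
  filter_upwards [(Metric.tendsto_nhds.1 ht) (η / 3) (by positivity)] with k hk
  rw [Real.dist_eq] at hk ⊢
  have h1 := hclose hgs.continuous hgf hsup hε (v k) (hv k) (hvp k) (hmass (some k))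
  have h2 := hclose hgs.continuous hgf hsup hε u hu hup (hmass none)
  rw [abs_le] at h1 h2
  rw [abs_lt] at hk ⊢
  constructor <;> linarith [h1.1, h1.2, h2.1, h2.2, hk.1, hk.2]

end MAConvergence

section MAMeasureSmooth

open scoped ContDiff ComplexOrder

variable {n : ℕ}

lemma contDiff_mul_of_contDiffOn {θ v : Cn n → ℝ} {U : Set (Cn n)} (hU : IsOpen U)
    (hθ : ContDiff ℝ ∞ θ) (hθU : tsupport θ ⊆ U) (hv : ContDiffOn ℝ ∞ v U) :
    ContDiff ℝ ∞ fun x => θ x * v x := by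
  rw [contDiff_iff_contDiffAt]
  intro x
  by_cases hx : x ∈ tsupport θ
  · exact hθ.contDiffAt.mul (hv.contDiffAt (hU.mem_nhds (hθU hx)))
  · have h0 : (fun x => θ x * v x) =ᶠ[𝓝 x] fun _ => 0 := by
      filter_upwards [(isClosed_tsupport θ).isOpen_compl.mem_nhds hx] with y hy
      rw [image_eq_zero_of_notMem_tsupport hy, zero_mul]
    exact contDiffAt_const.congr_of_eventuallyEq h0

/-- Continuity of the Monge–Ampère operator along decreasing sequences of smooth psh functions
with smooth limit. -/
lemma tendsto_integral_mul_maDensity {U : Set (Cn n)} (hU : IsOpen U) {v : ℕ → Cn n → ℝ}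
    (hv : ∀ k, ContDiffOn ℝ ∞ (v k) U)
    (hpsh : ∀ k, PlurisubharmonicOn (fun z => ((v k z : ℝ) : EReal)) U)
    (hanti : ∀ k, ∀ z ∈ U, v (k + 1) z ≤ v k z) {u : Cn n → ℝ} (hu : ContDiff ℝ ∞ u)
    (hup : ∀ x ∈ U, (hessC n u x).PosSemidef)
    (hinf : ∀ z ∈ U, (⨅ k, ((v k z : ℝ) : EReal)) = (u z : EReal))
    {f : Cn n → ℝ} (hf : Continuous f) (hc : HasCompactSupport f) (hfU : tsupport f ⊆ U) :
    Tendsto (fun k => ∫ z, f z * maDensity n (v k) z) atTop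
      (𝓝 (∫ z, f z * maDensity n u z)) := by
  obtain ⟨L, hL, hfL, hLU⟩ := exists_compact_between hc.isCompact hU hfU
  obtain ⟨θ, hθ, hθc, hθU, -, -, hθ1⟩ := exists_contDiff_cutoff hL hU hLU
  have hle : ∀ k, ∀ z ∈ U, u z ≤ v k z := by
    intro k z hz
    have := iInf_le (fun k => ((v k z : ℝ) : EReal)) k
    rw [hinf z hz] at this
    exact EReal.coe_le_coe_iff.1 this
  have hmono : ∀ z ∈ U, Antitone fun k => v k z := fun z hz =>
    antitone_nat_of_succ_le fun k => hanti k z hz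
  have hV : IsOpen (interior L) := isOpen_interior
  have hw : ∀ k, ContDiff ℝ ∞ fun x => θ x * v k x := fun k =>
    contDiff_mul_of_contDiffOn hU hθ hθU (hv k)
  have hwe : ∀ k, ∀ x ∈ L, (fun x => θ x * v k x) =ᶠ[𝓝 x] v k := by
    intro k x hx
    filter_upwards [hθ1 x hx] with y hy
    rw [hy, one_mul]
  have hwx : ∀ k, ∀ x ∈ L, θ x * v k x = v k x := fun k x hx => (hwe k x hx).self_of_nhds
  obtain ⟨M₀, hM₀⟩ := hL.exists_bound_of_continuousOn ((hv 0).continuousOn.mono hLU)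
  obtain ⟨M₁, hM₁⟩ := hL.exists_bound_of_continuousOn hu.continuous.continuousOn
  simp only [Real.norm_eq_abs] at hM₀ hM₁
  have key := tendsto_integral_mul_mixMA hV (v := fun k x => θ x * v k x) (u := u)
    (M := max M₀ M₁) hw hu ?_ (fun x hx => hup x (hLU (interior_subset hx))) ?_ ?_ ?_ hf hc hfL
  · have e : ∀ k, (fun z => f z * maDensity n (v k) z) =
        fun z => f z * mixMA n (fun _ z => θ z * v k z) z := by
      intro k
      funext z
      by_cases hz : z ∈ tsupport f
      · rw [maDensity_eq_mixMA, mixMA_congr fun _ => hwe k z (interior_subset (hfL hz))]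
      · rw [image_eq_zero_of_notMem_tsupport hz, zero_mul, zero_mul]
    have e' : (fun z => f z * maDensity n u z) = fun z => f z * mixMA n (fun _ => u) z := by
      funext z
      rw [maDensity_eq_mixMA]
    simp only [e, e']
    exact key
  · intro k x hx
    refine posSemidef_hessC (hw k) hV ?_ hx
    refine ((hpsh k).mono (interior_subset.trans hLU)).congr fun z hz => ?_
    rw [hwx k z (interior_subset hz)]
  · intro k x hx
    have hxL := interior_subset hx
    change |θ x * v k x| ≤ _
    rw [hwx k x hxL]
    have h1 := hle k x (hLU hxL)
    have h2 := hmono x (hLU hxL) (Nat.zero_le k)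
    have h3 := abs_le.1 (hM₀ x hxL)
    have h4 := abs_le.1 (hM₁ x hxL)
    exact abs_le.2 ⟨by linarith [le_max_right M₀ M₁], by
      linarith [le_max_left M₀ M₁, show v k x ≤ v 0 x from h2]⟩
  · exact fun x hx => (hM₁ x (interior_subset hx)).trans (le_max_right _ _)
  · intro ε hε
    obtain ⟨k₀, hk₀⟩ := exists_forall_lt_of_antitone hL (h := v)
      (fun k => (hv k).continuousOn.mono hLU) (fun k x hx => hanti k x (hLU hx))
      (c := fun x => u x + ε) (hu.continuous.add continuous_const).continuousOn (by
        intro x hx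
        have h1 : (⨅ k, ((v k x : ℝ) : EReal)) < ((u x + ε : ℝ) : EReal) := by
          rw [hinf x (hLU hx)]
          exact EReal.coe_lt_coe_iff.2 (by linarith)
        obtain ⟨k, hk⟩ := iInf_lt_iff.1 h1
        exact ⟨k, EReal.coe_lt_coe_iff.1 hk⟩)
    filter_upwards [eventually_ge_atTop k₀] with k hk x hx
    have hxL := interior_subset hx
    rw [hwx k x hxL, abs_le]
    have h1 := hle k x (hLU hxL)
    have h2 := hk₀ k hk x hxL
    exact ⟨by linarith, by linarith⟩

lemma sqDist_disc (a' a b : Cn n) (ζ : ℂ) : sqDist n a' (a + ζ • b) = sqDist n a' a +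
    2 * ((∑ i, (starRingEnd ℂ) (a i - a' i) * b i) * ζ).re + ‖ζ‖ ^ 2 * sqDist n 0 b := by
  rw [Finset.sum_mul, Complex.re_sum, Finset.mul_sum, ← Complex.normSq_eq_norm_sq,
    Complex.normSq_apply]
  simp only [sqDist, Finset.mul_sum]
  rw [← Finset.sum_add_distrib, ← Finset.sum_add_distrib]
  refine Finset.sum_congr rfl fun i _ => ?_
  simp
  ring

lemma plurisubharmonicOn_sqDist (a : Cn n) {c : ℝ} (hc : 0 ≤ c) (d : ℝ) (Ω : Set (Cn n)) :
    PlurisubharmonicOn (fun z => ((c * sqDist n a z + d : ℝ) : EReal)) Ω := by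
  constructor
  · exact ((continuous_coe_real_ereal.comp ((continuous_const.mul
      (contDiff_sqDist a).continuous).add continuous_const)).upperSemicontinuous).upperSemicontinuousOn Ω
  · intro x b r hr _ p hp ζ hζ
    set s := ∑ i, (starRingEnd ℂ) (x i - a i) * b i with hs
    set Q : Polynomial ℂ := Polynomial.C ((c * (sqDist n a x + r ^ 2 * sqDist n 0 b) + d : ℝ) : ℂ) +
      Polynomial.C ((2 * c : ℝ) : ℂ) * (Polynomial.C s * Polynomial.X) - p with hQ
    have hQe : ∀ ξ, (Q.eval ξ).re = c * (sqDist n a x + r ^ 2 * sqDist n 0 b) + d +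
        2 * c * (s * ξ).re - (p.eval ξ).re := by
      intro ξ
      simp only [hQ, Polynomial.eval_sub, Polynomial.eval_add, Polynomial.eval_mul,
        Polynomial.eval_C, Polynomial.eval_X, Complex.sub_re, Complex.add_re, Complex.ofReal_re,
        Complex.re_ofReal_mul]
    have h1 : (Q.eval ζ).re ≤ 0 := by
      refine re_eval_le_of_circle hr (fun ξ hξ => ?_) hζ
      have h2 := EReal.coe_le_coe_iff.1 (hp ξ hξ)
      rw [sqDist_disc, hξ] at h2
      rw [hQe]
      linarith
    refine EReal.coe_le_coe_iff.2 ?_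
    rw [hQe] at h1
    rw [sqDist_disc]
    have h3 : 0 ≤ sqDist n 0 b := Finset.sum_nonneg fun i _ => by positivity
    have h4 : ‖ζ‖ ^ 2 ≤ r ^ 2 := by gcongr
    have h5 := mul_le_mul_of_nonneg_left (mul_le_mul_of_nonneg_right h4 h3) hc
    linarith

lemma hessC_affine_sqDist (a x : Cn n) (c d : ℝ) :
    hessC n (fun z => c * sqDist n a z + d) x = (c : ℂ) • (1 : Matrix (Fin n) (Fin n) ℂ) := by
  rw [hessC_add (contDiff_const.mul (contDiff_sqDist a)) contDiff_const,
    hessC_const_mul (contDiff_sqDist a), hessC_const, hessC_sqDist, add_zero]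

lemma mixMA_affine_sqDist (a x : Cn n) (c d : ℝ) :
    mixMA n (fun _ z => c * sqDist n a z + d) x = 4 ^ n * (n.factorial * c ^ n) := by
  simp only [mixMA, hessC_affine_sqDist, mixDet_const, Matrix.det_smul, Matrix.det_one, mul_one,
    Fintype.card_fin]
  norm_cast

lemma isMAMeasure_affine_sqDist {Ω : Set (Cn n)} (hΩ : IsOpen Ω) (a : Cn n) {c : ℝ}
    (hc : 0 ≤ c) (d : ℝ) :
    IsMAMeasure n (fun z => ((c * sqDist n a z + d : ℝ) : EReal)) Ω
      (ENNReal.ofReal (4 ^ n * (n.factorial * c ^ n)) • volume.restrict Ω) := by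
  refine ⟨by simp [hΩ.measurableSet], fun K hK _ => ?_, ?_⟩
  · rw [Measure.smul_apply, smul_eq_mul]
    exact ENNReal.mul_ne_top ENNReal.ofReal_ne_top
      ((Measure.restrict_apply_le _ _).trans_lt hK.measure_lt_top).ne
  · intro U hU hUΩ v hv hpsh hanti hinf f hf hfc hfU
    have hu : ContDiff ℝ ∞ fun z => c * sqDist n a z + d :=
      (contDiff_const.mul (contDiff_sqDist a)).add contDiff_const
    have h := tendsto_integral_mul_maDensity hU hv hpsh hanti hu (fun x hx => posSemidef_hessC hu
      hU (plurisubharmonicOn_sqDist a hc d U) hx) hinf hf hfc hfU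
    convert h using 2
    rw [integral_smul_measure, ENNReal.toReal_ofReal (by positivity), setIntegral_eq_integral_of_forall_compl_eq_zero
      fun x hx => image_eq_zero_of_notMem_tsupport fun h => hx (hUΩ (hfU h)), smul_eq_mul,
      ← integral_const_mul]
    refine integral_congr_ae (Eventually.of_forall fun x => ?_)
    change _ = f x * maDensity n _ x
    rw [maDensity_eq_mixMA, mixMA_affine_sqDist]
    exact mul_comm _ _

/-- Lebesgue measure is controlled by capacity. -/
lemma exists_volume_le_mul_MACap {Ω : Set (Cn n)} (hΩ : IsOpen Ω)
    (hb : Bornology.IsBounded Ω) : ∃ C : ℝ≥0∞, C ≠ ⊤ ∧ ∀ S, S ⊆ Ω → volume S ≤ C * MACap n Ω S := by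
  obtain ⟨R, hR⟩ := (hb.isCompact_closure).exists_bound_of_continuousOn
    (contDiff_sqDist (0 : Cn n)).continuous.continuousOn
  set M := max R 1 with hMdef
  have hM : 0 < M := lt_of_lt_of_le one_pos (le_max_right _ _)
  have hle : ∀ z ∈ Ω, sqDist n 0 z ≤ M := fun z hz =>
    (le_abs_self _).trans ((hR z (subset_closure hz)).trans (le_max_left _ _))
  have hpos : (0:ℝ) < 4 ^ n * (n.factorial * (M⁻¹) ^ n) := by positivity
  set κ := ENNReal.ofReal (4 ^ n * (n.factorial * (M⁻¹) ^ n)) with hκ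
  have hκ0 : κ ≠ 0 := (ENNReal.ofReal_pos.2 hpos).ne'
  refine ⟨κ⁻¹, ENNReal.inv_ne_top.2 hκ0, fun S hS => ?_⟩
  have h1 : κ * volume S ≤ MACap n Ω S := by
    have hmem : (fun z => ((M⁻¹ * sqDist n 0 z + (-1) : ℝ) : EReal)) ∈
        {u : Cn n → EReal | PlurisubharmonicOn u Ω ∧ ∀ z ∈ Ω, -1 ≤ u z ∧ u z ≤ 0} := by
      refine ⟨plurisubharmonicOn_sqDist 0 (by positivity) _ Ω, fun z hz => ⟨?_, ?_⟩⟩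
      · change ((-1 : ℝ) : EReal) ≤ _
        refine EReal.coe_le_coe_iff.2 ?_
        have : 0 ≤ M⁻¹ * sqDist n 0 z := mul_nonneg (by positivity)
          (Finset.sum_nonneg fun i _ => by positivity)
        linarith
      · refine EReal.coe_le_coe_iff.2 ?_
        have : M⁻¹ * sqDist n 0 z ≤ 1 := by
          rw [inv_mul_le_iff₀ hM, mul_one]
          exact hle z hz
        linarith
    have h2 : (κ • volume.restrict Ω) S = κ * volume S := by
      rw [Measure.smul_apply, smul_eq_mul, Measure.restrict_eq_self _ hS]
    rw [← h2]
    exact le_iSup₂_of_le _ hmem (le_iSup₂_of_le (κ • volume.restrict Ω)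
      (isMAMeasure_affine_sqDist hΩ 0 (by positivity) (-1)) le_rfl)
  calc volume S = κ⁻¹ * (κ * volume S) := by
        rw [← mul_assoc, ENNReal.inv_mul_cancel hκ0 ENNReal.ofReal_ne_top, one_mul]
    _ ≤ κ⁻¹ * MACap n Ω S := by gcongr

end MAMeasureSmooth

section CapacityBound

open scoped ContDiff ComplexOrder

variable {n : ℕ}

/-- Adding a nonnegative compactly supported bump decreases the Monge–Ampère energy tested against
a function that is superharmonic on the support of the bump. -/
lemma integral_mul_mixMA_add_le {ψ g H : Cn n → ℝ} (hψ : ContDiff ℝ ∞ ψ) (hg : ContDiff ℝ ∞ g)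
    (hH : ContDiff ℝ ∞ H) (hc : HasCompactSupport H)
    (hg0 : ∀ x, 0 ≤ g x)
    (h1 : ∀ x ∈ tsupport g, (hessC n ψ x).PosSemidef)
    (h2 : ∀ x ∈ tsupport g, (hessC n (fun y => ψ y + g y) x).PosSemidef)
    (h3 : ∀ x ∈ tsupport g, (hessC n (fun y => (-1) * H y) x).PosSemidef) :
    ∫ x, H x * mixMA n (fun _ y => ψ y + g y) x ≤ ∫ x, H x * mixMA n (fun _ => ψ) x := by
  set W : Cn n → ℝ := fun y => ψ y + g y with hW
  have hWs : ContDiff ℝ ∞ W := hψ.add hg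
  have hsm : ∀ (p : Finset (Fin n)) (i : Fin n), ContDiff ℝ ∞ (if i ∈ p then W else ψ) := by
    intro p i
    split_ifs
    exacts [hWs, hψ]
  suffices h : ∀ p : Finset (Fin n), ∫ x, H x * mixMA n (fun i => if i ∈ p then W else ψ) x ≤
      ∫ x, H x * mixMA n (fun _ => ψ) x by
    simpa using h Finset.univ
  intro p
  induction p using Finset.induction_on with
  | empty => simp
  | insert i p hi ih =>
    refine le_trans ?_ ih
    have e1 : (fun j => if j ∈ insert i p then W else ψ) =
        Function.update (fun j => if j ∈ p then W else ψ) i W := by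
      funext j
      by_cases hj : j = i
      · subst hj; simp
      · simp [hj]
    have e2 : (fun j => if j ∈ p then W else ψ) =
        Function.update (fun j => if j ∈ p then W else ψ) i ψ := by
      funext j
      by_cases hj : j = i
      · subst hj; simp [hi]
      · simp [hj]
    have hsub : ∀ x, H x * mixMA n (Function.update (fun j => if j ∈ p then W else ψ) i g) x =
        H x * mixMA n (fun j => if j ∈ insert i p then W else ψ) x -
          H x * mixMA n (fun j => if j ∈ p then W else ψ) x := by
      intro x
      have hgW : g = fun y => W y - ψ y := by
        funext y
        simp [hW]
      have key := mixMA_update_sub (fun j => if j ∈ p then W else ψ) i hWs hψ x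
      rw [← hgW, ← e2] at key
      rw [e1, key, mul_sub]
    have hle : ∫ x, H x * mixMA n (Function.update (fun j => if j ∈ p then W else ψ) i g) x ≤ 0 := by
      rw [integral_mul_mixMA_comm _ (hsm p) i hH hg (Or.inl hc)]
      refine integral_nonpos fun x => ?_
      change g x * _ ≤ 0
      by_cases hx : x ∈ tsupport g
      · refine mul_nonpos_of_nonneg_of_nonpos (hg0 x) ?_
        have := mixMA_update_nonneg (F := fun j => if j ∈ p then W else ψ) (i := i)
          (fun j _ => by
            split_ifs
            exacts [h2 x hx, h1 x hx]) (h3 x hx)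
        rw [mixMA_update_const_mul _ i hH] at this
        linarith
      · rw [image_eq_zero_of_notMem_tsupport hx, zero_mul]
    simp only [hsub] at hle
    rw [integral_sub (integrable_mul_mixMA hH.continuous hc (hsm _))
      (integrable_mul_mixMA hH.continuous hc (hsm _))] at hle
    linarith

lemma IsCompact.exists_forall_closedBall_subset {K O : Set (Cn n)} (hK : IsCompact K)
    (hO : IsOpen O) (h : K ⊆ O) : ∃ δ : ℝ, 0 < δ ∧ ∀ x ∈ K, Metric.closedBall x δ ⊆ O := by
  obtain ⟨δ, hδ, hsub⟩ := hK.exists_cthickening_subset_open hO h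
  exact ⟨δ, hδ, fun x hx => (Metric.closedBall_subset_cthickening hx δ).trans hsub⟩

lemma isCompact_sqDist_le (a : Cn n) (s : ℝ) : IsCompact {z | sqDist n a z ≤ s} := by
  refine (isCompact_closedBall a (Real.sqrt s)).of_isClosed_subset
    (isClosed_le (contDiff_sqDist a).continuous continuous_const) fun z hz => ?_
  rw [Metric.mem_closedBall, dist_eq_norm]
  exact Real.le_sqrt_of_sq_le ((norm_sq_le_sqDist a z).trans hz)

lemma isOpen_sqDist_lt (a : Cn n) (s : ℝ) : IsOpen {z | sqDist n a z < s} :=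
  isOpen_lt (contDiff_sqDist a).continuous continuous_const

lemma sqDist_nonneg (a z : Cn n) : 0 ≤ sqDist n a z :=
  Finset.sum_nonneg fun i _ => by positivity

/-- Averaging changes an affine function of the squared distance by a constant. -/
lemma kAvg_affine_sqDist {k : Cn n → ℝ} (hk : CircledKernel volume k) (a : Cn n) (c d s ε : ℝ)
    (hε : 0 ≤ ε) {x y : Cn n} (hx : Metric.closedBall x ε ⊆ {z | sqDist n a z < s})
    (hy : Metric.closedBall y ε ⊆ {z | sqDist n a z < s}) {v : Cn n → ℝ}
    (hv : Measurable v) {M : ℝ} (hM : ∀ z, |v z| ≤ M)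
    (hvs : ∀ z, sqDist n a z < s → v z = c * sqDist n a z + d) :
    kAvg volume k v ε x - kAvg volume k v ε y =
      c * sqDist n a x - c * sqDist n a y := by
  have hsym : ∀ x, 2 * kAvg volume k v ε x =
      ∫ w, k w * (v (x + (ε : ℂ) • w) + v (x + (-ε : ℂ) • w)) := by
    intro x
    have h := hk.integral_smul_eq (v := v) (-1) (by simp) ε x
    simp only [mul_neg, mul_one] at h
    simp only [mul_add]
    rw [integral_add (hk.integrable_kAvg hv hM _ x) (hk.integrable_kAvg hv hM _ x), h, kAvg]
    ring
  have hval : ∀ {x : Cn n}, Metric.closedBall x ε ⊆ {z | sqDist n a z < s} → ∀ w : Cn n, ‖w‖ ≤ 1 →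
      v (x + (ε : ℂ) • w) + v (x + (-ε : ℂ) • w) =
        2 * (c * sqDist n a x) + 2 * d + 2 * c * (ε ^ 2 * sqDist n 0 w) := by
    intro x hx w hw
    have hmem : ∀ e : ℂ, ‖e‖ = ε → x + e • w ∈ {z | sqDist n a z < s} := by
      intro e he
      refine hx ?_
      rw [Metric.mem_closedBall, dist_eq_norm, add_sub_cancel_left, norm_smul, he]
      exact mul_le_of_le_one_right hε hw
    have hn : ‖(ε : ℂ)‖ = ε := by rw [Complex.norm_real, Real.norm_eq_abs, abs_of_nonneg hε]
    rw [hvs _ (hmem ε hn), hvs _ (hmem (-ε) (by rw [norm_neg, hn])), sqDist_disc, sqDist_disc,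
      norm_neg, hn]
    simp only [mul_neg, Complex.neg_re]
    ring
  have hInt : ∀ x, Integrable fun w => k w * (v (x + (ε : ℂ) • w) + v (x + (-ε : ℂ) • w)) := by
    intro x
    simp only [mul_add]
    exact (hk.integrable_kAvg hv hM _ x).add (hk.integrable_kAvg hv hM _ x)
  have h2 : 2 * (kAvg volume k v ε x - kAvg volume k v ε y) =
      ∫ w, k w * (2 * (c * sqDist n a x) - 2 * (c * sqDist n a y)) := by
    rw [mul_sub, hsym, hsym, ← integral_sub (hInt x) (hInt y)]
    refine integral_congr_ae (ae_of_all _ fun w => ?_)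
    by_cases hw : 1 < ‖w‖
    · simp [hk.support w hw]
    · simp only
      rw [hval hx w (not_lt.1 hw), hval hy w (not_lt.1 hw)]
      ring
  rw [integral_mul_const, hk.integral_eq_one] at h2
  linarith

end CapacityBound

section Gluing

open scoped ContDiff ComplexOrder

variable {n : ℕ}

/-- Regularizations of a psh function with values in `[-1, 0]` agree near the centre of a ball,
up to a constant, with a fixed paraboloid plus a compactly supported bump. -/
lemma exists_gluing {k : Cn n → ℝ} (hk : CircledKernel volume k) (hks : ContDiff ℝ ∞ k)
    (x0 : Cn n) {s : ℝ} (hs : 0 < s) :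
    ∃ ε0 : ℝ, 0 < ε0 ∧ ∀ w : Cn n → ℝ, Measurable w → (∀ z, -1 ≤ w z) → (∀ z, w z ≤ 0) →
      PlurisubharmonicOn (fun z => (w z : EReal)) {z | sqDist n x0 z < s} →
      ∀ ε, 0 < ε → ε ≤ ε0 → ∃ (g : Cn n → ℝ) (c : ℝ), ContDiff ℝ ∞ g ∧ (∀ x, 0 ≤ g x) ∧
        tsupport g ⊆ {z | sqDist n x0 z ≤ 3 / 4 * s} ∧
        (∀ x, sqDist n x0 x < 7 / 8 * s →
          (hessC n (fun y => (8 / s * sqDist n x0 y + -4) + g y) x).PosSemidef) ∧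
        ∀ x, sqDist n x0 x < s / 8 →
          kAvg volume k w ε x = ((8 / s * sqDist n x0 x + -4) + g x) + c := by
  set q := sqDist n x0 with hq
  have hqc : Continuous q := (contDiff_sqDist x0).continuous
  have hq0 : ∀ z, 0 ≤ q z := sqDist_nonneg x0
  have hsub : ∀ {a b : ℝ}, a < b → {z | q z ≤ a} ⊆ {z | q z < b} :=
    fun h z hz => lt_of_le_of_lt hz h
  obtain ⟨e1, he1, h1⟩ := (isCompact_sqDist_le x0 (7 / 8 * s)).exists_forall_closedBall_subset
    (isOpen_sqDist_lt x0 s) (hsub (by linarith))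
  obtain ⟨e2, he2, h2⟩ := (isCompact_sqDist_le x0 (s / 8)).exists_forall_closedBall_subset
    (isOpen_sqDist_lt x0 (s / 4)) (hsub (by linarith))
  obtain ⟨e3, he3, h3⟩ := (isCompact_sqDist_le x0 (s / 2)).exists_forall_closedBall_subset
    (isOpen_sqDist_lt x0 (3 / 4 * s)) (hsub (by linarith))
  refine ⟨min e1 (min e2 e3), by positivity, fun w hw hw1 hw0 hpsh ε hε hεle => ?_⟩
  have hε1 : ε ≤ e1 := hεle.trans (min_le_left _ _)
  have hε2 : ε ≤ e2 := hεle.trans ((min_le_right _ _).trans (min_le_left _ _))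
  have hε3 : ε ≤ e3 := hεle.trans ((min_le_right _ _).trans (min_le_right _ _))
  set ψ : Cn n → ℝ := fun y => 8 / s * q y + -4 with hψ
  have hψs : ContDiff ℝ ∞ ψ := by
    have := contDiff_sqDist x0
    rw [hψ, hq]
    fun_prop
  have hψlow : ∀ z, -4 ≤ ψ z := fun z => by
    have : 0 ≤ 8 / s * q z := mul_nonneg (by positivity) (hq0 z)
    simp only [hψ]
    linarith
  have hψval : ∀ z, s * (ψ z + 4) = 8 * q z := fun z => by
    simp only [hψ]
    field_simp
    ring
  set φ : Cn n → ℝ := fun z => Max.max (w z - ψ z) 0 with hφ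
  have hφm : Measurable φ := (hw.sub hψs.continuous.measurable).max measurable_const
  have hφ0 : ∀ z, 0 ≤ φ z := fun z => le_max_right _ _
  have hφb : ∀ z, |φ z| ≤ 4 := fun z => by
    rw [abs_of_nonneg (hφ0 z)]
    exact max_le (by linarith [hw0 z, hψlow z]) (by norm_num)
  have hφz : ∀ z, s / 2 ≤ q z → φ z = 0 := fun z hz => by
    refine max_eq_right ?_
    have : 0 ≤ ψ z := by
      by_contra hneg
      nlinarith [hψval z]
    linarith [hw0 z]
  set ψB : Cn n → ℝ := fun z => if q z < s then ψ z else 0 with hψB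
  have hB : MeasurableSet {z | q z < s} := (isOpen_sqDist_lt x0 s).measurableSet
  have hψBm : Measurable ψB := Measurable.ite hB hψs.continuous.measurable measurable_const
  have hψBb : ∀ z, |ψB z| ≤ 4 := fun z => by
    simp only [hψB]
    split_ifs with h
    · refine abs_le.2 ⟨hψlow z, ?_⟩
      by_contra hneg
      nlinarith [hψval z]
    · simp
  set v : Cn n → ℝ := fun z => φ z + ψB z with hv
  have hvm : Measurable v := hφm.add hψBm
  have hvb : ∀ z, |v z| ≤ 4 + 4 := fun z =>
    (abs_add_le _ _).trans (add_le_add (hφb z) (hψBb z))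
  have hvmax : ∀ z, q z < s → v z = Max.max (w z) (ψ z) := fun z hz => by
    simp only [hv, hφ, hψB, if_pos hz]
    rw [max_add, sub_add_cancel, zero_add]
  have hvpsh : PlurisubharmonicOn (fun z => (v z : EReal)) {z | q z < s} := by
    refine (hpsh.max (plurisubharmonicOn_sqDist x0 (c := 8 / s) (by positivity) (-4) _)).congr
      fun z hz => ?_
    change (v z : EReal) = Max.max (w z : EReal) (ψ z : EReal)
    rw [hvmax z hz, EReal.coe_strictMono.monotone.map_max]
  have hgadd : ∀ x, kAvg volume k v ε x = kAvg volume k φ ε x + kAvg volume k ψB ε x :=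
    fun x => kAvg_add hk hφm hφb hψBm hψBb ε x
  set c : ℝ := kAvg volume k ψB ε x0 - 8 / s * q x0 + 4 with hc
  have hball : ∀ x, q x ≤ 7 / 8 * s → Metric.closedBall x ε ⊆ {z | q z < s} := fun x hx =>
    (Metric.closedBall_subset_closedBall hε1).trans (h1 x hx)
  have hx0 : q x0 = 0 := by simp [hq, sqDist]
  have hval : ∀ x, q x ≤ 7 / 8 * s →
      kAvg volume k v ε x = (ψ x + kAvg volume k φ ε x) + c := fun x hx => by
    have := kAvg_affine_sqDist hk x0 (8 / s) (-4) s ε hε.le (hball x hx)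
      (hball x0 (by rw [hx0]; positivity)) hψBm hψBb
      (fun z hz => by simp only [hψB]; rw [if_pos hz])
    rw [hgadd, hc]
    simp only [hψ]
    linarith
  have hgs : ContDiff ℝ ∞ (kAvg volume k φ ε) :=
    contDiff_kAvg_of_locallyIntegrable hk hks (locallyIntegrable_of_abs_le hφm hφb) hε
  refine ⟨kAvg volume k φ ε, c, hgs, fun x => ?_, ?_, fun x hx => ?_, fun x hx => ?_⟩
  · exact integral_nonneg fun y => mul_nonneg (hk.nonneg y) (hφ0 _)
  · refine closure_minimal (fun x hx => ?_) (isClosed_le hqc continuous_const)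
    by_contra hx'
    refine hx ?_
    rw [kAvg_congr hk hε.le (w := fun _ => 0), kAvg_const hk]
    intro z hz
    refine hφz z (le_of_not_ge fun hz' => hx' ?_)
    have : x ∈ {z | q z < 3 / 4 * s} :=
      h3 z hz' (Metric.closedBall_subset_closedBall hε3 (Metric.mem_closedBall_comm.1 hz))
    exact (show q x < 3 / 4 * s from this).le
  · refine posSemidef_hessC (hψs.add hgs) (isOpen_sqDist_lt x0 (7 / 8 * s)) ?_ hx
    refine (((plurisubharmonicOn_kAvg hk hks hvpsh hvm hvb hε).mono
      fun y (hy : q y < 7 / 8 * s) => hball y hy.le).add_const (-c)).congr fun y hy => ?_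
    rw [hval y (le_of_lt hy), ← EReal.coe_add]
    congr 1
    simp only [hψ]
    ring
  · rw [← hval x (by linarith)]
    refine kAvg_congr hk hε.le fun z hz => ?_
    have hz4 : q z < s / 4 :=
      h2 x hx.le (Metric.closedBall_subset_closedBall hε2 hz)
    rw [hvmax z (by linarith), max_eq_left]
    refine le_trans ?_ (hw1 z)
    by_contra hneg
    nlinarith [hψval z]

end Gluing

section LocalBound

open scoped ContDiff ComplexOrder

variable {n : ℕ}

lemma tendsto_div_natCast_add_one (d : ℝ) : Tendsto (fun j : ℕ => d / ((j : ℝ) + 1)) atTop (𝓝 0) :=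
  tendsto_const_nhds.div_atTop
    (tendsto_atTop_add_const_right _ _ tendsto_natCast_atTop_atTop)

/-- Small averages of a truncated psh function stay below a level on compact subsets of the
sublevel set. -/
lemma exists_kAvg_lt {k : Cn n → ℝ} (hk : CircledKernel volume k) (hks : ContDiff ℝ ∞ k)
    {Ω : Set (Cn n)} (hΩ : IsOpen Ω) {w : Cn n → ℝ}
    (hpsh : PlurisubharmonicOn (fun z => (w z : EReal)) Ω) (hw : Measurable w) {M : ℝ}
    (hM : ∀ z, |w z| ≤ M) {S : Set (Cn n)} (hS : IsCompact S) {d : ℝ} (hd : 0 < d)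
    (hSd : ∀ x ∈ S, Metric.closedBall x d ⊆ Ω) {c : ℝ} (hc : ∀ x ∈ S, w x < c) :
    ∃ ε, 0 < ε ∧ ε ≤ d ∧ ∀ x ∈ S, kAvg volume k w ε x < c := by
  set ε : ℕ → ℝ := fun j => d / ((j : ℝ) + 1) with hε
  have hε0 : ∀ j, 0 < ε j := fun j => by positivity
  have hεd : ∀ j, ε j ≤ d := fun j =>
    div_le_self hd.le (by linarith [j.cast_nonneg (α := ℝ)])
  have hεanti : ∀ j, ε (j + 1) ≤ ε j := fun j => by
    simp only [hε]
    gcongr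
    linarith
  obtain ⟨j, hj⟩ := exists_forall_lt_of_antitone hS (h := fun j => kAvg volume k w (ε j))
    (c := fun _ => c)
    (fun j => (contDiff_kAvg_of_locallyIntegrable hk hks
      (locallyIntegrable_of_abs_le hw hM) (hε0 j)).continuous.continuousOn)
    (fun j x hx => kAvg_mono hk hpsh hw hM (hε0 _).le (hεanti j)
      ((Metric.closedBall_subset_closedBall (hεd j)).trans (hSd x hx)))
    continuousOn_const (fun x hx => by
      obtain ⟨c', h1, h2⟩ := exists_between (hc x hx)
      obtain ⟨e, he, hle⟩ := exists_kAvg_le hk hpsh.1 hΩ hw hM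
        (hSd x hx (Metric.mem_closedBall_self hd.le)) h1
      obtain ⟨j, hj⟩ := ((tendsto_div_natCast_add_one d).eventually (gt_mem_nhds he)).exists
      exact ⟨j, (hle (ε j) (hε0 j).le hj).trans_lt h2⟩)
  exact ⟨ε j, hε0 j, hεd j, hj j le_rfl⟩

lemma integral_mul_mixMA_le_of_lt {Ω : Set (Cn n)} (hΩ : IsOpen Ω) {x0 : Cn n} {s : ℝ}
    (hs : 0 < s) (hsub : {z | sqDist n x0 z ≤ 7 / 8 * s} ⊆ Ω) {g : Cn n → ℝ}
    (hg : ContDiff ℝ ∞ g) (hg0 : ∀ x, 0 ≤ g x)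
    (hgs : tsupport g ⊆ {z | sqDist n x0 z ≤ 3 / 4 * s})
    (hpsd : ∀ x, sqDist n x0 x < 7 / 8 * s →
      (hessC n (fun y => (8 / s * sqDist n x0 y + -4) + g y) x).PosSemidef)
    {v : Cn n → EReal} (hv : PSHNeg v Ω) {m : ℝ} (hm : 0 < m) {f : Cn n → ℝ}
    (hf : Continuous f) (hfc : HasCompactSupport f) (hf1 : ∀ x, f x ≤ 1)
    (hfs : tsupport f ⊆ {z | sqDist n x0 z ≤ 3 / 4 * s ∧ v z < (-m : ℝ)}) :
    ENNReal.ofReal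
      (∫ x, f x * mixMA n (fun _ y => (8 / s * sqDist n x0 y + -4) + g y) x) ≤
      ENNReal.ofReal (4 ^ n * (n.factorial * (8 / s) ^ n) / m) *
        negIntegral volume Ω v {z | sqDist n x0 z ≤ 7 / 8 * s} := by
  obtain ⟨k, hk, hks⟩ := exists_contDiff_circledKernel (E := Cn n) volume
  set q := sqDist n x0 with hq
  set ψ : Cn n → ℝ := fun y => 8 / s * q y + -4 with hψ
  set κ : ℝ := 4 ^ n * (n.factorial * (8 / s) ^ n) with hκ
  have hκ0 : 0 ≤ κ := by positivity
  have hψs : ContDiff ℝ ∞ ψ := by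
    have := contDiff_sqDist x0
    rw [hψ, hq]
    fun_prop
  have hK := isCompact_sqDist_le x0 (7 / 8 * s)
  obtain ⟨d, hd, hball⟩ := hK.exists_forall_closedBall_subset hΩ hsub
  obtain ⟨N, hN⟩ := exists_nat_gt m
  set w := trunc Ω v N with hw
  have hwm : Measurable w := measurable_trunc hΩ hv.1.1 N
  have hwb : ∀ z, |w z| ≤ N := abs_trunc_le hv.2 N.cast_nonneg
  have hwp : PlurisubharmonicOn (fun z => (w z : EReal)) Ω := hv.plurisubharmonicOn_trunc N
  have hwneg : ∀ z, w z ≤ 0 := trunc_nonpos hv.2 N.cast_nonneg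
  have hle34 : ∀ {z}, q z ≤ 3 / 4 * s → q z < 7 / 8 * s := fun h => by linarith
  obtain ⟨ε, hε, hεd, hlt⟩ := exists_kAvg_lt hk hks hΩ hwp hwm hwb hfc hd
    (fun x hx => hball x (hle34 (hfs hx).1).le) (c := -m) (fun x hx => by
      rw [← EReal.coe_lt_coe_iff, hw, coe_trunc hv.2 (hsub (hle34 (hfs hx).1).le)]
      exact max_lt (hfs hx).2 (EReal.coe_lt_coe_iff.2 (by linarith)))
  set V := kAvg volume k w ε with hV
  have hVs : ContDiff ℝ ∞ V :=
    contDiff_kAvg_of_locallyIntegrable hk hks (locallyIntegrable_of_abs_le hwm hwb) hε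
  have hVneg : ∀ x, V x ≤ 0 := fun x => by
    rw [← kAvg_const (μ := volume) hk 0 ε x]
    exact kAvg_mono_fun hk hwm hwb (M' := 0) measurable_const (by simp) hε.le fun z _ => hwneg z
  have hVball : ∀ x, q x ≤ 7 / 8 * s → Metric.closedBall x ε ⊆ Ω := fun x hx =>
    (Metric.closedBall_subset_closedBall hεd).trans (hball x hx)
  have hVp : PlurisubharmonicOn (fun z => (V z : EReal)) {x | q x < 7 / 8 * s} :=
    (plurisubharmonicOn_kAvg hk hks hwp hwm hwb hε).mono fun x hx => hVball x (le_of_lt hx)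
  obtain ⟨θ, hθ, hθc, hθs, hθ0, hθ1, hθK⟩ := exists_contDiff_cutoff
    (isCompact_sqDist_le x0 (3 / 4 * s)) (isOpen_sqDist_lt x0 (7 / 8 * s))
    (fun z hz => hle34 hz)
  set H : Cn n → ℝ := fun x => θ x * (-V x) with hH
  have hHs : ContDiff ℝ ∞ H := hθ.mul hVs.neg
  have hHc : HasCompactSupport H := hθc.mul_right
  have hH0 : ∀ x, 0 ≤ H x := fun x => mul_nonneg (hθ0 x) (by linarith [hVneg x])
  have hHz : ∀ x, 7 / 8 * s ≤ q x → H x = 0 := fun x hx => by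
    have : x ∉ tsupport θ := fun h => absurd (hθs h) (not_lt.2 hx)
    simp only [hH]
    rw [image_eq_zero_of_notMem_tsupport this, zero_mul]
  have hWs : ContDiff ℝ ∞ fun y => ψ y + g y := hψs.add hg
  have h_compare : ∫ x, f x * mixMA n (fun _ y => ψ y + g y) x ≤
      (1 / m) * ∫ x, H x * mixMA n (fun _ y => ψ y + g y) x := by
    rw [← integral_const_mul]
    refine integral_mono (integrable_mul_mixMA hf hfc fun _ => hWs)
      ((integrable_mul_mixMA hHs.continuous hHc fun _ => hWs).const_mul _) fun x => ?_
    change f x * _ ≤ 1 / m * (H x * _)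
    by_cases hx : q x < 7 / 8 * s
    · have hM : 0 ≤ mixMA n (fun _ y => ψ y + g y) x := mixMA_nonneg fun _ => hpsd x hx
      rw [← mul_assoc]
      refine mul_le_mul_of_nonneg_right ?_ hM
      by_cases hxf : x ∈ tsupport f
      · have h1 := hlt x hxf
        have h2 := (hθK x (hfs hxf).1).self_of_nhds
        simp only [hH]
        rw [h2, one_mul, one_div, inv_mul_eq_div]
        refine (hf1 x).trans ((one_le_div hm).2 ?_)
        linarith
      · rw [image_eq_zero_of_notMem_tsupport hxf]
        have := hH0 x
        positivity
    · have hxf : x ∉ tsupport f := fun h => hx (hle34 (hfs h).1)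
      rw [image_eq_zero_of_notMem_tsupport hxf, hHz x (not_lt.1 hx)]
      simp
  have h_glued : ∫ x, H x * mixMA n (fun _ y => ψ y + g y) x ≤
      ∫ x, H x * mixMA n (fun _ => ψ) x := by
    refine integral_mul_mixMA_add_le hψs hg hHs hHc hg0 (fun x _ => ?_)
      (fun x hx => hpsd x (hle34 (hgs hx))) fun x hx => ?_
    · exact posSemidef_hessC hψs isOpen_univ
        (plurisubharmonicOn_sqDist x0 (c := 8 / s) (by positivity) (-4) _) (Set.mem_univ x)
    · refine posSemidef_hessC (contDiff_const.mul hHs)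
        (isOpen_interior.inter (isOpen_sqDist_lt x0 (7 / 8 * s)))
        ((hVp.mono Set.inter_subset_right).congr fun y hy => ?_)
        ⟨mem_interior_iff_mem_nhds.2 (hθK x (hgs hx)), hle34 (hgs hx)⟩
      have h1 : y ∈ {x | θ x = 1} := interior_subset hy.1
      simp [hH, h1.out]
  have h_constant : ∫ x, H x * mixMA n (fun _ => ψ) x = κ * ∫ x, H x := by
    rw [← integral_const_mul]
    refine integral_congr_ae (ae_of_all _ fun x => ?_)
    simp only [hψ]
    rw [mixMA_affine_sqDist, mul_comm]
  have h_negIntegral : ENNReal.ofReal (∫ x, H x) ≤ negIntegral volume Ω v {z | q z ≤ 7 / 8 * s} := by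
    rw [ofReal_integral_eq_lintegral_ofReal
      (hHs.continuous.integrable_of_hasCompactSupport hHc) (ae_of_all _ hH0),
      ← setLIntegral_eq_of_support_subset (s := {z | q z ≤ 7 / 8 * s})]
    · refine le_trans (setLIntegral_mono' hK.measurableSet fun x hx => ?_)
        (le_iSup (fun N : ℕ => ∫⁻ z in {z | q z ≤ 7 / 8 * s}, ENNReal.ofReal (-(trunc Ω v N z))) N)
      refine ENNReal.ofReal_le_ofReal ?_
      have h1 : w x ≤ V x := le_kAvg hk hwp hwm hwb hε.le (hVball x hx)
      have h2 := mul_le_mul_of_nonneg_right (hθ1 x) (by linarith [hVneg x] : 0 ≤ -V x)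
      simp only [hH]
      linarith
    · intro x hx
      by_contra hx'
      refine hx ?_
      simp only
      rw [hHz x (le_of_not_ge hx'), ENNReal.ofReal_zero]
  calc ENNReal.ofReal (∫ x, f x * mixMA n (fun _ y => ψ y + g y) x)
      ≤ ENNReal.ofReal (κ / m * ∫ x, H x) := by
        refine ENNReal.ofReal_le_ofReal (h_compare.trans ?_)
        rw [h_constant] at h_glued
        calc _ ≤ 1 / m * (κ * ∫ x, H x) := mul_le_mul_of_nonneg_left h_glued (by positivity)
          _ = _ := by ring
    _ = ENNReal.ofReal (κ / m) * ENNReal.ofReal (∫ x, H x) :=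
        ENNReal.ofReal_mul (by positivity)
    _ ≤ _ := by gcongr

end LocalBound

section CapacityEstimate

open scoped ContDiff ComplexOrder

variable {n : ℕ}

lemma mixMA_add_const {W : Cn n → ℝ} (hW : ContDiff ℝ ∞ W) (c : ℝ) (x : Cn n) :
    mixMA n (fun _ y => W y + c) x = mixMA n (fun _ => W) x := by
  rw [mixMA, mixMA, hessC_add hW contDiff_const, hessC_const, add_zero]

lemma IsMAMeasure.ofReal_integral_le {Ω : Set (Cn n)} (hΩ : IsOpen Ω) {x0 : Cn n} {s : ℝ}
    (hs : 0 < s) (hsub : {z | sqDist n x0 z ≤ s} ⊆ Ω) {w : Cn n → EReal}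
    (hw : PlurisubharmonicOn w Ω) (hw1 : ∀ z ∈ Ω, -1 ≤ w z ∧ w z ≤ 0) {μ : Measure (Cn n)}
    (hμ : IsMAMeasure n w Ω μ) {v : Cn n → EReal} (hv : PSHNeg v Ω) {m : ℝ} (hm : 0 < m)
    {f : Cn n → ℝ} (hf : Continuous f) (hfc : HasCompactSupport f) (hf1 : ∀ x, f x ≤ 1)
    (hfs : tsupport f ⊆ {z | sqDist n x0 z < s / 8 ∧ v z < (-m : ℝ)}) :
    ENNReal.ofReal (∫ x, f x ∂μ) ≤ ENNReal.ofReal (4 ^ n * (n.factorial * (8 / s) ^ n) / m) *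
        negIntegral volume Ω v {z | sqDist n x0 z ≤ 7 / 8 * s} := by
  obtain ⟨k, hk, hks⟩ := exists_contDiff_circledKernel (E := Cn n) volume
  have hwneg : PSHNeg w Ω := ⟨hw, fun z hz => (hw1 z hz).2⟩
  set w1 := trunc Ω w 1 with hw1def
  have hwm : Measurable w1 := measurable_trunc hΩ hw.1 1
  have hwb : ∀ z, |w1 z| ≤ 1 := abs_trunc_le hwneg.2 zero_le_one
  have hwp : PlurisubharmonicOn (fun z => (w1 z : EReal)) Ω := hwneg.plurisubharmonicOn_trunc 1
  have hwe : ∀ z ∈ Ω, (w1 z : EReal) = w z := fun z hz => by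
    rw [hw1def, coe_trunc hwneg.2 hz]
    exact max_eq_left (by simpa using (hw1 z hz).1)
  set U := {z | sqDist n x0 z < s / 8} with hU
  have hUo : IsOpen U := isOpen_sqDist_lt x0 (s / 8)
  have hlt_sub : {z | sqDist n x0 z < s} ⊆ Ω := fun z hz => hsub (show sqDist n x0 z ≤ s from le_of_lt hz)
  have hUΩ : U ⊆ Ω := fun z (hz : sqDist n x0 z < s / 8) => hsub (by
    change sqDist n x0 z ≤ s
    linarith)
  obtain ⟨e0, he0, hglue⟩ := exists_gluing hk hks x0 hs
  obtain ⟨d, hd, hball⟩ := (isCompact_sqDist_le x0 s).exists_forall_closedBall_subset hΩ hsub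
  have hUball : ∀ x ∈ U, Metric.closedBall x d ⊆ Ω := fun x (hx : sqDist n x0 x < s / 8) =>
    hball x (by
      change sqDist n x0 x ≤ s
      linarith)
  set δ := min e0 d with hδ
  have hδ0 : 0 < δ := by positivity
  set ε : ℕ → ℝ := fun j => δ / ((j : ℝ) + 1) with hε
  have hε0 : ∀ j, 0 < ε j := fun j => by positivity
  have hεδ : ∀ j, ε j ≤ δ := fun j =>
    div_le_self hδ0.le (by linarith [j.cast_nonneg (α := ℝ)])
  have hεanti : ∀ j, ε (j + 1) ≤ ε j := fun j => by
    simp only [hε]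
    gcongr
    linarith
  have hεball : ∀ j, ∀ x ∈ U, Metric.closedBall x (ε j) ⊆ Ω := fun j x hx =>
    (Metric.closedBall_subset_closedBall ((hεδ j).trans (min_le_right _ _))).trans (hUball x hx)
  have hlim := hμ.2.2 U hUo hUΩ (fun j => kAvg volume k w1 (ε j))
    (fun j => (contDiff_kAvg_of_locallyIntegrable hk hks
      (locallyIntegrable_of_abs_le hwm hwb) (hε0 j)).contDiffOn)
    (fun j => (plurisubharmonicOn_kAvg hk hks hwp hwm hwb (hε0 j)).mono fun x hx =>
      hεball j x hx)
    (fun j x hx => kAvg_mono hk hwp hwm hwb (hε0 _).le (hεanti j) (hεball j x hx))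
    (fun x hx => by
      rw [← hwe x (hUΩ hx)]
      refine le_antisymm (le_of_forall_gt fun c hc => ?_) (le_iInf fun j =>
        EReal.coe_le_coe_iff.2 (le_kAvg hk hwp hwm hwb (hε0 j).le (hεball j x hx)))
      obtain ⟨c', h1, h2⟩ := EReal.lt_iff_exists_real_btwn.1 hc
      obtain ⟨e, he, hle⟩ := exists_kAvg_le hk hwp.1 hΩ hwm hwb (hUΩ hx)
        (EReal.coe_lt_coe_iff.1 h1)
      obtain ⟨j, hj⟩ := ((tendsto_div_natCast_add_one δ).eventually (gt_mem_nhds he)).exists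
      exact (iInf_le _ j).trans_lt
        ((EReal.coe_le_coe_iff.2 (hle (ε j) (hε0 j).le hj)).trans_lt h2))
    f hf hfc (fun x hx => (hfs hx).1)
  refine le_of_tendsto ((ENNReal.continuous_ofReal.tendsto _).comp hlim)
    (Eventually.of_forall fun j => ?_)
  obtain ⟨g, c, hg, hg0, hgs, hpsd, hval⟩ := hglue w1 hwm (neg_le_trunc hwneg.2 1)
    (trunc_nonpos hwneg.2 zero_le_one) (hwp.mono hlt_sub) (ε j) (hε0 j)
    ((hεδ j).trans (min_le_left _ _))
  have hWs : ContDiff ℝ ∞ fun y => (8 / s * sqDist n x0 y + -4) + g y := by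
    have := contDiff_sqDist x0
    fun_prop
  have hfeq : ∀ x, f x * maDensity n (kAvg volume k w1 (ε j)) x =
      f x * mixMA n (fun _ y => (8 / s * sqDist n x0 y + -4) + g y) x := fun x => by
    by_cases hx : x ∈ tsupport f
    · rw [maDensity_eq_mixMA, ← mixMA_add_const hWs c]
      congr 1
      exact mixMA_congr fun _ => by
        filter_upwards [hUo.mem_nhds (hfs hx).1] with y hy using hval y hy
    · rw [image_eq_zero_of_notMem_tsupport hx, zero_mul, zero_mul]
  simp only [Function.comp_apply, hfeq]
  exact integral_mul_mixMA_le_of_lt hΩ hs (fun z (hz : sqDist n x0 z ≤ 7 / 8 * s) => hsub (by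
    change sqDist n x0 z ≤ s
    linarith)) hg hg0 hgs hpsd hv hm hf hfc hf1 fun x hx => ⟨by
      have : sqDist n x0 x < s / 8 := (hfs hx).1
      linarith, (hfs hx).2⟩

lemma IsMAMeasure.measure_sublevel_le {Ω : Set (Cn n)} (hΩ : IsOpen Ω) {x0 : Cn n} {s : ℝ}
    (hs : 0 < s) (hsub : {z | sqDist n x0 z ≤ s} ⊆ Ω) {w : Cn n → EReal}
    (hw : PlurisubharmonicOn w Ω) (hw1 : ∀ z ∈ Ω, -1 ≤ w z ∧ w z ≤ 0) {μ : Measure (Cn n)}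
    (hμ : IsMAMeasure n w Ω μ) {v : Cn n → EReal} (hv : PSHNeg v Ω) {m : ℝ} (hm : 0 < m) :
    μ {z | sqDist n x0 z < s / 8 ∧ v z < (-m : ℝ)} ≤
      ENNReal.ofReal (4 ^ n * (n.factorial * (8 / s) ^ n) / m) *
        negIntegral volume Ω v {z | sqDist n x0 z ≤ 7 / 8 * s} := by
  set O := {z | sqDist n x0 z < s / 8 ∧ v z < (-m : ℝ)} with hO
  have hsmall : ∀ {z}, sqDist n x0 z < s / 8 → z ∈ {z | sqDist n x0 z ≤ s} := fun {z} hz => by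
    change sqDist n x0 z ≤ s
    linarith
  have hOo : IsOpen O := by
    rw [isOpen_iff_mem_nhds]
    intro z hz
    have hzΩ : z ∈ Ω := hsub (hsmall hz.1)
    have h1 := hv.1.1 z hzΩ _ hz.2
    rw [hΩ.nhdsWithin_eq hzΩ] at h1
    exact ((isOpen_sqDist_lt x0 (s / 8)).eventually_mem hz.1).and h1
  obtain ⟨F, hFc, hFO, hFU, hFm⟩ := hOo.exists_iUnion_isClosed
  rw [← hFU, hFm.measure_iUnion]
  refine iSup_le fun j => ?_
  have hFk : IsCompact (F j) := (isCompact_sqDist_le x0 s).of_isClosed_subset (hFc j)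
    fun z hz => hsmall (hFO j hz).1
  obtain ⟨f, hf, hfc, hfs, hf0, hf1, hfK⟩ := exists_contDiff_cutoff hFk hOo (hFO j)
  refine le_trans ?_ (hμ.ofReal_integral_le hΩ hs hsub hw hw1 hv hm hf.continuous hfc hf1 hfs)
  have hfin : μ (tsupport f) ≠ ⊤ := hμ.2.1 _ hfc fun z hz => hsub (hsmall (hfs hz).1)
  have hInt : Integrable f μ := by
    rw [← integrableOn_iff_integrable_of_support_subset (subset_tsupport f)]
    refine Measure.integrableOn_of_bounded (M := 1) hfin hf.continuous.aestronglyMeasurable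
      (ae_of_all _ fun x => ?_)
    rw [Real.norm_eq_abs, abs_of_nonneg (hf0 x)]
    exact hf1 x
  rw [ofReal_integral_eq_lintegral_ofReal hInt (ae_of_all _ hf0)]
  calc μ (F j) = ∫⁻ x in F j, 1 ∂μ := by simp
    _ = ∫⁻ x in F j, ENNReal.ofReal (f x) ∂μ :=
        setLIntegral_congr_fun (hFc j).measurableSet fun x hx => by
          simp [(hfK x hx).self_of_nhds]
    _ ≤ _ := setLIntegral_le_lintegral _ _

/-- Capacity of sublevel sets of negative psh functions is controlled by their local `L¹` norm. -/
theorem exists_MACap_sublevel_le {Ω : Set (Cn n)} (hΩ : IsOpen Ω) {K : Set (Cn n)}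
    (hK : IsCompact K) (hKΩ : K ⊆ Ω) :
    ∃ K' : Set (Cn n), IsCompact K' ∧ K' ⊆ Ω ∧ ∃ C : ℝ, 0 ≤ C ∧ ∀ v : Cn n → EReal, PSHNeg v Ω →
      ∀ m : ℝ, 0 < m → MACap n Ω {z | z ∈ K ∧ v z < (-m : ℝ)} ≤
        ENNReal.ofReal (C / m) * negIntegral volume Ω v K' := by
  have hloc : ∀ x ∈ K, ∃ s : ℝ, 0 < s ∧ {z | sqDist n x z ≤ s} ⊆ Ω := fun x hx => by
    obtain ⟨r, hr, hsub⟩ := Metric.isOpen_iff.1 hΩ x (hKΩ hx)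
    refine ⟨(r / 2) ^ 2, by positivity, fun z hz => hsub ?_⟩
    have h1 : ‖z - x‖ ^ 2 ≤ (r / 2) ^ 2 := (norm_sq_le_sqDist x z).trans hz
    have h2 := abs_le_of_sq_le_sq' h1 (by positivity)
    rw [Metric.mem_ball, dist_eq_norm]
    linarith [h2.2]
  choose! s hs hsub using hloc
  obtain ⟨t, htK, ht⟩ := hK.elim_nhds_subcover (fun x => {z | sqDist n x z < s x / 8})
    fun x hx => (isOpen_sqDist_lt x (s x / 8)).mem_nhds (by
      have := hs x hx
      simp only [sqDist, Set.mem_ofPred_eq, sub_self]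
      simpa using this)
  set κ : Cn n → ℝ := fun x => 4 ^ n * (n.factorial * (8 / s x) ^ n) with hκ
  have hκ0 : ∀ x ∈ t, 0 ≤ κ x := fun x hx => by
    have := hs x (htK x hx)
    positivity
  refine ⟨⋃ x ∈ t, {z | sqDist n x z ≤ s x}, t.isCompact_biUnion fun x _ => isCompact_sqDist_le _ _,
    Set.iUnion₂_subset fun x hx => hsub x (htK x hx), ∑ x ∈ t, κ x, Finset.sum_nonneg hκ0,
    fun v hv m hm => ?_⟩
  refine iSup₂_le fun w hw => iSup₂_le fun μ hμ => ?_
  have hcov : {z | z ∈ K ∧ v z < (-m : ℝ)} ⊆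
      ⋃ x ∈ t, {z | sqDist n x z < s x / 8 ∧ v z < (-m : ℝ)} := fun z hz => by
    obtain ⟨x, hx, hzx⟩ := Set.mem_iUnion₂.1 (ht hz.1)
    exact Set.mem_iUnion₂.2 ⟨x, hx, hzx, hz.2⟩
  rw [Finset.sum_div, ENNReal.ofReal_sum_of_nonneg fun x hx => div_nonneg (hκ0 x hx) hm.le,
    Finset.sum_mul]
  refine (measure_mono hcov).trans ((measure_biUnion_finset_le _ _).trans
    (Finset.sum_le_sum fun x hx => ?_))
  refine (hμ.measure_sublevel_le hΩ (hs x (htK x hx)) (hsub x (htK x hx)) hw.1 hw.2 hv hm).trans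
    (mul_le_mul_right (negIntegral_mono fun z (hz : sqDist n x z ≤ 7 / 8 * s x) =>
      Set.mem_iUnion₂.2 ⟨x, hx, ?_⟩) _)
  have := hs x (htK x hx)
  change sqDist n x z ≤ s x
  linarith

end CapacityEstimate

section CapacityConvergence

variable {n : ℕ} {Ω : Set (Cn n)} {φ ψ : Cn n → EReal}

lemma MACap_mono {S T : Set (Cn n)} (h : S ⊆ T) : MACap n Ω S ≤ MACap n Ω T :=
  iSup₂_mono fun _ _ => iSup₂_mono fun _ _ => measure_mono h

lemma MACap_union_le (S T : Set (Cn n)) :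
    MACap n Ω (S ∪ T) ≤ MACap n Ω S + MACap n Ω T :=
  iSup₂_le fun u hu => iSup₂_le fun μ hμ => (measure_union_le S T).trans
    (add_le_add
      (le_iSup₂_of_le (f := fun u _ => ⨆ μ ∈ {μ : Measure (Cn n) | IsMAMeasure n u Ω μ}, μ S)
        u hu (le_iSup₂_of_le (f := fun (μ : Measure (Cn n)) _ => μ S) μ hμ le_rfl))
      (le_iSup₂_of_le (f := fun u _ => ⨆ μ ∈ {μ : Measure (Cn n) | IsMAMeasure n u Ω μ}, μ T)
        u hu (le_iSup₂_of_le (f := fun (μ : Measure (Cn n)) _ => μ T) μ hμ le_rfl)))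

lemma MACap_empty : MACap n Ω ∅ = 0 := by simp [MACap]

lemma EReal.inv_mul_le_add {σ C : ℝ} (hσ : 0 < σ) {x y : EReal}
    (h : x ≤ (σ : EReal) * y + (C : EReal)) :
    ((σ⁻¹ : ℝ) : EReal) * x ≤ y + ((σ⁻¹ * C : ℝ) : EReal) := by
  have hs := inv_pos.2 hσ
  refine (EReal.monotone_coe_mul hs h).trans (le_of_eq ?_)
  change ((σ⁻¹ : ℝ) : EReal) * ((σ : EReal) * y + (C : EReal)) = _
  rw [EReal.left_distrib_of_nonneg_of_ne_top (EReal.coe_nonneg.2 hs.le) (EReal.coe_ne_top _),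
    ← mul_assoc, ← EReal.coe_mul, ← EReal.coe_mul, inv_mul_cancel₀ hσ.ne', EReal.coe_one,
    one_mul]

lemma EReal.lt_of_add_add_lt {c : ℝ} {x y : EReal} (hx : x ≤ 0) (hy : y ≤ 0)
    (h : x + y + (c : EReal) < x) : y < ((-c : ℝ) : EReal) := by
  induction x with
  | bot => simp at h
  | top => simp at hx
  | coe x =>
    induction y with
    | bot => exact EReal.bot_lt_coe _
    | top => simp at hy
    | coe y =>
      have h' : x + y + c < x := by exact_mod_cast h
      rw [EReal.coe_lt_coe_iff]
      linarith

lemma EReal.lt_of_mul_add_lt {a c : ℝ} (ha : 1 < a) {x : EReal} (hx : x ≤ 0)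
    (h : (a : EReal) * x + (c : EReal) < x) : x < ((-(c / (a - 1)) : ℝ) : EReal) := by
  induction x with
  | bot => simp at h
  | top => simp at hx
  | coe x =>
    have h' : a * x + c < x := by exact_mod_cast h
    rw [EReal.coe_lt_coe_iff, ← neg_div, lt_div_iff₀ (by linarith)]
    linarith

lemma EReal.mul_le_self_of_one_le {a : ℝ} (ha : 1 ≤ a) {x : EReal} (hx : x ≤ 0) :
    (a : EReal) * x ≤ x := by
  induction x with
  | bot => simp [EReal.coe_mul_bot_of_pos (zero_lt_one.trans_le ha)]
  | top => simp at hx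
  | coe x =>
    have h' : x ≤ 0 := by exact_mod_cast hx
    rw [← EReal.coe_mul, EReal.coe_le_coe_iff]
    nlinarith

/-- Under the conditions on residual functions, `φ` is approximated in capacity from below by psh
functions that are at most `ψ + O(1)`. -/
lemma exists_le_MACap_lt (hΩ : IsOpen Ω) (hc : IsConnected Ω) (hφ : PSHNeg φ Ω) (hψ : PSHNeg ψ Ω)
    (hψc : GpCond ψ Ω) (hle : ∀ z ∈ Ω, φ z ≤ gp ψ Ω z) {K : Set (Cn n)} (hK : IsCompact K)
    (hKΩ : K ⊆ Ω) {ε : ℝ} (hε : 0 < ε) {η : ℝ} (hη : 0 < η) :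
    ∃ (v : Cn n → EReal) (C : ℝ), PSHNeg v Ω ∧ 0 ≤ C ∧ (∀ z ∈ Ω, v z ≤ φ z) ∧
      (∀ z ∈ Ω, v z ≤ ψ z + (C : EReal)) ∧
      MACap n Ω {z | z ∈ K ∧ v z + (ε : EReal) < φ z} ≤ ENNReal.ofReal η := by
  by_cases hbot : ∃ z ∈ Ω, φ z ≠ ⊥
  swap
  · push Not at hbot
    refine ⟨φ, 0, hφ, le_rfl, fun _ _ => le_rfl, fun z hz => by rw [hbot z hz]; exact bot_le, ?_⟩
    have : {z | z ∈ K ∧ φ z + (ε : EReal) < φ z} = ∅ := by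
      refine Set.eq_empty_of_forall_notMem fun z hz => ?_
      have h := hz.2
      rw [hbot z (hKΩ hz.1)] at h
      exact not_lt_bot h
    rw [this, MACap_empty]
    exact zero_le
  obtain ⟨K', hK', hK'Ω, B, hB, hcap⟩ := exists_MACap_sublevel_le hΩ hK hKΩ
  rcases hψc.cases hψ with ⟨w, hw, hw0, hwle⟩ | hσ
  · obtain ⟨h, ⟨hh, C, hC⟩, hInt⟩ := exists_mem_gpClass_negIntegral_le (μ := volume) hΩ hw0 hK'
      hK'Ω (η := η * ε / (B + 1)) (by positivity)
    refine ⟨fun z => φ z + h z, |C|, hφ.add hh, abs_nonneg _, fun z hz => ?_, fun z hz => ?_, ?_⟩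
    · exact add_le_of_nonpos_right (hh.2 z hz)
    · calc φ z + h z ≤ gp ψ Ω z + (w z + (C : EReal)) := add_le_add (hle z hz) (hC z hz)
        _ = (gp ψ Ω z + w z) + (C : EReal) := (add_assoc _ _ _).symm
        _ ≤ _ := add_le_add (hwle z hz) (EReal.coe_le_coe_iff.2 (le_abs_self C))
    · refine (MACap_mono (T := {z | z ∈ K ∧ h z < ((-ε : ℝ) : EReal)}) fun z hz =>
        ⟨hz.1, EReal.lt_of_add_add_lt (hφ.2 z (hKΩ hz.1))
        (hh.2 z (hKΩ hz.1)) hz.2⟩).trans ((hcap h hh ε hε).trans ?_)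
      refine (mul_le_mul_right hInt _).trans ?_
      rw [← ENNReal.ofReal_mul (by positivity)]
      refine ENNReal.ofReal_le_ofReal ?_
      rw [div_mul_div_comm, div_le_iff₀ (by positivity)]
      nlinarith [mul_pos hη hε]
  · set I := negIntegral volume Ω φ K' with hI
    have hIfin : I ≠ ⊤ := (hφ.negIntegral_lt_top hΩ hc hbot hK' hK'Ω).ne
    set δ : ℝ := ε * η / (B * I.toReal + 1) with hδ
    have hBI : 0 ≤ B * I.toReal := mul_nonneg hB ENNReal.toReal_nonneg
    have hδ0 : 0 < δ := by positivity
    obtain ⟨C, hC⟩ := hσ (1 + δ)⁻¹ ⟨by positivity, inv_lt_one_of_one_lt₀ (by linarith)⟩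
    refine ⟨fun z => ((1 + δ : ℝ) : EReal) * φ z, |(1 + δ) * C|, hφ.const_mul (by linarith),
      abs_nonneg _, fun z hz => EReal.mul_le_self_of_one_le (by linarith) (hφ.2 z hz),
      fun z hz => ?_, ?_⟩
    · have h := EReal.inv_mul_le_add (by positivity) ((hle z hz).trans (hC z hz))
      rw [inv_inv] at h
      exact h.trans (add_le_add le_rfl (EReal.coe_le_coe_iff.2 (le_abs_self _)))
    · refine (MACap_mono (T := {z | z ∈ K ∧ φ z < ((-(ε / (1 + δ - 1)) : ℝ) : EReal)}) fun z hz =>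
        ⟨hz.1, EReal.lt_of_mul_add_lt (by linarith)
        (hφ.2 z (hKΩ hz.1)) hz.2⟩).trans ((hcap φ hφ (ε / (1 + δ - 1)) ?_).trans ?_)
      · rw [add_sub_cancel_left]
        positivity
      rw [add_sub_cancel_left, ← hI, ← ENNReal.ofReal_toReal hIfin,
        ← ENNReal.ofReal_mul (by positivity)]
      refine ENNReal.ofReal_le_ofReal ?_
      have h1 : δ * (B * I.toReal + 1) = ε * η := div_mul_cancel₀ _ (by positivity)
      rw [div_div_eq_mul_div, div_mul_eq_mul_div, div_le_iff₀ hε]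
      nlinarith

/-- A curve squeezed between `(1 - τ) φ` and the approximants `v - C τ` converges to `φ` in
capacity as `τ → 0`. -/
lemma tendsto_MACap_of_le_gp (hΩ : IsOpen Ω) (hc : IsConnected Ω) (hφ : PSHNeg φ Ω)
    (hψ : PSHNeg ψ Ω) (hψc : GpCond ψ Ω) (hle : ∀ z ∈ Ω, φ z ≤ gp ψ Ω z)
    {l : Filter ℝ} {τ : ℝ → ℝ} (hτ : Tendsto τ l (𝓝 0)) {G : ℝ → Cn n → EReal}
    (hup : ∀ᶠ t in l, 0 < τ t ∧ τ t < 1 ∧ ∀ z ∈ Ω, ∀ c : ℝ, φ z ≤ c →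
       G t z ≤ (((1 - τ t) * c : ℝ) : EReal))
    (hlow : ∀ (v : Cn n → EReal) (C : ℝ), PSHNeg v Ω → 0 ≤ C → (∀ z ∈ Ω, v z ≤ φ z) →
      (∀ z ∈ Ω, v z ≤ ψ z + (C : EReal)) → ∀ t z, v z + ((-(C * τ t) : ℝ) : EReal) ≤ G t z)
    {ε : ℝ} (hε : 0 < ε) {K : Set (Cn n)} (hK : IsCompact K) (hKΩ : K ⊆ Ω) :
    Tendsto (fun t => MACap n Ω
      {z | z ∈ K ∧ ¬ (G t z ≤ φ z + (ε : EReal) ∧ φ z ≤ G t z + (ε : EReal))}) l (𝓝 0) := by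
  have hupper : ∀ η : ℝ, 0 < η → ∀ᶠ t in l,
      MACap n Ω {z | z ∈ K ∧ φ z + (ε : EReal) < G t z} ≤ ENNReal.ofReal η := by
    intro η hη
    have hsub : ∀ᶠ t in l, 0 < τ t ∧ ∀ z ∈ K, φ z + (ε : EReal) < G t z →
        φ z ≠ ⊥ ∧ φ z < ((-(ε / τ t) : ℝ) : EReal) := by
      filter_upwards [hup] with t ⟨ht, ht1, hG⟩
      refine ⟨ht, fun z hzK hz => ?_⟩
      have hne : φ z ≠ ⊥ := fun hbot => by
        rw [hbot, EReal.bot_add] at hz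
        refine hz.ne' ((EReal.eq_bot_iff_forall_lt _).2 fun y => ?_)
        refine (hG z (hKΩ hzK) ((1 - τ t)⁻¹ * (y - 1)) (hbot ▸ bot_le)).trans_lt ?_
        rw [mul_inv_cancel_left₀ (by linarith), EReal.coe_lt_coe_iff]
        linarith
      refine ⟨hne, ?_⟩
      have hφ0 := hφ.2 z (hKΩ hzK)
      have hGz := hG z (hKΩ hzK)
      generalize φ z = x at *
      induction x with
      | bot => exact absurd rfl hne
      | top => simp at hφ0
      | coe x =>
        have h := hz.trans_le (hGz x le_rfl)
        rw [← EReal.coe_add, EReal.coe_lt_coe_iff] at h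
        rw [EReal.coe_lt_coe_iff, ← neg_div, lt_div_iff₀ ht]
        linarith
    by_cases hbot : ∃ z ∈ Ω, φ z ≠ ⊥
    · obtain ⟨K', hK', hK'Ω, B, hB, hcap⟩ := exists_MACap_sublevel_le hΩ hK hKΩ
      set I := negIntegral volume Ω φ K' with hI
      have hIfin : I ≠ ⊤ := (hφ.negIntegral_lt_top hΩ hc hbot hK' hK'Ω).ne
      have hsmall : ∀ᶠ t in l, τ t * (B / ε * I.toReal) < η := by
        have := hτ.mul_const (B / ε * I.toReal)
        rw [zero_mul] at this
        exact this.eventually (gt_mem_nhds hη)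
      filter_upwards [hsub, hsmall] with t ⟨ht, hs⟩ hlt
      refine (MACap_mono (T := {z | z ∈ K ∧ φ z < ((-(ε / τ t) : ℝ) : EReal)}) fun z hz =>
        ⟨hz.1, (hs z hz.1 hz.2).2⟩).trans ((hcap φ hφ (ε / τ t) (by positivity)).trans ?_)
      rw [← hI, ← ENNReal.ofReal_toReal hIfin, ← ENNReal.ofReal_mul (by positivity)]
      refine ENNReal.ofReal_le_ofReal ((le_of_eq ?_).trans hlt.le)
      rw [div_div_eq_mul_div]
      ring
    · push Not at hbot
      filter_upwards [hsub] with t ⟨_, hs⟩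
      have : {z | z ∈ K ∧ φ z + (ε : EReal) < G t z} = ∅ :=
        Set.eq_empty_of_forall_notMem fun z hz => (hs z hz.1 hz.2).1 (hbot z (hKΩ hz.1))
      rw [this, MACap_empty]
      exact zero_le
  have hlower : ∀ η : ℝ, 0 < η → ∀ᶠ t in l,
      MACap n Ω {z | z ∈ K ∧ G t z + (ε : EReal) < φ z} ≤ ENNReal.ofReal η := by
    intro η hη
    obtain ⟨v, C, hv, hC, hvφ, hvψ, hcap⟩ :=
      exists_le_MACap_lt hΩ hc hφ hψ hψc hle hK hKΩ (half_pos hε) hη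
    have hsmall : ∀ᶠ t in l, τ t * C < ε / 2 := by
      have := hτ.mul_const C
      rw [zero_mul] at this
      exact this.eventually (gt_mem_nhds (half_pos hε))
    filter_upwards [hsmall] with t ht
    refine (MACap_mono (T := {z | z ∈ K ∧ v z + ((ε / 2 : ℝ) : EReal) < φ z}) fun z hz =>
      ⟨hz.1, lt_of_le_of_lt ?_ hz.2⟩).trans hcap
    refine le_trans ?_ (add_le_add (hlow v C hv hC hvφ hvψ t z) le_rfl)
    rw [add_assoc, ← EReal.coe_add]
    exact add_le_add le_rfl (EReal.coe_le_coe_iff.2 (by linarith))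
  refine ENNReal.tendsto_nhds_zero.2 fun η hη => ?_
  obtain ⟨r, hr0, hr⟩ := ENNReal.lt_iff_exists_nnreal_btwn.1 hη
  have hr0' : (0 : ℝ) < r := by exact_mod_cast hr0
  filter_upwards [hupper (r / 2) (by positivity), hlower (r / 2) (by positivity)] with t h1 h2
  calc _ ≤ MACap n Ω ({z | z ∈ K ∧ φ z + (ε : EReal) < G t z} ∪
          {z | z ∈ K ∧ G t z + (ε : EReal) < φ z}) := MACap_mono fun z hz => by
        rcases not_and_or.1 hz.2 with h | h
        · exact Or.inl ⟨hz.1, not_le.1 h⟩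
        · exact Or.inr ⟨hz.1, not_le.1 h⟩
    _ ≤ _ := MACap_union_le _ _
    _ ≤ ENNReal.ofReal (r / 2) + ENNReal.ofReal (r / 2) := add_le_add h1 h2
    _ = r := by
        rw [← ENNReal.ofReal_add (by positivity) (by positivity), add_halves,
          ENNReal.ofReal_coe_nnreal]
    _ ≤ η := hr.le

/-- A curve converging in capacity to `φ` and bounded by `(1 - τ) gp ψ` forces `φ ≤ gp ψ`. -/
lemma le_gp_of_tendsto_MACap (hΩ : IsOpen Ω) (hb : Bornology.IsBounded Ω) (hφ : PSHNeg φ Ω)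
    {l : Filter ℝ} [l.NeBot] {τ : ℝ → ℝ} (hτ : Tendsto τ l (𝓝 0)) {G : ℝ → Cn n → EReal}
    (hup : ∀ᶠ t in l, ∀ z ∈ Ω, ∀ c : ℝ, gp ψ Ω z ≤ c → G t z ≤ (((1 - τ t) * c : ℝ) : EReal))
    (hG : ∀ ε : ℝ, 0 < ε → ∀ K : Set (Cn n), IsCompact K → K ⊆ Ω → Tendsto (fun t => MACap n Ω
      {z | z ∈ K ∧ ¬ (G t z ≤ φ z + (ε : EReal) ∧ φ z ≤ G t z + (ε : EReal))}) l (𝓝 0))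
    {z : Cn n} (hz : z ∈ Ω) : φ z ≤ gp ψ Ω z := by
  obtain ⟨C, hC, hvol⟩ := exists_volume_le_mul_MACap hΩ hb
  refine hφ.le_gp_of_ae volume hΩ (fun z hz c η hη r hr hrΩ hgp => ?_) hz
  have hlim := ENNReal.Tendsto.const_mul
    (hG (η / 2) (half_pos hη) _ (isCompact_closedBall z r) hrΩ) (Or.inr hC)
  rw [mul_zero] at hlim
  refine le_antisymm (ge_of_tendsto hlim ?_) bot_le
  have hsmall : ∀ᶠ t in l, τ t * (-c) < η / 2 := by
    have := hτ.mul_const (-c)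
    rw [zero_mul] at this
    exact this.eventually (gt_mem_nhds (half_pos hη))
  filter_upwards [hup, hsmall] with t hGt ht
  refine (hvol _ fun y hy => hrΩ hy.1).trans (mul_le_mul_right (MACap_mono fun y hy => ?_) _)
  refine ⟨hy.1, fun hcon => ?_⟩
  have h1 := hcon.2.trans (add_le_add (hGt y (hrΩ hy.1) c (hgp y hy.1).le) le_rfl)
  have h2 := hy.2.trans_le h1
  rw [← EReal.coe_add, EReal.coe_lt_coe_iff] at h2
  linarith

end CapacityConvergence

/-- Theorem 8.4: geodesic connectivity criterion. Each `u_j` satisfies one of the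
conditions of Proposition 7.2; then the geodesic connects `u₀` and `u₁` (in capacity)
iff `u₀ ≤ g_{u₁}` and `u₁ ≤ g_{u₀}`; moreover, if both `u_j ∈ PSH_s⁻(D)` or both
`u_j ∈ N(D, fb u_j)` with `fb u_j ∈ PSH_s⁻(D)`, the latter is equivalent to
`g_{u₀} = g_{u₁}`. -/
theorem statement19 {n : ℕ} (Ω : Set (Cn n)) (hΩconn : IsConnected Ω) (hΩopen : IsOpen Ω)
    (hΩbd : Bornology.IsBounded Ω) (hΩhc : Hyperconvex Ω) (hΩbr : BRegular Ω)
    (u0 u1 : Cn n → EReal) (h0 : PSHNeg u0 Ω) (h1 : PSHNeg u1 Ω)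
    (hcond0 :
      (∃ w : Cn n → EReal, PSHNeg w Ω ∧ Set.EqOn (gp w Ω) 0 Ω ∧
        ∀ z ∈ Ω, gp u0 Ω z + w z ≤ u0 z) ∨
      Set.EqOn (gp u0 Ω) 0 Ω ∨
      (∀ σ : ℝ, σ ∈ Set.Ioo (0 : ℝ) 1 →
        ∃ C : ℝ, ∀ z ∈ Ω, gp u0 Ω z ≤ (σ : EReal) * u0 z + (C : EReal)))
    (hcond1 :
      (∃ w : Cn n → EReal, PSHNeg w Ω ∧ Set.EqOn (gp w Ω) 0 Ω ∧
        ∀ z ∈ Ω, gp u1 Ω z + w z ≤ u1 z) ∨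
      Set.EqOn (gp u1 Ω) 0 Ω ∨
      (∀ σ : ℝ, σ ∈ Set.Ioo (0 : ℝ) 1 →
        ∃ C : ℝ, ∀ z ∈ Ω, gp u1 Ω z ≤ (σ : EReal) * u1 z + (C : EReal))) :
    -- the geodesic connects `u₀` and `u₁` iff `u₀ ≤ g_{u₁}` and `u₁ ≤ g_{u₀}`
    ((TendstoInCap n Ω (geodesic n Ω u0 u1) u0 0 ∧
        TendstoInCap n Ω (geodesic n Ω u0 u1) u1 1) ↔
      ((∀ z ∈ Ω, u0 z ≤ gp u1 Ω z) ∧ (∀ z ∈ Ω, u1 z ≤ gp u0 Ω z))) ∧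
    -- under the additional assumptions, this is equivalent to `g_{u₀} = g_{u₁}`
    (((PSHs u0 Ω ∧ PSHs u1 Ω) ∨
        ((∃ H0 : Cn n → EReal, IsLeastMaxMajorant u0 H0 Ω ∧
            InClassRel n Ω (ClassN n Ω) H0 u0 ∧ PSHs H0 Ω) ∧
         (∃ H1 : Cn n → EReal, IsLeastMaxMajorant u1 H1 Ω ∧
            InClassRel n Ω (ClassN n Ω) H1 u1 ∧ PSHs H1 Ω))) →
      (((∀ z ∈ Ω, u0 z ≤ gp u1 Ω z) ∧ (∀ z ∈ Ω, u1 z ≤ gp u0 Ω z)) ↔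
        Set.EqOn (gp u0 Ω) (gp u1 Ω) Ω)) := by
  have hn0 : (𝓝[Set.Ioo (0 : ℝ) 1] (0 : ℝ)).NeBot := by
    rw [← mem_closure_iff_nhdsWithin_neBot, closure_Ioo zero_ne_one]
    exact ⟨le_rfl, zero_le_one⟩
  have hn1 : (𝓝[Set.Ioo (0 : ℝ) 1] (1 : ℝ)).NeBot := by
    rw [← mem_closure_iff_nhdsWithin_neBot, closure_Ioo zero_ne_one]
    exact ⟨zero_le_one, le_rfl⟩
  have ht0 : Tendsto (fun t : ℝ => t) (𝓝[Set.Ioo (0 : ℝ) 1] 0) (𝓝 0) :=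
    tendsto_nhdsWithin_of_tendsto_nhds tendsto_id
  have ht1 : Tendsto (fun t : ℝ => 1 - t) (𝓝[Set.Ioo (0 : ℝ) 1] 1) (𝓝 0) := by
    refine tendsto_nhdsWithin_of_tendsto_nhds ?_
    exact (show Continuous fun t : ℝ => 1 - t by fun_prop).tendsto' 1 0 (sub_self 1)
  refine ⟨⟨fun ⟨hc0, hc1⟩ => ⟨fun z hz => ?_, fun z hz => ?_⟩, fun ⟨hle0, hle1⟩ => ⟨?_, ?_⟩⟩,
    fun _ => gp_eqOn_iff hΩopen h0 h1 hcond0 hcond1⟩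
  · refine le_gp_of_tendsto_MACap hΩopen hΩbd h0 ht0 ?_ hc0 hz
    filter_upwards [self_mem_nhdsWithin] with t ht z hz c hc
    exact geodesic_le_one_sub_mul_gp hΩopen h0.2 hz ht hc
  · refine le_gp_of_tendsto_MACap hΩopen hΩbd h1 ht1 ?_ hc1 hz
    filter_upwards [self_mem_nhdsWithin] with t ht z hz c hc
    rw [sub_sub_cancel]
    exact geodesic_le_mul_gp hΩopen h1.2 hz ht hc
  · intro ε hε K hK hKΩ
    refine tendsto_MACap_of_le_gp hΩopen hΩconn h0 h1 hcond1 hle0 ht0 ?_ ?_ hε hK hKΩ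
    · filter_upwards [self_mem_nhdsWithin] with t ht
      exact ⟨ht.1, ht.2, fun z hz c hc => geodesic_le_one_sub_mul h1.2 hz ht hc⟩
    · intro v C hv hC hv0 hv1 t z
      have h := le_geodesic (u0 := u0) (u1 := u1) (a := -C) (b := 0) (t := t) (z := z) hv le_rfl
        (by linarith) (fun z hz => by simpa using hv0 z hz) fun z hz => by
          rw [add_zero, EReal.coe_neg, ← sub_eq_add_neg]
          exact EReal.sub_le_of_le_add (hv1 z hz)
      rwa [add_zero, neg_mul] at h
  · intro ε hε K hK hKΩ
    refine tendsto_MACap_of_le_gp hΩopen hΩconn h1 h0 hcond0 hle1 ht1 ?_ ?_ hε hK hKΩ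
    · filter_upwards [self_mem_nhdsWithin] with t ht
      refine ⟨sub_pos.2 ht.2, by linarith [ht.1], fun z hz c hc => ?_⟩
      rw [sub_sub_cancel]
      exact geodesic_le_mul h0.2 hz ht hc
    · intro v C hv hC hv1 hv0 t z
      have h := le_geodesic (u0 := u0) (u1 := u1) (a := C) (b := -C) (t := t) (z := z) hv
        (by linarith) (by linarith) (fun z hz => by
          rw [EReal.coe_neg, ← sub_eq_add_neg]
          exact EReal.sub_le_of_le_add (hv0 z hz)) fun z hz => by simpa using hv1 z hz
      rwa [show C * t + -C = -(C * (1 - t)) by ring] at h
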